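/- For every signal-to-noise ratio a with 0 < a ≤ 5.7 and every rate R with R₁ ≤ R ≤ R_crit, the reliability function of the Gaussian channel equals the random coding exponent: E(R,a) = E₀(R,a) = (a/4)(1 − cos θ_x) + R_x − R. -/

import Mathlib

open Real Filter MeasureTheory

/-- The standard Gaussian measure on `ℝⁿ` (i.i.d. standard normal coordinates). -/
noncomputable def gaussPi (n : ℕ) : Measure (Fin n → ℝ) :=
  Measure.pi fun _ => ProbabilityTheory.gaussianReal 0 1

/-- Euclidean distance on `Fin n → ℝ`. -/
noncomputable def eudist {n : ℕ} (x y : Fin n → ℝ) : ℝ :=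
  Real.sqrt (∑ i, (x i - y i)^2)

/-- Average maximum-likelihood decoding error probability of a spherical code on the
Gaussian channel (nearest codeword in Euclidean distance; ties counted as errors). -/
noncomputable def PeG {n : ℕ} (C : Finset (Fin n → ℝ)) : ℝ :=
  (C.card : ℝ)⁻¹ * ∑ x ∈ C,
    ((gaussPi n) {z | ∃ c ∈ C, c ≠ x ∧
      eudist c (fun i => x i + z i) ≤ eudist x (fun i => x i + z i)}).toReal

/-- Reliability function of the Gaussian channel with signal-to-noise ratio `a`:
`E(R,a) = limsup (1/n) ln max{1/P_e(C,a)}`, the maximum over codes `C` of `⌈e^{Rn}⌉`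
points on the sphere of radius `√(na)` in `ℝⁿ`. -/
noncomputable def relEG (a R : ℝ) : ℝ :=
  limsup (fun n : ℕ =>
    (n : ℝ)⁻¹ * Real.log (sSup ((fun C : Finset (Fin n → ℝ) => 1 / PeG C) ''
      {C | (∀ x ∈ C, ∑ i, (x i)^2 = (n : ℝ) * a) ∧ C.card = ⌈Real.exp (R * n)⌉₊}))) atTop

/-- `R_x = (1/2)ln(1/2 + (1/2)√(1+a²/4))`. -/
noncomputable def Rx (a : ℝ) : ℝ := (1/2) * Real.log (1/2 + (1/2) * Real.sqrt (1 + a^2/4))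

/-- `θ_x = arccos √(1 − e^{−2R_x})`. -/
noncomputable def thetax (a : ℝ) : ℝ := Real.arccos (Real.sqrt (1 - Real.exp (-2 * Rx a)))

/-- `R_crit = (1/2)ln(1/2 + a/4 + (1/2)√(1+a²/4))`. -/
noncomputable def RcritG (a : ℝ) : ℝ :=
  (1/2) * Real.log (1/2 + a/4 + (1/2) * Real.sqrt (1 + a^2/4))

/-- The random coding exponent `E₀(R,a) = (a/4)(1 − cos θ_x) + R_x − R`. -/
noncomputable def E0G (a R : ℝ) : ℝ := (a/4) * (1 - Real.cos (thetax a)) + Rx a - R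

/-- `ψ(x)`, the Kabatiansky–Levenshtein rate function for spherical codes. -/
noncomputable def psi (x : ℝ) : ℝ :=
  -((1 - Real.sin x) / (2 * Real.sin x)) * Real.log ((1 - Real.sin x) / (1 + Real.sin x))
    - Real.log (2 * Real.sin x / (1 + Real.sin x))

namespace GaussRel

open ProbabilityTheory
open scoped InnerProductSpace
set_option linter.unusedSectionVars false

section Toolkit

variable {E : Type*} [NormedAddCommGroup E] [InnerProductSpace ℝ E] [FiniteDimensional ℝ E]
  [MeasurableSpace E] [BorelSpace E]

/-- The Lebesgue density of the standard Gaussian measure. -/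
noncomputable def gdens (x : E) : ℝ :=
  ((2 * π) ^ ((Module.finrank ℝ E : ℝ) / 2))⁻¹ * exp (-(1 / 2) * ‖x‖ ^ 2)

lemma gdens_nonneg (x : E) : 0 ≤ gdens x := by unfold gdens; positivity

lemma measurable_gdens : Measurable (gdens : E → ℝ) := by unfold gdens; fun_prop

lemma integrable_exp_neg_sq (b : ℝ) (hb : 0 < b) :
    Integrable (fun x : E => exp (-b * ‖x‖ ^ 2)) := by
  have h := (GaussianFourier.integrable_cexp_neg_mul_sq_norm_add (V := E) (b := (b : ℂ))
    (by simpa using hb) 0 0).re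
  refine h.congr (ae_of_all _ fun x => ?_)
  simp only [zero_mul, add_zero, RCLike.re_to_complex]
  rw [show (-(b : ℂ) * ((‖x‖ : ℝ) : ℂ) ^ 2) = ((-b * ‖x‖ ^ 2 : ℝ) : ℂ) by push_cast; ring,
    Complex.exp_ofReal_re]

lemma integral_gdens : ∫ x : E, gdens x = 1 := by
  unfold gdens
  rw [integral_const_mul, GaussianFourier.integral_rexp_neg_mul_sq_norm (by norm_num)]
  rw [show π / (1 / 2) = 2 * π by ring]
  have : 0 < (2 * π) ^ ((Module.finrank ℝ E : ℝ) / 2) := by positivity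
  field_simp

lemma integrable_gdens : Integrable (gdens : E → ℝ) :=
  (integrable_exp_neg_sq (1 / 2) (by norm_num)).const_mul _

lemma stdGaussian_eq_withDensity :
    stdGaussian E = (volume : Measure E).withDensity (fun x => ENNReal.ofReal (gdens x)) := by
  have hp : IsProbabilityMeasure
      ((volume : Measure E).withDensity (fun x => ENNReal.ofReal (gdens x))) := by
    constructor
    rw [withDensity_apply _ MeasurableSet.univ, Measure.restrict_univ,
      ← ofReal_integral_eq_lintegral_ofReal integrable_gdens (ae_of_all _ gdens_nonneg),
      integral_gdens, ENNReal.ofReal_one]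
  apply Measure.ext_of_charFun
  ext t
  rw [charFun_stdGaussian, charFun_apply, integral_withDensity_eq_integral_toReal_smul
    measurable_gdens.ennreal_ofReal (by simp)]
  have h := GaussianFourier.integral_cexp_neg_mul_sq_norm_add (V := E) (b := (1 / 2 : ℂ))
    (by norm_num) Complex.I t
  have hpos : (0 : ℝ) < (2 * π) ^ ((Module.finrank ℝ E : ℝ) / 2) := by positivity
  have h2 : ∀ x : E, (ENNReal.ofReal (gdens x)).toReal • Complex.exp (⟪x, t⟫_ℝ * Complex.I) =
      ((((2 * π) ^ ((Module.finrank ℝ E : ℝ) / 2))⁻¹ : ℝ) : ℂ) *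
        Complex.exp (-(1 / 2 : ℂ) * ‖x‖ ^ 2 + Complex.I * ⟪t, x⟫_ℝ) := by
    intro x
    rw [ENNReal.toReal_ofReal (gdens_nonneg x), gdens, Complex.real_smul, Complex.ofReal_mul,
      Complex.exp_add, real_inner_comm, mul_comm Complex.I, Complex.ofReal_exp]
    push_cast
    ring
  simp_rw [h2]
  rw [integral_const_mul, h]
  have h3 : ((π : ℂ) / (1 / 2 : ℂ)) ^ ((Module.finrank ℝ E : ℂ) / 2) =
      (((2 * π) ^ ((Module.finrank ℝ E : ℝ) / 2) : ℝ) : ℂ) := by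
    rw [Complex.ofReal_cpow (by positivity)]
    push_cast
    congr 1; ring
  rw [h3, ← mul_assoc, ← Complex.ofReal_mul, inv_mul_cancel₀ hpos.ne']
  simp only [Complex.ofReal_one, Complex.I_sq, one_mul]
  congr 1; ring

lemma integral_stdGaussian (F : E → ℝ) :
    ∫ x, F x ∂(stdGaussian E) = ∫ x, gdens x * F x := by
  rw [stdGaussian_eq_withDensity, integral_withDensity_eq_integral_toReal_smul
    measurable_gdens.ennreal_ofReal (by simp)]
  simp_rw [ENNReal.toReal_ofReal (gdens_nonneg _), smul_eq_mul]

lemma integrable_stdGaussian_iff (F : E → ℝ) :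
    Integrable F (stdGaussian E) ↔ Integrable (fun x => gdens x * F x) := by
  rw [stdGaussian_eq_withDensity, integrable_withDensity_iff_integrable_smul'
    measurable_gdens.ennreal_ofReal (by simp)]
  simp_rw [ENNReal.toReal_ofReal (gdens_nonneg _), smul_eq_mul]

lemma gdens_sub_eq (v y : E) :
    gdens (y - v) = gdens y * exp (⟪v, y⟫_ℝ - ‖v‖ ^ 2 / 2) := by
  unfold gdens
  rw [mul_assoc, ← exp_add, norm_sub_sq_real, real_inner_comm]
  congr 2; ring

/-- Cameron-Martin formula. -/
lemma integral_shift (v : E) (F : E → ℝ) :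
    ∫ z, F (v + z) ∂(stdGaussian E) =
      ∫ y, exp (⟪v, y⟫_ℝ - ‖v‖ ^ 2 / 2) * F y ∂(stdGaussian E) := by
  rw [integral_stdGaussian, integral_stdGaussian,
    ← integral_sub_right_eq_self (fun x => gdens x * F (v + x)) v]
  congr 1 with y
  rw [gdens_sub_eq, add_sub_cancel, mul_assoc]

lemma integrable_shift_iff (v : E) (F : E → ℝ) :
    Integrable (fun z => F (v + z)) (stdGaussian E) ↔
      Integrable (fun y => exp (⟪v, y⟫_ℝ - ‖v‖ ^ 2 / 2) * F y) (stdGaussian E) := by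
  rw [integrable_stdGaussian_iff, integrable_stdGaussian_iff]
  have h : (fun x => gdens x * (exp (⟪v, x⟫_ℝ - ‖v‖ ^ 2 / 2) * F x)) =
      fun x => (fun x => gdens x * F (v + x)) (x - v) := by
    ext y
    simp only [gdens_sub_eq, add_sub_cancel, mul_assoc]
  rw [h]
  refine ⟨fun h => h.comp_sub_right v, fun h => ?_⟩
  simpa using h.comp_add_right v

lemma gdens_inv_smul_eq {s : ℝ} (y : E) :
    gdens (s⁻¹ • y) = gdens y * exp (-((s⁻¹) ^ 2 - 1) * ‖y‖ ^ 2 / 2) := by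
  unfold gdens
  rw [mul_assoc, ← exp_add, norm_smul, mul_pow, Real.norm_eq_abs, sq_abs]
  congr 2; ring

lemma integral_scale {s : ℝ} (hs : 0 < s) (F : E → ℝ) :
    ∫ z, F (s • z) ∂(stdGaussian E) = (s ^ Module.finrank ℝ E)⁻¹ *
      ∫ y, exp (-((s⁻¹) ^ 2 - 1) * ‖y‖ ^ 2 / 2) * F y ∂(stdGaussian E) := by
  rw [integral_stdGaussian, integral_stdGaussian]
  have h := Measure.integral_comp_smul_of_nonneg (volume : Measure E)
    (fun x => gdens (s⁻¹ • x) * F x) s (hR := hs.le)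
  simp only [smul_smul, inv_mul_cancel₀ hs.ne', one_smul, smul_eq_mul] at h
  rw [h]
  congr 2 with y
  rw [gdens_inv_smul_eq, mul_assoc]

lemma integrable_scale_iff {s : ℝ} (hs : 0 < s) (F : E → ℝ) :
    Integrable (fun z => F (s • z)) (stdGaussian E) ↔
      Integrable (fun y => exp (-((s⁻¹) ^ 2 - 1) * ‖y‖ ^ 2 / 2) * F y) (stdGaussian E) := by
  rw [integrable_stdGaussian_iff, integrable_stdGaussian_iff]
  rw [← integrable_comp_smul_iff (volume : Measure E)
    (fun x => gdens x * (exp (-((s⁻¹) ^ 2 - 1) * ‖x‖ ^ 2 / 2) * F x)) hs.ne']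
  simp only [← mul_assoc, ← gdens_inv_smul_eq, smul_smul, inv_mul_cancel₀ hs.ne', one_smul]

lemma integral_exp_inner (v : E) :
    ∫ z, exp ⟪v, z⟫_ℝ ∂(stdGaussian E) = exp (‖v‖ ^ 2 / 2) := by
  have h := integral_shift v (fun _ => 1)
  simp only [integral_const, probReal_univ, smul_eq_mul, mul_one, exp_sub, div_eq_mul_inv,
    integral_mul_const] at h
  rw [eq_mul_inv_iff_mul_eq₀ (exp_ne_zero _), one_mul] at h
  rw [← h, div_eq_mul_inv]

lemma integrable_exp_inner (v : E) (c : ℝ) :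
    Integrable (fun z => exp (⟪v, z⟫_ℝ + c)) (stdGaussian E) := by
  have h := (integrable_shift_iff v (fun _ => 1)).1 (integrable_const _)
  refine (h.mul_const (exp (c + ‖v‖ ^ 2 / 2))).congr (ae_of_all _ fun x => ?_)
  simp only [mul_one, ← exp_add]
  congr 1; ring

lemma integral_exp_sq {c : ℝ} (hc : -1 < c) :
    ∫ z, exp (-c * ‖z‖ ^ 2 / 2) ∂(stdGaussian E) = (√(1 + c) ^ Module.finrank ℝ E)⁻¹ := by
  have hs : 0 < √(1 + c) := Real.sqrt_pos.2 (by linarith)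
  have h := integral_scale (E := E) (inv_pos.2 hs) (fun _ => 1)
  simp only [integral_const, probReal_univ, smul_eq_mul, mul_one, inv_inv] at h
  rw [Real.sq_sqrt (by linarith), inv_pow, inv_inv, add_sub_cancel_left] at h
  exact eq_inv_of_mul_eq_one_right h.symm

lemma integrable_exp_sq {c : ℝ} (hc : -1 < c) :
    Integrable (fun z => exp (-c * ‖z‖ ^ 2 / 2)) (stdGaussian E) := by
  have hs : 0 < √(1 + c) := Real.sqrt_pos.2 (by linarith)
  have h := (integrable_scale_iff (E := E) (inv_pos.2 hs) (fun _ => 1)).1 (integrable_const _)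
  simp only [mul_one, inv_inv] at h
  rwa [Real.sq_sqrt (by linarith), add_sub_cancel_left] at h

end Toolkit

end GaussRel

namespace GaussRel

open ProbabilityTheory
open scoped InnerProductSpace
set_option linter.unusedSectionVars false

lemma chernoff {Ω : Type*} [MeasurableSpace Ω] {μ : Measure Ω} [IsFiniteMeasure μ] {F : Ω → ℝ}
    (h : Integrable (fun x => exp (F x)) μ) :
    μ.real {x | 0 ≤ F x} ≤ ∫ x, exp (F x) ∂μ := by
  have h1 := mul_meas_ge_le_integral_of_nonneg (ae_of_all μ fun x => (exp_pos (F x)).le) h 1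
  rw [one_mul] at h1
  refine le_trans (measureReal_mono (fun x hx => ?_)) h1
  exact one_le_exp hx

section Tails

variable {E : Type*} [NormedAddCommGroup E] [InnerProductSpace ℝ E] [FiniteDimensional ℝ E]
  [MeasurableSpace E] [BorelSpace E]

local notation "dim" => Module.finrank ℝ E

lemma sqrt_pow_inv_eq {x : ℝ} (hx : 0 < x) (n : ℕ) :
    (√x ^ n)⁻¹ = exp (-(n / 2) * log x) := by
  rw [Real.sqrt_eq_rpow, ← Real.rpow_natCast, ← Real.rpow_mul hx.le, ← Real.rpow_neg hx.le,
    Real.rpow_def_of_pos hx]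
  congr 1; ring

lemma norm_sq_upper_tail {η : ℝ} (hη : 0 < η) :
    (stdGaussian E).real {z | (1 + η) * dim ≤ ‖z‖ ^ 2} ≤
      exp (-((η - log (1 + η)) / 2) * dim) := by
  set s := η / (1 + η) with hs
  have hs1 : s < 1 := by rw [hs, div_lt_one (by linarith)]; linarith
  have hs0 : 0 < s := by positivity
  have hsη : s * (1 + η) = η := by rw [hs]; field_simp
  have hi : Integrable (fun z : E => exp (-(-s) * ‖z‖ ^ 2 / 2)) (stdGaussian E) :=
    integrable_exp_sq (by linarith)
  have h := integral_exp_sq (E := E) (c := -s) (by linarith)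
  have h1s : 1 + -s = (1 + η)⁻¹ := by rw [hs]; field_simp; ring
  rw [sqrt_pow_inv_eq (by linarith), h1s, log_inv] at h
  have hi' := hi.mul_const (exp (-η * dim / 2))
  simp_rw [← exp_add] at hi'
  refine le_trans (measureReal_mono (fun z hz => ?_)) ((chernoff hi').trans (le_of_eq ?_))
  · simp only [Set.mem_ofPred_eq] at hz ⊢
    have := mul_le_mul_of_nonneg_left hz hs0.le
    rw [← mul_assoc, hsη] at this
    linarith
  · simp_rw [exp_add]
    rw [integral_mul_const, h, ← exp_add]
    congr 1; ring

lemma norm_sq_lower_tail {η : ℝ} (hη : 0 < η) (hη1 : η < 1) :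
    (stdGaussian E).real {z | ‖z‖ ^ 2 ≤ (1 - η) * dim} ≤
      exp (-((-η - log (1 - η)) / 2) * dim) := by
  have h1η : 0 < 1 - η := by linarith
  set s := η / (1 - η) with hs
  have hs0 : 0 < s := by positivity
  have hsη : s * (1 - η) = η := by rw [hs]; field_simp
  have hi : Integrable (fun z : E => exp (-s * ‖z‖ ^ 2 / 2)) (stdGaussian E) :=
    integrable_exp_sq (by linarith)
  have h := integral_exp_sq (E := E) (c := s) (by linarith)
  have h1s : 1 + s = (1 - η)⁻¹ := by rw [hs]; field_simp; ring
  rw [sqrt_pow_inv_eq (by linarith), h1s, log_inv] at h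
  have hi' := hi.mul_const (exp (η * dim / 2))
  simp_rw [← exp_add] at hi'
  refine le_trans (measureReal_mono (fun z hz => ?_)) ((chernoff hi').trans (le_of_eq ?_))
  · simp only [Set.mem_ofPred_eq] at hz ⊢
    have := mul_le_mul_of_nonneg_left hz hs0.le
    rw [← mul_assoc, hsη] at this
    linarith
  · simp_rw [exp_add]
    rw [integral_mul_const, h, ← exp_add]
    congr 1; ring

lemma rate_upper_pos {η : ℝ} (hη : 0 < η) : 0 < (η - log (1 + η)) / 2 := by
  have := log_lt_sub_one_of_pos (x := 1 + η) (by linarith) (by linarith)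
  linarith

lemma rate_lower_pos {η : ℝ} (hη : 0 < η) (hη1 : η < 1) : 0 < (-η - log (1 - η)) / 2 := by
  have := log_lt_sub_one_of_pos (x := 1 - η) (by linarith) (by linarith)
  linarith

/-- Gaussian tail of a linear functional, in a form insensitive to the vanishing of `v`. -/
lemma inner_tail (v : E) (s t : ℝ) :
    (stdGaussian E).real {z | t ≤ s * ⟪v, z⟫_ℝ} ≤ exp (s ^ 2 * ‖v‖ ^ 2 / 2 - t) := by
  have hi := integrable_exp_inner (s • v) (-t)
  refine le_trans (measureReal_mono (fun z hz => ?_)) ((chernoff hi).trans (le_of_eq ?_))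
  · simp only [Set.mem_ofPred_eq, inner_smul_left, RCLike.conj_to_real] at hz ⊢
    linarith
  · simp_rw [exp_add]
    rw [integral_mul_const, integral_exp_inner, ← exp_add, norm_smul, mul_pow, Real.norm_eq_abs,
      sq_abs]
    rfl

/-- `⟨v, z⟩ ≤ t n` up to exponentially small probability, when `‖v‖² ≤ A n`. -/
lemma inner_tail_linear (v : E) {A t : ℝ} (hA : 0 < A) (hv : ‖v‖ ^ 2 ≤ A * dim) (ht : 0 < t) :
    (stdGaussian E).real {z | t * dim ≤ ⟪v, z⟫_ℝ} ≤ exp (-(t ^ 2 / (2 * A)) * dim) := by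
  have h := inner_tail v (t / A) (t / A * (t * dim))
  refine le_trans (measureReal_mono (fun z hz => ?_)) (h.trans (exp_le_exp.2 ?_))
  · simp only [Set.mem_ofPred_eq] at hz ⊢
    exact mul_le_mul_of_nonneg_left hz (by positivity)
  · have : (t / A) ^ 2 * ‖v‖ ^ 2 ≤ (t / A) ^ 2 * (A * dim) :=
      mul_le_mul_of_nonneg_left hv (by positivity)
    have e : (t / A) ^ 2 * (A * dim) / 2 - t / A * (t * dim) = -(t ^ 2 / (2 * A)) * dim := by
      field_simp; ring
    linarith

lemma integrable_norm_sq : Integrable (fun z : E => ‖z‖ ^ 2) (stdGaussian E) := by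
  have h := integrable_exp_sq (E := E) (c := -(1 / 2)) (by norm_num)
  refine (h.const_mul 4).mono' (by fun_prop) (ae_of_all _ fun z => ?_)
  rw [Real.norm_of_nonneg (by positivity)]
  have := add_one_le_exp (-(-(1 / 2)) * ‖z‖ ^ 2 / 2)
  nlinarith

lemma integrable_inner (v : E) : Integrable (fun z : E => ⟪v, z⟫_ℝ) (stdGaussian E) := by
  have h := (integrable_norm_sq (E := E)).add (integrable_const (‖v‖ ^ 2))
  refine h.mono' (by fun_prop) (ae_of_all _ fun z => ?_)
  have := abs_real_inner_le_norm v z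
  rw [Real.norm_eq_abs]
  simp only [Pi.add_apply]
  nlinarith [sq_nonneg (‖v‖ - ‖z‖), norm_nonneg v, norm_nonneg z]

lemma integral_inner (v : E) : ∫ z : E, ⟪v, z⟫_ℝ ∂(stdGaussian E) = 0 := by
  have h := integral_strongDual_stdGaussian (E := E) (innerSL ℝ v)
  simpa using h

lemma integrable_inner_sq (v : E) : Integrable (fun z : E => ⟪v, z⟫_ℝ ^ 2) (stdGaussian E) := by
  refine ((integrable_norm_sq (E := E)).const_mul (‖v‖ ^ 2)).mono' (by fun_prop)
    (ae_of_all _ fun z => ?_)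
  rw [Real.norm_of_nonneg (by positivity), ← mul_pow, ← sq_abs]
  exact pow_le_pow_left₀ (abs_nonneg _) (abs_real_inner_le_norm v z) 2

lemma integral_inner_sq (v : E) : ∫ z : E, ⟪v, z⟫_ℝ ^ 2 ∂(stdGaussian E) = ‖v‖ ^ 2 := by
  have h := variance_dual_stdGaussian (innerSL ℝ v)
  rw [variance_eq_integral (by fun_prop), integral_strongDual_stdGaussian] at h
  simpa using h

lemma integral_norm_sq : ∫ z : E, ‖z‖ ^ 2 ∂(stdGaussian E) = dim := by
  have h : ∀ z : E, ‖z‖ ^ 2 = ∑ i, ⟪stdOrthonormalBasis ℝ E i, z⟫_ℝ ^ 2 := fun z =>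
    ((stdOrthonormalBasis ℝ E).sum_sq_inner_right z).symm
  simp_rw [h]
  rw [integral_finsetSum _ fun i _ => integrable_inner_sq _]
  simp_rw [integral_inner_sq]
  simp

end Tails

/-- Change of measure: if `Q = f · P` and `Q B` is close to `1`, then `P B ≥ exp (-KL / Q B)`,
up to a constant. -/
lemma change_of_measure {Ω : Type*} [MeasurableSpace Ω] {P : Measure Ω} [IsProbabilityMeasure P]
    {f : Ω → ℝ} (hf : ∀ x, 0 < f x) (hfi : Integrable f P)
    (hfl : Integrable (fun x => f x * log (f x)) P) {B : Set Ω} (hB : MeasurableSet B)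
    {q K : ℝ} (hq : 0 < q) (hqB : q ≤ ∫ x in B, f x ∂P) (hK : ∫ x, f x * log (f x) ∂P ≤ K) 
    (hK0 : 0 ≤ K) : q * exp (-(K + 1) / q) ≤ P.real B := by
  set Q := ∫ x in B, f x ∂P with hQ
  have hQ0 : 0 < Q := hq.trans_le hqB
  have hbelow : ∀ x, -1 ≤ f x * log (f x) := fun x => by
    have h1 := log_le_sub_one_of_pos (inv_pos.2 (hf x))
    rw [log_inv] at h1
    have h2 : f x * (-log (f x)) ≤ f x * ((f x)⁻¹ - 1) := mul_le_mul_of_nonneg_left h1 (hf x).le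
    rw [mul_sub, mul_inv_cancel₀ (hf x).ne'] at h2
    have := hf x
    linarith
  have hKB : ∫ x in B, f x * log (f x) ∂P ≤ K + 1 := by
    have h1 := integral_add_compl hB hfl
    have h2 : ∫ x in Bᶜ, (-1 : ℝ) ∂P ≤ ∫ x in Bᶜ, f x * log (f x) ∂P :=
      setIntegral_mono (integrable_const _).integrableOn hfl.integrableOn hbelow
    have h3 : -1 ≤ ∫ x in Bᶜ, (-1 : ℝ) ∂P := by
      simp only [integral_const, smul_eq_mul, mul_neg, mul_one, neg_le_neg_iff,
        measureReal_restrict_apply_univ]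
      exact measureReal_le_one
    linarith
  -- tangent-line form of Jensen's inequality
  set m := (K + 1) / Q with hm
  have hpt : ∀ x, exp (-m) * (f x * (1 + m) - f x * log (f x)) ≤ 1 := fun x => by
    have h1 := add_one_le_exp (m - log (f x))
    rw [exp_sub, exp_log (hf x)] at h1
    have h2 : f x * (m - log (f x) + 1) ≤ exp m := by
      rw [le_div_iff₀ (hf x)] at h1; linarith
    calc exp (-m) * (f x * (1 + m) - f x * log (f x))
        = exp (-m) * (f x * (m - log (f x) + 1)) := by ring
      _ ≤ exp (-m) * exp m := mul_le_mul_of_nonneg_left h2 (exp_pos _).le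
      _ = 1 := by rw [← exp_add]; simp
  have hIntegrable : ∫ x in B, exp (-m) * (f x * (1 + m) - f x * log (f x)) ∂P ≤ ∫ x in B, (1 : ℝ) ∂P :=
    setIntegral_mono (((hfi.mul_const _).sub hfl).const_mul _).integrableOn
      (integrable_const _).integrableOn hpt
  rw [integral_const_mul, integral_sub (hfi.mul_const _).integrableOn hfl.integrableOn,
    integral_mul_const, ← hQ] at hIntegrable
  simp only [integral_const, smul_eq_mul, mul_one, measureReal_restrict_apply_univ] at hIntegrable
  have hQm : Q * m = K + 1 := by rw [hm]; field_simp
  have h5 : exp (-m) * Q ≤ exp (-m) * (Q * (1 + m) - ∫ x in B, f x * log (f x) ∂P) := by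
    refine mul_le_mul_of_nonneg_left ?_ (exp_pos _).le
    rw [mul_add, hQm]; linarith
  have h6 : q * exp (-(K + 1) / q) ≤ exp (-m) * Q := by
    rw [mul_comm]
    refine mul_le_mul (exp_le_exp.2 ?_) hqB hq.le (exp_pos _).le
    rw [hm, neg_div, neg_le_neg_iff]
    exact div_le_div_of_nonneg_left (by linarith) hq hqB
  linarith

end GaussRel

namespace GaussRel

open ProbabilityTheory
open scoped InnerProductSpace
set_option linter.unusedSectionVars false

section Rotation

variable {E : Type*} [NormedAddCommGroup E] [InnerProductSpace ℝ E] [FiniteDimensional ℝ E]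
  [MeasurableSpace E] [BorelSpace E]

lemma measurePreserving_rotation (θ : ℝ) :
    MeasurePreserving (ContinuousLinearMap.rotation θ : E × E → E × E)
      ((stdGaussian E).prod (stdGaussian E)) ((stdGaussian E).prod (stdGaussian E)) :=
  ⟨by fun_prop, IsGaussian.map_rotation_eq_self_of_forall_strongDual_eq_zero
    (fun L => integral_strongDual_stdGaussian L) θ⟩

lemma integral_rotation (θ : ℝ) {F : E × E → ℝ} (hF : Continuous F) :
    ∫ x, F (ContinuousLinearMap.rotation θ x) ∂((stdGaussian E).prod (stdGaussian E)) =
      ∫ x, F x ∂((stdGaussian E).prod (stdGaussian E)) := by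
  have h := measurePreserving_rotation (E := E) θ
  conv_rhs => rw [← h.map_eq]
  rw [integral_map h.measurable.aemeasurable hF.aestronglyMeasurable]

lemma integrable_rotation (θ : ℝ) {F : E × E → ℝ}
    (hi : Integrable F ((stdGaussian E).prod (stdGaussian E))) :
    Integrable (fun x => F (ContinuousLinearMap.rotation θ x))
      ((stdGaussian E).prod (stdGaussian E)) :=
  (measurePreserving_rotation θ).integrable_comp_of_integrable hi

lemma sq_intervalIntegral_le {f : ℝ → ℝ} (hf : Continuous f) {c : ℝ} (hc : 0 < c) :
    (∫ t in (0)..c, f t) ^ 2 ≤ c * ∫ t in (0)..c, f t ^ 2 := by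
  set m := (∫ t in (0)..c, f t) / c with hm
  have h : 0 ≤ ∫ t in (0)..c, (f t - m) ^ 2 :=
    intervalIntegral.integral_nonneg hc.le fun t _ => sq_nonneg _
  have e : ∀ t, (f t - m) ^ 2 = f t ^ 2 - 2 * m * f t + m ^ 2 := fun t => by ring
  simp_rw [e] at h
  rw [intervalIntegral.integral_add ((by fun_prop : Continuous _).intervalIntegrable _ _)
      ((by fun_prop : Continuous _).intervalIntegrable _ _),
    intervalIntegral.integral_sub ((by fun_prop : Continuous _).intervalIntegrable _ _)
      ((by fun_prop : Continuous _).intervalIntegrable _ _),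
    intervalIntegral.integral_const_mul, intervalIntegral.integral_const] at h
  have hmc : (∫ t in (0)..c, f t) = m * c := by rw [hm]; field_simp
  rw [hmc] at h ⊢
  simp only [sub_zero, smul_eq_mul] at h
  nlinarith

lemma integrable_prod_inner_sq {g : E → E} (hg : Continuous g) {L : ℝ} (hL : ∀ z, ‖g z‖ ≤ L) :
    Integrable (fun x : E × E => ⟪g x.1, x.2⟫_ℝ ^ 2) ((stdGaussian E).prod (stdGaussian E)) := by
  have h := (integrable_const (μ := stdGaussian E) (L ^ 2)).mul_prod (integrable_norm_sq (E := E))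
  refine h.mono' (by fun_prop) (ae_of_all _ fun x => ?_)
  rw [Real.norm_of_nonneg (by positivity), ← mul_pow, ← sq_abs]
  refine pow_le_pow_left₀ (abs_nonneg _) ((abs_real_inner_le_norm _ _).trans ?_) 2
  exact mul_le_mul_of_nonneg_right (hL _) (norm_nonneg _)

/-- The Gaussian Poincaré inequality (with a non-optimal constant), by the rotation argument of
Maurey and Pisier. -/
lemma integral_sub_sq_le {h : E → ℝ} {g : E → E} (hg : Continuous g)
    (hgrad : ∀ z, HasFDerivAt h (innerSL ℝ (g z)) z) {L : ℝ} (hL : ∀ z, ‖g z‖ ≤ L) :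
    ∫ x : E × E, (h x.2 - h x.1) ^ 2 ∂((stdGaussian E).prod (stdGaussian E)) ≤
      π ^ 2 / 4 * L ^ 2 := by
  set P := (stdGaussian E).prod (stdGaussian E) with hP
  have hc : Continuous h := continuous_iff_continuousAt.2 fun z => (hgrad z).continuousAt
  let D : ℝ → E × E → ℝ := fun θ x =>
    ⟪g (cos θ • x.1 + sin θ • x.2), -sin θ • x.1 + cos θ • x.2⟫_ℝ
  have hDc : Continuous (fun p : (E × E) × ℝ => D p.2 p.1) := by
    simp only [D]; fun_prop
  have hD1 : ∀ x, Continuous (fun θ => D θ x) := fun x => by simp only [D]; fun_prop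
  have hD2 : ∀ θ, Continuous (fun x => D θ x) := fun θ => by simp only [D]; fun_prop
  have hFTC : ∀ x : E × E, h x.2 - h x.1 = ∫ θ in (0)..(π / 2), D θ x := fun x => by
    have hd : ∀ θ ∈ Set.uIcc 0 (π / 2), HasDerivAt (fun θ => h (cos θ • x.1 + sin θ • x.2))
        (D θ x) θ := fun θ _ => by
      have h1 : HasDerivAt (fun θ => cos θ • x.1 + sin θ • x.2)
          (-sin θ • x.1 + cos θ • x.2) θ :=
        ((hasDerivAt_cos θ).smul_const x.1).add ((hasDerivAt_sin θ).smul_const x.2)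
      exact (hgrad _).comp_hasDerivAt θ h1
    have := intervalIntegral.integral_eq_sub_of_hasDerivAt hd ((hD1 x).intervalIntegrable _ _)
    simp at this
    exact this.symm
  have hsq : ∀ x : E × E, (h x.2 - h x.1) ^ 2 ≤ π / 2 * ∫ θ in (0)..(π / 2), D θ x ^ 2 :=
    fun x => by rw [hFTC]; exact sq_intervalIntegral_le (hD1 x) (by positivity)
  have hDi : ∀ θ, Integrable (fun x => D θ x ^ 2) P := fun θ => by
    have := integrable_rotation θ (F := fun x : E × E => ⟪g x.1, x.2⟫_ℝ ^ 2)
      (integrable_prod_inner_sq hg hL)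
    exact this
  have hDe : ∀ θ, ∫ x, D θ x ^ 2 ∂P ≤ L ^ 2 := fun θ => by
    have h1 := integral_rotation θ (F := fun x : E × E => ⟪g x.1, x.2⟫_ℝ ^ 2) (by fun_prop)
    rw [← hP] at h1
    have h2 : ∫ x, D θ x ^ 2 ∂P = ∫ x : E × E, ⟪g x.1, x.2⟫_ℝ ^ 2 ∂P := h1
    rw [h2, hP, integral_prod _ (integrable_prod_inner_sq hg hL)]
    simp_rw [integral_inner_sq]
    calc ∫ x, ‖g x‖ ^ 2 ∂(stdGaussian E) ≤ ∫ x, L ^ 2 ∂(stdGaussian E) := by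
          refine integral_mono_of_nonneg (ae_of_all _ fun x => by positivity) (integrable_const _)
            (ae_of_all _ fun x => pow_le_pow_left₀ (norm_nonneg _) (hL x) 2)
      _ = L ^ 2 := by simp
  have hle : ∀ θ ∈ Set.uIcc 0 (π / 2), ∀ x, ‖D θ x ^ 2‖ ≤ L ^ 2 * (‖x.1‖ + ‖x.2‖) ^ 2 :=
    fun θ _ x => by
      rw [Real.norm_of_nonneg (by positivity), ← mul_pow, ← sq_abs]
      refine pow_le_pow_left₀ (abs_nonneg _) ((abs_real_inner_le_norm _ _).trans ?_) 2
      refine mul_le_mul (hL _) ?_ (norm_nonneg _) ((norm_nonneg _).trans (hL 0))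
      refine (norm_add_le _ _).trans (add_le_add ?_ ?_) <;> rw [norm_smul]
      · rw [norm_neg]
        exact mul_le_of_le_one_left (norm_nonneg _) (abs_sin_le_one θ)
      · exact mul_le_of_le_one_left (norm_nonneg _) (abs_cos_le_one θ)
  have hDint : Integrable (Function.uncurry fun (θ : ℝ) (x : E × E) => D θ x ^ 2)
      ((volume.restrict (Set.uIoc 0 (π / 2))).prod P) := by
    have hb : Integrable (fun x : E × E => L ^ 2 * (2 * ‖x.1‖ ^ 2 + 2 * ‖x.2‖ ^ 2)) P := by
      have h1 := (integrable_norm_sq (E := E)).comp_fst (stdGaussian E)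
      have h2 := (integrable_norm_sq (E := E)).comp_snd (stdGaussian E)
      exact ((h1.const_mul 2).add (h2.const_mul 2)).const_mul _
    have : IsFiniteMeasure (volume.restrict (Set.uIoc 0 (π / 2))) :=
      ⟨by simp [Set.uIoc_of_le (by positivity : (0:ℝ) ≤ π / 2)]⟩
    have hb' := (integrable_const (μ := volume.restrict (Set.uIoc 0 (π / 2))) (1 : ℝ)).mul_prod hb
    refine hb'.mono' ?_ ?_
    · exact ((hDc.pow 2).comp continuous_swap).aestronglyMeasurable
    · rw [Measure.ae_prod_iff_ae_ae]
      · refine (ae_restrict_iff' measurableSet_uIoc).2 (ae_of_all _ fun θ hθ => ae_of_all _ fun x => ?_)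
        refine (hle θ (Set.uIoc_subset_uIcc hθ) x).trans ?_
        rw [one_mul]
        refine mul_le_mul_of_nonneg_left ?_ (by positivity)
        nlinarith [sq_nonneg (‖x.1‖ - ‖x.2‖)]
      · exact measurableSet_le ((hDc.pow 2).comp continuous_swap).norm.measurable
          (by fun_prop)
  have hswap := intervalIntegral_integral_swap (μ := P) (f := fun θ x => D θ x ^ 2) hDint
  have hInt : Integrable (fun x => ∫ θ in (0)..(π / 2), D θ x ^ 2) P := by
    have := hDint.integral_prod_right
    simpa [intervalIntegral.integral_of_le (by positivity : (0:ℝ) ≤ π / 2),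
      Set.uIoc_of_le (by positivity : (0:ℝ) ≤ π / 2)] using this
  calc ∫ x : E × E, (h x.2 - h x.1) ^ 2 ∂P
      ≤ ∫ x, (π / 2 * ∫ θ in (0)..(π / 2), D θ x ^ 2) ∂P :=
        integral_mono_of_nonneg (ae_of_all _ fun x => sq_nonneg _) (hInt.const_mul _)
          (ae_of_all _ hsq)
    _ = π / 2 * ∫ θ in (0)..(π / 2), ∫ x, D θ x ^ 2 ∂P := by
        rw [integral_const_mul, hswap]
    _ ≤ π / 2 * ∫ θ in (0)..(π / 2), L ^ 2 := by
        refine mul_le_mul_of_nonneg_left ?_ (by positivity)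
        have hii : IntervalIntegrable (fun θ => ∫ x, D θ x ^ 2 ∂P) volume 0 (π / 2) := by
          rw [intervalIntegrable_iff]
          exact hDint.integral_prod_left
        exact intervalIntegral.integral_mono_on (by positivity) hii (by simp)
          fun θ _ => hDe θ
    _ = π ^ 2 / 4 * L ^ 2 := by
        rw [intervalIntegral.integral_const]; simp only [smul_eq_mul]; ring

end Rotation

end GaussRel

namespace GaussRel

open ProbabilityTheory
open scoped InnerProductSpace
set_option linter.unusedSectionVars false

section Mix

variable {E : Type*} [NormedAddCommGroup E] [InnerProductSpace ℝ E] [FiniteDimensional ℝ E]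
  [MeasurableSpace E] [BorelSpace E] {ι : Type*}

/-- Density of the Gaussian shifted by `u` relative to the standard Gaussian. -/
noncomputable def phi (u z : E) : ℝ := exp (⟪u, z⟫_ℝ - ‖u‖ ^ 2 / 2)

/-- Density of a Gaussian mixture. -/
noncomputable def mix (s : Finset ι) (w : ι → ℝ) (u : ι → E) (z : E) : ℝ :=
  ∑ j ∈ s, w j * phi (u j) z

/-- Gradient of the density of a Gaussian mixture. -/
noncomputable def mixv (s : Finset ι) (w : ι → ℝ) (u : ι → E) (z : E) : E :=
  ∑ j ∈ s, (w j * phi (u j) z) • u j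

lemma phi_pos (u z : E) : 0 < phi u z := exp_pos _

@[fun_prop] lemma continuous_phi (u : E) : Continuous (phi u) := by unfold phi; fun_prop

lemma integrable_phi (u : E) : Integrable (phi u) (stdGaussian E) := by
  have := integrable_exp_inner u (-(‖u‖ ^ 2 / 2))
  exact this.congr (ae_of_all _ fun z => by simp only [phi, sub_eq_add_neg])

lemma integral_phi (u : E) : ∫ z, phi u z ∂(stdGaussian E) = 1 := by
  simp only [phi, exp_sub, integral_div, integral_exp_inner]
  exact div_self (exp_pos _).ne'

lemma integral_shift' (v : E) (F : E → ℝ) :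
    ∫ z, F (v + z) ∂(stdGaussian E) = ∫ y, phi v y * F y ∂(stdGaussian E) := integral_shift v F

/-- Mehler's formula for exponentials. -/
lemma integral_phi_mehler (u z : E) {c d : ℝ} (h : c ^ 2 + d ^ 2 = 1) :
    ∫ z', phi u (c • z + d • z') ∂(stdGaussian E) = phi (c • u) z := by
  have e : ∀ z', phi u (c • z + d • z') = phi (c • u) z * phi (d • u) z' := fun z' => by
    simp only [phi, ← exp_add, inner_add_right, inner_smul_right, inner_smul_left, norm_smul,
      mul_pow, Real.norm_eq_abs, sq_abs, RCLike.conj_to_real]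
    congr 1
    linear_combination (‖u‖ ^ 2 / 2) * h
  simp_rw [e]
  rw [integral_const_mul, integral_phi, mul_one]

lemma integrable_phi_mehler (u z : E) (c d : ℝ) :
    Integrable (fun z' => phi u (c • z + d • z')) (stdGaussian E) := by
  have := integrable_exp_inner (d • u) (c * ⟪u, z⟫_ℝ - ‖u‖ ^ 2 / 2)
  refine this.congr (ae_of_all _ fun z' => ?_)
  simp only [phi, inner_add_right, inner_smul_right, inner_smul_left, RCLike.conj_to_real]
  congr 1; ring

variable {s : Finset ι} {w : ι → ℝ} {u : ι → E}

@[fun_prop] lemma continuous_mix : Continuous (mix s w u) := by unfold mix; fun_prop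
@[fun_prop] lemma continuous_mixv : Continuous (mixv s w u) := by unfold mixv; fun_prop

lemma mix_pos (hs : s.Nonempty) (hw : ∀ j ∈ s, 0 < w j) (z : E) : 0 < mix s w u z :=
  Finset.sum_pos (fun j hj => mul_pos (hw j hj) (phi_pos _ _)) hs

lemma hasFDerivAt_phi (u z : E) : HasFDerivAt (phi u) (innerSL ℝ (phi u z • u)) z := by
  have h1 : HasFDerivAt (fun z => ⟪u, z⟫_ℝ - ‖u‖ ^ 2 / 2) (innerSL ℝ u) z :=
    (innerSL ℝ u).hasFDerivAt.sub_const _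
  have := h1.exp
  rw [map_smul]
  exact this

lemma hasFDerivAt_mix (z : E) : HasFDerivAt (mix s w u) (innerSL ℝ (mixv s w u z)) z := by
  have h : HasFDerivAt (mix s w u) (∑ j ∈ s, w j • innerSL ℝ (phi (u j) z • u j)) z :=
    HasFDerivAt.fun_sum fun j _ => (hasFDerivAt_phi (u j) z).const_mul (w j)
  convert h using 1
  simp only [mixv, map_sum, map_smul, smul_smul]

lemma hasFDerivAt_log_mix (hs : s.Nonempty) (hw : ∀ j ∈ s, 0 < w j) (z : E) :
    HasFDerivAt (fun z => log (mix s w u z)) (innerSL ℝ ((mix s w u z)⁻¹ • mixv s w u z)) z := by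
  have := (hasFDerivAt_mix (s := s) (w := w) (u := u) z).log (mix_pos hs hw z).ne'
  rw [map_smul]
  exact this

/-- Functions with bounded gradient have linear growth. -/
lemma abs_sub_le_of_grad {h : E → ℝ} {g : E → E}
    (hgrad : ∀ z, HasFDerivAt h (innerSL ℝ (g z)) z) {L : ℝ} (hL : ∀ z, ‖g z‖ ≤ L) (x y : E) :
    |h y - h x| ≤ L * ‖y - x‖ := by
  have := Convex.norm_image_sub_le_of_norm_hasFDerivWithin_le (f := h) (C := L) (s := Set.univ)
    (x := x) (y := y) (fun z _ => (hgrad z).hasFDerivWithinAt)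
    (fun z _ => by rw [innerSL_apply_norm]; exact hL z) convex_univ trivial trivial
  exact this

lemma integrable_norm : Integrable (fun z : E => ‖z‖) (stdGaussian E) := by
  refine ((integrable_norm_sq (E := E)).add (integrable_const 1)).mono' (by fun_prop)
    (ae_of_all _ fun z => ?_)
  simp only [norm_norm, Pi.add_apply]
  nlinarith [sq_nonneg (‖z‖ - 1)]

lemma integrable_of_grad {h : E → ℝ} {g : E → E}
    (hgrad : ∀ z, HasFDerivAt h (innerSL ℝ (g z)) z) {L : ℝ} (hL : ∀ z, ‖g z‖ ≤ L) :
    Integrable h (stdGaussian E) ∧ Integrable (fun z => h z ^ 2) (stdGaussian E) := by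
  have hc : Continuous h := continuous_iff_continuousAt.2 fun z => (hgrad z).continuousAt
  have hb : ∀ z, |h z| ≤ |h 0| + L * ‖z‖ := fun z => by
    have := abs_sub_le_of_grad hgrad hL 0 z
    rw [sub_zero] at this
    have h2 := abs_sub_abs_le_abs_sub (h z) (h 0)
    linarith
  constructor
  · exact ((integrable_const (|h 0|)).add (integrable_norm.const_mul L)).mono'
      hc.aestronglyMeasurable (ae_of_all _ hb)
  · refine ((integrable_const (2 * |h 0| ^ 2)).add
      ((integrable_norm_sq (E := E)).const_mul (2 * L ^ 2))).mono'
      (hc.pow 2).aestronglyMeasurable (ae_of_all _ fun z => ?_)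
    simp only [Pi.add_apply]
    rw [Real.norm_of_nonneg (by positivity), ← sq_abs]
    have := pow_le_pow_left₀ (abs_nonneg _) (hb z) 2
    nlinarith [sq_nonneg (|h 0| - L * ‖z‖)]

/-- Chebyshev bound for functions with bounded gradient. -/
lemma deviation_of_grad {h : E → ℝ} {g : E → E} (hg : Continuous g)
    (hgrad : ∀ z, HasFDerivAt h (innerSL ℝ (g z)) z) {L : ℝ} (hL : ∀ z, ‖g z‖ ≤ L)
    {t : ℝ} (ht : 0 < t) :
    (stdGaussian E).real {z | t ≤ |h z - ∫ z', h z' ∂(stdGaussian E)|} ≤ 2 * L ^ 2 / t ^ 2 := by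
  obtain ⟨h1, h2⟩ := integrable_of_grad hgrad hL
  have hc : Continuous h := continuous_iff_continuousAt.2 fun z => (hgrad z).continuousAt
  set m := ∫ z', h z' ∂(stdGaussian E) with hm
  have hP := integral_sub_sq_le hg hgrad hL
  have e : ∀ x : E × E, (h x.2 - h x.1) ^ 2 = (h x.2 ^ 2 - 2 * (h x.1 * h x.2)) + h x.1 ^ 2 :=
    fun x => by ring
  simp_rw [e] at hP
  have i1 := h2.comp_snd (stdGaussian E)
  have i2 := h2.comp_fst (stdGaussian E)
  have i3 := (h1.mul_prod h1).const_mul 2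
  rw [integral_add (by exact i1.sub i3) i2, integral_sub i1 i3, integral_const_mul,
    integral_prod_mul (μ := stdGaussian E) (ν := stdGaussian E) h h,
    integral_fun_fst (μ := stdGaussian E) (ν := stdGaussian E) (fun z => h z ^ 2),
    integral_fun_snd (μ := stdGaussian E) (ν := stdGaussian E) (fun z => h z ^ 2)] at hP
  simp only [probReal_univ, one_smul, ← hm] at hP
  have hvi : Integrable (fun z => (h z - m) ^ 2) (stdGaussian E) := by
    have : ∀ z, (h z - m) ^ 2 = h z ^ 2 - 2 * m * h z + m ^ 2 := fun z => by ring
    simp_rw [this]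
    exact (h2.sub (h1.const_mul _)).add (integrable_const _)
  have hv : ∫ z, (h z - m) ^ 2 ∂(stdGaussian E) = ∫ z, h z ^ 2 ∂(stdGaussian E) - m * m := by
    have : ∀ z, (h z - m) ^ 2 = h z ^ 2 - 2 * m * h z + m ^ 2 := fun z => by ring
    simp_rw [this]
    rw [integral_add (by exact h2.sub (h1.const_mul _)) (integrable_const _),
      integral_sub h2 (h1.const_mul _), integral_const_mul]
    simp [← hm]; ring
  have hmk := mul_meas_ge_le_integral_of_nonneg (ae_of_all _ fun z => sq_nonneg (h z - m)) hvi (t ^ 2)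
  rw [le_div_iff₀ (by positivity), mul_comm]
  have hset : {z | t ≤ |h z - m|} = {z | t ^ 2 ≤ (h z - m) ^ 2} := by
    ext z
    simp only [Set.mem_ofPred_eq]
    rw [← sq_abs (h z - m), pow_le_pow_iff_left₀ ht.le (abs_nonneg _) two_ne_zero]
  rw [hset]
  have hpi : π ^ 2 ≤ 16 := by nlinarith [pi_le_four, pi_pos]
  have : π ^ 2 / 4 * L ^ 2 ≤ 4 * L ^ 2 := by
    apply mul_le_mul_of_nonneg_right _ (sq_nonneg _); linarith
  have hmk' : t ^ 2 * (stdGaussian E).real {z | t ^ 2 ≤ (h z - m) ^ 2} ≤ 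
    ∫ z, (h z - m) ^ 2 ∂(stdGaussian E) := hmk
  linarith

end Mix

end GaussRel

namespace GaussRel

open ProbabilityTheory
open scoped InnerProductSpace
set_option linter.unusedSectionVars false

section LSI

variable {E : Type*} [NormedAddCommGroup E] [InnerProductSpace ℝ E] [FiniteDimensional ℝ E]
  [MeasurableSpace E] [BorelSpace E] {ι : Type*}

lemma integrable_exp_norm (c : ℝ) : Integrable (fun z : E => exp (c * ‖z‖)) (stdGaussian E) := by
  refine ((integrable_exp_sq (E := E) (c := -(1 / 2)) (by norm_num)).mul_const
    (exp (c ^ 2))).mono' (by fun_prop) (ae_of_all _ fun z => ?_)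
  rw [Real.norm_of_nonneg (exp_pos _).le, ← exp_add]
  refine exp_le_exp.2 ?_
  nlinarith [sq_nonneg (c - ‖z‖ / 2)]

/-- Gaussian integration by parts. -/
lemma integral_inner_mul {G : E → ℝ} {g : E → E} (hg : Continuous g)
    (hgrad : ∀ z, HasFDerivAt G (innerSL ℝ (g z)) z) {L B : ℝ} (hL : ∀ z, ‖g z‖ ≤ L)
    (hB : ∀ z, |G z| ≤ B) (u : E) :
    ∫ z, ⟪u, z⟫_ℝ * G z ∂(stdGaussian E) = ∫ z, ⟪g z, u⟫_ℝ ∂(stdGaussian E) := by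
  have hGc : Continuous G := continuous_iff_continuousAt.2 fun z => (hgrad z).continuousAt
  have hGi : Integrable G (stdGaussian E) := (integrable_of_grad hgrad hL).1
  have h1 : HasDerivAt (fun t : ℝ => ∫ z, G (t • u + z) ∂(stdGaussian E))
      (∫ z, ⟪g ((0 : ℝ) • u + z), u⟫_ℝ ∂(stdGaussian E)) 0 := by
    refine (hasDerivAt_integral_of_dominated_loc_of_deriv_le (bound := fun _ => L * ‖u‖)
      (F' := fun t z => ⟪g (t • u + z), u⟫_ℝ) (s := Metric.ball 0 1)
      (Metric.ball_mem_nhds _ one_pos) (Eventually.of_forall fun t => by fun_prop) (by simpa using hGi)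
      (by fun_prop) (ae_of_all _ fun z t _ => ?_) (integrable_const _)
      (ae_of_all _ fun z t _ => ?_)).2
    · exact (norm_inner_le_norm _ _).trans (mul_le_mul_of_nonneg_right (hL _) (norm_nonneg _))
    · have h : HasDerivAt (fun t : ℝ => t • u + z) u t := by
        simpa using ((hasDerivAt_id t).smul_const u).add_const z
      exact (hgrad _).comp_hasDerivAt t h
  have h2 : HasDerivAt (fun t : ℝ => ∫ z, phi (t • u) z * G z ∂(stdGaussian E))
      (∫ z, (⟪u, z⟫_ℝ - 0 * ‖u‖ ^ 2) * phi ((0 : ℝ) • u) z * G z ∂(stdGaussian E)) 0 := by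
    refine (hasDerivAt_integral_of_dominated_loc_of_deriv_le
      (bound := fun z => exp (2 * ‖u‖ * ‖z‖) * (exp (‖u‖ ^ 2) * B))
      (F' := fun t z => (⟪u, z⟫_ℝ - t * ‖u‖ ^ 2) * phi (t • u) z * G z) (s := Metric.ball 0 1)
      (Metric.ball_mem_nhds _ one_pos) (Eventually.of_forall fun t => by fun_prop)
      (by simpa [phi] using hGi)
      (by fun_prop) (ae_of_all _ fun z t ht => ?_) ((integrable_exp_norm _).mul_const _)
      (ae_of_all _ fun z t _ => ?_)).2
    · rw [Metric.mem_ball, dist_zero_right, Real.norm_eq_abs] at ht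
      rw [norm_mul, norm_mul, Real.norm_eq_abs, Real.norm_eq_abs, Real.norm_eq_abs,
        abs_of_pos (phi_pos _ _)]
      have hi := abs_real_inner_le_norm u z
      have e1 : |⟪u, z⟫_ℝ - t * ‖u‖ ^ 2| ≤ exp (‖u‖ * ‖z‖ + ‖u‖ ^ 2) := by
        have h3 : |t * ‖u‖ ^ 2| ≤ ‖u‖ ^ 2 := by
          rw [abs_mul, abs_of_nonneg (sq_nonneg ‖u‖)]
          exact mul_le_of_le_one_left (sq_nonneg _) ht.le
        have h4 := abs_sub (⟪u, z⟫_ℝ) (t * ‖u‖ ^ 2)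
        have h5 := add_one_le_exp (‖u‖ * ‖z‖ + ‖u‖ ^ 2)
        linarith
      have e2 : phi (t • u) z ≤ exp (‖u‖ * ‖z‖) := by
        refine exp_le_exp.2 ?_
        rw [inner_smul_left, RCLike.conj_to_real]
        have h3 : t * ⟪u, z⟫_ℝ ≤ ‖u‖ * ‖z‖ := by
          refine (le_abs_self _).trans ?_
          rw [abs_mul]
          exact (mul_le_of_le_one_left (abs_nonneg _) ht.le).trans hi
        have := sq_nonneg ‖t • u‖
        linarith
      have hB0 : 0 ≤ B := (abs_nonneg _).trans (hB 0)
      calc |⟪u, z⟫_ℝ - t * ‖u‖ ^ 2| * phi (t • u) z * |G z|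
          ≤ exp (‖u‖ * ‖z‖ + ‖u‖ ^ 2) * exp (‖u‖ * ‖z‖) * B :=
            mul_le_mul (mul_le_mul e1 e2 (phi_pos _ _).le (exp_pos _).le) (hB z) (abs_nonneg _)
              (by positivity)
        _ = exp (2 * ‖u‖ * ‖z‖) * (exp (‖u‖ ^ 2) * B) := by
            rw [← mul_assoc, ← exp_add, ← exp_add]; ring_nf
    · have h3 : HasDerivAt (fun t : ℝ => t * ⟪u, z⟫_ℝ - t ^ 2 * ‖u‖ ^ 2 / 2)
          (⟪u, z⟫_ℝ - t * ‖u‖ ^ 2) t := by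
        have := ((hasDerivAt_id' t).mul_const (⟪u, z⟫_ℝ)).sub
          (((hasDerivAt_pow 2 t).mul_const (‖u‖ ^ 2)).div_const 2)
        exact this.congr_deriv (by push_cast; ring)
      have h4 : ∀ t : ℝ, phi (t • u) z = exp (t * ⟪u, z⟫_ℝ - t ^ 2 * ‖u‖ ^ 2 / 2) := fun t => by
        simp only [phi, inner_smul_left, norm_smul, mul_pow, Real.norm_eq_abs, sq_abs,
          RCLike.conj_to_real]
      simp_rw [h4]
      have := h3.exp.mul_const (G z)
      refine this.congr_deriv ?_
      ring
  have he : (fun t : ℝ => ∫ z, G (t • u + z) ∂(stdGaussian E)) =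
      fun t : ℝ => ∫ z, phi (t • u) z * G z ∂(stdGaussian E) := by
    funext t; exact integral_shift' (t • u) G
  rw [he] at h1
  have := h2.unique h1
  simpa [phi] using this

variable {s : Finset ι} {w : ι → ℝ} {u : ι → E}

/-- Posterior weights in a Gaussian mixture. -/
noncomputable def post (s : Finset ι) (w : ι → ℝ) (u : ι → E) (k : ι) (y : E) : ℝ :=
  w k * phi (u k) y / mix s w u y

lemma post_nonneg (hs : s.Nonempty) (hw : ∀ j ∈ s, 0 < w j) {k : ι} (hk : k ∈ s) (y : E) :
    0 ≤ post s w u k y :=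
  div_nonneg (mul_pos (hw k hk) (phi_pos _ _)).le (mix_pos hs hw y).le

lemma sum_post (hs : s.Nonempty) (hw : ∀ j ∈ s, 0 < w j) (y : E) :
    ∑ k ∈ s, post s w u k y = 1 := by
  simp only [post]
  rw [← Finset.sum_div]
  exact div_self (mix_pos hs hw y).ne'

lemma post_le_one (hs : s.Nonempty) (hw : ∀ j ∈ s, 0 < w j) {k : ι} (hk : k ∈ s) (y : E) :
    post s w u k y ≤ 1 := by
  rw [← sum_post hs hw y (u := u)]
  exact Finset.single_le_sum (f := fun k => post s w u k y)
    (fun j hj => post_nonneg hs hw hj y) hk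

lemma hasFDerivAt_post (hs : s.Nonempty) (hw : ∀ j ∈ s, 0 < w j) {k : ι} (y : E) :
    HasFDerivAt (post s w u k)
      (innerSL ℝ (post s w u k y • (u k - (mix s w u y)⁻¹ • mixv s w u y))) y := by
  have h1 := ((hasFDerivAt_phi (u k) y).const_mul (w k))
  have h2 : HasFDerivAt (fun y => (w k * phi (u k) y) * exp (-log (mix s w u y))) _ y :=
    h1.mul (hasFDerivAt_log_mix hs hw y (u := u)).neg.exp
  have e : post s w u k = fun y => (w k * phi (u k) y) * exp (-log (mix s w u y)) := by
    funext y
    rw [exp_neg, exp_log (mix_pos hs hw y)]; rfl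
  have e' := congrFun e y
  rw [e]
  refine h2.congr_fderiv ?_
  ext v
  simp only [map_smul, map_sub, smul_apply, sub_apply, add_apply, neg_apply, smul_eq_mul,
    Pi.neg_apply]
  ring

lemma continuous_post (hs : s.Nonempty) (hw : ∀ j ∈ s, 0 < w j) {k : ι} :
    Continuous (post s w u k) :=
  (continuous_const.mul (continuous_phi _)).div continuous_mix fun y => (mix_pos hs hw y).ne'

end LSI

end GaussRel

namespace GaussRel

open ProbabilityTheory
open scoped InnerProductSpace
set_option linter.unusedSectionVars false

section LSI

variable {E : Type*} [NormedAddCommGroup E] [InnerProductSpace ℝ E] [FiniteDimensional ℝ E]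
  [MeasurableSpace E] [BorelSpace E] {ι : Type*}

lemma hasFDerivAt_shift {h : E → ℝ} {g : E → E}
    (hgrad : ∀ z, HasFDerivAt h (innerSL ℝ (g z)) z) (v z : E) :
    HasFDerivAt (fun z => h (v + z)) (innerSL ℝ (g (v + z))) z := by
  have h1 : HasFDerivAt (fun z => v + z) (ContinuousLinearMap.id ℝ E) z :=
    (hasFDerivAt_id z).const_add v
  have := (hgrad (v + z)).comp z h1
  rwa [ContinuousLinearMap.comp_id] at this

variable {s : Finset ι} {w : ι → ℝ} {u : ι → E}

/-- Posterior mean of `x` in a Gaussian mixture with centers `u`. -/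
noncomputable def pmean (s : Finset ι) (w : ι → ℝ) (u x : ι → E) (y : E) : E :=
  ∑ k ∈ s, post s w u k y • x k

lemma grad_log_mix_eq (y : E) : (mix s w u y)⁻¹ • mixv s w u y = pmean s w u u y := by
  simp only [mixv, pmean, post, Finset.smul_sum, smul_smul]
  exact Finset.sum_congr rfl fun k _ => by rw [div_eq_inv_mul]

lemma norm_pmean_le (hs : s.Nonempty) (hw : ∀ j ∈ s, 0 < w j) {x : ι → E} {L : ℝ}
    (hx : ∀ j ∈ s, ‖x j‖ ≤ L) (y : E) : ‖pmean s w u x y‖ ≤ L := by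
  refine (norm_sum_le _ _).trans ?_
  calc ∑ k ∈ s, ‖post s w u k y • x k‖ ≤ ∑ k ∈ s, post s w u k y * L :=
        Finset.sum_le_sum fun k hk => by
          rw [norm_smul, Real.norm_of_nonneg (post_nonneg hs hw hk y)]
          exact mul_le_mul_of_nonneg_left (hx k hk) (post_nonneg hs hw hk y)
    _ = L := by rw [← Finset.sum_mul, sum_post hs hw, one_mul]

lemma continuous_pmean (hs : s.Nonempty) (hw : ∀ j ∈ s, 0 < w j) {x : ι → E} :
    Continuous (pmean s w u x) :=
  continuous_finsetSum _ fun _ _ => (continuous_post hs hw).smul continuous_const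

lemma pmean_smul (c : ℝ) (x : ι → E) (y : E) :
    pmean s w u (fun k => c • x k) y = c • pmean s w u x y := by
  simp only [pmean, Finset.smul_sum, smul_comm c]

lemma mix_smul_pmean (hs : s.Nonempty) (hw : ∀ j ∈ s, 0 < w j) (x : ι → E) (y : E) :
    mix s w u y • pmean s w u x y = ∑ k ∈ s, (w k * phi (u k) y) • x k := by
  simp only [pmean, Finset.smul_sum, post, smul_smul]
  exact Finset.sum_congr rfl fun k _ => by rw [mul_div_cancel₀ _ (mix_pos hs hw y).ne']

/-- The expected squared posterior mean. -/
noncomputable def pm2 (s : Finset ι) (w : ι → ℝ) (u x : ι → E) : ℝ :=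
  ∫ y, mix s w u y * ‖pmean s w u x y‖ ^ 2 ∂(stdGaussian E)

lemma integrable_mix : Integrable (mix s w u) (stdGaussian E) :=
  integrable_finsetSum _ fun _ _ => (integrable_phi _).const_mul _

lemma integral_mix : ∫ y, mix s w u y ∂(stdGaussian E) = ∑ j ∈ s, w j := by
  unfold mix
  rw [integral_finsetSum _ fun _ _ => (integrable_phi _).const_mul _]
  simp [integral_const_mul, integral_phi]

lemma integrable_mix_mul {F : E → ℝ} (hF : Continuous F) {B : ℝ} (hB : ∀ y, |F y| ≤ B) :
    Integrable (fun y => mix s w u y * F y) (stdGaussian E) :=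
  integrable_mix.mul_bdd hF.aestronglyMeasurable (ae_of_all _ hB)

lemma pm2_mono (hs : s.Nonempty) (hw : ∀ j ∈ s, 0 < w j) (x : ι → E) {c : ℝ} (hc0 : 0 ≤ c)
    (hc1 : c ≤ 1) : pm2 s w (fun k => c • u k) x ≤ pm2 s w u x := by
  obtain ⟨θ, rfl⟩ : ∃ θ, c = cos θ := ⟨arccos c, (cos_arccos (by linarith) hc1).symm⟩
  set P := (stdGaussian E).prod (stdGaussian E)
  obtain ⟨L, hL⟩ : ∃ L, ∀ k ∈ s, ‖x k‖ ≤ L :=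
    ⟨∑ k ∈ s, ‖x k‖, fun k hk => Finset.single_le_sum (f := fun k => ‖x k‖)
      (fun _ _ => norm_nonneg _) hk⟩
  set v := pmean s w (fun k => cos θ • u k) x with hv
  have hvc : Continuous v := continuous_pmean hs hw
  have hpc : Continuous (pmean s w u x) := continuous_pmean hs hw
  have hvL : ∀ y, ‖v y‖ ≤ L := norm_pmean_le hs hw hL
  have hpL : ∀ y, ‖pmean s w u x y‖ ≤ L := norm_pmean_le hs hw hL
  have hL0 : 0 ≤ L := (norm_nonneg _).trans (hvL 0)
  let A : E × E → ℝ := fun p => mix s w u p.1 * ‖pmean s w u x p.1‖ ^ 2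
  have hA1 : Integrable A P := by
    have : Integrable (fun y => mix s w u y * ‖pmean s w u x y‖ ^ 2) (stdGaussian E) :=
      integrable_mix_mul (by fun_prop) (B := L ^ 2) fun y => by
        rw [abs_of_nonneg (by positivity)]; exact pow_le_pow_left₀ (norm_nonneg _) (hpL y) 2
    exact this.comp_fst _
  have hAr := integrable_rotation θ hA1
  have hA2 : ∫ p, A (ContinuousLinearMap.rotation θ p) ∂P = pm2 s w u x := by
    rw [integral_rotation θ (by simp only [A]; fun_prop)]
    rw [integral_fun_fst (μ := stdGaussian E) (ν := stdGaussian E)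
      (fun y => mix s w u y * ‖pmean s w u x y‖ ^ 2)]
    simp [pm2]
  rw [← hA2, integral_prod _ hAr]
  refine integral_mono_of_nonneg (ae_of_all _ fun y => ?_) hAr.integral_prod_left ?_
  · exact mul_nonneg (mix_pos hs hw y).le (sq_nonneg _)
  · filter_upwards [hAr.prod_right_ae] with z hz
    have hsq : cos θ ^ 2 + sin θ ^ 2 = 1 := by rw [add_comm]; exact sin_sq_add_cos_sq θ
    have hrot : ∀ z', (ContinuousLinearMap.rotation θ (z, z')).1 = cos θ • z + sin θ • z' :=
      fun _ => rfl
    have hlow : ∀ z', ∑ k ∈ s, w k * (2 * ⟪v z, x k⟫_ℝ - ‖v z‖ ^ 2) *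
        phi (u k) (cos θ • z + sin θ • z') ≤ A (ContinuousLinearMap.rotation θ (z, z')) :=
      fun z' => by
        simp only [A, hrot]
        set y := cos θ • z + sin θ • z'
        have h1 : ∑ k ∈ s, w k * (2 * ⟪v z, x k⟫_ℝ - ‖v z‖ ^ 2) * phi (u k) y =
            2 * ⟪v z, mix s w u y • pmean s w u x y⟫_ℝ - ‖v z‖ ^ 2 * mix s w u y := by
          rw [mix_smul_pmean hs hw, inner_sum, mix, Finset.mul_sum, Finset.mul_sum,
            ← Finset.sum_sub_distrib]
          refine Finset.sum_congr rfl fun k _ => ?_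
          rw [inner_smul_right]; ring
        rw [h1, inner_smul_right]
        have h2 := mul_nonneg (mix_pos hs hw (u := u) y).le (sq_nonneg ‖v z - pmean s w u x y‖)
        rw [@norm_sub_sq_real] at h2
        linarith
    have hIntegrable : ∫ z', ∑ k ∈ s, w k * (2 * ⟪v z, x k⟫_ℝ - ‖v z‖ ^ 2) *
        phi (u k) (cos θ • z + sin θ • z') ∂(stdGaussian E) =
        mix s w (fun k => cos θ • u k) z * ‖v z‖ ^ 2 := by
      rw [integral_finsetSum _ fun k _ => (integrable_phi_mehler _ _ _ _).const_mul _]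
      simp_rw [integral_const_mul, integral_phi_mehler _ _ hsq]
      have h1 : ∑ k ∈ s, w k * (2 * ⟪v z, x k⟫_ℝ - ‖v z‖ ^ 2) * phi (cos θ • u k) z =
          2 * ⟪v z, mix s w (fun k => cos θ • u k) z • v z⟫_ℝ -
            ‖v z‖ ^ 2 * mix s w (fun k => cos θ • u k) z := by
        rw [hv, mix_smul_pmean hs hw, inner_sum, mix, Finset.mul_sum, Finset.mul_sum,
          ← Finset.sum_sub_distrib]
        refine Finset.sum_congr rfl fun k _ => ?_
        rw [inner_smul_right]; ring
      rw [h1, inner_smul_right, real_inner_self_eq_norm_sq]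
      ring
    rw [← hIntegrable]
    exact integral_mono (integrable_finsetSum _ fun k _ => (integrable_phi_mehler _ _ _ _).const_mul _)
      hz hlow

lemma hasFDerivAt_log_mix' (hs : s.Nonempty) (hw : ∀ j ∈ s, 0 < w j) (z : E) :
    HasFDerivAt (fun z => log (mix s w u z)) (innerSL ℝ (pmean s w u u z)) z := by
  rw [← grad_log_mix_eq]; exact hasFDerivAt_log_mix hs hw z

lemma integrable_log_mix_shift (hs : s.Nonempty) (hw : ∀ j ∈ s, 0 < w j) (v : E) :
    Integrable (fun z => log (mix s w u (v + z))) (stdGaussian E) := by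
  obtain ⟨L, hL⟩ : ∃ L, ∀ k ∈ s, ‖u k‖ ≤ L :=
    ⟨∑ k ∈ s, ‖u k‖, fun k hk => Finset.single_le_sum (f := fun k => ‖u k‖)
      (fun _ _ => norm_nonneg _) hk⟩
  exact (integrable_of_grad (fun z => hasFDerivAt_shift (hasFDerivAt_log_mix' hs hw) v z)
    fun z => norm_pmean_le hs hw hL _).1

lemma mix_mul (z : E) (X : ℝ) : mix s w u z * X = ∑ j ∈ s, w j * (phi (u j) z * X) := by
  simp only [mix, Finset.sum_mul, mul_assoc]

lemma integrable_mul_log_mix (hs : s.Nonempty) (hw : ∀ j ∈ s, 0 < w j) :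
    Integrable (fun z => mix s w u z * log (mix s w u z)) (stdGaussian E) := by
  have h : ∀ j ∈ s, Integrable (fun z => w j * (phi (u j) z * log (mix s w u z)))
      (stdGaussian E) := fun j _ =>
    ((integrable_shift_iff (u j) _).1 (integrable_log_mix_shift hs hw (u j))).const_mul _
  exact (integrable_finsetSum _ h).congr (ae_of_all _ fun z => (mix_mul z _).symm)

/-- Entropy of the mixture with centers scaled by `t`. -/
noncomputable def ment (s : Finset ι) (w : ι → ℝ) (u : ι → E) (t : ℝ) : ℝ :=
  ∑ j ∈ s, w j * ∫ z, log (mix s w (fun k => t • u k) (t • u j + z)) ∂(stdGaussian E)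

lemma ment_eq (hs : s.Nonempty) (hw : ∀ j ∈ s, 0 < w j) (t : ℝ) :
    ment s w u t = ∫ z, mix s w (fun k => t • u k) z * log (mix s w (fun k => t • u k) z)
      ∂(stdGaussian E) := by
  have h : ∀ j ∈ s, Integrable (fun z => w j * (phi (t • u j) z *
      log (mix s w (fun k => t • u k) z))) (stdGaussian E) := fun j _ =>
    ((integrable_shift_iff (t • u j) _).1
      (integrable_log_mix_shift (u := fun k => t • u k) hs hw (t • u j))).const_mul _
  have e : ∀ z, mix s w (fun k => t • u k) z * log (mix s w (fun k => t • u k) z) =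
      ∑ j ∈ s, w j * (phi (t • u j) z * log (mix s w (fun k => t • u k) z)) :=
    fun z => mix_mul z _
  simp_rw [e]
  rw [integral_finsetSum _ h, ment]
  refine Finset.sum_congr rfl fun j _ => ?_
  rw [integral_const_mul]
  congr 1
  exact integral_shift' (t • u j) fun z => log (mix s w (fun k => t • u k) z)

lemma phi_smul_shift (t : ℝ) (a b z : E) :
    phi (t • a) (t • b + z) = exp (t ^ 2 * (⟪a, b⟫_ℝ - ‖a‖ ^ 2 / 2) + t * ⟪a, z⟫_ℝ) := by
  simp only [phi, inner_add_right, inner_smul_right, inner_smul_left, norm_smul, mul_pow,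
    Real.norm_eq_abs, sq_abs, RCLike.conj_to_real]
  congr 1; ring

lemma hasDerivAt_ment_integrand (hs : s.Nonempty) (hw : ∀ j ∈ s, 0 < w j) (b z : E) (t : ℝ) :
    HasDerivAt (fun t : ℝ => log (mix s w (fun k => t • u k) (t • b + z)))
      (∑ k ∈ s, post s w (fun k => t • u k) k (t • b + z) *
        (2 * t * (⟪u k, b⟫_ℝ - ‖u k‖ ^ 2 / 2) + ⟪u k, z⟫_ℝ)) t := by
  have h1 : ∀ k ∈ s, HasDerivAt (fun t : ℝ => w k * phi (t • u k) (t • b + z))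
      (w k * phi (t • u k) (t • b + z) *
        (2 * t * (⟪u k, b⟫_ℝ - ‖u k‖ ^ 2 / 2) + ⟪u k, z⟫_ℝ)) t := fun k _ => by
    simp_rw [phi_smul_shift]
    have := (((hasDerivAt_pow 2 t).mul_const (⟪u k, b⟫_ℝ - ‖u k‖ ^ 2 / 2)).add
      ((hasDerivAt_id' t).mul_const ⟪u k, z⟫_ℝ)).exp.const_mul (w k)
    refine this.congr_deriv ?_
    simp only [Pi.add_apply]
    push_cast; ring
  have h2 := (HasDerivAt.fun_sum h1).log (mix_pos hs hw (u := fun k => t • u k) (t • b + z)).ne'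
  refine h2.congr_deriv ?_
  rw [Finset.sum_div]
  exact Finset.sum_congr rfl fun k _ => by simp only [post, mix]; ring

lemma integral_ment_integrand (hs : s.Nonempty) (hw : ∀ j ∈ s, 0 < w j) (b : E) (t : ℝ) :
    ∫ z, (∑ k ∈ s, post s w (fun k => t • u k) k (t • b + z) *
        (2 * t * (⟪u k, b⟫_ℝ - ‖u k‖ ^ 2 / 2) + ⟪u k, z⟫_ℝ)) ∂(stdGaussian E) =
      t * ∫ z, (2 * ⟪b, pmean s w (fun k => t • u k) u (t • b + z)⟫_ℝ -
        ‖pmean s w (fun k => t • u k) u (t • b + z)‖ ^ 2) ∂(stdGaussian E) := by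
  set U : ι → E := fun k => t • u k with hU
  set p : ι → E → ℝ := fun k z => post s w U k (t • b + z) with hp
  set m : E → E := fun z => pmean s w U u (t • b + z) with hm
  have hpc : ∀ k, Continuous (p k) := fun k => (continuous_post hs hw).comp (by fun_prop)
  have hmc : Continuous m := (continuous_pmean hs hw).comp (by fun_prop)
  have hpB : ∀ k ∈ s, ∀ z, |p k z| ≤ 1 := fun k hk z => by
    rw [abs_of_nonneg (post_nonneg hs hw hk _)]; exact post_le_one hs hw hk _
  have hpi : ∀ k ∈ s, Integrable (p k) (stdGaussian E) := fun k hk =>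
    (integrable_const (1 : ℝ)).mono' (hpc k).aestronglyMeasurable (ae_of_all _ (hpB k hk))
  obtain ⟨L, hL⟩ : ∃ L, ∀ k ∈ s, ‖u k‖ ≤ L :=
    ⟨∑ k ∈ s, ‖u k‖, fun k hk => Finset.single_le_sum (f := fun k => ‖u k‖)
      (fun _ _ => norm_nonneg _) hk⟩
  have hmL : ∀ z, ‖m z‖ ≤ L := fun z => norm_pmean_le hs hw hL _
  have hmU : ∀ y, pmean s w U U y = t • pmean s w U u y := fun y => pmean_smul t u y
  have hgrad : ∀ k z, HasFDerivAt (p k) (innerSL ℝ ((t * p k z) • (u k - m z))) z := fun k z => by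
    have := hasFDerivAt_shift (fun z => hasFDerivAt_post hs hw (u := U) (k := k) z) (t • b) z
    rw [grad_log_mix_eq, hmU, ← smul_sub, smul_smul, mul_comm] at this
    exact this
  have hibp : ∀ k ∈ s, ∫ z, ⟪u k, z⟫_ℝ * p k z ∂(stdGaussian E) =
      ∫ z, ⟪(t * p k z) • (u k - m z), u k⟫_ℝ ∂(stdGaussian E) := fun k hk => by
    refine integral_inner_mul (L := |t| * (L + L)) (B := 1) ?_ (hgrad k) (fun z => ?_) (hpB k hk) (u k)
    · have := hpc k; fun_prop
    · rw [norm_smul, Real.norm_eq_abs, abs_mul]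
      refine mul_le_mul (mul_le_of_le_one_right (abs_nonneg _) (hpB k hk z)) ?_ (norm_nonneg _)
        (abs_nonneg _)
      exact (norm_sub_le _ _).trans (add_le_add (hL k hk) (hmL z))
  have hi1 : ∀ k ∈ s, Integrable (fun z => p k z * (2 * t * (⟪u k, b⟫_ℝ - ‖u k‖ ^ 2 / 2)))
      (stdGaussian E) := fun k hk => (hpi k hk).mul_const _
  have hi2 : ∀ k ∈ s, Integrable (fun z => ⟪u k, z⟫_ℝ * p k z) (stdGaussian E) := fun k hk =>
    (integrable_inner (u k)).mul_bdd (hpc k).aestronglyMeasurable (ae_of_all _ (hpB k hk))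
  have hi3 : ∀ k ∈ s, Integrable (fun z => ⟪(t * p k z) • (u k - m z), u k⟫_ℝ)
      (stdGaussian E) := fun k hk => by
    refine (integrable_const (|t| * (L + L) * L)).mono' ?_ (ae_of_all _ fun z => ?_)
    · have := hpc k; fun_prop
    · refine (norm_inner_le_norm _ _).trans (mul_le_mul ?_ (hL k hk) (norm_nonneg _) ?_)
      · rw [norm_smul, Real.norm_eq_abs, abs_mul]
        refine mul_le_mul (mul_le_of_le_one_right (abs_nonneg _) (hpB k hk z)) ?_ (norm_nonneg _)
          (abs_nonneg _)
        exact (norm_sub_le _ _).trans (add_le_add (hL k hk) (hmL z))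
      · have := (norm_nonneg _).trans (hL k hk); positivity
  have e1 : ∀ z, ∑ k ∈ s, p k z * (2 * t * (⟪u k, b⟫_ℝ - ‖u k‖ ^ 2 / 2) + ⟪u k, z⟫_ℝ) =
      ∑ k ∈ s, (p k z * (2 * t * (⟪u k, b⟫_ℝ - ‖u k‖ ^ 2 / 2)) + ⟪u k, z⟫_ℝ * p k z) := fun z =>
    Finset.sum_congr rfl fun k _ => by ring
  calc ∫ z, (∑ k ∈ s, p k z * (2 * t * (⟪u k, b⟫_ℝ - ‖u k‖ ^ 2 / 2) + ⟪u k, z⟫_ℝ)) ∂(stdGaussian E)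
      = ∑ k ∈ s, ∫ z, (p k z * (2 * t * (⟪u k, b⟫_ℝ - ‖u k‖ ^ 2 / 2)) +
          ⟪(t * p k z) • (u k - m z), u k⟫_ℝ) ∂(stdGaussian E) := by
        simp_rw [e1]
        rw [integral_finsetSum _ (by exact fun k hk => (hi1 k hk).add (hi2 k hk))]
        refine Finset.sum_congr rfl fun k hk => ?_
        rw [integral_add (hi1 k hk) (hi2 k hk), integral_add (hi1 k hk) (hi3 k hk), hibp k hk]
    _ = ∫ z, ∑ k ∈ s, (p k z * (2 * t * (⟪u k, b⟫_ℝ - ‖u k‖ ^ 2 / 2)) +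
          ⟪(t * p k z) • (u k - m z), u k⟫_ℝ) ∂(stdGaussian E) :=
        (integral_finsetSum _ fun k hk => (hi1 k hk).add (hi3 k hk)).symm
    _ = ∫ z, t * (2 * ⟪b, m z⟫_ℝ - ‖m z‖ ^ 2) ∂(stdGaussian E) := by
        congr 1; funext z
        have h1 : ⟪b, m z⟫_ℝ = ∑ k ∈ s, p k z * ⟪u k, b⟫_ℝ := by
          simp only [hm, pmean, inner_sum, inner_smul_right, hp]
          exact Finset.sum_congr rfl fun k _ => by rw [real_inner_comm]
        have h2 : ‖m z‖ ^ 2 = ∑ k ∈ s, p k z * ⟪m z, u k⟫_ℝ := by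
          have h3 : ∀ v : E, ⟪v, m z⟫_ℝ = ∑ k ∈ s, p k z * ⟪v, u k⟫_ℝ := fun v => by
            simp only [hm, pmean, inner_sum, inner_smul_right, hp]
          rw [← real_inner_self_eq_norm_sq, h3]
        rw [h1, h2, Finset.mul_sum, ← Finset.sum_sub_distrib, Finset.mul_sum]
        refine Finset.sum_congr rfl fun k _ => ?_
        rw [inner_smul_left, inner_sub_left, real_inner_self_eq_norm_sq, RCLike.conj_to_real]
        ring
    _ = _ := by rw [integral_const_mul]

lemma hasDerivAt_ment (hs : s.Nonempty) (hw : ∀ j ∈ s, 0 < w j) (t : ℝ) :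
    HasDerivAt (ment s w u) (t * pm2 s w (fun k => t • u k) u) t := by
  obtain ⟨L, hL⟩ : ∃ L, ∀ k ∈ s, ‖u k‖ ≤ L :=
    ⟨∑ k ∈ s, ‖u k‖, fun k hk => Finset.single_le_sum (f := fun k => ‖u k‖)
      (fun _ _ => norm_nonneg _) hk⟩
  have hL0 : 0 ≤ L := by obtain ⟨k, hk⟩ := hs; exact (norm_nonneg _).trans (hL k hk)
  have h1 : ∀ j ∈ s, HasDerivAt
      (fun t : ℝ => w j * ∫ z, log (mix s w (fun k => t • u k) (t • u j + z)) ∂(stdGaussian E))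
      (w j * (t * ∫ z, (2 * ⟪u j, pmean s w (fun k => t • u k) u (t • u j + z)⟫_ℝ -
        ‖pmean s w (fun k => t • u k) u (t • u j + z)‖ ^ 2) ∂(stdGaussian E))) t := fun j hj => by
    refine HasDerivAt.const_mul _ ?_
    rw [← integral_ment_integrand hs hw]
    refine (hasDerivAt_integral_of_dominated_loc_of_deriv_le (μ := stdGaussian E)
      (F := fun t z => log (mix s w (fun k => t • u k) (t • u j + z)))
      (F' := fun t z => ∑ k ∈ s, post s w (fun k => t • u k) k (t • u j + z) *
        (2 * t * (⟪u k, u j⟫_ℝ - ‖u k‖ ^ 2 / 2) + ⟪u k, z⟫_ℝ))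
      (bound := fun z => 2 * (|t| + 1) * (L * L + L ^ 2 / 2) + L * ‖z‖)
      (s := Metric.ball t 1)
      (Metric.ball_mem_nhds _ one_pos) (Eventually.of_forall fun t' => ?_)
      (integrable_log_mix_shift hs hw _) ?_ (ae_of_all _ fun z t' ht' => ?_)
      ((integrable_const _).add (integrable_norm.const_mul _))
      (ae_of_all _ fun z t' _ => hasDerivAt_ment_integrand hs hw _ _ _)).2
    · exact (integrable_log_mix_shift hs hw _).aestronglyMeasurable
    · refine Continuous.aestronglyMeasurable (continuous_finsetSum _ fun k _ => ?_)
      exact ((continuous_post hs hw).comp (by fun_prop)).mul (by fun_prop)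
    · rw [Metric.mem_ball, Real.dist_eq] at ht'
      have ht2 : |t'| ≤ |t| + 1 := by
        have := abs_sub_abs_le_abs_sub t' t; linarith
      refine (norm_sum_le _ _).trans ?_
      calc ∑ k ∈ s, ‖post s w (fun k => t' • u k) k (t' • u j + z) *
              (2 * t' * (⟪u k, u j⟫_ℝ - ‖u k‖ ^ 2 / 2) + ⟪u k, z⟫_ℝ)‖
          ≤ ∑ k ∈ s, post s w (fun k => t' • u k) k (t' • u j + z) *
              (2 * (|t| + 1) * (L * L + L ^ 2 / 2) + L * ‖z‖) :=
            Finset.sum_le_sum fun k hk => by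
              have hp := post_nonneg hs hw (u := fun k => t' • u k) hk (t' • u j + z)
              rw [norm_mul, Real.norm_of_nonneg hp]
              refine mul_le_mul_of_nonneg_left ((norm_add_le _ _).trans (add_le_add ?_ ?_)) hp
              · rw [norm_mul, norm_mul, Real.norm_eq_abs, Real.norm_eq_abs, Real.norm_eq_abs, abs_two]
                refine mul_le_mul (by linarith) ((abs_sub _ _).trans (add_le_add ?_ ?_))
                  (abs_nonneg _) (by positivity)
                · exact (abs_real_inner_le_norm _ _).trans
                    (mul_le_mul (hL k hk) (hL j hj) (norm_nonneg _) hL0)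
                · rw [abs_of_nonneg (by positivity)]
                  have := pow_le_pow_left₀ (norm_nonneg _) (hL k hk) 2
                  linarith
              · exact (norm_inner_le_norm _ _).trans
                  (mul_le_mul_of_nonneg_right (hL k hk) (norm_nonneg _))
        _ = _ := by rw [← Finset.sum_mul, sum_post hs hw, one_mul]
  refine (HasDerivAt.fun_sum h1).congr_deriv ?_
  set U : ι → E := fun k => t • u k with hU
  set M : E → E := pmean s w U u with hM
  have hMc : Continuous M := continuous_pmean hs hw
  have hML : ∀ z, ‖M z‖ ≤ L := norm_pmean_le hs hw hL
  have hbd : ∀ j ∈ s, ∀ z, |2 * ⟪u j, M z⟫_ℝ - ‖M z‖ ^ 2| ≤ 2 * (L * L) + L ^ 2 := fun j hj z => by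
    refine (abs_sub _ _).trans (add_le_add ?_ ?_)
    · rw [abs_mul, abs_two]
      exact mul_le_mul_of_nonneg_left ((abs_real_inner_le_norm _ _).trans
        (mul_le_mul (hL j hj) (hML z) (norm_nonneg _) hL0)) zero_le_two
    · rw [abs_of_nonneg (by positivity)]
      exact pow_le_pow_left₀ (norm_nonneg _) (hML z) 2
  calc ∑ j ∈ s, w j * (t * ∫ z, (2 * ⟪u j, M (t • u j + z)⟫_ℝ - ‖M (t • u j + z)‖ ^ 2)
        ∂(stdGaussian E))
      = t * ∑ j ∈ s, ∫ z, w j * (phi (t • u j) z * (2 * ⟪u j, M z⟫_ℝ - ‖M z‖ ^ 2))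
          ∂(stdGaussian E) := by
        rw [Finset.mul_sum]
        refine Finset.sum_congr rfl fun j _ => ?_
        rw [integral_const_mul,
          integral_shift' (t • u j) (fun z => 2 * ⟪u j, M z⟫_ℝ - ‖M z‖ ^ 2)]
        ring
    _ = t * ∫ z, ∑ j ∈ s, w j * (phi (t • u j) z * (2 * ⟪u j, M z⟫_ℝ - ‖M z‖ ^ 2))
          ∂(stdGaussian E) := by
        rw [integral_finsetSum]
        exact fun j hj => (((integrable_phi _).mul_bdd (by fun_prop)
          (ae_of_all _ (hbd j hj))).const_mul _)
    _ = t * pm2 s w U u := by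
        rw [pm2]
        congr 2; funext z
        have h2 : ∑ j ∈ s, w j * (phi (t • u j) z * (2 * ⟪u j, M z⟫_ℝ - ‖M z‖ ^ 2)) =
            2 * ⟪M z, mix s w U z • M z⟫_ℝ - ‖M z‖ ^ 2 * mix s w U z := by
          have h3 : ∀ v : E, ⟪v, mix s w U z • M z⟫_ℝ =
              ⟪v, ∑ k ∈ s, (w k * phi (U k) z) • u k⟫_ℝ := fun v => by
            rw [hM, mix_smul_pmean hs hw]
          rw [h3, inner_sum, mix, Finset.mul_sum, Finset.mul_sum, ← Finset.sum_sub_distrib]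
          refine Finset.sum_congr rfl fun k _ => ?_
          rw [inner_smul_right, real_inner_comm]; ring
        rw [h2, inner_smul_right, real_inner_self_eq_norm_sq]
        ring

/-- The logarithmic Sobolev inequality for Gaussian mixtures. -/
lemma entropy_mix_le (hs : s.Nonempty) (hw : ∀ j ∈ s, 0 < w j) (hsum : ∑ j ∈ s, w j = 1) :
    ∫ z, mix s w u z * log (mix s w u z) ∂(stdGaussian E) ≤ pm2 s w u u / 2 := by
  have h0 : ment s w u 0 = 0 := by
    have : ∀ z : E, mix s w (fun k => (0 : ℝ) • u k) z = 1 := fun z => by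
      simp [mix, phi, hsum]
    simp only [ment, this, log_one, integral_zero, mul_zero, Finset.sum_const_zero]
  have h1 : ment s w u 1 = ∫ z, mix s w u z * log (mix s w u z) ∂(stdGaussian E) := by
    rw [ment_eq hs hw]; simp
  have hd : ∀ t, HasDerivAt (fun t => ment s w u t - t ^ 2 * (pm2 s w u u / 2))
      (t * pm2 s w (fun k => t • u k) u - t * pm2 s w u u) t := fun t => by
    refine ((hasDerivAt_ment hs hw t).sub
      ((hasDerivAt_pow 2 t).mul_const (pm2 s w u u / 2))).congr_deriv ?_
    push_cast; ring
  have hanti : AntitoneOn (fun t => ment s w u t - t ^ 2 * (pm2 s w u u / 2)) (Set.Icc 0 1) := by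
    refine antitoneOn_of_deriv_nonpos (convex_Icc _ _)
      (fun t _ => (hd t).continuousAt.continuousWithinAt)
      (fun t _ => (hd t).differentiableAt.differentiableWithinAt) fun t ht => ?_
    rw [interior_Icc] at ht
    rw [(hd t).deriv, ← mul_sub]
    have := pm2_mono hs hw (u := u) (x := u) ht.1.le ht.2.le
    exact mul_nonpos_of_nonneg_of_nonpos ht.1.le (by linarith)
  have := hanti (Set.left_mem_Icc.2 zero_le_one) (Set.right_mem_Icc.2 zero_le_one) zero_le_one
  simp only [h0, h1] at this
  linarith

end LSI

end GaussRel

namespace GaussRel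
open ProbabilityTheory
open scoped InnerProductSpace
set_option linter.unusedSectionVars false

section Amp

variable {E : Type*} [NormedAddCommGroup E] [InnerProductSpace ℝ E] [FiniteDimensional ℝ E]
  [MeasurableSpace E] [BorelSpace E]

/-- Square root of the density of the Gaussian centred at `x` relative to the standard one. -/
noncomputable def amp (x y : E) : ℝ := exp (⟪x, y⟫_ℝ / 2 - ‖x‖ ^ 2 / 4)

/-- Hellinger affinity of two translated Gaussians. -/
noncomputable def aff (x y : E) : ℝ := exp (-‖x - y‖ ^ 2 / 8)

/-- Midpoint of two vectors. -/
noncomputable def mid (x y : E) : E := (1 / 2 : ℝ) • (x + y)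

/-- Sum of amplitudes. -/
noncomputable def asum (J : Finset E) (y : E) : ℝ := ∑ j ∈ J, amp j y

/-- Noise vectors for which some competitor of `x` in `C` comes within `t` of beating `x`. -/
def nearSet (C : Finset E) (x : E) (t : ℝ) : Set E :=
  {z | ∃ c ∈ C, c ≠ x ∧ ‖c - x‖ ^ 2 / 2 - t ≤ ⟪c - x, z⟫_ℝ}

/-- Error probability of the word `x` of the code `C`. -/
noncomputable def perr (C : Finset E) (x : E) : ℝ := (stdGaussian E).real (nearSet C x 0)

lemma amp_pos (x y : E) : 0 < amp x y := exp_pos _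

@[fun_prop] lemma continuous_amp (x : E) : Continuous (amp x) := by unfold amp; fun_prop

lemma aff_pos (x y : E) : 0 < aff x y := exp_pos _

lemma aff_comm (x y : E) : aff x y = aff y x := by rw [aff, aff, norm_sub_rev]

lemma mid_comm (x y : E) : mid x y = mid y x := by rw [mid, mid, add_comm]

lemma amp_mul_amp (i j y : E) : amp i y * amp j y = aff i j * phi (mid i j) y := by
  simp only [amp, aff, phi, mid, ← exp_add, norm_smul, mul_pow, inner_smul_left, inner_add_left,
    RCLike.conj_to_real, norm_add_sq_real, norm_sub_sq_real, Real.norm_eq_abs, sq_abs]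
  congr 1; ring

lemma amp_mul_self (i y : E) : amp i y * amp i y = phi i y := by
  simp only [amp, phi, ← exp_add]
  congr 1; ring

lemma amp_eq (i y : E) : amp i y = exp (-‖i‖ ^ 2 / 8) * phi ((1 / 2 : ℝ) • i) y := by
  simp only [amp, phi, ← exp_add, norm_smul, mul_pow, inner_smul_left, RCLike.conj_to_real,
    Real.norm_eq_abs, sq_abs]
  congr 1; ring

lemma amp_shift (i j x : E) :
    amp j (i + x) = amp i (i + x) * (aff i j * phi ((1 / 2 : ℝ) • (j - i)) x) := by
  simp only [amp, aff, phi, ← exp_add, norm_smul, mul_pow, inner_smul_left, inner_sub_left,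
    RCLike.conj_to_real, norm_sub_sq_real, Real.norm_eq_abs, sq_abs, inner_add_right,
    real_inner_self_eq_norm_sq, real_inner_comm i j]
  congr 1; ring

lemma amp_mid (i j z : E) :
    amp j (mid i j + z) = amp i (mid i j + z) * exp (⟪j - i, z⟫_ℝ / 2) := by
  simp only [amp, mid, ← exp_add, inner_smul_right, inner_sub_left, inner_add_right,
    real_inner_self_eq_norm_sq, real_inner_comm i j]
  congr 1; ring

lemma amp_shift_le_iff (i j z : E) (s : ℝ) :
    exp (-s) * amp i (i + z) ≤ amp j (i + z) ↔ ‖j - i‖ ^ 2 / 2 - 2 * s ≤ ⟪j - i, z⟫_ℝ := by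
  rw [amp_shift i j, mul_comm, mul_le_mul_iff_right₀ (amp_pos _ _)]
  simp only [aff, phi, ← exp_add, exp_le_exp, norm_smul, mul_pow, inner_smul_left,
    RCLike.conj_to_real, Real.norm_eq_abs, sq_abs, norm_sub_rev i j]
  constructor <;> intro h <;> linarith

lemma asum_eq_mix (J : Finset E) (y : E) :
    asum J y = mix J (fun j => exp (-‖j‖ ^ 2 / 8)) (fun j => (1 / 2 : ℝ) • j) y := by
  simp only [asum, mix, ← amp_eq]

@[fun_prop] lemma continuous_asum (J : Finset E) : Continuous (asum J) := by
  unfold asum; fun_prop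

lemma asum_nonneg (J : Finset E) (y : E) : 0 ≤ asum J y :=
  Finset.sum_nonneg fun _ _ => (amp_pos _ _).le

lemma asum_pos {J : Finset E} (hJ : J.Nonempty) (y : E) : 0 < asum J y :=
  Finset.sum_pos (fun _ _ => amp_pos _ _) hJ

lemma integral_amp_mul (i j : E) (F : E → ℝ) :
    ∫ y, amp i y * amp j y * F y ∂(stdGaussian E) =
      aff i j * ∫ z, F (mid i j + z) ∂(stdGaussian E) := by
  rw [integral_shift', ← integral_const_mul]
  simp_rw [amp_mul_amp, mul_assoc]

lemma integrable_amp_mul (i j : E) : Integrable (fun y => amp i y * amp j y) (stdGaussian E) := by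
  simp_rw [amp_mul_amp]
  exact (integrable_phi _).const_mul _

lemma integrable_amp_mul_bdd (i j : E) {F : E → ℝ} (hF : Measurable F) {B : ℝ}
    (hB : ∀ y, |F y| ≤ B) : Integrable (fun y => amp i y * amp j y * F y) (stdGaussian E) :=
  (integrable_amp_mul i j).mul_bdd hF.aestronglyMeasurable (ae_of_all _ hB)

lemma integral_amp_indicator (i j : E) {B : Set E} (hB : MeasurableSet B) :
    ∫ y, amp i y * amp j y * B.indicator 1 y ∂(stdGaussian E) =
      aff i j * (stdGaussian E).real {z | mid i j + z ∈ B} := by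
  rw [integral_amp_mul]
  congr 1
  have hm : MeasurableSet {z : E | mid i j + z ∈ B} := hB.preimage (by fun_prop)
  rw [← integral_indicator_one hm]
  rfl

lemma integrable_amp_indicator (i j : E) {B : Set E} (hB : MeasurableSet B) :
    Integrable (fun y => amp i y * amp j y * B.indicator 1 y) (stdGaussian E) :=
  integrable_amp_mul_bdd i j (measurable_one.indicator hB) (B := 1) fun y => by
    by_cases h : y ∈ B <;> simp [h]

lemma measurableSet_nearSet (C : Finset E) (x : E) (t : ℝ) : MeasurableSet (nearSet C x t) := by
  classical
  have : nearSet C x t = ⋃ c ∈ C.filter (· ≠ x), {z | ‖c - x‖ ^ 2 / 2 - t ≤ ⟪c - x, z⟫_ℝ} := by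
    ext z; simp [nearSet, and_assoc]
  rw [this]
  exact Finset.measurableSet_biUnion _ fun c _ => measurableSet_le (by fun_prop) (by fun_prop)

lemma nearSet_mono {C C' : Finset E} (h : C ⊆ C') (x : E) (t : ℝ) :
    nearSet C x t ⊆ nearSet C' x t := fun _ ⟨c, hc, h'⟩ => ⟨c, h hc, h'⟩

lemma perr_mono {C C' : Finset E} (h : C ⊆ C') (x : E) : perr C x ≤ perr C' x :=
  measureReal_mono (nearSet_mono h x 0)

lemma perr_nonneg (C : Finset E) (x : E) : 0 ≤ perr C x := measureReal_nonneg

/-- Scaling the noise turns near errors into errors. -/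
lemma near_le_aux {C : Finset E} {x : E} {t l K : ℝ} (hl : 1 < l)
    (h : ∀ c ∈ C, c ≠ x → t * l ≤ (l - 1) * (‖c - x‖ ^ 2 / 2)) :
    (stdGaussian E).real (nearSet C x t) ≤
      (stdGaussian E).real {z | K ≤ ‖z‖ ^ 2} + exp ((l ^ 2 - 1) * K / 2) * perr C x := by
  have hl0 : 0 < l := by linarith
  set S : Set E := nearSet C x t ∩ {z | ‖z‖ ^ 2 < K} with hS
  have hSm : MeasurableSet S := (measurableSet_nearSet _ _ _).inter
    (measurableSet_lt (by fun_prop) (by fun_prop))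
  set R : Set E := nearSet C x 0 ∩ {z | ‖z‖ ^ 2 < l ^ 2 * K} with hR
  have hRm : MeasurableSet R := (measurableSet_nearSet _ _ _).inter
    (measurableSet_lt (by fun_prop) (by fun_prop))
  have h1 : (stdGaussian E).real (nearSet C x t) ≤
      (stdGaussian E).real {z | K ≤ ‖z‖ ^ 2} + (stdGaussian E).real S := by
    refine (measureReal_mono (fun z hz => ?_)).trans (measureReal_union_le _ _)
    by_cases hk : K ≤ ‖z‖ ^ 2
    · exact Or.inl hk
    · exact Or.inr ⟨hz, not_le.1 hk⟩
  have hSR : ∀ z, S.indicator 1 z ≤ R.indicator (1 : E → ℝ) (l • z) := fun z => by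
    by_cases hz : z ∈ S
    · have : l • z ∈ R := by
        obtain ⟨⟨c, hc, hcx, hcz⟩, hzK⟩ := hz
        refine ⟨⟨c, hc, hcx, ?_⟩, ?_⟩
        · rw [inner_smul_right]
          have := h c hc hcx
          have := mul_le_mul_of_nonneg_left hcz hl0.le
          linarith
        · simp only [Set.mem_ofPred_eq] at hzK ⊢
          rw [norm_smul, mul_pow, Real.norm_of_nonneg hl0.le]
          exact mul_lt_mul_of_pos_left hzK (by positivity)
      simp [hz, this]
    · rw [Set.indicator_of_notMem hz]
      exact Set.indicator_nonneg (fun _ _ => zero_le_one) _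
  have hle : ∀ y, exp (-((l⁻¹) ^ 2 - 1) * ‖y‖ ^ 2 / 2) * R.indicator (1 : E → ℝ) y ≤
      exp ((l ^ 2 - 1) * K / 2) * (nearSet C x 0).indicator (1 : E → ℝ) y := fun y => by
    by_cases hy : y ∈ R
    · rw [Set.indicator_of_mem hy, Set.indicator_of_mem hy.1]
      refine mul_le_mul_of_nonneg_right (exp_le_exp.2 ?_) zero_le_one
      have h2 : ‖y‖ ^ 2 < l ^ 2 * K := hy.2
      have h3 : (l⁻¹) ^ 2 ≤ 1 := by
        rw [inv_pow]; exact inv_le_one_of_one_le₀ (one_le_pow₀ hl.le)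
      have h4 : (1 - (l⁻¹) ^ 2) * ‖y‖ ^ 2 ≤ (1 - (l⁻¹) ^ 2) * (l ^ 2 * K) :=
        mul_le_mul_of_nonneg_left h2.le (by linarith)
      have h5 : (1 - (l⁻¹) ^ 2) * (l ^ 2 * K) = (l ^ 2 - 1) * K := by field_simp
      linarith
    · rw [Set.indicator_of_notMem hy, mul_zero]
      exact mul_nonneg (exp_pos _).le (Set.indicator_nonneg (fun _ _ => zero_le_one) _)
  have hi0 : Integrable (fun z : E => R.indicator (1 : E → ℝ) (l • z)) (stdGaussian E) :=
    (integrable_const (1 : ℝ)).mono' ((measurable_one.indicator hRm).comp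
      (measurable_const_smul l)).aestronglyMeasurable (ae_of_all _ fun z => by
        by_cases hz : l • z ∈ R <;> simp [hz])
  have hi1 := (integrable_scale_iff hl0 (R.indicator (1 : E → ℝ))).1 hi0
  have h2 : (stdGaussian E).real S ≤ exp ((l ^ 2 - 1) * K / 2) * perr C x := by
    calc (stdGaussian E).real S = ∫ z, S.indicator (1 : E → ℝ) z ∂(stdGaussian E) :=
          (integral_indicator_one hSm).symm
      _ ≤ ∫ z, R.indicator (1 : E → ℝ) (l • z) ∂(stdGaussian E) :=
          integral_mono ((integrable_indicator_iff hSm).2 (integrable_const (1 : ℝ)).integrableOn)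
            hi0 hSR
      _ ≤ 1 * ∫ y, exp (-((l⁻¹) ^ 2 - 1) * ‖y‖ ^ 2 / 2) * R.indicator (1 : E → ℝ) y
            ∂(stdGaussian E) := by
          rw [integral_scale hl0]
          refine mul_le_mul_of_nonneg_right (inv_le_one_of_one_le₀ (one_le_pow₀ hl.le))
            (integral_nonneg fun y => mul_nonneg (exp_pos _).le
              (Set.indicator_nonneg (fun _ _ => zero_le_one) _))
      _ ≤ ∫ y, exp ((l ^ 2 - 1) * K / 2) * (nearSet C x 0).indicator (1 : E → ℝ) y
            ∂(stdGaussian E) := by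
          rw [one_mul]
          exact integral_mono hi1 (((integrable_indicator_iff (measurableSet_nearSet _ _ _)).2
            (integrable_const (1 : ℝ)).integrableOn).const_mul _) hle
      _ = _ := by
          rw [integral_const_mul, perr, ← integral_indicator_one (measurableSet_nearSet _ _ _)]
  linarith

end Amp

/-- Near errors at exponential scale `ζ` have the exponent of errors up to `δ`. -/
lemma exists_near_le {η δ K : ℝ} (hη : 0 < η) (hδ : 0 < δ) (hK : 0 < K) :
    ∃ ζ₀ > 0, ∀ ζ ≤ ζ₀, ∀ (E : Type) [NormedAddCommGroup E] [InnerProductSpace ℝ E]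
      [FiniteDimensional ℝ E] [MeasurableSpace E] [BorelSpace E] (C : Finset E) (x : E),
      (∀ c ∈ C, c ≠ x → η * Module.finrank ℝ E ≤ ‖c - x‖ ^ 2) →
      (stdGaussian E).real (nearSet C x (2 * (ζ * Module.finrank ℝ E))) ≤
        exp (-(K * Module.finrank ℝ E)) + exp (δ * Module.finrank ℝ E) * perr C x := by
  set h := (K + 2) ^ 2 - 1 with hh
  have hh0 : 0 < h := by nlinarith
  have hrate : K ≤ (h - log (1 + h)) / 2 := by
    have h1 : 1 + h = (K + 2) ^ 2 := by rw [hh]; ring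
    have h2 := log_le_sub_one_of_pos (x := K + 2) (by linarith)
    rw [h1, log_pow]; push_cast; nlinarith
  obtain ⟨l, hl1, hl⟩ : ∃ l : ℝ, 1 < l ∧ (l ^ 2 - 1) * (1 + h) / 2 ≤ δ := by
    refine ⟨√(1 + 2 * δ / (1 + h)), ?_, ?_⟩
    · rw [Real.lt_sqrt zero_le_one, one_pow]
      have : 0 < 2 * δ / (1 + h) := by positivity
      linarith
    · rw [Real.sq_sqrt (by positivity)]
      apply le_of_eq; field_simp; ring
  refine ⟨η * (l - 1) / (4 * l), by have : 0 < l - 1 := by linarith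
                                    positivity, fun ζ hζ E _ _ _ _ _ C x hd => ?_⟩
  have hl0 : 0 < l := by linarith
  have hdim : (0 : ℝ) ≤ Module.finrank ℝ E := Nat.cast_nonneg _
  refine (near_le_aux (K := (1 + h) * Module.finrank ℝ E) hl1 fun c hc hcx => ?_).trans (add_le_add
    ((norm_sq_upper_tail hh0).trans (exp_le_exp.2 ?_)) (mul_le_mul_of_nonneg_right
      (exp_le_exp.2 ?_) (perr_nonneg _ _)))
  · have h1 := hd c hc hcx
    have h2 : ζ * (4 * l) ≤ η * (l - 1) := (le_div_iff₀ (by positivity)).1 hζ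
    have h3 := mul_le_mul_of_nonneg_right h2 hdim
    have h4 := mul_le_mul_of_nonneg_left h1 (by linarith : 0 ≤ l - 1)
    nlinarith
  · nlinarith [mul_le_mul_of_nonneg_right hrate hdim]
  · have := mul_le_mul_of_nonneg_right hl hdim
    linarith

end GaussRel

namespace GaussRel
open ProbabilityTheory
open scoped InnerProductSpace
set_option linter.unusedSectionVars false

section Replica

variable {ι : Type*} [DecidableEq ι] {C : Finset ι} {J Jp Cl : ι → Finset ι} {a : ι → ℝ}

lemma sum_sum_comm_of_symm (hJC : ∀ i ∈ C, J i ⊆ C) (hsymm : ∀ i ∈ C, ∀ j ∈ C, j ∈ J i ↔ i ∈ J j)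
    (f : ι → ι → ℝ) : ∑ i ∈ C, ∑ j ∈ J i, f i j = ∑ j ∈ C, ∑ i ∈ J j, f i j :=
  Finset.sum_comm' fun i j => ⟨fun ⟨hi, hj⟩ => ⟨(hsymm i hi j (hJC i hi hj)).1 hj, hJC i hi hj⟩,
    fun ⟨hi, hj⟩ => ⟨hJC j hj hi, (hsymm i (hJC j hj hi) j hj).2 hi⟩⟩

/-- Pointwise bound for the contribution of close replicas. -/
lemma close_replica_le (ha : ∀ i, 0 < a i) (hJC : ∀ i ∈ C, J i ⊆ C)
    (hsymm : ∀ i ∈ C, ∀ j ∈ C, j ∈ J i ↔ i ∈ J j) (hJp : ∀ i ∈ C, Jp i ⊆ J i)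
    {V : ι → ι → ℝ} {U : ι → ℝ} (hV0 : ∀ i j, 0 ≤ V i j) (hU0 : ∀ j, 0 ≤ U j) {κ c : ℝ}
    (hκ : 0 < κ) (hc : 0 < c)
    (hVU : ∀ i ∈ C, ∀ j ∈ Jp i, 1 ≤ V i j ∨ (1 ≤ U j ∧ ∑ k ∈ J j, a k ≤ c * ∑ k ∈ J i, a k)) :
    ∑ i ∈ C, ∑ j ∈ Jp i, a i * a j * ((∑ k ∈ Jp i ∩ Cl j, a k) / ∑ k ∈ Jp i, a k) ≤
      κ * ∑ i ∈ C, a i * ∑ k ∈ J i, a k + ∑ i ∈ C, ∑ j ∈ Jp i, a i * a j * V i j +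
      c / κ * ∑ j ∈ C, ∑ k ∈ Cl j, a j * a k * U j := by
  have hS : ∀ T : Finset ι, 0 ≤ ∑ k ∈ T, a k := fun T => Finset.sum_nonneg fun k _ => (ha k).le
  have hS' : ∀ T : Finset ι, ∀ j ∈ T, 0 < ∑ k ∈ T, a k := fun T j hj =>
    Finset.sum_pos (fun k _ => ha k) ⟨j, hj⟩
  have hX1 : ∀ i j, (∑ k ∈ Jp i ∩ Cl j, a k) / ∑ k ∈ Jp i, a k ≤ 1 := fun i j =>
    div_le_one_of_le₀ (Finset.sum_le_sum_of_subset_of_nonneg Finset.inter_subset_left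
      fun k _ _ => (ha k).le) (hS _)
  have hX0 : ∀ i j, 0 ≤ (∑ k ∈ Jp i ∩ Cl j, a k) / ∑ k ∈ Jp i, a k := fun i j =>
    div_nonneg (hS _) (hS _)
  set f : ι → ι → ℝ := fun i j => c / κ * (a i * (a j * U j * (∑ k ∈ Cl j, a k)) / ∑ k ∈ J j, a k)
    with hf
  have hf0 : ∀ i j, 0 ≤ f i j := fun i j => mul_nonneg (div_pos hc hκ).le
    (div_nonneg (mul_nonneg (ha i).le (mul_nonneg (mul_nonneg (ha j).le (hU0 j)) (hS _))) (hS _))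
  have hi : ∀ i ∈ C, ∑ j ∈ Jp i, a i * a j * ((∑ k ∈ Jp i ∩ Cl j, a k) / ∑ k ∈ Jp i, a k) ≤
      κ * (a i * ∑ k ∈ J i, a k) + ∑ j ∈ Jp i, a i * a j * V i j + ∑ j ∈ J i, f i j := by
    intro i hi
    have hVn : 0 ≤ ∑ j ∈ Jp i, a i * a j * V i j := Finset.sum_nonneg fun j _ =>
      mul_nonneg (mul_pos (ha i) (ha j)).le (hV0 i j)
    by_cases hlt : ∑ k ∈ Jp i, a k < κ * ∑ k ∈ J i, a k
    · have h1 : ∑ j ∈ Jp i, a i * a j * ((∑ k ∈ Jp i ∩ Cl j, a k) / ∑ k ∈ Jp i, a k) ≤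
          a i * ∑ j ∈ Jp i, a j := by
        rw [Finset.mul_sum]
        exact Finset.sum_le_sum fun j _ =>
          mul_le_of_le_one_right (mul_pos (ha i) (ha j)).le (hX1 i j)
      have h2 := mul_le_mul_of_nonneg_left hlt.le (ha i).le
      have h3 : 0 ≤ ∑ j ∈ J i, f i j := Finset.sum_nonneg fun j _ => hf0 i j
      linarith
    · rw [not_lt] at hlt
      have h1 : ∀ j ∈ Jp i, a i * a j * ((∑ k ∈ Jp i ∩ Cl j, a k) / ∑ k ∈ Jp i, a k) ≤
          a i * a j * V i j + f i j := by
        intro j hj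
        have haij := mul_pos (ha i) (ha j)
        rcases hVU i hi j hj with h | ⟨hU, hc'⟩
        · have := mul_le_mul_of_nonneg_left ((hX1 i j).trans h) haij.le
          linarith [hf0 i j]
        · have hJi := hS' (J i) j (hJp i hi hj)
          have hJj : 0 < ∑ k ∈ J j, a k :=
            hS' (J j) i ((hsymm i hi j (hJC i hi (hJp i hi hj))).1 (hJp i hi hj))
          have h2 : (∑ k ∈ Jp i ∩ Cl j, a k) / ∑ k ∈ Jp i, a k ≤
              (∑ k ∈ Cl j, a k) * (c / (κ * ∑ k ∈ J j, a k)) := by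
            rw [div_eq_mul_inv]
            refine mul_le_mul (Finset.sum_le_sum_of_subset_of_nonneg Finset.inter_subset_right
              fun k _ _ => (ha k).le) ?_ (inv_nonneg.2 (hS _)) (hS _)
            rw [inv_le_comm₀ (hS' _ j hj) (by positivity), inv_div, div_le_iff₀ hc]
            have := mul_le_mul_of_nonneg_left hc' hκ.le
            nlinarith
          have h3 : a i * a j * ((∑ k ∈ Jp i ∩ Cl j, a k) / ∑ k ∈ Jp i, a k) ≤ f i j := by
            calc _ ≤ a i * a j * ((∑ k ∈ Cl j, a k) * (c / (κ * ∑ k ∈ J j, a k))) :=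
                  mul_le_mul_of_nonneg_left h2 haij.le
              _ ≤ U j * (a i * a j * ((∑ k ∈ Cl j, a k) * (c / (κ * ∑ k ∈ J j, a k)))) := by
                  refine le_mul_of_one_le_left (mul_nonneg haij.le (mul_nonneg (hS _) ?_)) hU
                  positivity
              _ = f i j := by rw [hf]; field_simp
          have := mul_nonneg haij.le (hV0 i j)
          linarith
      have h4 := Finset.sum_le_sum h1
      rw [Finset.sum_add_distrib] at h4
      have h5 : ∑ j ∈ Jp i, f i j ≤ ∑ j ∈ J i, f i j :=
        Finset.sum_le_sum_of_subset_of_nonneg (hJp i hi) fun j _ _ => hf0 i j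
      have h6 : 0 ≤ κ * (a i * ∑ k ∈ J i, a k) :=
        mul_nonneg hκ.le (mul_nonneg (ha i).le (hS _))
      linarith
  refine (Finset.sum_le_sum hi).trans ?_
  rw [Finset.sum_add_distrib, Finset.sum_add_distrib, ← Finset.mul_sum,
    sum_sum_comm_of_symm hJC hsymm]
  refine add_le_add le_rfl ?_
  rw [Finset.mul_sum]
  refine Finset.sum_le_sum fun j _ => ?_
  have h7 : ∑ i ∈ J j, f i j =
      c / κ * (a j * U j * (∑ k ∈ Cl j, a k)) * ((∑ i ∈ J j, a i) / ∑ k ∈ J j, a k) := by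
    rw [Finset.sum_div, Finset.mul_sum]
    exact Finset.sum_congr rfl fun i _ => by rw [hf]; ring
  have h8 : c / κ * ∑ k ∈ Cl j, a j * a k * U j = c / κ * (a j * U j * (∑ k ∈ Cl j, a k)) := by
    rw [Finset.mul_sum (Cl j) a]
    congr 1
    exact Finset.sum_congr rfl fun k _ => by ring
  rw [h7, h8]
  exact mul_le_of_le_one_right (mul_nonneg (div_pos hc hκ).le (mul_nonneg
    (mul_nonneg (ha j).le (hU0 j)) (hS _))) (div_self_le_one _)

/-- Pointwise bound for the contribution of coinciding replicas. -/
lemma self_replica_le (ha : ∀ i, 0 < a i) {V : ι → ι → ℝ} {U : ι → ℝ} (hV0 : ∀ i j, 0 ≤ V i j)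
    (hU0 : ∀ j, 0 ≤ U j) {c : ℝ} (hc : 0 < c)
    (hVU : ∀ i ∈ C, ∀ j ∈ Jp i, 1 ≤ V i j ∨ (1 ≤ U i ∧ a j ≤ c * a i)) :
    ∑ i ∈ C, ∑ j ∈ Jp i, a i * a j * (a j / ∑ k ∈ Jp i, a k) ≤
      ∑ i ∈ C, ∑ j ∈ Jp i, a i * a j * V i j + c * ∑ i ∈ C, a i * a i * U i := by
  have hS : ∀ T : Finset ι, 0 ≤ ∑ k ∈ T, a k := fun T => Finset.sum_nonneg fun k _ => (ha k).le
  rw [Finset.mul_sum, ← Finset.sum_add_distrib]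
  refine Finset.sum_le_sum fun i hi => ?_
  have h1 : ∀ j ∈ Jp i, a i * a j * (a j / ∑ k ∈ Jp i, a k) ≤
      a i * a j * V i j + c * (a i * a i * U i) * (a j / ∑ k ∈ Jp i, a k) := by
    intro j hj
    have hx0 : 0 ≤ a j / ∑ k ∈ Jp i, a k := div_nonneg (ha j).le (hS _)
    have hx1 : a j / ∑ k ∈ Jp i, a k ≤ 1 :=
      div_le_one_of_le₀ (Finset.single_le_sum (fun k _ => (ha k).le) hj) (hS _)
    have haij := mul_pos (ha i) (ha j)
    have hai := mul_pos (ha i) (ha i)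
    rcases hVU i hi j hj with h | ⟨hU, hc'⟩
    · have h2 := mul_le_mul_of_nonneg_left (hx1.trans h) haij.le
      have h3 : 0 ≤ c * (a i * a i * U i) * (a j / ∑ k ∈ Jp i, a k) :=
        mul_nonneg (mul_nonneg hc.le (mul_nonneg hai.le (hU0 i))) hx0
      linarith
    · have h2 := mul_nonneg haij.le (hV0 i j)
      have h3 : a i * a j ≤ c * (a i * a i * U i) := by
        have h4 := mul_le_mul_of_nonneg_left hc' (ha i).le
        have h5 := mul_le_mul_of_nonneg_left hU (mul_pos hc hai).le
        nlinarith
      have := mul_le_mul_of_nonneg_right h3 hx0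
      linarith
  refine (Finset.sum_le_sum h1).trans ?_
  rw [Finset.sum_add_distrib, ← Finset.mul_sum, ← Finset.sum_div]
  refine add_le_add le_rfl (mul_le_of_le_one_right ?_ (div_self_le_one _))
  exact mul_nonneg hc.le (mul_nonneg (mul_pos (ha i) (ha i)).le (hU0 i))

end Replica

end GaussRel

namespace GaussRel
open ProbabilityTheory
open scoped InnerProductSpace
set_option linter.unusedSectionVars false

section Replica

variable {E : Type*} [NormedAddCommGroup E] [InnerProductSpace ℝ E] [FiniteDimensional ℝ E]
  [MeasurableSpace E] [BorelSpace E]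

/-- Weight of the posterior of `T` within `J`. -/
noncomputable def pfrac (T J : Finset E) (y : E) : ℝ := asum T y / asum J y

lemma measurable_pfrac (T J : Finset E) : Measurable (pfrac T J) :=
  (continuous_asum T).measurable.div (continuous_asum J).measurable

lemma pfrac_nonneg (T J : Finset E) (y : E) : 0 ≤ pfrac T J y :=
  div_nonneg (asum_nonneg _ _) (asum_nonneg _ _)

lemma pfrac_le_one {T J : Finset E} (h : T ⊆ J) (y : E) : pfrac T J y ≤ 1 :=
  div_le_one_of_le₀ (Finset.sum_le_sum_of_subset_of_nonneg h fun _ _ _ => (amp_pos _ _).le)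
    (asum_nonneg _ _)

lemma integrable_amp_pfrac (i j : E) {T J : Finset E} (h : T ⊆ J) :
    Integrable (fun y => amp i y * amp j y * pfrac T J y) (stdGaussian E) :=
  integrable_amp_mul_bdd i j (measurable_pfrac T J) (B := 1) fun y => by
    rw [abs_of_nonneg (pfrac_nonneg _ _ _)]; exact pfrac_le_one h y

lemma integral_sum_sum {C : Finset E} {J : E → Finset E} {F : E → E → E → ℝ}
    (h : ∀ i ∈ C, ∀ j ∈ J i, Integrable (F i j) (stdGaussian E)) :
    ∫ y, ∑ i ∈ C, ∑ j ∈ J i, F i j y ∂(stdGaussian E) =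
      ∑ i ∈ C, ∑ j ∈ J i, ∫ y, F i j y ∂(stdGaussian E) := by
  rw [integral_finsetSum _ fun i hi => integrable_finsetSum _ (h i hi)]
  exact Finset.sum_congr rfl fun i hi => integral_finsetSum _ (h i hi)

lemma integrable_sum_sum {C : Finset E} {J : E → Finset E} {F : E → E → E → ℝ}
    (h : ∀ i ∈ C, ∀ j ∈ J i, Integrable (F i j) (stdGaussian E)) :
    Integrable (fun y => ∑ i ∈ C, ∑ j ∈ J i, F i j y) (stdGaussian E) :=
  integrable_finsetSum _ fun i hi => integrable_finsetSum _ (h i hi)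

variable {C : Finset E} {J Jp : E → Finset E}

lemma integral_amp_mul_self (i j : E) :
    ∫ y, amp i y * amp j y ∂(stdGaussian E) = aff i j := by
  have := integral_amp_mul i j (fun _ => 1)
  simpa using this

open Classical in
lemma integral_close_replica_le {Cl : E → Finset E} (hJC : ∀ i ∈ C, J i ⊆ C)
    (hsymm : ∀ i ∈ C, ∀ j ∈ C, j ∈ J i ↔ i ∈ J j) (hJp : ∀ i ∈ C, Jp i ⊆ J i)
    {V : E → E → Set E} {U : E → Set E} (hV : ∀ i j, MeasurableSet (V i j))
    (hU : ∀ j, MeasurableSet (U j)) {κ c : ℝ} (hκ : 0 < κ) (hc : 0 < c)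
    (hVU : ∀ i ∈ C, ∀ j ∈ Jp i, ∀ y, y ∉ V i j → y ∈ U j ∧ asum (J j) y ≤ c * asum (J i) y) :
    ∑ i ∈ C, ∑ j ∈ Jp i, ∫ y, amp i y * amp j y * pfrac (Jp i ∩ Cl j) (Jp i) y ∂(stdGaussian E) ≤
      κ * ∑ i ∈ C, ∑ j ∈ J i, aff i j +
      ∑ i ∈ C, ∑ j ∈ Jp i, aff i j * (stdGaussian E).real {z | mid i j + z ∈ V i j} +
      c / κ * ∑ j ∈ C, ∑ k ∈ Cl j, aff j k * (stdGaussian E).real {z | mid j k + z ∈ U j} := by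
  have i1 : ∀ i ∈ C, ∀ j ∈ Jp i, Integrable
      (fun y => amp i y * amp j y * pfrac (Jp i ∩ Cl j) (Jp i) y) (stdGaussian E) :=
    fun i _ j _ => integrable_amp_pfrac i j Finset.inter_subset_left
  have i2 : ∀ i ∈ C, ∀ j ∈ J i, Integrable (fun y => amp i y * amp j y) (stdGaussian E) :=
    fun i _ j _ => integrable_amp_mul i j
  have i3 : ∀ i ∈ C, ∀ j ∈ Jp i, Integrable
      (fun y => amp i y * amp j y * (V i j).indicator 1 y) (stdGaussian E) :=
    fun i _ j _ => integrable_amp_indicator i j (hV i j)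
  have i4 : ∀ j ∈ C, ∀ k ∈ Cl j, Integrable
      (fun y => amp j y * amp k y * (U j).indicator 1 y) (stdGaussian E) :=
    fun j _ k _ => integrable_amp_indicator j k (hU j)
  rw [← integral_sum_sum i1]
  have hpt : ∀ y, ∑ i ∈ C, ∑ j ∈ Jp i, amp i y * amp j y * pfrac (Jp i ∩ Cl j) (Jp i) y ≤
      κ * ∑ i ∈ C, ∑ j ∈ J i, amp i y * amp j y +
      ∑ i ∈ C, ∑ j ∈ Jp i, amp i y * amp j y * (V i j).indicator 1 y +
      c / κ * ∑ j ∈ C, ∑ k ∈ Cl j, amp j y * amp k y * (U j).indicator 1 y := fun y => by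
    have := close_replica_le (a := fun i => amp i y) (Cl := Cl) (fun i => amp_pos i y) hJC hsymm hJp
      (V := fun i j => (V i j).indicator 1 y) (U := fun j => (U j).indicator 1 y)
      (fun i j => Set.indicator_nonneg (fun _ _ => zero_le_one) _)
      (fun j => Set.indicator_nonneg (fun _ _ => zero_le_one) _) hκ hc (fun i hi j hj => by
        by_cases hy : y ∈ V i j
        · left; simp [hy]
        · right
          obtain ⟨h1, h2⟩ := hVU i hi j hj y hy
          exact ⟨by simp [h1], h2⟩)
    simp only [← Finset.mul_sum] at this ⊢
    exact this
  refine (integral_mono (integrable_sum_sum i1) ((((integrable_sum_sum i2).const_mul κ).add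
    (integrable_sum_sum i3)).add ((integrable_sum_sum i4).const_mul (c / κ))) hpt).trans
    (le_of_eq ?_)
  have e1 := (integrable_sum_sum i2).const_mul κ
  have e3 := integrable_sum_sum i3
  have e4 := (integrable_sum_sum i4).const_mul (c / κ)
  rw [integral_add' (e1.add e3) e4, integral_add' e1 e3, integral_const_mul,
    integral_const_mul, integral_sum_sum i2, integral_sum_sum i3, integral_sum_sum i4]
  simp only [integral_amp_mul_self, integral_amp_indicator _ _ (hV _ _),
    integral_amp_indicator _ _ (hU _)]

lemma integral_self_replica_le {V : E → E → Set E} {U : E → Set E}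
    (hV : ∀ i j, MeasurableSet (V i j)) (hU : ∀ j, MeasurableSet (U j)) {c : ℝ} (hc : 0 < c)
    (hVU : ∀ i ∈ C, ∀ j ∈ Jp i, ∀ y, y ∉ V i j → y ∈ U i ∧ amp j y ≤ c * amp i y) :
    ∑ i ∈ C, ∑ j ∈ Jp i, ∫ y, amp i y * amp j y * pfrac {j} (Jp i) y ∂(stdGaussian E) ≤
      ∑ i ∈ C, ∑ j ∈ Jp i, aff i j * (stdGaussian E).real {z | mid i j + z ∈ V i j} +
      c * ∑ i ∈ C, (stdGaussian E).real {z | i + z ∈ U i} := by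
  classical
  have i1 : ∀ i ∈ C, ∀ j ∈ Jp i, Integrable
      (fun y => amp i y * amp j y * pfrac {j} (Jp i) y) (stdGaussian E) :=
    fun i _ j hj => integrable_amp_pfrac i j (Finset.singleton_subset_iff.2 hj)
  have i3 : ∀ i ∈ C, ∀ j ∈ Jp i, Integrable
      (fun y => amp i y * amp j y * (V i j).indicator 1 y) (stdGaussian E) :=
    fun i _ j _ => integrable_amp_indicator i j (hV i j)
  have i4 : ∀ i ∈ C, Integrable
      (fun y => amp i y * amp i y * (U i).indicator 1 y) (stdGaussian E) :=
    fun i _ => integrable_amp_indicator i i (hU i)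
  rw [← integral_sum_sum i1]
  have hpt : ∀ y, ∑ i ∈ C, ∑ j ∈ Jp i, amp i y * amp j y * pfrac {j} (Jp i) y ≤
      ∑ i ∈ C, ∑ j ∈ Jp i, amp i y * amp j y * (V i j).indicator 1 y +
      c * ∑ i ∈ C, amp i y * amp i y * (U i).indicator 1 y := fun y => by
    have := self_replica_le (C := C) (Jp := Jp) (a := fun i => amp i y) (fun i => amp_pos i y)
      (V := fun i j => (V i j).indicator 1 y) (U := fun j => (U j).indicator 1 y)
      (fun i j => Set.indicator_nonneg (fun _ _ => zero_le_one) _)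
      (fun j => Set.indicator_nonneg (fun _ _ => zero_le_one) _) hc (fun i hi j hj => by
        by_cases hy : y ∈ V i j
        · left; simp [hy]
        · right
          obtain ⟨h1, h2⟩ := hVU i hi j hj y hy
          exact ⟨by simp [h1], h2⟩)
    simpa only [pfrac, asum, Finset.sum_singleton] using this
  have e3 := integrable_sum_sum i3
  have e4 := (integrable_finsetSum _ i4).const_mul c
  refine (integral_mono (integrable_sum_sum i1) (e3.add e4) hpt).trans (le_of_eq ?_)
  rw [integral_add' e3 e4, integral_const_mul, integral_sum_sum i3, integral_finsetSum _ i4]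
  have haff : ∀ i : E, aff i i = 1 := fun i => by simp [aff]
  have hmid : ∀ i : E, mid i i = i := fun i => by
    rw [mid, ← two_smul ℝ i, smul_smul]; norm_num
  simp only [integral_amp_indicator _ _ (hV _ _), integral_amp_indicator _ _ (hU _), haff, one_mul,
    hmid]

end Replica

end GaussRel

namespace GaussRel
open ProbabilityTheory
open scoped InnerProductSpace
set_option linter.unusedSectionVars false

section Transport

variable {E : Type*} [NormedAddCommGroup E] [InnerProductSpace ℝ E] [FiniteDimensional ℝ E]
  [MeasurableSpace E] [BorelSpace E]

variable {J : Finset E} {i : E}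

/-- Normalised affinities of `i` to the words of `J`. -/
noncomputable def nwt (J : Finset E) (i j : E) : ℝ := aff i j / ∑ k ∈ J, aff i k

/-- Half displacement. -/
noncomputable def hdis (i j : E) : E := (1 / 2 : ℝ) • (j - i)

lemma sum_aff_pos (hJ : J.Nonempty) (i : E) : 0 < ∑ k ∈ J, aff i k :=
  Finset.sum_pos (fun _ _ => aff_pos _ _) hJ

lemma nwt_pos (hJ : J.Nonempty) (i j : E) : 0 < nwt J i j := div_pos (aff_pos _ _) (sum_aff_pos hJ i)

lemma sum_nwt (hJ : J.Nonempty) (i : E) : ∑ j ∈ J, nwt J i j = 1 := by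
  simp only [nwt]
  rw [← Finset.sum_div]
  exact div_self (sum_aff_pos hJ i).ne'

lemma nwt_mul_phi (i j x : E) : nwt J i j * phi (hdis i j) x =
    amp j (i + x) / (amp i (i + x) * ∑ k ∈ J, aff i k) := by
  rw [amp_shift i j, nwt, hdis, mul_div_mul_left _ _ (amp_pos _ _).ne']
  ring

lemma mix_nwt (i x : E) : mix J (nwt J i) (hdis i) x =
    asum J (i + x) / (amp i (i + x) * ∑ k ∈ J, aff i k) := by
  simp only [mix, nwt_mul_phi, asum]
  rw [Finset.sum_div]

lemma post_nwt (hJ : J.Nonempty) (i j x : E) : post J (nwt J i) (hdis i) j x =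
    amp j (i + x) / asum J (i + x) := by
  rw [post, nwt_mul_phi, mix_nwt, div_div_div_cancel_right₀]
  exact (mul_pos (amp_pos _ _) (sum_aff_pos hJ i)).ne'

lemma sum_post_nwt (hJ : J.Nonempty) (T : Finset E) (i x : E) :
    ∑ j ∈ T, post J (nwt J i) (hdis i) j x = pfrac T J (i + x) := by
  simp only [post_nwt hJ, pfrac, asum]
  rw [Finset.sum_div]

lemma inner_hdis (i j k : E) :
    ⟪hdis i j, hdis i k⟫_ℝ = (‖i - j‖ ^ 2 + ‖i - k‖ ^ 2 - ‖j - k‖ ^ 2) / 8 := by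
  have h : j - k = (j - i) - (k - i) := by abel
  rw [norm_sub_rev i j, norm_sub_rev i k, h, norm_sub_sq_real (j - i) (k - i), hdis,
    hdis, inner_smul_left,
    inner_smul_right, RCLike.conj_to_real]
  ring

lemma integral_mix_mul_post (hJ : J.Nonempty) (i j : E) {T : Finset E} :
    ∫ x, mix J (nwt J i) (hdis i) x * (post J (nwt J i) (hdis i) j x * pfrac T J (i + x))
      ∂(stdGaussian E) =
    (∫ y, amp i y * amp j y * pfrac T J y ∂(stdGaussian E)) / ∑ k ∈ J, aff i k := by
  have hW := (sum_aff_pos hJ i).ne'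
  have h1 := integral_shift' i
    (fun y => amp j y / (amp i y * ∑ k ∈ J, aff i k) * pfrac T J y)
  rw [← integral_div]
  calc _ = ∫ z, amp j (i + z) / (amp i (i + z) * ∑ k ∈ J, aff i k) * pfrac T J (i + z)
          ∂(stdGaussian E) := by
        congr 1; funext x
        rw [mix_nwt, post_nwt hJ]
        have := (asum_pos hJ (i + x)).ne'
        field_simp
    _ = _ := h1
    _ = _ := by
        congr 1; funext y
        rw [← amp_mul_self]
        have := (amp_pos i y).ne'
        field_simp

open Classical in
/-- If replicas are mostly far apart, the posterior mean is short. -/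
lemma pm2_nwt_le (hJ : J.Nonempty) {Cl : E → Finset E} {D D' ε : ℝ}
    (hD : ∀ j ∈ J, ‖i - j‖ ^ 2 ≤ D) (hD' : D' ≤ 2 * D)
    (hfar : ∀ j ∈ J, ∀ k ∈ J, k ≠ j → k ∉ Cl j → D' ≤ ‖j - k‖ ^ 2)
    (hrep : ∑ j ∈ J, ∫ y, amp i y * amp j y * pfrac (J ∩ Cl j) J y ∂(stdGaussian E) +
      ∑ j ∈ J, ∫ y, amp i y * amp j y * pfrac {j} J y ∂(stdGaussian E) ≤
        ε * ∑ j ∈ J, aff i j) :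
    pm2 J (nwt J i) (hdis i) (hdis i) ≤ (2 * D - D') / 8 + ε * (D / 4) := by
  have hw : ∀ j ∈ J, 0 < nwt J i j := fun j _ => nwt_pos hJ i j
  have hW := sum_aff_pos hJ i
  have hD0 : 0 ≤ D := by obtain ⟨j, hj⟩ := hJ; exact (sq_nonneg _).trans (hD j hj)
  set p : E → E → ℝ := fun j x => post J (nwt J i) (hdis i) j x with hp
  have hp0 : ∀ j ∈ J, ∀ x, 0 ≤ p j x := fun j hj x => post_nonneg hJ hw hj x
  have hp1 : ∀ x, ∑ j ∈ J, p j x = 1 := fun x => sum_post hJ hw x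
  have hpt : ∀ x, ‖pmean J (nwt J i) (hdis i) (hdis i) x‖ ^ 2 ≤ (2 * D - D') / 8 +
      D / 4 * (∑ j ∈ J, p j x * pfrac (J ∩ Cl j) J (i + x) +
        ∑ j ∈ J, p j x * pfrac {j} J (i + x)) := fun x => by
    have e1 : ‖pmean J (nwt J i) (hdis i) (hdis i) x‖ ^ 2 =
        ∑ j ∈ J, p j x * ∑ k ∈ J, p k x * ⟪hdis i j, hdis i k⟫_ℝ := by
      rw [← real_inner_self_eq_norm_sq, pmean, sum_inner]
      refine Finset.sum_congr rfl fun j _ => ?_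
      rw [inner_smul_left, inner_sum, RCLike.conj_to_real]
      congr 1
      exact Finset.sum_congr rfl fun k _ => by rw [inner_smul_right]
    have e2 : ∀ j ∈ J, ∑ k ∈ J, p k x * ⟪hdis i j, hdis i k⟫_ℝ ≤ (2 * D - D') / 8 +
        D / 4 * (pfrac (J ∩ Cl j) J (i + x) + pfrac {j} J (i + x)) := fun j hj => by
      have h3 : ∀ k ∈ J, p k x * ⟪hdis i j, hdis i k⟫_ℝ ≤ p k x * ((2 * D - D') / 8) +
          D / 4 * ((if k ∈ Cl j then p k x else 0) + (if k = j then p k x else 0)) := by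
        intro k hk
        have hpk := hp0 k hk x
        have hj1 := hD j hj
        have hk1 := hD k hk
        rw [inner_hdis]
        have hmul : ∀ t : ℝ, ‖i - j‖ ^ 2 + ‖i - k‖ ^ 2 - ‖j - k‖ ^ 2 ≤ t → p k x *
            ((‖i - j‖ ^ 2 + ‖i - k‖ ^ 2 - ‖j - k‖ ^ 2) / 8) ≤ p k x * (t / 8) := fun t ht =>
          mul_le_mul_of_nonneg_left (by linarith) hpk
        have h2D := hmul (2 * D) (by linarith [sq_nonneg ‖j - k‖])
        have hz : 0 ≤ p k x * ((2 * D - D') / 8) := mul_nonneg hpk (by linarith)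
        have hDp := mul_nonneg hD0 hpk
        by_cases hkj : k = j
        · rw [if_pos hkj]
          have : 0 ≤ (if k ∈ Cl j then p k x else 0) := by split_ifs <;> simp [hpk]
          nlinarith [mul_nonneg hD0 this]
        · by_cases hkc : k ∈ Cl j
          · rw [if_pos hkc, if_neg hkj]
            linarith
          · rw [if_neg hkc, if_neg hkj]
            have := hmul (2 * D - D') (by linarith [hfar j hj k hk hkj hkc])
            linarith
      refine (Finset.sum_le_sum h3).trans (le_of_eq ?_)
      rw [Finset.sum_add_distrib, ← Finset.sum_mul, hp1, one_mul, ← Finset.mul_sum,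
        Finset.sum_add_distrib, ← Finset.sum_filter, ← Finset.sum_filter]
      congr 3
      · rw [hp, sum_post_nwt hJ, Finset.filter_mem_eq_inter]
      · rw [hp, ← sum_post_nwt hJ]
        congr 1
        ext a
        simp only [Finset.mem_filter, Finset.mem_singleton]
        exact ⟨fun h => h.2, fun h => ⟨h ▸ hj, h⟩⟩
    rw [e1]
    refine (Finset.sum_le_sum fun j hj => mul_le_mul_of_nonneg_left (e2 j hj) (hp0 j hj x)).trans
      (le_of_eq ?_)
    simp only [mul_add, Finset.sum_add_distrib, ← Finset.sum_mul, hp1, one_mul, Finset.mul_sum]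
    congr 2 <;> exact Finset.sum_congr rfl fun j _ => by ring
  have hi : ∀ j ∈ J, ∀ T ⊆ J, Integrable (fun x => mix J (nwt J i) (hdis i) x *
      (p j x * pfrac T J (i + x))) (stdGaussian E) := fun j hj T hT => by
    refine integrable_mix.mul_bdd (c := 1) ?_ (ae_of_all _ fun x => ?_)
    · exact ((continuous_post hJ hw).measurable.mul
        ((measurable_pfrac T J).comp (measurable_const_add i))).aestronglyMeasurable
    · rw [Real.norm_of_nonneg (mul_nonneg (hp0 j hj x) (pfrac_nonneg _ _ _))]
      exact mul_le_one₀ (post_le_one hJ hw hj x) (pfrac_nonneg _ _ _) (pfrac_le_one hT _)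
  set c0 := (2 * D - D') / 8
  have i0 : Integrable (fun x => mix J (nwt J i) (hdis i) x * c0) (stdGaussian E) :=
    integrable_mix.mul_const _
  have i1 := integrable_finsetSum J fun j hj => hi j hj (J ∩ Cl j) Finset.inter_subset_left
  have i2 := integrable_finsetSum J fun j hj => hi j hj {j} (Finset.singleton_subset_iff.2 hj)
  have hle : ∀ x, mix J (nwt J i) (hdis i) x * ‖pmean J (nwt J i) (hdis i) (hdis i) x‖ ^ 2 ≤
      mix J (nwt J i) (hdis i) x * c0 + D / 4 *
      (∑ j ∈ J, mix J (nwt J i) (hdis i) x * (p j x * pfrac (J ∩ Cl j) J (i + x)) +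
        ∑ j ∈ J, mix J (nwt J i) (hdis i) x * (p j x * pfrac {j} J (i + x))) := fun x => by
    have := mul_le_mul_of_nonneg_left (hpt x) (mix_pos hJ hw (u := hdis i) x).le
    rw [← Finset.mul_sum, ← Finset.mul_sum]
    linarith
  have i3 : Integrable (fun x => mix J (nwt J i) (hdis i) x *
      ‖pmean J (nwt J i) (hdis i) (hdis i) x‖ ^ 2) (stdGaussian E) := by
    refine integrable_mix_mul (((continuous_pmean hJ hw).norm).pow 2) (B := (∑ j ∈ J, ‖hdis i j‖) ^ 2)
      fun y => ?_
    rw [abs_of_nonneg (by positivity)]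
    exact pow_le_pow_left₀ (norm_nonneg _) (norm_pmean_le hJ hw (fun j hj =>
      Finset.single_le_sum (f := fun k => ‖hdis i k‖) (fun _ _ => norm_nonneg _) hj) y) 2
  rw [pm2]
  refine (integral_mono i3 (i0.add ((i1.add i2).const_mul (D / 4))) hle).trans ?_
  rw [integral_add' i0 ((i1.add i2).const_mul (D / 4)), integral_mul_const, integral_mix,
    sum_nwt hJ, one_mul, integral_const_mul, integral_add' i1 i2,
    integral_finsetSum _ fun j hj => hi j hj (J ∩ Cl j) Finset.inter_subset_left,
    integral_finsetSum _ fun j hj => hi j hj {j} (Finset.singleton_subset_iff.2 hj)]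
  simp only [hp, integral_mix_mul_post hJ]
  rw [← Finset.sum_div, ← Finset.sum_div, ← add_div]
  have := mul_le_mul_of_nonneg_left ((div_le_iff₀ hW).2 hrep) (by linarith : 0 ≤ D / 4)
  linarith

/-- Lower bound on the near-error probability from a short posterior mean. -/
lemma near_ge_of_pm2 (hJ : J.Nonempty) (hi : i ∉ J) {K q t : ℝ} (hq : 0 < q)
    (hK : pm2 J (nwt J i) (hdis i) (hdis i) ≤ 2 * K)
    (ht : ∀ j ∈ J, (stdGaussian E).real {z | t ≤ ⟪i - j, z⟫_ℝ} ≤ 1 - q) :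
    q * exp (-(K + 1) / q) ≤ (stdGaussian E).real (nearSet J i t) := by
  have hw : ∀ j ∈ J, 0 < nwt J i j := fun j _ => nwt_pos hJ i j
  have hm := measurableSet_nearSet J i t
  have hK' := entropy_mix_le hJ hw (u := hdis i) (sum_nwt hJ i)
  have hpm : 0 ≤ pm2 J (nwt J i) (hdis i) (hdis i) :=
    integral_nonneg fun y => mul_nonneg (mix_pos hJ hw y).le (sq_nonneg _)
  refine change_of_measure (mix_pos hJ hw (u := hdis i)) integrable_mix
    (integrable_mul_log_mix hJ hw) hm hq ?_ (hK'.trans (by linarith)) (by linarith)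
  have h1 : ∫ x in nearSet J i t, mix J (nwt J i) (hdis i) x ∂(stdGaussian E) =
      ∑ j ∈ J, nwt J i j * (stdGaussian E).real {z | hdis i j + z ∈ nearSet J i t} := by
    unfold mix
    rw [integral_finsetSum _ fun j _ => ((integrable_phi _).const_mul _).integrableOn]
    refine Finset.sum_congr rfl fun j _ => ?_
    rw [integral_const_mul]
    congr 1
    have h2 : MeasurableSet {z : E | hdis i j + z ∈ nearSet J i t} := hm.preimage (by fun_prop)
    rw [← integral_indicator hm, ← integral_indicator_one h2]
    refine Eq.trans ?_ (integral_shift' (hdis i j) ((nearSet J i t).indicator 1)).symm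
    congr 1; funext y
    by_cases hy : y ∈ nearSet J i t <;> simp [hy]
  rw [h1, ← one_mul q, ← sum_nwt hJ i, Finset.sum_mul]
  refine Finset.sum_le_sum fun j hj => mul_le_mul_of_nonneg_left ?_ (hw j hj).le
  have h3 : (stdGaussian E).real {z | ¬ t ≤ ⟪i - j, z⟫_ℝ} ≤
      (stdGaussian E).real {z | hdis i j + z ∈ nearSet J i t} := by
    refine measureReal_mono fun z hz => ⟨j, hj, fun h => hi (h ▸ hj), ?_⟩
    simp only [Set.mem_ofPred_eq, not_le] at hz
    rw [← neg_sub i j, inner_neg_left, norm_neg, hdis, inner_add_right, inner_smul_right,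
      ← neg_sub i j, inner_neg_right, real_inner_self_eq_norm_sq]
    linarith
  have hms : MeasurableSet {z : E | t ≤ ⟪i - j, z⟫_ℝ} :=
    measurableSet_le (by fun_prop) (by fun_prop)
  have h4 : (stdGaussian E).real {z | ¬ t ≤ ⟪i - j, z⟫_ℝ} =
      1 - (stdGaussian E).real {z | t ≤ ⟪i - j, z⟫_ℝ} :=
    probReal_compl_eq_one_sub hms
  linarith [ht j hj]

end Transport

end GaussRel

namespace GaussRel
open ProbabilityTheory
open scoped InnerProductSpace
set_option linter.unusedSectionVars false

section FixedSpace

variable {E : Type*} [NormedAddCommGroup E] [InnerProductSpace ℝ E] [FiniteDimensional ℝ E]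
  [MeasurableSpace E] [BorelSpace E]

lemma half_le_halfspace (v : E) : 1 / 2 ≤ (stdGaussian E).real {z | 0 ≤ ⟪v, z⟫_ℝ} := by
  have hm : MeasurableSet {z : E | 0 ≤ ⟪v, z⟫_ℝ} := measurableSet_le (by fun_prop) (by fun_prop)
  have h1 : (stdGaussian E).real {z | 0 ≤ ⟪v, z⟫_ℝ} = (stdGaussian E).real {z | ⟪v, z⟫_ℝ ≤ 0} := by
    have h := stdGaussian_map (LinearIsometryEquiv.neg ℝ (E := E))
    conv_lhs => rw [← h]
    rw [map_measureReal_apply (by fun_prop) hm]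
    congr 1
    ext z
    simp [inner_neg_right]
  have h2 : (1 : ℝ) ≤ (stdGaussian E).real {z | 0 ≤ ⟪v, z⟫_ℝ} +
      (stdGaussian E).real {z | ⟪v, z⟫_ℝ ≤ 0} := by
    rw [← probReal_univ (μ := stdGaussian E)]
    refine le_trans (measureReal_mono fun z _ => ?_) (measureReal_union_le _ _)
    exact le_total 0 ⟪v, z⟫_ℝ
  linarith

lemma integral_phi_mul_log_phi (v : E) :
    ∫ y, phi v y * log (phi v y) ∂(stdGaussian E) = ‖v‖ ^ 2 / 2 := by
  rw [← integral_shift' v (fun y => log (phi v y))]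
  have : ∀ z : E, log (phi v (v + z)) = ⟪v, z⟫_ℝ + ‖v‖ ^ 2 / 2 := fun z => by
    rw [phi, log_exp, inner_add_right, real_inner_self_eq_norm_sq]; ring
  simp only [this]
  rw [integral_add (integrable_inner v) (integrable_const _), integral_inner]
  simp

lemma integrable_phi_mul_log_phi (v : E) :
    Integrable (fun y => phi v y * log (phi v y)) (stdGaussian E) := by
  have := (integrable_shift_iff v (fun y : E => log (phi v y))).1 ?_
  · exact this
  · have : ∀ z : E, log (phi v (v + z)) = ⟪v, z⟫_ℝ + ‖v‖ ^ 2 / 2 := fun z => by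
      rw [phi, log_exp, inner_add_right, real_inner_self_eq_norm_sq]; ring
    simp only [this]
    exact (integrable_inner v).add (integrable_const _)

lemma perr_ge_of_mem {C : Finset E} {x c : E} (hc : c ∈ C) (hcx : c ≠ x) :
    1 / 2 * exp (-(‖c - x‖ ^ 2 / 8 + 1) / (1 / 2)) ≤ perr C x := by
  set v : E := (1 / 2 : ℝ) • (c - x) with hv
  set B : Set E := {z | ‖c - x‖ ^ 2 / 2 ≤ ⟪c - x, z⟫_ℝ} with hB
  have hBm : MeasurableSet B := measurableSet_le (by fun_prop) (by fun_prop)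
  have hnv : ‖v‖ ^ 2 / 2 = ‖c - x‖ ^ 2 / 8 := by
    rw [hv, norm_smul, mul_pow]; norm_num; ring
  have h1 : 1 / 2 ≤ ∫ y in B, phi v y ∂(stdGaussian E) := by
    refine (half_le_halfspace (c - x)).trans (le_of_eq ?_)
    have hm : MeasurableSet {z : E | 0 ≤ ⟪c - x, z⟫_ℝ} :=
      measurableSet_le (by fun_prop) (by fun_prop)
    rw [← integral_indicator hBm, ← integral_indicator_one hm]
    have := integral_shift' v (B.indicator 1)
    refine Eq.trans (Eq.trans ?_ this) ?_
    · congr 1; funext z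
      have : z ∈ {z : E | 0 ≤ ⟪c - x, z⟫_ℝ} ↔ v + z ∈ B := by
        simp only [hB, Set.mem_ofPred_eq, inner_add_right, hv, inner_smul_right,
          real_inner_self_eq_norm_sq]
        constructor <;> intro h <;> linarith
      by_cases hz : z ∈ {z : E | 0 ≤ ⟪c - x, z⟫_ℝ}
      · rw [Set.indicator_of_mem hz, Set.indicator_of_mem (this.1 hz)]; rfl
      · rw [Set.indicator_of_notMem hz, Set.indicator_of_notMem (fun h => hz (this.2 h))]
    · congr 1; funext z
      by_cases hz : z ∈ B <;> simp [hz]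
  have h2 := change_of_measure (P := stdGaussian E) (f := phi v) (phi_pos v) (integrable_phi v)
    (integrable_phi_mul_log_phi v) hBm (by norm_num) h1 (integral_phi_mul_log_phi v).le
    (by positivity)
  rw [hnv] at h2
  refine h2.trans (measureReal_mono fun z hz => ⟨c, hc, hcx, ?_⟩)
  rw [sub_zero]; exact hz

lemma log_asum_dev {J J' : Finset E} (hJ : J.Nonempty) (hJ' : J'.Nonempty) {L : ℝ}
    (hL : ∀ j ∈ J, ‖j‖ ^ 2 ≤ L) (hL' : ∀ j ∈ J', ‖j‖ ^ 2 ≤ L) (m : E) {t : ℝ} (ht : 0 < t) :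
    (stdGaussian E).real {z | t ≤ |(log (asum J (m + z)) - log (asum J' (m + z))) -
      ∫ z', (log (asum J (m + z')) - log (asum J' (m + z'))) ∂(stdGaussian E)|} ≤
      2 * L / t ^ 2 := by
  have hw : ∀ J : Finset E, ∀ j ∈ J, 0 < exp (-‖j‖ ^ 2 / 8) := fun _ _ _ => exp_pos _
  have hL0 : 0 ≤ L := by obtain ⟨j, hj⟩ := hJ; exact (sq_nonneg _).trans (hL j hj)
  have hb : ∀ J : Finset E, (∀ j ∈ J, ‖j‖ ^ 2 ≤ L) → ∀ j ∈ J, ‖(1 / 2 : ℝ) • j‖ ≤ √L / 2 :=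
    fun J h j hj => by
      rw [norm_smul]
      have := le_sqrt_of_sq_le (h j hj)
      norm_num; linarith
  have h1 := fun z => (hasFDerivAt_shift
    (hasFDerivAt_log_mix' hJ (hw J) (u := fun j => (1 / 2 : ℝ) • j)) m z)
  have h2 := fun z => (hasFDerivAt_shift
    (hasFDerivAt_log_mix' hJ' (hw J') (u := fun j => (1 / 2 : ℝ) • j)) m z)
  have h3 := fun z => (h1 z).sub (h2 z)
  have c1 := continuous_pmean hJ (hw J) (u := fun j => (1 / 2 : ℝ) • j)
    (x := fun j => (1 / 2 : ℝ) • j)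
  have c2 := continuous_pmean hJ' (hw J') (u := fun j => (1 / 2 : ℝ) • j)
    (x := fun j => (1 / 2 : ℝ) • j)
  have h4 := deviation_of_grad (L := √L) (h := fun z => log (asum J (m + z)) - log (asum J' (m + z)))
    (g := fun z => pmean J (fun j => exp (-‖j‖ ^ 2 / 8)) (fun j => (1 / 2 : ℝ) • j)
        (fun j => (1 / 2 : ℝ) • j) (m + z) -
      pmean J' (fun j => exp (-‖j‖ ^ 2 / 8)) (fun j => (1 / 2 : ℝ) • j)
        (fun j => (1 / 2 : ℝ) • j) (m + z)) (by fun_prop) (fun z => by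
        simp only [asum_eq_mix, map_sub]
        exact h3 z) (fun z => by
        refine (norm_sub_le _ _).trans ?_
        have a1 := norm_pmean_le hJ (hw J) (u := fun j => (1 / 2 : ℝ) • j) (hb J hL) (m + z)
        have a2 := norm_pmean_le hJ' (hw J') (u := fun j => (1 / 2 : ℝ) • j) (hb J' hL') (m + z)
        linarith) ht
  rwa [sq_sqrt hL0] at h4

lemma norm_mid_add_sub_sq (i j z : E) :
    ‖mid i j + z - j‖ ^ 2 = ‖z‖ ^ 2 + ⟪i - j, z⟫_ℝ + ‖i - j‖ ^ 2 / 4 := by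
  have : mid i j + z - j = z + (1 / 2 : ℝ) • (i - j) := by
    rw [mid]; module
  rw [this, norm_add_sq_real, inner_smul_right, norm_smul, mul_pow, real_inner_comm]
  norm_num
  ring

local notation "dim" => (Module.finrank ℝ E : ℝ)

lemma lower_volume_tail {i j : E} {η A D : ℝ} (hη : 0 < η) (hη1 : η < 1) (hA : 0 < A)
    (h1 : ‖i - j‖ ^ 2 ≤ A * dim) (h2 : D - η * dim ≤ ‖i - j‖ ^ 2) :
    (stdGaussian E).real {z | ‖mid i j + z - j‖ ^ 2 < dim + D / 4 - η * dim} ≤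
      exp (-((-(η / 4) - log (1 - η / 4)) / 2) * dim) + exp (-((η / 2) ^ 2 / (2 * A)) * dim) := by
  have a1 := norm_sq_lower_tail (E := E) (η := η / 4) (by linarith) (by linarith)
  have a2 := inner_tail_linear (j - i) hA (by rwa [norm_sub_rev]) (t := η / 2) (by linarith)
  refine le_trans (le_trans (measureReal_mono fun z hz => ?_) (measureReal_union_le _ _))
    (add_le_add a1 a2)
  simp only [Set.mem_ofPred_eq, norm_mid_add_sub_sq, Set.mem_union] at hz ⊢
  by_contra! hcon
  have : ⟪j - i, z⟫_ℝ = -⟪i - j, z⟫_ℝ := by rw [← inner_neg_left, neg_sub]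
  linarith [hcon.1, hcon.2]

lemma upper_volume_tail {j k : E} {η A D : ℝ} (hη : 0 < η) (hA : 0 < A)
    (h1 : ‖j - k‖ ^ 2 ≤ A * dim) (h2 : ‖j - k‖ ^ 2 ≤ D - 8 * (η * dim)) :
    (stdGaussian E).real {z | ¬ ‖mid j k + z - j‖ ^ 2 < dim + D / 4 - η * dim} ≤
      exp (-((η / 2 - log (1 + η / 2)) / 2) * dim) + exp (-((η / 2) ^ 2 / (2 * A)) * dim) := by
  have a1 := norm_sq_upper_tail (E := E) (η := η / 2) (by linarith)
  have a2 := inner_tail_linear (k - j) hA (by rwa [norm_sub_rev]) (t := η / 2) (by linarith)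
  refine le_trans (le_trans (measureReal_mono fun z hz => ?_) (measureReal_union_le _ _))
    (add_le_add a1 a2)
  simp only [Set.mem_ofPred_eq, mid_comm j k, norm_mid_add_sub_sq, Set.mem_union] at hz ⊢
  by_contra! hcon
  rw [norm_sub_rev k j] at hz
  push Not at hz
  linarith [hcon.1, hcon.2]

end FixedSpace

end GaussRel

namespace GaussRel
open ProbabilityTheory
open scoped InnerProductSpace
set_option linter.unusedSectionVars false

section Antisymm

variable {ι : Type*} {C : Finset ι} {J : ι → Finset ι}

/-- Keeping only the pairs on which an antisymmetric function is nonnegative retains at least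
half of a symmetric nonnegative double sum. -/
lemma sum_sum_le_two_mul (hJC : ∀ i ∈ C, J i ⊆ C) (hsymm : ∀ i ∈ C, ∀ j ∈ C, j ∈ J i ↔ i ∈ J j)
    {f G : ι → ι → ℝ} (hf : ∀ i j, f i j = f j i) (hf0 : ∀ i j, 0 ≤ f i j)
    (hG : ∀ i j, G j i = -G i j) :
    ∑ i ∈ C, ∑ j ∈ J i, f i j ≤ 2 * ∑ i ∈ C, ∑ j ∈ (J i).filter (fun j => 0 ≤ G i j), f i j := by
  classical
  have h1 : ∀ i ∈ C, ∀ F : ι → ℝ, ∑ j ∈ J i, F j = ∑ j ∈ C, if j ∈ J i then F j else 0 :=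
    fun i hi F => by
      rw [← Finset.sum_filter, Finset.filter_mem_eq_inter, Finset.inter_eq_right.2 (hJC i hi)]
  set S := ∑ i ∈ C, ∑ j ∈ C, if j ∈ J i then (if 0 ≤ G i j then f i j else 0) else 0 with hS
  have h2 : ∑ i ∈ C, ∑ j ∈ (J i).filter (fun j => 0 ≤ G i j), f i j = S :=
    Finset.sum_congr rfl fun i hi => by rw [Finset.sum_filter, h1 i hi]
  have h3 : S = ∑ i ∈ C, ∑ j ∈ C, if j ∈ J i then (if G i j ≤ 0 then f i j else 0) else 0 := by
    rw [hS, Finset.sum_comm]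
    refine Finset.sum_congr rfl fun i hi => Finset.sum_congr rfl fun j hj => ?_
    simp only [hsymm i hi j hj, hf j i, hG i j, neg_nonneg]
  rw [h2, two_mul]
  nth_rewrite 2 [h3]
  rw [hS, ← Finset.sum_add_distrib]
  refine Finset.sum_le_sum fun i hi => ?_
  rw [h1 i hi, ← Finset.sum_add_distrib]
  refine Finset.sum_le_sum fun j _ => ?_
  by_cases hj : j ∈ J i
  · simp only [if_pos hj]
    rcases le_total 0 (G i j) with h | h
    · rw [if_pos h]; have := hf0 i j; split_ifs <;> linarith
    · rw [if_pos h]; have := hf0 i j; split_ifs <;> linarith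
  · simp [hj]

end Antisymm

section FixedSpace

variable {E : Type*} [NormedAddCommGroup E] [InnerProductSpace ℝ E] [FiniteDimensional ℝ E]
  [MeasurableSpace E] [BorelSpace E]

local notation "dim" => (Module.finrank ℝ E : ℝ)

/-- Mean log-ratio of the amplitude sums seen from the midpoint of two words. -/
noncomputable def gap (J : E → Finset E) (i j : E) : ℝ :=
  ∫ z, (log (asum (J i) (mid i j + z)) - log (asum (J j) (mid i j + z))) ∂(stdGaussian E)

lemma gap_antisymm (J : E → Finset E) (i j : E) : gap J j i = -gap J i j := by
  rw [gap, gap, ← integral_neg]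
  simp only [neg_sub, mid_comm j i]

open Classical in
/-- The words of `J i` that do not outweigh `i`. -/
noncomputable def lead (J : E → Finset E) (i : E) : Finset E := (J i).filter (fun j => 0 ≤ gap J i j)

variable {C : Finset E} {J Cl : E → Finset E} {η ζ A L D κ B : ℝ}

lemma sum_aff_le_lead (hJC : ∀ i ∈ C, J i ⊆ C)
    (hsymm : ∀ i ∈ C, ∀ j ∈ C, j ∈ J i ↔ i ∈ J j) :
    ∑ i ∈ C, ∑ j ∈ J i, aff i j ≤ 2 * ∑ i ∈ C, ∑ j ∈ lead J i, aff i j := by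
  classical
  have := sum_sum_le_two_mul hJC hsymm aff_comm (fun i j => (aff_pos i j).le) (gap_antisymm J)
  refine this.trans (le_of_eq ?_)
  congr 1

open Classical in
lemma close_total_le (hJC : ∀ i ∈ C, J i ⊆ C) (hsymm : ∀ i ∈ C, ∀ j ∈ C, j ∈ J i ↔ i ∈ J j)
    (hη : 0 < η) (hη1 : η < 1) (hA : 0 < A) (hn : 0 < dim) (hζ : 0 < ζ) (hκ : 0 < κ)
    (hC : ∀ x ∈ C, ‖x‖ ^ 2 ≤ L) (hDA : D ≤ A * dim)
    (hJ1 : ∀ i ∈ C, ∀ j ∈ J i, D - η * dim ≤ ‖i - j‖ ^ 2) (hJ2 : ∀ i ∈ C, ∀ j ∈ J i, ‖i - j‖ ^ 2 ≤ D)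
    (hCl : ∀ j ∈ C, ∀ k ∈ Cl j, ‖j - k‖ ^ 2 ≤ D - 8 * (η * dim))
    (hB : ∑ j ∈ C, ∑ k ∈ Cl j, aff j k ≤ B) :
    ∑ i ∈ C, ∑ j ∈ lead J i,
        ∫ y, amp i y * amp j y * pfrac (lead J i ∩ Cl j) (lead J i) y ∂(stdGaussian E) ≤
      κ * ∑ i ∈ C, ∑ j ∈ J i, aff i j +
      (∑ i ∈ C, ∑ j ∈ lead J i, aff i j) * (2 * L / (ζ * dim) ^ 2 +
        (exp (-((-(η / 4) - log (1 - η / 4)) / 2) * dim) + exp (-((η / 2) ^ 2 / (2 * A)) * dim))) +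
      exp (ζ * dim) / κ * (B *
        (exp (-((η / 2 - log (1 + η / 2)) / 2) * dim) +
          exp (-((η / 2) ^ 2 / (2 * A)) * dim))) := by
  have hlead : ∀ i, lead J i ⊆ J i := fun i => Finset.filter_subset _ _
  set U : E → Set E := fun j => {y | ¬ ‖y - j‖ ^ 2 < dim + D / 4 - η * dim} with hU
  set V : E → E → Set E := fun i j =>
    {y | asum (J i) y < exp (-(ζ * dim)) * asum (J j) y} ∪
      {y | ‖y - j‖ ^ 2 < dim + D / 4 - η * dim} with hV
  have hm : ∀ j : E, MeasurableSet {y : E | ‖y - j‖ ^ 2 < dim + D / 4 - η * dim} := fun j =>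
    measurableSet_lt (by fun_prop) (by fun_prop)
  have hVm : ∀ i j, MeasurableSet (V i j) := fun i j =>
    (measurableSet_lt (by fun_prop) (by fun_prop)).union (hm j)
  refine (integral_close_replica_le (V := V) (U := U) (c := exp (ζ * dim)) hJC hsymm
    (fun i _ => hlead i) hVm (fun j => (hm j).compl) hκ (exp_pos _) ?_).trans ?_
  · intro i hi j hj y hy
    simp only [hV, Set.mem_union, Set.mem_ofPred_eq, not_or] at hy
    refine ⟨hy.2, ?_⟩
    have := not_lt.1 hy.1
    calc asum (J j) y = exp (ζ * dim) * (exp (-(ζ * dim)) * asum (J j) y) := by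
          rw [← mul_assoc, ← exp_add]; simp
      _ ≤ _ := mul_le_mul_of_nonneg_left this (exp_pos _).le
  · refine add_le_add (add_le_add le_rfl ?_) ?_
    · rw [Finset.sum_mul]
      refine Finset.sum_le_sum fun i hi => ?_
      rw [Finset.sum_mul]
      refine Finset.sum_le_sum fun j hj => mul_le_mul_of_nonneg_left ?_ (aff_pos i j).le
      have hjJ := hlead i hj
      have hjC := hJC i hi hjJ
      have hJi : (J i).Nonempty := ⟨j, hjJ⟩
      have hJj : (J j).Nonempty := ⟨i, (hsymm i hi j hjC).1 hjJ⟩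
      have hg : 0 ≤ gap J i j := (Finset.mem_filter.1 hj).2
      refine (measureReal_union_le _ _).trans (add_le_add ?_ ?_)
      · refine le_trans (measureReal_mono fun z hz => ?_) (log_asum_dev hJi hJj
          (fun k hk => hC k (hJC i hi hk)) (fun k hk => hC k (hJC j hjC hk)) (mid i j)
          (mul_pos hζ hn))
        simp only [Set.mem_ofPred_eq] at hz ⊢
        have h1 : log (asum (J i) (mid i j + z)) ≤ -(ζ * dim) + log (asum (J j) (mid i j + z)) := by
          rw [← log_exp (-(ζ * dim)), ← log_mul (exp_pos _).ne' (asum_pos hJj _).ne']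
          exact log_le_log (asum_pos hJi _) hz.le
        rw [abs_sub_comm]
        refine le_trans ?_ (le_abs_self _)
        rw [gap] at hg
        linarith
      · exact lower_volume_tail hη hη1 hA ((hJ2 i hi j hjJ).trans hDA) (hJ1 i hi j hjJ)
    · refine mul_le_mul_of_nonneg_left ?_ (by positivity)
      refine le_trans ?_ (mul_le_mul_of_nonneg_right hB (by positivity))
      rw [Finset.sum_mul]
      refine Finset.sum_le_sum fun j hj => ?_
      rw [Finset.sum_mul]
      refine Finset.sum_le_sum fun k hk => mul_le_mul_of_nonneg_left ?_ (aff_pos j k).le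
      have h1 := hCl j hj k hk
      exact upper_volume_tail hη hA (h1.trans ((by
        have := mul_pos hη hn
        linarith : D - 8 * (η * dim) ≤ D).trans hDA)) h1

lemma self_total_le (hJC : ∀ i ∈ C, J i ⊆ C) (hJi : ∀ i ∈ C, i ∉ J i) {Jp : E → Finset E}
    (hJp : ∀ i, Jp i ⊆ J i) (hA : 0 < A) (hζ : 0 < ζ) {P : ℝ}
    (hJ2 : ∀ i ∈ C, ∀ j ∈ J i, ‖i - j‖ ^ 2 ≤ A * dim)
    (hP : ∀ i ∈ C, (stdGaussian E).real (nearSet C i (2 * (ζ * dim))) ≤ P) :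
    ∑ i ∈ C, ∑ j ∈ Jp i, ∫ y, amp i y * amp j y * pfrac {j} (Jp i) y ∂(stdGaussian E) ≤
      (∑ i ∈ C, ∑ j ∈ Jp i, aff i j) * (2 * exp (-((2 * ζ) ^ 2 / (2 * A)) * dim)) +
      exp (ζ * dim) * (C.card * P) := by
  set U : E → Set E := fun i => {y | y - i ∈ nearSet C i (2 * (ζ * dim))} with hU
  set V : E → E → Set E := fun i j =>
    {y | exp (ζ * dim) * amp i y < amp j y} ∪ {y | amp j y < exp (-(ζ * dim)) * amp i y} with hV
  have hVm : ∀ i j, MeasurableSet (V i j) := fun i j =>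
    (measurableSet_lt (by fun_prop) (by fun_prop)).union
      (measurableSet_lt (by fun_prop) (by fun_prop))
  have hUm : ∀ i, MeasurableSet (U i) := fun i =>
    (measurableSet_nearSet C i _).preimage (by fun_prop)
  refine (integral_self_replica_le (V := V) (U := U) (c := exp (ζ * dim)) hVm hUm
    (exp_pos _) ?_).trans ?_
  · intro i hi j hj y hy
    simp only [hV, Set.mem_union, Set.mem_ofPred_eq, not_or, not_lt] at hy
    refine ⟨⟨j, hJC i hi (hJp i hj), fun h => hJi i hi (h ▸ hJp i hj), ?_⟩, hy.1⟩
    have := amp_shift_le_iff i j (y - i) (ζ * dim)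
    rw [add_sub_cancel] at this
    exact this.1 hy.2
  · refine add_le_add ?_ (mul_le_mul_of_nonneg_left ?_ (exp_pos _).le)
    · rw [Finset.sum_mul]
      refine Finset.sum_le_sum fun i hi => ?_
      rw [Finset.sum_mul]
      refine Finset.sum_le_sum fun j hj => mul_le_mul_of_nonneg_left ?_ (aff_pos i j).le
      have h1 := hJ2 i hi j (hJp i hj)
      have a1 := inner_tail_linear (i - j) hA h1 (t := 2 * ζ) (by linarith)
      have a2 := inner_tail_linear (j - i) hA (by rwa [norm_sub_rev]) (t := 2 * ζ) (by linarith)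
      rw [two_mul (exp _)]
      refine le_trans (le_trans (measureReal_mono fun z hz => ?_) (measureReal_union_le _ _))
        (add_le_add a2 a1)
      simp only [hV, Set.mem_union, Set.mem_ofPred_eq, amp_mid, mul_comm (exp _) (amp i _)] at hz ⊢
      rw [mul_lt_mul_iff_right₀ (amp_pos _ _), mul_lt_mul_iff_right₀ (amp_pos _ _), exp_lt_exp,
        exp_lt_exp] at hz
      rw [← neg_sub j i, inner_neg_left]
      rcases hz with h | h
      · left; linarith
      · right; linarith
    · rw [← nsmul_eq_mul]
      refine Finset.sum_le_card_nsmul _ _ _ fun i hi => ?_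
      refine le_trans (le_of_eq ?_) (hP i hi)
      congr 1
      ext z
      simp [hU]

end FixedSpace

end GaussRel

namespace GaussRel
open ProbabilityTheory
open scoped InnerProductSpace
set_option linter.unusedSectionVars false

section FixedSpace

variable {E : Type*} [NormedAddCommGroup E] [InnerProductSpace ℝ E] [FiniteDimensional ℝ E]
  [MeasurableSpace E] [BorelSpace E]

local notation "dim" => (Module.finrank ℝ E : ℝ)

/-- Replica cost per unit of affinity, in dimension `n`. -/
noncomputable def repCost (A β E₀ η ζ κ P n : ℝ) : ℝ :=
  2 * κ + (2 * (A * n) / (ζ * n) ^ 2 +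
    (exp (-((-(η / 4) - log (1 - η / 4)) / 2) * n) +
      exp (-((η / 2) ^ 2 / (2 * (β + η))) * n))) +
  exp (ζ * n) / κ * (2 * (⌊β / η⌋₊ + 1) *
    (exp (-((η / 2 - log (1 + η / 2)) / 2) * n) + exp (-((η / 2) ^ 2 / (2 * (β + η))) * n))) +
  2 * exp (-((2 * ζ) ^ 2 / (2 * (β + η))) * n) +
  exp (ζ * n) * (2 * (⌊β / η⌋₊ + 1) * (P * exp (n * E₀)))

open Classical in
lemma near_ge_of_pairs {C : Finset E} {A β E₀ η ζ κ P q : ℝ} (hC0 : C.Nonempty)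
    (hn : 0 < dim) (hβ : 0 < β) (hη : 0 < η) (hη1 : η < 1) (hζ : 0 < ζ) (hκ : 0 < κ) (hq : 0 < q)
    (hq1 : exp (-((2 * ζ) ^ 2 / (2 * (β + η))) * dim) ≤ 1 - q)
    (hC : ∀ x ∈ C, ‖x‖ ^ 2 ≤ A * dim)
    (hT : C.card * exp (-(dim * E₀)) ≤
      ∑ i ∈ C, ∑ j ∈ C.filter (fun j => j ≠ i ∧ ‖i - j‖ ^ 2 ≤ β * dim), aff i j)
    (hP : ∀ i ∈ C, (stdGaussian E).real (nearSet C i (2 * (ζ * dim))) ≤ P) :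
    q * exp (-((β / 16 + η + repCost A β E₀ η ζ κ P dim * (β + η) / 8) * dim + 1) / q) ≤ P := by
  have hηn := mul_pos hη hn
  set bin : E → E → ℕ := fun i j => ⌊‖i - j‖ ^ 2 / (η * dim)⌋₊ with hbin
  set B : ℕ := ⌊β / η⌋₊ + 1 with hB
  have hbinB : ∀ i j, ‖i - j‖ ^ 2 ≤ β * dim → bin i j < B := fun i j h => by
    rw [hB, Nat.lt_succ_iff]
    refine Nat.floor_le_floor ?_
    rw [div_le_div_iff₀ hηn hη]
    nlinarith
  set W : ℕ → ℝ := fun b => ∑ i ∈ C, ∑ j ∈ C.filter (fun j => j ≠ i ∧ bin i j = b), aff i j with hW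
  obtain ⟨b, hbB, hbmax⟩ := Finset.exists_max_image (Finset.range B) W ⟨0, by simp [hB]⟩
  have hbB' := Finset.mem_range.1 hbB
  have hBW : ∀ Q : E → E → Prop, (∀ i j, Q i j → bin i j < B) →
      ∑ i ∈ C, ∑ j ∈ C.filter (fun j => j ≠ i ∧ Q i j), aff i j ≤ B * W b := by
    intro Q hQ
    calc _ ≤ ∑ b' ∈ Finset.range B, W b' := by
          simp only [hW]
          rw [Finset.sum_comm]
          refine Finset.sum_le_sum fun i hi => ?_
          rw [← Finset.sum_biUnion]
          · refine Finset.sum_le_sum_of_subset_of_nonneg (fun j hj => ?_)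
              fun _ _ _ => (aff_pos _ _).le
            simp only [Finset.mem_filter, Finset.mem_biUnion, Finset.mem_range] at hj ⊢
            exact ⟨bin i j, hQ i j hj.2.2, hj.1, hj.2.1, rfl⟩
          · intro b1 _ b2 _ hne
            refine Finset.disjoint_left.2 fun j h1 h2 => hne ?_
            simp only [Finset.mem_filter] at h1 h2
            rw [← h1.2.2, h2.2.2]
      _ ≤ (Finset.range B).card • W b := Finset.sum_le_card_nsmul _ _ _ hbmax
      _ = _ := by rw [Finset.card_range, nsmul_eq_mul]
  set D : ℝ := (b + 1) * (η * dim) with hD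
  set J : E → Finset E := fun i => C.filter (fun j => j ≠ i ∧ bin i j = b) with hJ
  set Cl : E → Finset E := fun j => C.filter (fun k => k ≠ j ∧ ‖j - k‖ ^ 2 ≤ D - 8 * (η * dim))
    with hCl
  have hDA : D ≤ (β + η) * dim := by
    have h1 : (b : ℝ) + 1 ≤ B := by exact_mod_cast hbB'
    have h2 : (B : ℝ) ≤ β / η + 1 := by
      rw [hB]; push_cast; linarith [Nat.floor_le (div_pos hβ hη).le]
    calc D ≤ (β / η + 1) * (η * dim) := mul_le_mul_of_nonneg_right (h1.trans h2) hηn.le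
      _ = _ := by field_simp
  have hJC : ∀ i ∈ C, J i ⊆ C := fun i _ => Finset.filter_subset _ _
  have hsymm : ∀ i ∈ C, ∀ j ∈ C, j ∈ J i ↔ i ∈ J j := fun i hi j hj => by
    simp only [hJ, Finset.mem_filter, hi, hj, true_and, hbin, norm_sub_rev j i, ne_comm (a := j)]
  have hJ1 : ∀ i ∈ C, ∀ j ∈ J i, D - η * dim ≤ ‖i - j‖ ^ 2 := fun i _ j hj => by
    have h1 : bin i j = b := (Finset.mem_filter.1 hj).2.2
    have h2 : (b : ℝ) ≤ ‖i - j‖ ^ 2 / (η * dim) := by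
      rw [← h1]; exact Nat.floor_le (by positivity)
    rw [le_div_iff₀ hηn] at h2
    rw [hD]; linarith
  have hJ2 : ∀ i ∈ C, ∀ j ∈ J i, ‖i - j‖ ^ 2 ≤ D := fun i _ j hj => by
    have h1 : bin i j = b := (Finset.mem_filter.1 hj).2.2
    have h2 : ‖i - j‖ ^ 2 / (η * dim) < b + 1 := by
      rw [← h1]; exact Nat.lt_floor_add_one _
    rw [div_lt_iff₀ hηn] at h2
    exact h2.le
  have hCl1 : ∀ j ∈ C, ∀ k ∈ Cl j, ‖j - k‖ ^ 2 ≤ D - 8 * (η * dim) := fun j _ k hk =>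
    (Finset.mem_filter.1 hk).2.2
  have hClB : ∑ j ∈ C, ∑ k ∈ Cl j, aff j k ≤ B * W b := hBW _ fun i j h => by
    refine lt_of_le_of_lt ?_ hbB'
    rw [hbin]
    have : ‖i - j‖ ^ 2 / (η * dim) ≤ b := by
      rw [div_le_iff₀ hηn]; rw [hD] at h; linarith
    exact (Nat.floor_le_floor this).trans_eq (Nat.floor_natCast _)
  have hTW : C.card * exp (-(dim * E₀)) ≤ B * W b := hT.trans (hBW _ fun i j h => hbinB i j h)
  have hB0 : (0 : ℝ) < B := by rw [hB]; positivity
  have hcard : (0 : ℝ) < C.card := by exact_mod_cast hC0.card_pos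
  have hWle := sum_aff_le_lead hJC hsymm
  set Wp := ∑ i ∈ C, ∑ j ∈ lead J i, aff i j with hWp
  change W b ≤ 2 * Wp at hWle
  have hWb : 0 < W b := by
    have : 0 < B * W b := lt_of_lt_of_le (by positivity) hTW
    exact (pos_iff_pos_of_mul_pos this).1 hB0
  have hWp0 : 0 < Wp := by linarith
  have hP0 : 0 ≤ P := by obtain ⟨i, hi⟩ := hC0; exact measureReal_nonneg.trans (hP i hi)
  have hcl := close_total_le hJC hsymm hη hη1 (A := β + η) (by linarith) hn hζ hκ hC hDA hJ1 hJ2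
    hCl1 hClB
  have hse := self_total_le hJC (fun i _ h => by simp [hJ] at h) (Jp := lead J)
    (fun i => Finset.filter_subset _ _) (A := β + η) (by linarith) hζ
    (fun i hi j hj => (hJ2 i hi j hj).trans hDA) hP
  set pU := exp (-((η / 2 - log (1 + η / 2)) / 2) * dim) + exp (-((η / 2) ^ 2 / (2 * (β + η))) * dim)
    with hpU
  set ε := repCost A β E₀ η ζ κ P dim with hε
  have hsum : ∑ i ∈ C, (∑ j ∈ lead J i,
        ∫ y, amp i y * amp j y * pfrac (lead J i ∩ Cl j) (lead J i) y ∂(stdGaussian E) +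
      ∑ j ∈ lead J i, ∫ y, amp i y * amp j y * pfrac {j} (lead J i) y ∂(stdGaussian E)) ≤
      ∑ i ∈ C, ε * ∑ j ∈ lead J i, aff i j := by
    rw [← Finset.mul_sum, Finset.sum_add_distrib]
    refine (add_le_add hcl hse).trans ?_
    change κ * W b + _ + _ + _ ≤ ε * Wp
    have e1 : κ * W b ≤ 2 * κ * Wp := by nlinarith
    have e2 : exp (ζ * dim) / κ * (B * W b * pU) ≤ exp (ζ * dim) / κ * (2 * B * pU) * Wp := by
      have : B * W b * pU ≤ B * (2 * Wp) * pU := by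
        have : 0 ≤ pU := by positivity
        gcongr
      calc _ ≤ exp (ζ * dim) / κ * (B * (2 * Wp) * pU) := by gcongr
        _ = _ := by ring
    have e3 : exp (ζ * dim) * (C.card * P) ≤
        exp (ζ * dim) * (2 * B * (P * exp (dim * E₀))) * Wp := by
      have h1 : (C.card : ℝ) ≤ 2 * B * exp (dim * E₀) * Wp := by
        have : (C.card : ℝ) = C.card * exp (-(dim * E₀)) * exp (dim * E₀) := by
          rw [mul_assoc, ← exp_add]; simp
        rw [this]
        calc _ ≤ B * (2 * Wp) * exp (dim * E₀) := by
              refine mul_le_mul_of_nonneg_right (hTW.trans ?_) (exp_pos _).le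
              gcongr
          _ = _ := by ring
      calc _ ≤ exp (ζ * dim) * (2 * B * exp (dim * E₀) * Wp * P) := by gcongr
        _ = _ := by ring
    have hBc : (B : ℝ) = ⌊β / η⌋₊ + 1 := by rw [hB]; push_cast; ring
    rw [hε, repCost, ← hBc, ← hpU]
    linarith
  obtain ⟨i, hi, hne, hrep⟩ : ∃ i ∈ C, (lead J i).Nonempty ∧ (∑ j ∈ lead J i,
        ∫ y, amp i y * amp j y * pfrac (lead J i ∩ Cl j) (lead J i) y ∂(stdGaussian E) +
      ∑ j ∈ lead J i, ∫ y, amp i y * amp j y * pfrac {j} (lead J i) y ∂(stdGaussian E)) ≤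
      ε * ∑ j ∈ lead J i, aff i j := by
    by_contra! hcon
    obtain ⟨i₀, hi₀, h0⟩ : ∃ i ∈ C, (lead J i).Nonempty := by
      by_contra! h0
      exact hWp0.ne' (Finset.sum_eq_zero fun i hi => by simp [h0 i hi])
    refine absurd hsum (not_le.2 (Finset.sum_lt_sum (fun i hi => ?_)
      ⟨i₀, hi₀, hcon i₀ hi₀ h0⟩))
    rcases (lead J i).eq_empty_or_nonempty with h | h
    · simp [h]
    · exact (hcon i hi h).le
  have hleadJ : lead J i ⊆ J i := Finset.filter_subset _ _
  have hpm := pm2_nwt_le hne (D := D) (D' := D - 8 * (η * dim)) (fun j hj => hJ2 i hi j (hleadJ hj))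
    (by
      have : 0 ≤ D := by rw [hD]; positivity
      linarith)
    (fun j hj k hk hkj hkc => by
      by_contra! hcon
      exact hkc (Finset.mem_filter.2 ⟨hJC i hi (hleadJ hk), hkj, hcon.le⟩)) hrep
  have hε0 : 0 ≤ ε := by
    have h1 : 0 < ∑ j ∈ lead J i, aff i j := sum_aff_pos hne i
    have h2 : 0 ≤ ε * ∑ j ∈ lead J i, aff i j := le_trans (add_nonneg
      (Finset.sum_nonneg fun j _ => integral_nonneg fun y => mul_nonneg
        (mul_pos (amp_pos _ _) (amp_pos _ _)).le (pfrac_nonneg _ _ _))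
      (Finset.sum_nonneg fun j _ => integral_nonneg fun y => mul_nonneg
        (mul_pos (amp_pos _ _) (amp_pos _ _)).le (pfrac_nonneg _ _ _))) hrep
    exact nonneg_of_mul_nonneg_left h2 h1
  have hii : i ∉ lead J i := fun h => by
    have := hleadJ h
    simp [hJ] at this
  refine (near_ge_of_pm2 hne hii (K := (β / 16 + η + ε * (β + η) / 8) * dim) (t := 2 * (ζ * dim)) hq
    (hpm.trans ?_) fun j hj => ?_).trans
    ((measureReal_mono (nearSet_mono (hleadJ.trans (hJC i hi)) i _)).trans (hP i hi))
  · have : ε * (D / 4) ≤ ε * ((β + η) * dim / 4) := by gcongr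
    linarith
  · refine le_trans ?_ hq1
    have := inner_tail_linear (i - j) (A := β + η) (by linarith)
      ((hJ2 i hi j (hleadJ hj)).trans hDA) (t := 2 * ζ) (by linarith)
    rwa [mul_assoc] at this

end FixedSpace

end GaussRel

namespace GaussRel
open ProbabilityTheory
open scoped InnerProductSpace
set_option linter.unusedSectionVars false

lemma tendsto_exp_neg_mul {c : ℝ} (hc : 0 < c) :
    Tendsto (fun n : ℝ => exp (-c * n)) atTop (nhds 0) :=
  tendsto_exp_atBot.comp ((tendsto_const_mul_atBot_of_neg (by linarith)).2 tendsto_id)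

lemma tendsto_repCost {A β E₀ η ζ κ δ : ℝ} (hβ : 0 < β) (hη : 0 < η) (hη1 : η < 1) (hζ : 0 < ζ)
    (h1 : ζ < (η / 2 - log (1 + η / 2)) / 2) (h2 : ζ < (η / 2) ^ 2 / (2 * (β + η)))
    (h3 : ζ < 3 * δ / 4) :
    Tendsto (fun n => repCost A β E₀ η ζ κ (3 * exp (-(E₀ + 3 * δ / 4) * n)) n) atTop
      (nhds (2 * κ)) := by
  have c2 : 0 < (η / 2) ^ 2 / (2 * (β + η)) := by positivity
  have c3 : 0 < (-(η / 4) - log (1 - η / 4)) / 2 := by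
    have := rate_lower_pos (η := η / 4) (by linarith) (by linarith)
    linarith
  have c4 : 0 < (2 * ζ) ^ 2 / (2 * (β + η)) := by positivity
  have t1 : Tendsto (fun n : ℝ => 2 * (A * n) / (ζ * n) ^ 2) atTop (nhds 0) := by
    have : Tendsto (fun n : ℝ => 2 * A / ζ ^ 2 * n⁻¹) atTop (nhds (2 * A / ζ ^ 2 * 0)) :=
      tendsto_inv_atTop_zero.const_mul _
    rw [mul_zero] at this
    refine this.congr' ?_
    filter_upwards [eventually_gt_atTop 0] with n hn
    field_simp
  have t2 := tendsto_exp_neg_mul c2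
  have t3 := tendsto_exp_neg_mul c3
  have t4 := tendsto_exp_neg_mul c4
  have t5 := tendsto_exp_neg_mul (sub_pos.2 h1)
  have t6 := tendsto_exp_neg_mul (sub_pos.2 h2)
  have t7 := tendsto_exp_neg_mul (sub_pos.2 h3)
  have := ((((tendsto_const_nhds (x := 2 * κ)).add (t1.add (t3.add t2))).add
    ((t5.add t6).const_mul (1 / κ * (2 * (⌊β / η⌋₊ + 1))))).add (t4.const_mul 2)).add
    (t7.const_mul (6 * ((⌊β / η⌋₊ : ℝ) + 1)))
  simp only [add_zero, mul_zero] at this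
  refine this.congr fun n => ?_
  have e : ∀ c : ℝ, exp (-(c - ζ) * n) = exp (ζ * n) * exp (-c * n) := fun c => by
    rw [← exp_add]; congr 1; ring
  have e' : exp (-(E₀ + 3 * δ / 4) * n) * exp (n * E₀) = exp (-(3 * δ / 4) * n) := by
    rw [← exp_add]; congr 1; ring
  rw [repCost, e, e, e, mul_assoc 3, e']
  ring

open Classical in
/-- Lower bound on the average error probability in terms of the low-distance affinities. -/
theorem exists_sum_perr_ge {A β E₀ δ : ℝ} (hβ : 0 < β) (hδ : 0 < δ) (hE : β / 16 ≤ E₀) :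
    ∃ n₀ : ℕ, ∀ (E : Type) [NormedAddCommGroup E] [InnerProductSpace ℝ E]
      [FiniteDimensional ℝ E] [MeasurableSpace E] [BorelSpace E], n₀ ≤ Module.finrank ℝ E →
      ∀ C : Finset E, (∀ x ∈ C, ‖x‖ ^ 2 ≤ A * Module.finrank ℝ E) →
      (∀ C' ⊆ C, C.card ≤ 2 * C'.card → C'.card * exp (-(Module.finrank ℝ E * E₀)) ≤
        ∑ i ∈ C', ∑ j ∈ C'.filter (fun j => j ≠ i ∧ ‖i - j‖ ^ 2 ≤ β * Module.finrank ℝ E),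
          aff i j) →
      C.card * exp (-(Module.finrank ℝ E * (E₀ + δ))) ≤ ∑ x ∈ C, perr C x := by
  have hE0 : 0 < E₀ := by linarith
  set η := min (1 / 2) (δ / 8) with hη'
  have hη : 0 < η := by positivity
  have hη1 : η < 1 := lt_of_le_of_lt (min_le_left _ _) (by norm_num)
  have hηδ : η ≤ δ / 8 := min_le_right _ _
  obtain ⟨ζ₀, hζ₀, hnear⟩ := exists_near_le (η := η) (δ := δ / 4) (K := E₀ + δ) hη (by linarith)
    (by linarith)
  obtain ⟨ζ, hζ, hζζ₀, h1, h2, h3⟩ : ∃ ζ > 0, ζ ≤ ζ₀ ∧ ζ < (η / 2 - log (1 + η / 2)) / 2 ∧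
      ζ < (η / 2) ^ 2 / (2 * (β + η)) ∧ ζ < 3 * δ / 4 := by
    have a1 : 0 < (η / 2 - log (1 + η / 2)) / 2 := by
      have := rate_upper_pos (η := η / 2) (by linarith)
      linarith
    have a2 : 0 < (η / 2) ^ 2 / (2 * (β + η)) := by positivity
    set m := min (min ζ₀ ((η / 2 - log (1 + η / 2)) / 2))
      (min ((η / 2) ^ 2 / (2 * (β + η))) (3 * δ / 4)) with hm
    have hm0 : 0 < m := by positivity
    have b1 : m ≤ ζ₀ := (min_le_left _ _).trans (min_le_left _ _)
    have b2 : m ≤ _ := (min_le_left _ _).trans (min_le_right _ _)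
    have b3 : m ≤ _ := (min_le_right _ _).trans (min_le_left _ _)
    have b4 : m ≤ _ := (min_le_right _ _).trans (min_le_right _ _)
    exact ⟨m / 2, by linarith, by linarith, by linarith, by linarith, by linarith⟩
  set κ := δ / (β + η) / 4 with hκ'
  have hκ : 0 < κ := by positivity
  set q := (E₀ + δ / 4) / (E₀ + δ / 2) with hq'
  have hq : 0 < q := by positivity
  have hq1 : q < 1 := by rw [hq', div_lt_one (by linarith)]; linarith
  have ev1 := (tendsto_repCost (A := A) (E₀ := E₀) (κ := κ) hβ hη hη1 hζ h1 h2 h3).eventually_le_const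
    (u := δ / (β + η)) (by
      have : 0 < δ / (β + η) := by positivity
      rw [hκ']; linarith)
  have ev2 := (tendsto_exp_neg_mul (c := (2 * ζ) ^ 2 / (2 * (β + η)))
    (by positivity)).eventually_le_const (u := 1 - q) (by linarith)
  have ev3 := (tendsto_exp_neg_mul (c := δ / 4) (by linarith)).eventually_lt_const
    (u := q * exp (-1 / q) / 3) (by positivity)
  have ev4 := (tendsto_exp_neg_mul (c := E₀ + δ - η / 4) (by linarith)).eventually_lt_const
    (u := 1 / 4 * exp (-2)) (by positivity)
  obtain ⟨x₀, hx₀⟩ := eventually_atTop.1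
    (ev1.and (ev2.and (ev3.and (ev4.and (eventually_gt_atTop 0)))))
  refine ⟨⌈x₀⌉₊, fun E _ _ _ _ _ hn C hA hT => ?_⟩
  obtain ⟨ev1, ev2, ev3, ev4, hn0⟩ := hx₀ ((Module.finrank ℝ E : ℕ) : ℝ)
    ((Nat.le_ceil x₀).trans (by exact_mod_cast hn))
  set n : ℝ := ((Module.finrank ℝ E : ℕ) : ℝ) with hn'
  clear hx₀
  by_contra! hcon
  set C' := C.filter (fun x => perr C x ≤ 2 * exp (-(n * (E₀ + δ)))) with hC'
  have hCC : C' ⊆ C := Finset.filter_subset _ _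
  have hcard : C.card ≤ 2 * C'.card := by
    by_contra! hlt
    have h4 : C'.card + (C.filter (fun x => ¬ perr C x ≤ 2 * exp (-(n * (E₀ + δ))))).card = C.card :=
      Finset.card_filter_add_card_filter_not _
    set C'' := C.filter (fun x => ¬ perr C x ≤ 2 * exp (-(n * (E₀ + δ)))) with hC''
    have h5 : C''.card • (2 * exp (-(n * (E₀ + δ)))) ≤ ∑ x ∈ C'', perr C x :=
      Finset.card_nsmul_le_sum _ _ _ fun x hx => (not_le.1 (Finset.mem_filter.1 hx).2).le
    have h6 : ∑ x ∈ C'', perr C x ≤ ∑ x ∈ C, perr C x :=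
      Finset.sum_le_sum_of_subset_of_nonneg (Finset.filter_subset _ _)
        fun _ _ _ => perr_nonneg _ _
    rw [nsmul_eq_mul] at h5
    have h7 : (C.card : ℝ) ≤ 2 * C''.card := by exact_mod_cast (by omega : C.card ≤ 2 * C''.card)
    have := mul_le_mul_of_nonneg_right h7 (exp_pos (-(n * (E₀ + δ)))).le
    linarith
  have hC0 : C'.Nonempty := by
    rw [Finset.nonempty_iff_ne_empty]
    intro h
    have h0 : C.card = 0 := by rw [h] at hcard; simpa using hcard
    rw [Finset.card_eq_zero.1 h0] at hcon
    simp at hcon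
  have hperr : ∀ x ∈ C', perr C' x ≤ 2 * exp (-(n * (E₀ + δ))) := fun x hx =>
    (perr_mono hCC x).trans (Finset.mem_filter.1 hx).2
  have hdist : ∀ x ∈ C', ∀ c ∈ C', c ≠ x → η * n ≤ ‖c - x‖ ^ 2 := by
    intro x hx c hc hcx
    by_contra! hlt
    have h5 := (perr_ge_of_mem hc hcx).trans (hperr x hx)
    have h6 : exp (-(η * n / 4) + -2) ≤ exp (-(‖c - x‖ ^ 2 / 8 + 1) / (1 / 2)) :=
      exp_le_exp.2 (by linarith)
    have h7 : exp (-(n * (E₀ + δ))) = exp (-(E₀ + δ - η / 4) * n) * exp (-(η * n / 4)) := by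
      rw [← exp_add]; congr 1; ring
    rw [exp_add] at h6
    rw [h7] at h5
    have := mul_lt_mul_of_pos_right ev4 (exp_pos (-(η * n / 4)))
    linarith
  have hP : ∀ i ∈ C', (stdGaussian E).real (nearSet C' i (2 * (ζ * n))) ≤
      3 * exp (-(E₀ + 3 * δ / 4) * n) := by
    intro i hi
    have h5 := hnear ζ hζζ₀ E C' i (hdist i hi)
    rw [← hn'] at h5
    have h6 : exp (δ / 4 * n) * perr C' i ≤ exp (δ / 4 * n) * (2 * exp (-(n * (E₀ + δ)))) :=
      mul_le_mul_of_nonneg_left (hperr i hi) (exp_pos _).le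
    have h7 : exp (δ / 4 * n) * exp (-(n * (E₀ + δ))) = exp (-(E₀ + 3 * δ / 4) * n) := by
      rw [← exp_add]; congr 1; ring
    have h8 : exp (-((E₀ + δ) * n)) ≤ exp (-(E₀ + 3 * δ / 4) * n) := exp_le_exp.2 (by nlinarith)
    linarith
  have hfin := near_ge_of_pairs (A := A) hC0 hn0 hβ hη hη1 hζ hκ hq ev2 (fun x hx => hA x (hCC hx))
    (hT C' hCC hcard) hP
  refine absurd hfin (not_le.2 ?_)
  set ε := repCost A β E₀ η ζ κ (3 * exp (-(E₀ + 3 * δ / 4) * n)) n with hε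
  have h5 : ε * (β + η) ≤ δ := by
    rwa [le_div_iff₀ (by linarith)] at ev1
  have h6 : -((E₀ + δ / 2) * n) + -1 / q ≤ -((β / 16 + η + ε * (β + η) / 8) * n + 1) / q := by
    have : (E₀ + δ / 2) * n = (E₀ + δ / 4) * n / q := by rw [hq']; field_simp
    rw [this, ← neg_div, ← add_div]
    refine div_le_div_of_nonneg_right ?_ hq.le
    nlinarith
  have h7 := exp_le_exp.2 h6
  rw [exp_add] at h7
  have h8 : exp (-(E₀ + 3 * δ / 4) * n) = exp (-(δ / 4) * n) * exp (-((E₀ + δ / 2) * n)) := by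
    rw [← exp_add]; congr 1; ring
  rw [h8]
  have h9 := mul_lt_mul_of_pos_right ev3 (exp_pos (-((E₀ + δ / 2) * n)))
  have h10 := mul_le_mul_of_nonneg_left h7 hq.le
  linarith

end GaussRel

namespace GaussRel
open ProbabilityTheory
open scoped InnerProductSpace
set_option linter.unusedSectionVars false

section Growth

variable {E : Type*} [NormedAddCommGroup E] [InnerProductSpace ℝ E] [FiniteDimensional ℝ E]
  [MeasurableSpace E] [BorelSpace E]

local notation "dim" => (Module.finrank ℝ E : ℝ)

/-- Measurable functions of at most exponential growth. -/
def Gr (F : E → ℝ) : Prop := Measurable F ∧ ∃ C b : ℝ, ∀ z, |F z| ≤ C * exp (b * ‖z‖)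

lemma Gr.exists_nonneg {F : E → ℝ} (h : Gr F) :
    ∃ C b : ℝ, 0 ≤ C ∧ 0 ≤ b ∧ ∀ z, |F z| ≤ C * exp (b * ‖z‖) := by
  obtain ⟨-, C, b, hF⟩ := h
  refine ⟨|C|, |b|, abs_nonneg _, abs_nonneg _, fun z => (hF z).trans ?_⟩
  exact mul_le_mul (le_abs_self _) (exp_le_exp.2 (mul_le_mul_of_nonneg_right (le_abs_self _)
    (norm_nonneg _))) (exp_pos _).le (abs_nonneg _)

lemma Gr.const (c : ℝ) : Gr (fun _ : E => c) :=
  ⟨measurable_const, |c|, 0, fun z => by simp⟩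

lemma Gr.mul {F G : E → ℝ} (hF : Gr F) (hG : Gr G) : Gr (fun z => F z * G z) := by
  obtain ⟨C, b, hC, hb, h1⟩ := hF.exists_nonneg
  obtain ⟨D, c, hD, hc, h2⟩ := hG.exists_nonneg
  refine ⟨hF.1.mul hG.1, C * D, b + c, fun z => ?_⟩
  rw [abs_mul]
  refine (mul_le_mul (h1 z) (h2 z) (abs_nonneg _) (by positivity)).trans (le_of_eq ?_)
  rw [add_mul, exp_add]; ring

lemma Gr.add {F G : E → ℝ} (hF : Gr F) (hG : Gr G) : Gr (fun z => F z + G z) := by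
  obtain ⟨C, b, hC, hb, h1⟩ := hF.exists_nonneg
  obtain ⟨D, c, hD, hc, h2⟩ := hG.exists_nonneg
  refine ⟨hF.1.add hG.1, C + D, b + c, fun z => (abs_add_le _ _).trans ?_⟩
  have e1 : exp (b * ‖z‖) ≤ exp ((b + c) * ‖z‖) := by gcongr; linarith
  have e2 : exp (c * ‖z‖) ≤ exp ((b + c) * ‖z‖) := by gcongr; linarith
  have := mul_le_mul_of_nonneg_left e1 hC
  have := mul_le_mul_of_nonneg_left e2 hD
  linarith [h1 z, h2 z]

lemma Gr.const_mul {F : E → ℝ} (c : ℝ) (hF : Gr F) : Gr (fun z => c * F z) := (Gr.const c).mul hF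

lemma Gr.sub {F G : E → ℝ} (hF : Gr F) (hG : Gr G) : Gr (fun z => F z - G z) := by
  have := hF.add (hG.const_mul (-1))
  refine ⟨hF.1.sub hG.1, ?_⟩
  simpa [sub_eq_add_neg] using this.2

lemma Gr.pow {F : E → ℝ} (hF : Gr F) (k : ℕ) : Gr (fun z => F z ^ k) := by
  induction k with
  | zero => simpa using Gr.const 1
  | succ k ih => simpa only [pow_succ] using ih.mul hF

lemma Gr.sum {ι : Type*} (s : Finset ι) {F : ι → E → ℝ} (hF : ∀ i, Gr (F i)) :
    Gr (fun z => ∑ i ∈ s, F i z) := by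
  classical
  induction s using Finset.induction_on with
  | empty => simpa using Gr.const 0
  | insert a s ha ih => simpa only [Finset.sum_insert ha] using (hF a).add ih

lemma Gr.norm : Gr (fun z : E => ‖z‖) := by
  refine ⟨measurable_norm, 1, 1, fun z => ?_⟩
  rw [abs_norm]
  linarith [add_one_le_exp (1 * ‖z‖)]

lemma Gr.inner (e : E) : Gr (fun z : E => ⟪e, z⟫_ℝ) := by
  obtain ⟨-, C, b, h⟩ := (Gr.norm (E := E)).const_mul ‖e‖
  refine ⟨by fun_prop, C, b, fun z => le_trans ?_ (h z)⟩
  exact (abs_real_inner_le_norm e z).trans (le_abs_self _)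

lemma Gr.exp_inner (e : E) (s : ℝ) : Gr (fun z : E => exp (s * ⟪e, z⟫_ℝ)) := by
  refine ⟨by fun_prop, 1, |s| * ‖e‖, fun z => ?_⟩
  rw [abs_of_pos (exp_pos _), one_mul]
  refine exp_le_exp.2 ((le_abs_self _).trans ?_)
  rw [abs_mul, mul_assoc]
  exact mul_le_mul_of_nonneg_left (abs_real_inner_le_norm e z) (abs_nonneg _)

lemma Gr.shift {F : E → ℝ} (hF : Gr F) (v : E) : Gr (fun z => F (v + z)) := by
  obtain ⟨C, b, hC, hb, h1⟩ := hF.exists_nonneg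
  refine ⟨hF.1.comp (measurable_const_add v), C * exp (b * ‖v‖), b, fun z => (h1 _).trans ?_⟩
  rw [mul_assoc, ← exp_add, ← mul_add]
  gcongr
  exact norm_add_le _ _

lemma Gr.indicator {F : E → ℝ} (hF : Gr F) {B : Set E} (hB : MeasurableSet B) :
    Gr (B.indicator F) := by
  obtain ⟨C, b, hC, hb, h1⟩ := hF.exists_nonneg
  refine ⟨hF.1.indicator hB, C, b, fun z => ?_⟩
  by_cases hz : z ∈ B
  · simpa [hz] using h1 z
  · simp only [hz, not_false_eq_true, Set.indicator_of_notMem, abs_zero]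
    positivity

lemma Gr.integrable {F : E → ℝ} (hF : Gr F) : Integrable F (stdGaussian E) := by
  obtain ⟨hm, C, b, h⟩ := hF
  exact ((integrable_exp_norm b).const_mul C).mono' hm.aestronglyMeasurable (ae_of_all _ h)

lemma Gr.hasDerivAt_inner {W : E → ℝ} (hW : Gr W) (e : E) (s : ℝ) :
    HasDerivAt (fun s : ℝ => ∫ z, exp (s * ⟪e, z⟫_ℝ) * W z ∂(stdGaussian E))
      (∫ z, exp (s * ⟪e, z⟫_ℝ) * (⟪e, z⟫_ℝ * W z) ∂(stdGaussian E)) s := by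
  obtain ⟨-, C, b, h⟩ := (Gr.inner e).mul hW
  have hm := hW.1
  refine (hasDerivAt_integral_of_dominated_loc_of_deriv_le
    (bound := fun z => C * exp (((|s| + 1) * ‖e‖ + b) * ‖z‖))
    (F' := fun s z => exp (s * ⟪e, z⟫_ℝ) * (⟪e, z⟫_ℝ * W z)) (s := Metric.ball s 1)
    (Metric.ball_mem_nhds _ one_pos)
    (Eventually.of_forall fun t => ((Gr.exp_inner e t).mul hW).1.aestronglyMeasurable)
    ((Gr.exp_inner e s).mul hW).integrable
    ((Gr.exp_inner e s).mul ((Gr.inner e).mul hW)).1.aestronglyMeasurable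
    (ae_of_all _ fun z t ht => ?_) ((integrable_exp_norm _).const_mul _)
    (ae_of_all _ fun z t _ => ?_)).2
  · rw [Real.norm_eq_abs, abs_mul, abs_of_pos (exp_pos _), add_mul _ b, exp_add]
    have h1 : t * ⟪e, z⟫_ℝ ≤ (|s| + 1) * ‖e‖ * ‖z‖ := by
      refine (le_abs_self _).trans ?_
      rw [abs_mul, mul_assoc]
      refine mul_le_mul ?_ (abs_real_inner_le_norm e z) (abs_nonneg _) (by positivity)
      rw [Metric.mem_ball, Real.dist_eq] at ht
      have := abs_sub_abs_le_abs_sub t s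
      linarith
    calc _ ≤ exp ((|s| + 1) * ‖e‖ * ‖z‖) * (C * exp (b * ‖z‖)) := by
          refine mul_le_mul (exp_le_exp.2 h1) (h z) (abs_nonneg _) (exp_pos _).le
      _ = _ := by ring
  · have h1 : HasDerivAt (fun t : ℝ => t * ⟪e, z⟫_ℝ) (⟪e, z⟫_ℝ) t := by
      simpa using (hasDerivAt_id t).mul_const (⟪e, z⟫_ℝ)
    exact (h1.exp.mul_const (W z)).congr_deriv (by ring)

lemma Gr.iteratedDeriv_inner {W : E → ℝ} (hW : Gr W) (e : E) (k : ℕ) :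
    iteratedDeriv k (fun s : ℝ => ∫ z, exp (s * ⟪e, z⟫_ℝ) * W z ∂(stdGaussian E)) =
      fun s => ∫ z, exp (s * ⟪e, z⟫_ℝ) * (⟪e, z⟫_ℝ ^ k * W z) ∂(stdGaussian E) := by
  induction k with
  | zero => simp
  | succ k ih =>
    rw [iteratedDeriv_succ, ih]
    funext s
    rw [((((Gr.inner e).pow k).mul hW).hasDerivAt_inner e s).deriv]
    refine integral_congr_ae (ae_of_all _ fun z => ?_)
    simp only; ring

lemma Gr.hasDerivAt_sq {W : E → ℝ} (hW : Gr W) :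
    HasDerivAt (fun θ : ℝ => ∫ z, exp (-θ * ‖z‖ ^ 2 / 2) * W z ∂(stdGaussian E))
      (-(1 / 2) * ∫ z, ‖z‖ ^ 2 * W z ∂(stdGaussian E)) 0 := by
  obtain ⟨-, C, b, h⟩ := ((Gr.norm (E := E)).pow 2).mul hW
  have hm := hW.1
  rw [← integral_const_mul]
  have hbd : ∀ z : E, exp (1 / 4 * ‖z‖ ^ 2 / 2) * exp (b * ‖z‖) ≤
      exp (-(-(1 / 2)) * ‖z‖ ^ 2 / 2) * exp (2 * b ^ 2) := fun z => by
    rw [← exp_add, ← exp_add]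
    refine exp_le_exp.2 ?_
    nlinarith [sq_nonneg (‖z‖ - 4 * b)]
  refine (hasDerivAt_integral_of_dominated_loc_of_deriv_le
    (bound := fun z => |C| * (exp (-(-(1 / 2)) * ‖z‖ ^ 2 / 2) * exp (2 * b ^ 2)))
    (F' := fun s z => -(1 / 2) * (exp (-s * ‖z‖ ^ 2 / 2) * (‖z‖ ^ 2 * W z)))
    (s := Metric.ball 0 (1 / 4)) (Metric.ball_mem_nhds _ (by norm_num))
    (Eventually.of_forall fun t => by fun_prop)
    (by simpa using hW.integrable) (by fun_prop)
    (ae_of_all _ fun z t ht => ?_)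
    (((integrable_exp_sq (by norm_num)).mul_const _).const_mul _)
    (ae_of_all _ fun z t _ => ?_)).2.congr_deriv (by simp)
  · rw [Real.norm_eq_abs, abs_mul, abs_mul, abs_of_pos (exp_pos _)]
    rw [Metric.mem_ball, dist_zero_right, Real.norm_eq_abs] at ht
    have h1 : -t * ‖z‖ ^ 2 / 2 ≤ 1 / 4 * ‖z‖ ^ 2 / 2 := by
      have := (neg_le_abs t).trans ht.le
      nlinarith [sq_nonneg ‖z‖]
    have h2 : |‖z‖ ^ 2 * W z| ≤ |C| * exp (b * ‖z‖) :=
      (h z).trans (mul_le_mul_of_nonneg_right (le_abs_self _) (exp_pos _).le)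
    have h3 : |(-(1 / 2) : ℝ)| ≤ 1 := by norm_num [abs_le]
    calc _ ≤ 1 * (exp (1 / 4 * ‖z‖ ^ 2 / 2) * (|C| * exp (b * ‖z‖))) := by gcongr
      _ = |C| * (exp (1 / 4 * ‖z‖ ^ 2 / 2) * exp (b * ‖z‖)) := by ring
      _ ≤ _ := mul_le_mul_of_nonneg_left (hbd z) (abs_nonneg _)
  · have h1 : HasDerivAt (fun t : ℝ => -t * ‖z‖ ^ 2 / 2) (-‖z‖ ^ 2 / 2) t := by
      simpa using ((hasDerivAt_id t).neg.mul_const (‖z‖ ^ 2)).div_const 2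
    exact (h1.exp.mul_const (W z)).congr_deriv (by ring)

/-- A scaling law of the Gaussian average determines the average against `‖z‖²`. -/
lemma Gr.integral_norm_sq_mul {F : E → ℝ} (hF : Gr F) (k : ℕ)
    (h : ∀ σ : ℝ, 0 < σ → ∫ z, F (σ • z) ∂(stdGaussian E) = σ ^ k * ∫ z, F z ∂(stdGaussian E)) :
    ∫ z, ‖z‖ ^ 2 * F z ∂(stdGaussian E) = (dim + k) * ∫ z, F z ∂(stdGaussian E) := by
  set I := ∫ z, F z ∂(stdGaussian E) with hI
  have h1 := hF.hasDerivAt_sq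
  have h2 : HasDerivAt (fun θ : ℝ => exp (-((dim + k) / 2) * log (1 + θ)) * I)
      (-((dim + k) / 2) * I) 0 := by
    have h3 : HasDerivAt (fun θ : ℝ => 1 + θ) 1 0 := by simpa using (hasDerivAt_id (0 : ℝ)).const_add 1
    have h4 := ((h3.log (by norm_num)).const_mul (-((dim + k) / 2))).exp.mul_const I
    refine h4.congr_deriv ?_
    simp
  have h5 := h1.unique (h2.congr_of_eventuallyEq ?_)
  · linarith
  · filter_upwards [Ioi_mem_nhds (show (-1 : ℝ) < 0 by norm_num)] with θ hθ
    have hθ' : 0 < 1 + θ := by linarith [Set.mem_Ioi.1 hθ]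
    have hs : 0 < √(1 + θ) := Real.sqrt_pos.2 hθ'
    have h6 := integral_scale (inv_pos.2 hs) F
    rw [h _ (inv_pos.2 hs), inv_inv, Real.sq_sqrt hθ'.le, inv_pow, inv_pow, inv_inv] at h6
    have e : ∀ y : E, exp (-(1 + θ - 1) * ‖y‖ ^ 2 / 2) = exp (-θ * ‖y‖ ^ 2 / 2) := fun y => by
      congr 1; ring
    simp only [e] at h6
    have h7 : ∫ y, exp (-θ * ‖y‖ ^ 2 / 2) * F y ∂(stdGaussian E) =
        (√(1 + θ) ^ (Module.finrank ℝ E + k))⁻¹ * I := by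
      rw [pow_add]
      field_simp
      field_simp at h6
      linarith
    rw [h7, sqrt_pow_inv_eq hθ']
    push_cast
    rfl

lemma Gr.hasDerivAt_shift {F : E → ℝ} (hF : Gr F) (v e : E) :
    HasDerivAt (fun s : ℝ => ∫ z, F (v + s • e + z) ∂(stdGaussian E))
      (∫ z, ⟪e, z⟫_ℝ * F (v + z) ∂(stdGaussian E)) 0 := by
  have h1 := (hF.shift v).hasDerivAt_inner e 0
  have h2 : HasDerivAt (fun s : ℝ => exp (-(s ^ 2 * (‖e‖ ^ 2 / 2)))) 0 0 := by
    have := (((hasDerivAt_id (0 : ℝ)).pow 2).mul_const (‖e‖ ^ 2 / 2)).neg.exp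
    simpa using this
  have h3 := h2.mul h1
  refine (h3.congr_deriv (by simp)).congr_of_eventuallyEq (Eventually.of_forall fun s => ?_)
  have h4 := integral_shift (s • e) (fun z => F (v + z))
  simp only [← add_assoc] at h4
  simp only [Pi.mul_apply]
  rw [h4, ← integral_const_mul]
  refine integral_congr_ae (ae_of_all _ fun z => ?_)
  simp only [inner_smul_left, RCLike.conj_to_real, norm_smul, mul_pow, Real.norm_eq_abs, sq_abs]
  rw [← mul_assoc, ← exp_add]
  congr 2; ring

end Growth
end GaussRel

namespace GaussRel
open ProbabilityTheory
open scoped InnerProductSpace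
set_option linter.unusedSectionVars false

/-- Homogeneous two-variable Gegenbauer polynomials; at `r = 1` they are normalized to take the
value `1` at `t = 1`. -/
noncomputable def sg (N : ℝ) : ℕ → ℝ → ℝ → ℝ
  | 0, _, _ => 1
  | 1, t, _ => t
  | i + 2, t, r => ((2 * i + 2 + N) * t * sg N (i + 1) t r - (i + 1) * r * sg N i t r) / (i + 1 + N)

section

variable {N : ℝ}

@[simp] lemma sg_zero (t r : ℝ) : sg N 0 t r = 1 := by rw [sg]

@[simp] lemma sg_one (t r : ℝ) : sg N 1 t r = t := by rw [sg]

lemma sg_rec (hN : 0 ≤ N) (i : ℕ) (t r : ℝ) :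
    (i + 1 + N) * sg N (i + 2) t r =
      (2 * i + 2 + N) * t * sg N (i + 1) t r - (i + 1) * r * sg N i t r := by
  have : (i + 1 + N) ≠ 0 := by positivity
  rw [sg, mul_div_cancel₀ _ this]

/-- Two-step induction. -/
lemma two_step {p : ℕ → Prop} (h0 : p 0) (h1 : p 1) (h : ∀ i, p i → p (i + 1) → p (i + 2)) (i : ℕ) :
    p i := by
  have : p i ∧ p (i + 1) := by
    induction i with
    | zero => exact ⟨h0, h1⟩
    | succ i ih => exact ⟨ih.2, h i ih.1 ih.2⟩
  exact this.1

lemma sg_homog (s t r : ℝ) (i : ℕ) : sg N i (s * t) (s ^ 2 * r) = s ^ i * sg N i t r := by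
  induction i using two_step with
  | h0 => simp
  | h1 => simp
  | h i h0 h1 => rw [sg, sg, h0, h1]; ring

lemma sg_diag (hN : 0 ≤ N) (t : ℝ) (i : ℕ) : sg N i t (t ^ 2) = t ^ i := by
  induction i using two_step with
  | h0 => simp
  | h1 => simp
  | h i h0 h1 =>
    have : (i + 1 + N) ≠ 0 := by positivity
    rw [sg, h0, h1]; field_simp; ring

lemma sg_hasDerivAt (hN : 0 < N) {p s : ℝ} {T R : ℝ → ℝ} (hT : HasDerivAt T p s)
    (hR : HasDerivAt R (2 * p * T s) s) (i : ℕ) :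
    HasDerivAt (fun s => sg N i (T s) (R s)) (p * (i * sg N (i - 1) (T s) (R s))) s := by
  induction i using two_step with
  | h0 => simpa using hasDerivAt_const s (1 : ℝ)
  | h1 => simpa using hT
  | h i h0 h1 =>
    have hN' : (i + 1 + N) ≠ 0 := by positivity
    have h := (((hT.const_mul (2 * i + 2 + N)).mul h1).sub
      ((hR.const_mul ((i : ℝ) + 1)).mul h0)).div_const (i + 1 + N)
    refine HasDerivAt.congr_of_eventuallyEq (h.congr_deriv ?_) (Eventually.of_forall fun x => by
      simp only [sg, Pi.mul_apply, Pi.sub_apply])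
    rw [div_eq_iff hN']
    simp only [Nat.add_sub_cancel]
    rw [show i + 2 - 1 = i + 1 by omega]
    push_cast
    have key : (i + N) * sg N (i + 1) (T s) (R s) =
        (2 * i + N) * T s * sg N i (T s) (R s) - i * R s * sg N (i - 1) (T s) (R s) := by
      cases i with
      | zero => simp
      | succ i =>
        have := sg_rec hN.le i (T s) (R s)
        simp only [Nat.add_sub_cancel]
        push_cast
        linear_combination this
    linear_combination (-p * (i + 1)) * key

end

section Harmonic

variable {E : Type*} [NormedAddCommGroup E] [InnerProductSpace ℝ E] [FiniteDimensional ℝ E]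
  [MeasurableSpace E] [BorelSpace E]

local notation "dim" => (Module.finrank ℝ E : ℝ)

/-- Zonal harmonic of degree `i`. -/
noncomputable def zon (i : ℕ) (y z : E) : ℝ := sg (dim - 2) i ⟪y, z⟫_ℝ (‖y‖ ^ 2 * ‖z‖ ^ 2)

lemma zon_comm (i : ℕ) (y z : E) : zon i y z = zon i z y := by
  rw [zon, zon, real_inner_comm, mul_comm (‖y‖ ^ 2)]

@[simp] lemma zon_zero (y z : E) : zon 0 y z = 1 := by simp [zon]

@[simp] lemma zon_one (y z : E) : zon 1 y z = ⟪y, z⟫_ℝ := by simp [zon]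

lemma zon_rec (hE : 2 < Module.finrank ℝ E) (i : ℕ) (y z : E) :
    (i + 1 + (dim - 2)) * zon (i + 2) y z = (2 * i + 2 + (dim - 2)) * (⟪y, z⟫_ℝ * zon (i + 1) y z) -
      (i + 1) * ‖y‖ ^ 2 * (‖z‖ ^ 2 * zon i y z) := by
  have h : (2 : ℝ) < dim := by exact_mod_cast hE
  rw [zon, sg_rec (by linarith), zon, zon]; ring

lemma zon_smul (i : ℕ) (y z : E) (s : ℝ) : zon i y (s • z) = s ^ i * zon i y z := by
  rw [zon, zon, ← sg_homog, inner_smul_right, norm_smul, mul_pow, Real.norm_eq_abs, sq_abs]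
  congr 1; ring

lemma zon_self (hE : 2 < Module.finrank ℝ E) (i : ℕ) (z : E) : zon i z z = ‖z‖ ^ (2 * i) := by
  have h : (2 : ℝ) < dim := by exact_mod_cast hE
  rw [zon, real_inner_self_eq_norm_sq, ← sq, sg_diag (by linarith), pow_mul]

lemma Gr.zon (i : ℕ) (y : E) : Gr (zon i y) := by
  induction i using two_step with
  | h0 =>
    rw [show GaussRel.zon 0 y = fun _ => 1 from funext fun z => zon_zero y z]
    exact Gr.const 1
  | h1 =>
    rw [show GaussRel.zon 1 y = fun z => ⟪y, z⟫_ℝ from funext fun z => zon_one y z]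
    exact Gr.inner y
  | h i h0 h1 =>
    have h := (((((Gr.inner y).const_mul (2 * i + 2 + (dim - 2))).mul h1).sub
      ((((Gr.norm (E := E)).pow 2).const_mul ((i + 1) * ‖y‖ ^ 2)).mul h0)).const_mul
      (i + 1 + (dim - 2))⁻¹)
    convert h using 2 with z
    rw [GaussRel.zon, sg, GaussRel.zon, GaussRel.zon, div_eq_inv_mul]
    ring

lemma zon_hasDerivAt_left (hE : 2 < Module.finrank ℝ E) (i : ℕ) (y v : E) :
    HasDerivAt (fun s : ℝ => zon i y (v + s • y)) (i * ‖y‖ ^ 2 * zon (i - 1) y v) 0 := by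
  have h : (2 : ℝ) < dim := by exact_mod_cast hE
  have hT : HasDerivAt (fun s : ℝ => ⟪y, v⟫_ℝ + s * ‖y‖ ^ 2) (‖y‖ ^ 2) 0 := by
    simpa using ((hasDerivAt_id (0 : ℝ)).mul_const (‖y‖ ^ 2)).const_add (⟪y, v⟫_ℝ)
  have hR : HasDerivAt (fun s : ℝ => ‖y‖ ^ 2 * (‖v‖ ^ 2 + 2 * s * ⟪y, v⟫_ℝ + s ^ 2 * ‖y‖ ^ 2))
      (2 * ‖y‖ ^ 2 * (⟪y, v⟫_ℝ + 0 * ‖y‖ ^ 2)) 0 := by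
    have := (((((hasDerivAt_id (0 : ℝ)).const_mul 2).mul_const (⟪y, v⟫_ℝ)).const_add (‖v‖ ^ 2)).add
      (((hasDerivAt_id (0 : ℝ)).pow 2).mul_const (‖y‖ ^ 2))).const_mul (‖y‖ ^ 2)
    refine this.congr_deriv ?_
    simp; ring
  have h2 := sg_hasDerivAt (N := dim - 2) (by linarith) hT hR i
  refine (h2.congr_deriv ?_).congr_of_eventuallyEq (Eventually.of_forall fun s => ?_)
  · simp [zon]; ring
  · simp only [zon]
    rw [inner_add_right, inner_smul_right, real_inner_self_eq_norm_sq, norm_add_sq_real,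
      inner_smul_right, norm_smul, mul_pow, Real.norm_eq_abs, sq_abs, real_inner_comm]
    congr 2; ring

lemma zon_hasDerivAt_right (i : ℕ) (y v : E) :
    HasDerivAt (fun s : ℝ => zon i y (v + s • v)) (i * zon i y v) 0 := by
  have h := (((hasDerivAt_id (0 : ℝ)).const_add 1).pow i).mul_const (zon i y v)
  refine (h.congr_deriv (by simp)).congr_of_eventuallyEq (Eventually.of_forall fun s => ?_)
  simp only [Pi.pow_apply, id]
  rw [← zon_smul, add_smul, one_smul]

/-- Mean value property of zonal harmonics. -/
lemma integral_zon_shift (hE : 2 < Module.finrank ℝ E) (i : ℕ) (y v : E) :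
    ∫ z, zon i y (v + z) ∂(stdGaussian E) = zon i y v := by
  have hd : (2 : ℝ) < dim := by exact_mod_cast hE
  revert v
  induction i using two_step with
  | h0 => intro v; simp
  | h1 =>
    intro v
    simp only [zon_one, inner_add_right]
    rw [integral_add (integrable_const _) (integrable_inner y), integral_inner]
    simp
  | h i h0 h1 =>
    intro v
    have g0 : Gr (zon i y) := Gr.zon i y
    have g1 : Gr (zon (i + 1) y) := Gr.zon (i + 1) y
    have a1 : ∫ z, ⟪y, z⟫_ℝ * zon (i + 1) y (v + z) ∂(stdGaussian E) =
        (i + 1 : ℝ) * ‖y‖ ^ 2 * zon i y v := by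
      have e1 := g1.hasDerivAt_shift v y
      simp only [h1] at e1
      simpa using e1.unique (zon_hasDerivAt_left hE (i + 1) y v)
    have a2 : ∫ z, ⟪v, z⟫_ℝ * zon i y (v + z) ∂(stdGaussian E) = i * zon i y v := by
      have e1 := g0.hasDerivAt_shift v v
      simp only [h0] at e1
      exact e1.unique (zon_hasDerivAt_right i y v)
    have a3 : ∫ z, ‖z‖ ^ 2 * zon i y (v + z) ∂(stdGaussian E) = dim * zon i y v := by
      have := (g0.shift v).integral_norm_sq_mul 0 (fun σ hσ => ?_)
      · rw [this, h0]; simp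
      · rw [h0, pow_zero, one_mul]
        have e : ∀ z, zon i y (v + σ • z) = σ ^ i * zon i y (σ⁻¹ • v + z) := fun z => by
          rw [← zon_smul, smul_add, smul_smul, mul_inv_cancel₀ hσ.ne', one_smul]
        simp only [e]
        rw [integral_const_mul, h0, ← zon_smul, smul_smul, mul_inv_cancel₀ hσ.ne', one_smul]
    have hpt : ∀ z, (i + 1 + (dim - 2)) * zon (i + 2) y (v + z) =
        (2 * i + 2 + (dim - 2)) * (⟪y, v⟫_ℝ * zon (i + 1) y (v + z)) +
        (2 * i + 2 + (dim - 2)) * (⟪y, z⟫_ℝ * zon (i + 1) y (v + z)) -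
        (((i + 1) * ‖y‖ ^ 2 * (‖v‖ ^ 2 * zon i y (v + z)) +
        (i + 1) * ‖y‖ ^ 2 * (2 * (⟪v, z⟫_ℝ * zon i y (v + z)))) +
        (i + 1) * ‖y‖ ^ 2 * (‖z‖ ^ 2 * zon i y (v + z))) := fun z => by
      rw [zon_rec hE, inner_add_right, norm_add_sq_real]; ring
    have hc : (i + 1 + (dim - 2)) ≠ 0 := by
      have : (0 : ℝ) ≤ i := by positivity
      linarith
    apply mul_left_cancel₀ hc
    rw [← integral_const_mul]
    simp only [hpt]
    have s0 := g0.shift v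
    have s1 := g1.shift v
    rw [integral_sub, integral_add, integral_add, integral_add]
    · simp only [integral_const_mul]
      rw [a1, a2, a3, h0, h1, zon_rec hE]; ring
    · exact ((s0.const_mul _).const_mul _).integrable
    · exact ((((Gr.inner v).mul s0).const_mul _).const_mul _).integrable
    · exact (((s0.const_mul _).const_mul _).add
        ((((Gr.inner v).mul s0).const_mul _).const_mul _)).integrable
    · exact (((Gr.norm.pow 2).mul s0).const_mul _).integrable
    · exact ((s1.const_mul _).const_mul _).integrable
    · exact (((Gr.inner y).mul s1).const_mul _).integrable
    · exact (((s1.const_mul _).const_mul _).add (((Gr.inner y).mul s1).const_mul _)).integrable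
    · exact ((((s0.const_mul _).const_mul _).add
        ((((Gr.inner v).mul s0).const_mul _).const_mul _)).add
        (((Gr.norm.pow 2).mul s0).const_mul _)).integrable

lemma integral_exp_mul_zon (hE : 2 < Module.finrank ℝ E) (i : ℕ) (x y : E) (s : ℝ) :
    ∫ z, exp (s * ⟪x, z⟫_ℝ) * zon i y z ∂(stdGaussian E) =
      s ^ i * (exp (s ^ 2 * (‖x‖ ^ 2 / 2)) * zon i x y) := by
  have h := integral_shift (s • x) (zon i y)
  rw [integral_zon_shift hE, zon_smul] at h
  have e : ∀ z, exp (s * ⟪x, z⟫_ℝ) * zon i y z = exp (s ^ 2 * (‖x‖ ^ 2 / 2)) *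
      (exp (⟪s • x, z⟫_ℝ - ‖s • x‖ ^ 2 / 2) * zon i y z) := fun z => by
    rw [← mul_assoc, ← exp_add, inner_smul_left, norm_smul, mul_pow, Real.norm_eq_abs, sq_abs]
    simp only [RCLike.conj_to_real]
    congr 2; ring
  simp only [e]
  rw [integral_const_mul, ← h, zon_comm]; ring

lemma iteratedDeriv_pow_mul {f : ℝ → ℝ} (hf : ContDiff ℝ ⊤ f) {k i : ℕ} (hk : k ≤ i) :
    iteratedDeriv k (fun s : ℝ => s ^ i * f s) 0 = if k = i then i.factorial * f 0 else 0 := by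
  rw [iteratedDeriv_fun_mul (by fun_prop) (hf.contDiffAt.of_le le_top)]
  rw [Finset.sum_eq_single_of_mem k (by simp)]
  · rw [iteratedDeriv_fun_pow_zero]
    split_ifs <;> simp_all
  · intro j hj hjk
    rw [iteratedDeriv_fun_pow_zero, if_neg]
    · simp
    · simp at hj; omega

/-- Low order moments of a zonal harmonic. -/
lemma integral_inner_pow_zon (hE : 2 < Module.finrank ℝ E) {i k : ℕ} (hk : k ≤ i) (x y : E) :
    ∫ z, ⟪x, z⟫_ℝ ^ k * zon i y z ∂(stdGaussian E) =
      if k = i then i.factorial * zon i x y else 0 := by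
  have h1 := congrFun ((Gr.zon i y).iteratedDeriv_inner x k) 0
  simp only [zero_mul, exp_zero, one_mul] at h1
  rw [← h1]
  simp only [integral_exp_mul_zon hE]
  rw [iteratedDeriv_pow_mul (by fun_prop) hk]
  simp

end Harmonic
end GaussRel

namespace GaussRel
open ProbabilityTheory
open scoped InnerProductSpace
set_option linter.unusedSectionVars false

/-- Leading coefficient of the normalized Gegenbauer polynomial. -/
noncomputable def leadc (N : ℝ) : ℕ → ℝ
  | 0 => 1
  | 1 => 1
  | j + 2 => leadc N (j + 1) * (2 * j + 2 + N) / (j + 1 + N)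

lemma leadc_pos {N : ℝ} (hN : 0 < N) (j : ℕ) : 0 < leadc N j := by
  induction j using two_step with
  | h0 => simp [leadc]
  | h1 => simp [leadc]
  | h j h0 h1 => rw [leadc]; positivity

lemma leadc_succ {N : ℝ} (hN : 0 < N) (j : ℕ) :
    leadc N (j + 1) * (j + N) = leadc N j * (2 * j + N) := by
  cases j with
  | zero => simp [leadc]
  | succ j =>
    rw [leadc]
    push_cast
    have : (j + 1 + N) ≠ 0 := by positivity
    field_simp

/-- Dimension of the space of spherical harmonics of degree `i`. -/
noncomputable def hdim (N : ℝ) : ℕ → ℝ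
  | 0 => 1
  | i + 1 => hdim N i * ((N + 2 + 2 * i) * (i + N) / ((i + 1) * (2 * i + N)))

lemma hdim_pos {N : ℝ} (hN : 0 < N) (i : ℕ) : 0 < hdim N i := by
  induction i with
  | zero => simp [hdim]
  | succ i ih => rw [hdim]; positivity

section

variable {E : Type*} [NormedAddCommGroup E] [InnerProductSpace ℝ E] [FiniteDimensional ℝ E]
  [MeasurableSpace E] [BorelSpace E]

local notation "dim" => (Module.finrank ℝ E : ℝ)

/-- Squared norm of a zonal harmonic. -/
noncomputable def znorm (N : ℝ) (i : ℕ) : ℝ := leadc N i * i.factorial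

lemma znorm_pos {N : ℝ} (hN : 0 < N) (i : ℕ) : 0 < znorm N i :=
  mul_pos (leadc_pos hN i) (by positivity)

lemma Gr.homog_norm_sq {F : E → ℝ} (hF : Gr F) {d : ℕ}
    (h : ∀ (s : ℝ) z, F (s • z) = s ^ d * F z) :
    ∫ z, ‖z‖ ^ 2 * F z ∂(stdGaussian E) = (dim + d) * ∫ z, F z ∂(stdGaussian E) :=
  hF.integral_norm_sq_mul d fun σ _ => by simp only [h]; rw [integral_const_mul]

lemma integral_inner_norm_zon (hE : 2 < Module.finrank ℝ E) {i k : ℕ} (hk : k < i) (x y : E)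
    (l : ℕ) : ∫ z, ⟪x, z⟫_ℝ ^ k * ‖z‖ ^ (2 * l) * zon i y z ∂(stdGaussian E) = 0 := by
  induction l with
  | zero => simpa [hk.ne] using integral_inner_pow_zon hE hk.le x y
  | succ l ih =>
    have g : Gr (fun z => ⟪x, z⟫_ℝ ^ k * ‖z‖ ^ (2 * l) * zon i y z) :=
      (((Gr.inner x).pow k).mul (Gr.norm.pow (2 * l))).mul (Gr.zon i y)
    have := g.homog_norm_sq (d := k + 2 * l + i) fun s z => by
      rw [inner_smul_right, norm_smul, zon_smul, mul_pow, mul_pow, pow_mul ‖s‖, Real.norm_eq_abs,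
        sq_abs]
      ring
    rw [ih, mul_zero] at this
    rw [← this]
    refine integral_congr_ae (ae_of_all _ fun z => ?_)
    simp only; ring

lemma integral_inner_zon_zon (hE : 2 < Module.finrank ℝ E) {i : ℕ} (x y : E) (j : ℕ) :
    (∀ k l : ℕ, j + k < i →
      ∫ z, ⟪x, z⟫_ℝ ^ k * ‖z‖ ^ (2 * l) * zon j x z * zon i y z ∂(stdGaussian E) = 0) ∧
    (∀ k : ℕ, j + k = i → ∫ z, ⟪x, z⟫_ℝ ^ k * zon j x z * zon i y z ∂(stdGaussian E) =
      leadc (dim - 2) j * i.factorial * zon i x y) := by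
  have hd : (2 : ℝ) < dim := by exact_mod_cast hE
  induction j using two_step with
  | h0 =>
    refine ⟨fun k l h => ?_, fun k h => ?_⟩
    · simpa using integral_inner_norm_zon hE (by omega : k < i) x y l
    · have := integral_inner_pow_zon hE (by omega : k ≤ i) x y
      rw [if_pos (by omega)] at this
      simpa [leadc] using this
  | h1 =>
    refine ⟨fun k l h => ?_, fun k h => ?_⟩
    · rw [← integral_inner_norm_zon hE (by omega : k + 1 < i) x y l]
      refine integral_congr_ae (ae_of_all _ fun z => ?_)
      simp only [zon_one]; ring
    · have := integral_inner_pow_zon hE (by omega : k + 1 ≤ i) x y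
      rw [if_pos (by omega)] at this
      simp only [leadc, one_mul]
      rw [← this]
      refine integral_congr_ae (ae_of_all _ fun z => ?_)
      simp only [zon_one]; ring
  | h j h0 h1 =>
    have hc : (j + 1 + (dim - 2)) ≠ 0 := by
      have : (0 : ℝ) ≤ j := by positivity
      linarith
    have key : ∀ k l : ℕ, (j + 1 + (dim - 2)) *
        ∫ z, ⟪x, z⟫_ℝ ^ k * ‖z‖ ^ (2 * l) * zon (j + 2) x z * zon i y z ∂(stdGaussian E) =
        (2 * j + 2 + (dim - 2)) * ∫ z, ⟪x, z⟫_ℝ ^ (k + 1) * ‖z‖ ^ (2 * l) * zon (j + 1) x z *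
          zon i y z ∂(stdGaussian E) - (j + 1) * ‖x‖ ^ 2 * ∫ z, ⟪x, z⟫_ℝ ^ k *
          ‖z‖ ^ (2 * (l + 1)) * zon j x z * zon i y z ∂(stdGaussian E) := fun k l => by
      rw [← integral_const_mul, ← integral_const_mul, ← integral_const_mul, ← integral_sub]
      · refine integral_congr_ae (ae_of_all _ fun z => ?_)
        simp only
        have := zon_rec hE j x z
        linear_combination (⟪x, z⟫_ℝ ^ k * ‖z‖ ^ (2 * l) * zon i y z) * this
      · exact (((((Gr.inner x).pow (k + 1)).mul (Gr.norm.pow (2 * l))).mul (Gr.zon (j + 1) x)).mul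
          (Gr.zon i y)).integrable.const_mul _
      · exact (((((Gr.inner x).pow k).mul (Gr.norm.pow (2 * (l + 1)))).mul (Gr.zon j x)).mul
          (Gr.zon i y)).integrable.const_mul _
    refine ⟨fun k l h => ?_, fun k h => ?_⟩
    · have := key k l
      rw [h1.1 (k + 1) l (by omega), h0.1 k (l + 1) (by omega)] at this
      simpa [hc] using this
    · have := key k 0
      rw [h0.1 k (0 + 1) (by omega)] at this
      simp only [mul_zero, pow_zero, mul_one, sub_zero] at this
      rw [h1.2 (k + 1) (by omega)] at this
      rw [leadc]
      apply mul_left_cancel₀ hc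
      rw [this]
      field_simp

/-- Reproducing property of zonal harmonics. -/
lemma integral_zon_mul_zon (hE : 2 < Module.finrank ℝ E) (i : ℕ) (x y : E) :
    ∫ z, zon i x z * zon i y z ∂(stdGaussian E) = znorm (dim - 2) i * zon i x y := by
  have := (integral_inner_zon_zon (i := i) hE x y i).2 0 (by simp)
  simpa [znorm] using this

lemma integral_norm_pow (hE : 2 < Module.finrank ℝ E) (i : ℕ) :
    ∫ z : E, ‖z‖ ^ (2 * i) ∂(stdGaussian E) = hdim (dim - 2) i * znorm (dim - 2) i := by
  have hd : (2 : ℝ) < dim := by exact_mod_cast hE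
  induction i with
  | zero => simp [hdim, znorm, leadc]
  | succ i ih =>
    have := ((Gr.norm (E := E)).pow (2 * i)).homog_norm_sq (d := 2 * i) fun s z => by
      rw [norm_smul, mul_pow, pow_mul ‖s‖, Real.norm_eq_abs, sq_abs, ← pow_mul]
    rw [ih] at this
    have e : ∀ z : E, ‖z‖ ^ (2 * (i + 1)) = ‖z‖ ^ 2 * ‖z‖ ^ (2 * i) := fun z => by ring
    simp only [e]
    rw [this, hdim, znorm, znorm, Nat.factorial_succ]
    have hl := leadc_succ (N := dim - 2) (by linarith) i
    have h0 : (0 : ℝ) ≤ i := by positivity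
    have h1 : (i + (dim - 2)) ≠ 0 := by linarith
    have h2 : (2 * i + (dim - 2)) ≠ 0 := by linarith
    have hl' : leadc (dim - 2) (i + 1) = leadc (dim - 2) i * (2 * i + (dim - 2)) / (i + (dim - 2)) := by
      rw [eq_div_iff h1, hl]
    rw [hl']
    push_cast
    field_simp
    ring

/-- Products of zonal harmonics are positive definite kernels. -/
lemma sum_zon_mul_zon_nonneg (hE : 2 < Module.finrank ℝ E) (i j : ℕ) (C : Finset E) (u : E → E) :
    0 ≤ ∑ x ∈ C, ∑ y ∈ C, zon i (u x) (u y) * zon j (u x) (u y) := by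
  have hd : (2 : ℝ) < dim := by exact_mod_cast hE
  have hi := znorm_pos (N := dim - 2) (by linarith) i
  have hj := znorm_pos (N := dim - 2) (by linarith) j
  have h1 : ∀ z, 0 ≤ ∑ x ∈ C, ∑ y ∈ C, zon j (u x) (u y) * (zon i (u x) z * zon i (u y) z) := fun z => by
    have e : 0 ≤ ∫ w, (∑ x ∈ C, zon i (u x) z * zon j (u x) w) ^ 2 ∂(stdGaussian E) :=
      integral_nonneg fun w => sq_nonneg _
    have e2 : ∫ w, (∑ x ∈ C, zon i (u x) z * zon j (u x) w) ^ 2 ∂(stdGaussian E) =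
        znorm (dim - 2) j * ∑ x ∈ C, ∑ y ∈ C, zon j (u x) (u y) * (zon i (u x) z * zon i (u y) z) := by
      simp only [sq, Finset.sum_mul_sum]
      rw [integral_finsetSum]
      · rw [Finset.mul_sum]
        refine Finset.sum_congr rfl fun x _ => ?_
        rw [integral_finsetSum]
        · rw [Finset.mul_sum]
          refine Finset.sum_congr rfl fun y _ => ?_
          rw [mul_comm (zon j (u x) (u y)), mul_left_comm, ← integral_zon_mul_zon hE, ← integral_const_mul]
          refine integral_congr_ae (ae_of_all _ fun w => ?_)
          simp only; ring
        · exact fun y _ => (((Gr.zon j (u x)).const_mul _).mul ((Gr.zon j (u y)).const_mul _)).integrable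
      · exact fun x _ => (Gr.sum _ fun y =>
          ((Gr.zon j (u x)).const_mul _).mul ((Gr.zon j (u y)).const_mul _)).integrable
    rw [e2] at e
    exact nonneg_of_mul_nonneg_right e hj
  have h2 : 0 ≤ ∫ z, ∑ x ∈ C, ∑ y ∈ C, zon j (u x) (u y) * (zon i (u x) z * zon i (u y) z) ∂(stdGaussian E) :=
    integral_nonneg h1
  have e2 : ∫ z, ∑ x ∈ C, ∑ y ∈ C, zon j (u x) (u y) * (zon i (u x) z * zon i (u y) z) ∂(stdGaussian E) =
      znorm (dim - 2) i * ∑ x ∈ C, ∑ y ∈ C, zon i (u x) (u y) * zon j (u x) (u y) := by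
    rw [integral_finsetSum]
    · rw [Finset.mul_sum]
      refine Finset.sum_congr rfl fun x _ => ?_
      rw [integral_finsetSum]
      · rw [Finset.mul_sum]
        refine Finset.sum_congr rfl fun y _ => ?_
        rw [integral_const_mul, integral_zon_mul_zon hE]; ring
      · exact fun y _ => (((Gr.zon i (u x)).mul (Gr.zon i (u y))).const_mul _).integrable
    · exact fun x _ => (Gr.sum _ fun y =>
        ((Gr.zon i (u x)).mul (Gr.zon i (u y))).const_mul _).integrable
  rw [e2] at h2
  exact nonneg_of_mul_nonneg_right h2 hi

/-- A Welch type bound for zonal harmonics. -/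
lemma sq_card_le_sum_zon_sq (hE : 2 < Module.finrank ℝ E) (i : ℕ) {C : Finset E} {u : E → E}
    (hC : ∀ x ∈ C, ‖u x‖ = 1) :
    (C.card : ℝ) ^ 2 ≤ hdim (dim - 2) i * ∑ x ∈ C, ∑ y ∈ C, zon i (u x) (u y) * zon i (u x) (u y) := by
  have hd : (2 : ℝ) < dim := by exact_mod_cast hE
  have hc := znorm_pos (N := dim - 2) (by linarith) i
  have hH := hdim_pos (N := dim - 2) (by linarith) i
  set c := znorm (dim - 2) i with hc'
  set H := hdim (dim - 2) i with hH'
  set l := (C.card : ℝ) / H with hl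
  have h1 : ∀ z : E, 0 ≤ (∑ x ∈ C, ∑ y ∈ C, zon i (u x) (u y) * (zon i (u x) z * zon i (u y) z)) -
      2 * l * (∑ x ∈ C, zon i (u x) z * zon i (u x) z) + l ^ 2 * ‖z‖ ^ (2 * i) := fun z => by
    have e : 0 ≤ ∫ w, ((∑ x ∈ C, zon i (u x) z * zon i (u x) w) - l * zon i z w) ^ 2 ∂(stdGaussian E) :=
      integral_nonneg fun w => sq_nonneg _
    have e1 : ∀ w, ((∑ x ∈ C, zon i (u x) z * zon i (u x) w) - l * zon i z w) ^ 2 =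
        (∑ x ∈ C, ∑ y ∈ C, zon i (u x) z * zon i (u y) z * (zon i (u x) w * zon i (u y) w)) -
        (∑ x ∈ C, 2 * l * zon i (u x) z * (zon i (u x) w * zon i z w)) +
        l ^ 2 * (zon i z w * zon i z w) := fun w => by
      rw [sub_sq, sq (∑ x ∈ C, _), Finset.sum_mul_sum, Finset.mul_sum, Finset.sum_mul]
      congr 1
      · congr 1
        · exact Finset.sum_congr rfl fun x _ => Finset.sum_congr rfl fun y _ => by ring
        · exact Finset.sum_congr rfl fun x _ => by ring
      · ring
    simp only [e1] at e
    have g1 : ∀ x y : E, Gr (fun w => zon i (u x) z * zon i (u y) z * (zon i (u x) w * zon i (u y) w)) :=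
      fun x y => ((Gr.zon i (u x)).mul (Gr.zon i (u y))).const_mul _
    have g2 : ∀ x : E, Gr (fun w => 2 * l * zon i (u x) z * (zon i (u x) w * zon i z w)) :=
      fun x => ((Gr.zon i (u x)).mul (Gr.zon i z)).const_mul _
    have g3 : Gr (fun w => l ^ 2 * (zon i z w * zon i z w)) :=
      ((Gr.zon i z).mul (Gr.zon i z)).const_mul _
    have g4 := Gr.sum C fun x => Gr.sum C fun y => g1 x y
    have g5 := Gr.sum C fun x => g2 x
    rw [integral_add (g4.sub g5).integrable g3.integrable, integral_sub g4.integrable g5.integrable,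
      integral_finsetSum _ (fun x _ => (Gr.sum C fun y => g1 x y).integrable),
      integral_finsetSum _ (fun x _ => (g2 x).integrable), integral_const_mul,
      integral_zon_mul_zon hE, zon_self hE] at e
    have e3 : ∀ x ∈ C, ∫ w, ∑ y ∈ C, zon i (u x) z * zon i (u y) z * (zon i (u x) w * zon i (u y) w)
        ∂(stdGaussian E) = c * ∑ y ∈ C, zon i (u x) (u y) * (zon i (u x) z * zon i (u y) z) := fun x _ => by
      rw [integral_finsetSum _ (fun y _ => (g1 x y).integrable), Finset.mul_sum]
      refine Finset.sum_congr rfl fun y _ => ?_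
      rw [integral_const_mul, integral_zon_mul_zon hE]; ring
    have e4 : ∀ x ∈ C, ∫ w, 2 * l * zon i (u x) z * (zon i (u x) w * zon i z w) ∂(stdGaussian E) =
        c * (2 * l * (zon i (u x) z * zon i (u x) z)) := fun x _ => by
      rw [integral_const_mul, integral_zon_mul_zon hE]; ring
    rw [Finset.sum_congr rfl e3, Finset.sum_congr rfl e4, ← Finset.mul_sum, ← Finset.mul_sum,
      ← Finset.mul_sum] at e
    refine nonneg_of_mul_nonneg_right (a := c) ?_ hc
    linarith
  have h2 : 0 ≤ ∫ z : E, ((∑ x ∈ C, ∑ y ∈ C, zon i (u x) (u y) * (zon i (u x) z * zon i (u y) z)) -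
      2 * l * (∑ x ∈ C, zon i (u x) z * zon i (u x) z) + l ^ 2 * ‖z‖ ^ (2 * i)) ∂(stdGaussian E) :=
    integral_nonneg h1
  have g1 : ∀ x y : E, Gr (fun z => zon i (u x) (u y) * (zon i (u x) z * zon i (u y) z)) := fun x y =>
    ((Gr.zon i (u x)).mul (Gr.zon i (u y))).const_mul _
  have g2 : ∀ x : E, Gr (fun z => zon i (u x) z * zon i (u x) z) := fun x => (Gr.zon i (u x)).mul (Gr.zon i (u x))
  have g4 := Gr.sum C fun x => Gr.sum C fun y => g1 x y
  have g5 := (Gr.sum C fun x => g2 x).const_mul (2 * l)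
  have g3 := ((Gr.norm (E := E)).pow (2 * i)).const_mul (l ^ 2)
  rw [integral_add (g4.sub g5).integrable g3.integrable, integral_sub g4.integrable g5.integrable,
    integral_const_mul, integral_const_mul,
    integral_finsetSum _ (fun x _ => (Gr.sum C fun y => g1 x y).integrable),
    integral_finsetSum _ (fun x _ => (g2 x).integrable), integral_norm_pow hE] at h2
  have e3 : ∀ x ∈ C, ∫ z, ∑ y ∈ C, zon i (u x) (u y) * (zon i (u x) z * zon i (u y) z) ∂(stdGaussian E) =
      c * ∑ y ∈ C, zon i (u x) (u y) * zon i (u x) (u y) := fun x _ => by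
    rw [integral_finsetSum _ (fun y _ => (g1 x y).integrable), Finset.mul_sum]
    refine Finset.sum_congr rfl fun y _ => ?_
    rw [integral_const_mul, integral_zon_mul_zon hE]; ring
  have e4 : ∀ x ∈ C, ∫ z, zon i (u x) z * zon i (u x) z ∂(stdGaussian E) = c := fun x hx => by
    rw [integral_zon_mul_zon hE, zon_self hE, hC x hx, one_pow, mul_one]
  rw [Finset.sum_congr rfl e3, Finset.sum_congr rfl e4, ← Finset.mul_sum, Finset.sum_const,
    nsmul_eq_mul] at h2
  set Q := ∑ x ∈ C, ∑ y ∈ C, zon i (u x) (u y) * zon i (u x) (u y) with hQ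
  have h3 : 0 ≤ Q - 2 * l * C.card + l ^ 2 * H := by
    refine nonneg_of_mul_nonneg_right (a := c) ?_ hc
    linarith
  have h4 : 0 ≤ H * (Q - 2 * l * C.card + l ^ 2 * H) := mul_nonneg hH.le h3
  have h5 : l * H = C.card := by rw [hl]; field_simp
  nlinarith [h4, h5]

end
end GaussRel

namespace GaussRel
open ProbabilityTheory
open scoped InnerProductSpace
set_option linter.unusedSectionVars false

section Ultraspherical

variable {N : ℝ}

lemma sg_hasDerivAt_fst (hN : 0 < N) (t : ℝ) (i : ℕ) :
    ∃ D, HasDerivAt (fun t => sg N i t 1) D t ∧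
      (1 - t ^ 2) * D = i * (sg N (i - 1) t 1 - t * sg N i t 1) := by
  induction i using two_step with
  | h0 => exact ⟨0, by simpa using hasDerivAt_const t (1 : ℝ), by simp⟩
  | h1 => exact ⟨1, by simp only [sg_one]; exact hasDerivAt_id' t, by simp; ring⟩
  | h i h0 h1 =>
    obtain ⟨D, hD, eD⟩ := h0
    obtain ⟨D', hD', eD'⟩ := h1
    have hN' : (i + 1 + N) ≠ 0 := by positivity
    have h := ((((hasDerivAt_id t).const_mul (2 * i + 2 + N)).mul hD').sub
      (hD.const_mul ((i : ℝ) + 1))).div_const (i + 1 + N)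
    refine ⟨_, h.congr_of_eventuallyEq (Eventually.of_forall fun x => by
      simp [sg]), ?_⟩
    rw [mul_div_assoc', div_eq_iff hN']
    simp only [Nat.add_sub_cancel, id] at eD' ⊢
    rw [show i + 2 - 1 = i + 1 by omega]
    have key : (i + N) * sg N (i + 1) t 1 =
        (2 * i + N) * t * sg N i t 1 - i * sg N (i - 1) t 1 := by
      cases i with
      | zero => simp
      | succ i =>
        have := sg_rec hN.le i t 1
        simp only [Nat.add_sub_cancel]
        push_cast
        linear_combination this
    have key2 := sg_rec hN.le i t 1
    push_cast at eD' ⊢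
    linear_combination (2 * i + 2 + N) * t * eD' - (i + 1) * eD - (i + 1) * key
      + (i + 2) * t * key2

/-- Ratio bounds for consecutive ultraspherical polynomials beyond the largest zero. -/
lemma sg_ratio (hN : 0 < N) {α c : ℝ} (hα : 0 < α) {i₀ : ℕ} (hc : 1 ≤ α * c)
    (h : i₀ * ((1 - α ^ 2) * c ^ 2 + 1) + N * (1 - α * c) ≤ 0) {t : ℝ} (ht : α ≤ t) (ht1 : t ≤ 1)
    (i : ℕ) (hi : i ≤ i₀) :
    0 < sg N i t 1 ∧ 0 < sg N (i + 1) t 1 ∧ sg N i t 1 ≤ (t + (1 - t ^ 2) * c) * sg N (i + 1) t 1 ∧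
      t * sg N (i + 1) t 1 ≤ sg N i t 1 := by
  have ht0 : 0 < t := hα.trans_le ht
  have hc0 : 0 < c := pos_of_mul_pos_right (by linarith) hα.le
  have ht2 : 0 ≤ 1 - t ^ 2 := by nlinarith
  have htc : 1 ≤ t * c := hc.trans (mul_le_mul_of_nonneg_right ht hc0.le)
  induction i with
  | zero =>
    refine ⟨by simp, by simpa using ht0, ?_, ?_⟩
    · simp only [sg_zero, zero_add, sg_one]
      nlinarith [mul_nonneg ht2 (sub_nonneg.2 htc)]
    · simp only [sg_zero, zero_add, sg_one]
      nlinarith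
  | succ i ih =>
    obtain ⟨h0, h1, h2, h3⟩ := ih (by omega)
    set ρ := t + (1 - t ^ 2) * c with hρ
    have hρ0 : 0 < ρ := by positivity
    have hr := sg_rec hN.le i t 1
    set A := sg N i t 1
    set B := sg N (i + 1) t 1
    set D := sg N (i + 2) t 1
    have hi' : (i + 1 : ℝ) ≤ i₀ := by exact_mod_cast hi
    have hq : (i + 1) * ((1 - t ^ 2) * c ^ 2 + 1) + N * (1 - t * c) ≤ 0 := by
      have e1 : (1 - t ^ 2) * c ^ 2 + 1 ≤ (1 - α ^ 2) * c ^ 2 + 1 := by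
        have : α ^ 2 ≤ t ^ 2 := by gcongr
        nlinarith [sq_nonneg c]
      have e2 : N * (1 - t * c) ≤ N * (1 - α * c) := by
        refine mul_le_mul_of_nonneg_left ?_ hN.le
        nlinarith
      have e3 : (i + 1) * ((1 - t ^ 2) * c ^ 2 + 1) ≤ i₀ * ((1 - α ^ 2) * c ^ 2 + 1) :=
        mul_le_mul hi' e1 (by positivity) (by positivity)
      linarith
    have hm : (i + 1 + N) * B ≤ ρ * ((i + 1 + N) * D) := by
      have e1 : ρ * ((i + 1 + N) * D) ≥ ρ * ((2 * i + 2 + N) * t * B - (i + 1) * (ρ * B)) := by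
        refine mul_le_mul_of_nonneg_left ?_ hρ0.le
        rw [hr]
        have : (0 : ℝ) ≤ i + 1 := by positivity
        nlinarith [mul_le_mul_of_nonneg_left h2 this]
      have e2 : (i + 1 + N) ≤ ρ * ((2 * i + 2 + N) * t - (i + 1) * ρ) := by
        have : ρ * ((2 * i + 2 + N) * t - (i + 1) * ρ) - (i + 1 + N) =
            -((1 - t ^ 2) * ((i + 1) * ((1 - t ^ 2) * c ^ 2 + 1) + N * (1 - t * c))) := by
          rw [hρ]; ring
        have := mul_nonneg ht2 (neg_nonneg.2 hq)
        linarith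
      nlinarith [mul_le_mul_of_nonneg_right e2 h1.le]
    have hN1 : 0 < i + 1 + N := by positivity
    have hBD : B ≤ ρ * D := by
      refine le_of_mul_le_mul_left ?_ hN1
      linarith
    refine ⟨h1, ?_, hBD, ?_⟩
    · exact pos_of_mul_pos_right (h1.trans_le hBD) hρ0.le
    · refine le_of_mul_le_mul_left ?_ hN1
      show (i + 1 + N) * (t * D) ≤ (i + 1 + N) * B
      have e1 : (i + 1 + N) * (t * D) = t * ((2 * i + 2 + N) * t * B - (i + 1) * A) := by
        rw [mul_one] at hr
        linear_combination t * hr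
      rw [e1]
      have e2 : (i + 1) * (t * B) ≤ (i + 1) * A := mul_le_mul_of_nonneg_left h3 (by positivity)
      nlinarith [mul_le_mul_of_nonneg_left e2 ht0.le, mul_nonneg ht2 (mul_pos hN1 h1).le]

lemma sg_growth (hN : 0 < N) {α c : ℝ} (hα : 0 < α) (hα1 : α < 1) {i₀ : ℕ} (hc : 1 ≤ α * c)
    (h : i₀ * ((1 - α ^ 2) * c ^ 2 + 1) + N * (1 - α * c) ≤ 0) {t : ℝ} (ht : α ≤ t) (ht1 : t ≤ 1) :
    0 < sg N i₀ α 1 ∧ sg N i₀ α 1 ≤ sg N i₀ t 1 ∧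
      sg N i₀ t 1 ≤ exp (i₀ * c * (t - α)) * sg N i₀ α 1 := by
  choose D hD eD using fun t => sg_hasDerivAt_fst (N := N) hN t i₀
  have hpos := fun {t} (ht : α ≤ t) (ht1 : t ≤ 1) => sg_ratio hN hα hc h ht ht1
  have hcont : Continuous fun t => sg N i₀ t 1 :=
    continuous_iff_continuousAt.2 fun t => (hD t).continuousAt
  have hr : ∀ t ∈ Set.Ioo α 1, 0 ≤ D t ∧ D t ≤ i₀ * c * sg N i₀ t 1 := fun t ht => by
    have ht2 : 0 < 1 - t ^ 2 := by nlinarith [ht.1, ht.2]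
    rcases Nat.eq_zero_or_pos i₀ with h0 | h0
    · have := eD t
      subst h0
      simp only [Nat.cast_zero, zero_mul, mul_eq_zero, ht2.ne', false_or] at this
      simp [this]
    · obtain ⟨j, rfl⟩ : ∃ j, i₀ = j + 1 := ⟨i₀ - 1, by omega⟩
      obtain ⟨-, h2, h3, h4⟩ := hpos ht.1.le ht.2.le j (by omega)
      have := eD t
      simp only [Nat.add_sub_cancel] at this
      constructor
      · refine le_of_mul_le_mul_left ?_ ht2
        rw [this, mul_zero]
        exact mul_nonneg (by positivity) (by linarith)
      · refine le_of_mul_le_mul_left ?_ ht2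
        rw [this]
        have : ((j + 1 : ℕ) : ℝ) * (sg N j t 1 - t * sg N (j + 1) t 1) ≤
            ((j + 1 : ℕ) : ℝ) * ((1 - t ^ 2) * c * sg N (j + 1) t 1) :=
          mul_le_mul_of_nonneg_left (by linarith) (by positivity)
        linarith
  refine ⟨(hpos le_rfl hα1.le i₀ le_rfl).1, ?_, ?_⟩
  · have hm : MonotoneOn (fun t => sg N i₀ t 1) (Set.Icc α 1) := by
      refine monotoneOn_of_deriv_nonneg (convex_Icc _ _) hcont.continuousOn
        (fun t _ => (hD t).differentiableAt.differentiableWithinAt) fun t ht => ?_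
      rw [interior_Icc] at ht
      rw [(hD t).deriv]
      exact (hr t ht).1
    exact hm ⟨le_rfl, hα1.le⟩ ⟨ht, ht1⟩ ht
  · have hd : ∀ t, HasDerivAt (fun t => exp (-(i₀ * c * (t - α))) * sg N i₀ t 1)
        (exp (-(i₀ * c * (t - α))) * (D t - i₀ * c * sg N i₀ t 1)) t := fun t => by
      have h1 : HasDerivAt (fun t => -(i₀ * c * (t - α))) (-(i₀ * c)) t :=
        (((hasDerivAt_id' t).sub_const α).const_mul (i₀ * c)).neg.congr_deriv (by ring)
      exact (h1.exp.mul (hD t)).congr_deriv (by ring)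
    have hm : AntitoneOn (fun t => exp (-(i₀ * c * (t - α))) * sg N i₀ t 1) (Set.Icc α 1) := by
      refine antitoneOn_of_deriv_nonpos (convex_Icc _ _)
        (continuous_iff_continuousAt.2 fun t => (hd t).continuousAt).continuousOn
        (fun t _ => (hd t).differentiableAt.differentiableWithinAt) fun t ht => ?_
      rw [interior_Icc] at ht
      rw [(hd t).deriv]
      exact mul_nonpos_of_nonneg_of_nonpos (exp_pos _).le (by linarith [(hr t ht).2])
    have := hm ⟨le_rfl, hα1.le⟩ ⟨ht, ht1⟩ ht
    simp only [sub_self, mul_zero, neg_zero, exp_zero, one_mul] at this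
    rw [exp_neg, inv_mul_le_iff₀ (exp_pos _)] at this
    exact this

lemma sg_abs_growth (hN : 0 < N) {t : ℝ} (ht : |t| ≤ 1) (i d : ℕ) :
    |sg N (i + d) t 1| + |sg N (i + d + 1) t 1| ≤ 4 ^ d * (|sg N i t 1| + |sg N (i + 1) t 1|) := by
  induction d with
  | zero => simp
  | succ d ih =>
    have hN1 : 0 < (i + d : ℕ) + 1 + N := by positivity
    have hr := sg_rec hN.le (i + d) t 1
    have h1 : |sg N (i + d + 2) t 1| ≤ 2 * |sg N (i + d + 1) t 1| + |sg N (i + d) t 1| := by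
      refine le_of_mul_le_mul_left ?_ hN1
      rw [← abs_of_pos hN1, ← abs_mul, hr, abs_of_pos hN1]
      refine (abs_sub _ _).trans ?_
      simp only [abs_mul, mul_one]
      rw [abs_of_pos (by positivity : (0 : ℝ) < 2 * ((i + d : ℕ) : ℝ) + 2 + N),
        abs_of_pos (by positivity : (0 : ℝ) < ((i + d : ℕ) : ℝ) + 1)]
      have hx := abs_nonneg (sg N (i + d + 1) t 1)
      have hy := abs_nonneg (sg N (i + d) t 1)
      have hn : (0 : ℝ) ≤ ((i + d : ℕ) : ℝ) := by positivity
      have e1 : (2 * ((i + d : ℕ) : ℝ) + 2 + N) * |t| * |sg N (i + d + 1) t 1| ≤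
          (2 * ((i + d : ℕ) : ℝ) + 2 + N) * 1 * |sg N (i + d + 1) t 1| := by gcongr
      nlinarith [mul_nonneg hN.le hx, mul_nonneg hN.le hy]
    rw [show i + (d + 1) = i + d + 1 by ring, show i + d + 1 + 1 = i + d + 2 by ring, pow_succ]
    nlinarith [abs_nonneg (sg N (i + d) t 1), abs_nonneg (sg N (i + d + 1) t 1)]

end Ultraspherical
end GaussRel

namespace GaussRel
open ProbabilityTheory
open scoped InnerProductSpace
set_option linter.unusedSectionVars false

/-- Orthonormal ultraspherical polynomials. -/
noncomputable def pk (N : ℝ) (i : ℕ) (t : ℝ) : ℝ := √(hdim N i) * sg N i t 1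

/-- Jacobi coefficients of the orthonormal ultraspherical polynomials. -/
noncomputable def bc (N : ℝ) (i : ℕ) : ℝ := √((i + 1) * (i + N) / ((2 * i + N) * (2 * i + 2 + N)))

lemma bc_nonneg (N : ℝ) (i : ℕ) : 0 ≤ bc N i := Real.sqrt_nonneg _

lemma sqrt_hdim_succ {N : ℝ} (hN : 0 < N) (i : ℕ) :
    √(hdim N (i + 1)) * ((i + 1) / (2 * i + 2 + N)) = bc N i * √(hdim N i) := by
  have h1 : (0 : ℝ) ≤ (i + 1) / (2 * i + 2 + N) := by positivity
  have hH := (hdim_pos hN i).le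
  rw [hdim, bc, ← Real.sqrt_sq h1, ← Real.sqrt_mul (by positivity), ← Real.sqrt_mul (by positivity)]
  congr 1
  field_simp
  ring

lemma sqrt_hdim_pred {N : ℝ} (hN : 0 < N) (i : ℕ) :
    bc N (i + 1) * √(hdim N (i + 2)) = √(hdim N (i + 1)) * ((i + 1 + N) / (2 * i + 2 + N)) := by
  have h1 : (0 : ℝ) ≤ (i + 1 + N) / (2 * i + 2 + N) := by positivity
  have hH := (hdim_pos hN (i + 1)).le
  rw [show i + 2 = i + 1 + 1 by rfl, hdim, bc, ← Real.sqrt_sq h1, ← Real.sqrt_mul (by positivity),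
    ← Real.sqrt_mul (by positivity)]
  congr 1
  push_cast
  have e : 2 * ((i : ℝ) + 1) + 2 + N ≠ 0 := by positivity
  have e2 : 2 * ((i : ℝ) + 1) + N ≠ 0 := by positivity
  have e3 : 2 * (i : ℝ) + 2 + N ≠ 0 := by positivity
  have e4 : 2 * ((i : ℝ) + 1) + N = 2 * i + 2 + N := by ring
  rw [e4]
  field_simp
  ring

lemma pk_rec {N : ℝ} (hN : 0 < N) (i : ℕ) (t : ℝ) :
    t * pk N (i + 1) t = bc N (i + 1) * pk N (i + 2) t + bc N i * pk N i t := by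
  have hc : (2 * i + 2 + N) ≠ 0 := by positivity
  have h := sg_rec hN.le i t 1
  have e1 := sqrt_hdim_succ hN i
  have e2 := sqrt_hdim_pred hN i
  rw [pk, pk, pk, ← mul_assoc (bc N (i + 1)), ← mul_assoc (bc N i), ← e1, e2]
  field_simp
  linear_combination (-√(hdim N (i + 1))) * h

section

variable {E : Type*} [NormedAddCommGroup E] [InnerProductSpace ℝ E] [FiniteDimensional ℝ E]
  [MeasurableSpace E] [BorelSpace E]

local notation "dim" => (Module.finrank ℝ E : ℝ)

lemma pk_mul_pk_eq {C : Finset E} {u : E → E} (hC : ∀ x ∈ C, ‖u x‖ = 1) (i j : ℕ) :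
    ∑ x ∈ C, ∑ y ∈ C, pk (dim - 2) i ⟪u x, u y⟫_ℝ * pk (dim - 2) j ⟪u x, u y⟫_ℝ =
      √(hdim (dim - 2) i) * √(hdim (dim - 2) j) * ∑ x ∈ C, ∑ y ∈ C, zon i (u x) (u y) * zon j (u x) (u y) := by
  rw [Finset.mul_sum]
  refine Finset.sum_congr rfl fun x hx => ?_
  rw [Finset.mul_sum]
  refine Finset.sum_congr rfl fun y hy => ?_
  rw [zon, zon, hC x hx, hC y hy, pk, pk]
  norm_num
  ring

/-- Linear programming lower bound for the kernel `(t - α) g(t)²`. -/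
lemma lp_lower (hE : 2 < Module.finrank ℝ E) {C : Finset E} {u : E → E} (hC : ∀ x ∈ C, ‖u x‖ = 1) {α η : ℝ}
    (hη : 0 ≤ η) {G : ℕ → ℝ} (hG : ∀ i, 0 ≤ G i) {L : ℕ} (h0 : G 0 = 0) (h1 : G 1 = 0)
    (hL : G L = 0) (hL1 : G (L + 1) = 0)
    (h : ∀ i, η * G (i + 1) ≤
      bc (dim - 2) i * G i + bc (dim - 2) (i + 1) * G (i + 2) - α * G (i + 1)) :
    η * (∑ i ∈ Finset.range L, G (i + 1) ^ 2) * (C.card : ℝ) ^ 2 ≤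
      ∑ x ∈ C, ∑ y ∈ C, (⟪u x, u y⟫_ℝ - α) *
        (∑ i ∈ Finset.range L, G (i + 1) * pk (dim - 2) (i + 1) ⟪u x, u y⟫_ℝ) ^ 2 := by
  have hd : (2 : ℝ) < dim := by exact_mod_cast hE
  set N := dim - 2 with hN'
  have hN : 0 < N := by linarith
  set H : ℕ → ℝ := fun i => bc N i * G i + bc N (i + 1) * G (i + 2) - α * G (i + 1) with hH
  have key : ∀ t, (t - α) * ∑ i ∈ Finset.range L, G (i + 1) * pk N (i + 1) t =
      ∑ i ∈ Finset.range L, H i * pk N (i + 1) t := fun t => by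
    have s1 := Finset.sum_range_succ (fun i => G i * bc N i * pk N (i + 1) t) L
    rw [Finset.sum_range_succ'] at s1
    have s2 := Finset.sum_range_succ (fun i => G (i + 1) * bc N i * pk N i t) L
    rw [Finset.sum_range_succ'] at s2
    simp only [h0, hL, hL1, h1, zero_mul, zero_add, add_zero] at s1 s2
    have e1 : ∀ i, H i * pk N (i + 1) t = G i * bc N i * pk N (i + 1) t +
        G (i + 1 + 1) * bc N (i + 1) * pk N (i + 1) t - α * (G (i + 1) * pk N (i + 1) t) :=
      fun i => by simp only [hH]; ring
    have e2 : ∀ i, t * (G (i + 1) * pk N (i + 1) t) = G (i + 1) * bc N (i + 1) * pk N (i + 1 + 1) t +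
        G (i + 1) * bc N i * pk N i t := fun i => by
      rw [mul_left_comm, pk_rec hN]; ring
    simp only [e1]
    rw [Finset.sum_sub_distrib, Finset.sum_add_distrib, ← s1, s2, ← Finset.sum_add_distrib,
      sub_mul, Finset.mul_sum, Finset.mul_sum]
    simp only [e2]
  set T : ℕ → ℕ → ℝ := fun i j => ∑ x ∈ C, ∑ y ∈ C, pk N (i + 1) ⟪u x, u y⟫_ℝ * pk N (j + 1) ⟪u x, u y⟫_ℝ
    with hT
  have hT0 : ∀ i j, 0 ≤ T i j := fun i j => by
    simp only [hT]
    rw [hN', pk_mul_pk_eq hC]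
    exact mul_nonneg (mul_nonneg (sqrt_nonneg _) (sqrt_nonneg _)) (sum_zon_mul_zon_nonneg hE _ _ C u)
  have hT1 : ∀ i, (C.card : ℝ) ^ 2 ≤ T i i := fun i => by
    simp only [hT]
    rw [hN', pk_mul_pk_eq hC, Real.mul_self_sqrt (hdim_pos (by rw [← hN']; exact hN) _).le]
    exact sq_card_le_sum_zon_sq hE _ hC
  have e : ∑ x ∈ C, ∑ y ∈ C, (⟪u x, u y⟫_ℝ - α) *
        (∑ i ∈ Finset.range L, G (i + 1) * pk N (i + 1) ⟪u x, u y⟫_ℝ) ^ 2 =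
      ∑ i ∈ Finset.range L, ∑ j ∈ Finset.range L, H i * G (j + 1) * T i j := by
    have e0 : ∀ t, (t - α) * (∑ i ∈ Finset.range L, G (i + 1) * pk N (i + 1) t) ^ 2 =
        ∑ i ∈ Finset.range L, ∑ j ∈ Finset.range L,
          H i * pk N (i + 1) t * (G (j + 1) * pk N (j + 1) t) := fun t => by
      rw [sq, ← mul_assoc, key, Finset.sum_mul_sum]
    simp only [e0, hT, Finset.mul_sum]
    have step1 : ∀ x ∈ C, ∑ y ∈ C, ∑ i ∈ Finset.range L, ∑ j ∈ Finset.range L,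
        H i * pk N (i + 1) ⟪u x, u y⟫_ℝ * (G (j + 1) * pk N (j + 1) ⟪u x, u y⟫_ℝ) =
        ∑ i ∈ Finset.range L, ∑ j ∈ Finset.range L, ∑ y ∈ C,
          H i * G (j + 1) * (pk N (i + 1) ⟪u x, u y⟫_ℝ * pk N (j + 1) ⟪u x, u y⟫_ℝ) := fun x _ => by
      rw [Finset.sum_comm]
      refine Finset.sum_congr rfl fun i _ => ?_
      rw [Finset.sum_comm]
      exact Finset.sum_congr rfl fun j _ => Finset.sum_congr rfl fun y _ => by ring
    rw [Finset.sum_congr rfl step1, Finset.sum_comm]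
    refine Finset.sum_congr rfl fun i _ => ?_
    rw [Finset.sum_comm]
  rw [e, mul_assoc, Finset.sum_mul, Finset.mul_sum]
  refine Finset.sum_le_sum fun i hi => ?_
  have hHi : η * G (i + 1) ≤ H i := h i
  have hHi0 : 0 ≤ H i := (mul_nonneg hη (hG _)).trans hHi
  refine le_trans ?_ (Finset.single_le_sum (f := fun j => H i * G (j + 1) * T i j)
    (fun j _ => mul_nonneg (mul_nonneg hHi0 (hG _)) (hT0 _ _)) hi)
  calc η * (G (i + 1) ^ 2 * (C.card : ℝ) ^ 2) = η * G (i + 1) * G (i + 1) * (C.card : ℝ) ^ 2 := by ring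
    _ ≤ H i * G (i + 1) * T i i := by
      have := hG (i + 1)
      exact mul_le_mul (mul_le_mul_of_nonneg_right hHi this) (hT1 i) (sq_nonneg _)
        (mul_nonneg hHi0 this)

open Classical in
/-- Lower bound for the low-distance part of a spherical code. -/
lemma lp_sum (hE : 2 < Module.finrank ℝ E) {C : Finset E} {u : E → E} (hC : ∀ x ∈ C, ‖u x‖ = 1) {α η b : ℝ}
    (hα : 0 ≤ α) (hη : 0 < η) {m w : ℕ} (hm : 1 ≤ m) (hb : ∀ i, m ≤ i → b ≤ bc (dim - 2) i)
    (hb0 : 0 ≤ b) (hw0 : 1 ≤ w) (hw : 2 * b ≤ (2 * b - α - η) * w)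
    (hM : 2 * ∑ i ∈ Finset.Ico m (m + w), hdim (dim - 2) (i + 1) ≤ η * C.card) :
    η / 2 * (C.card : ℝ) ^ 2 ≤ ∑ x ∈ C, ∑ y ∈ C.filter (fun y => y ≠ x ∧ α ≤ ⟪u x, u y⟫_ℝ),
      ∑ i ∈ Finset.Ico m (m + w), pk (dim - 2) (i + 1) ⟪u x, u y⟫_ℝ ^ 2 := by
  have hd : (2 : ℝ) < dim := by exact_mod_cast hE
  set N := dim - 2 with hN'
  have hN : 0 < N := by linarith
  set G : ℕ → ℝ := fun i => max 0 (((i : ℝ) - m) * (m + w + 1 - i)) with hG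
  have hG0 : ∀ i, 0 ≤ G i := fun i => le_max_left _ _
  have hGlo : ∀ i ≤ m, G i = 0 := fun i hi => by
    have : (i : ℝ) ≤ m := by exact_mod_cast hi
    refine max_eq_left (mul_nonpos_of_nonpos_of_nonneg (by linarith) ?_)
    have : (0 : ℝ) ≤ w := by positivity
    linarith
  have hGhi : ∀ i, m + w + 1 ≤ i → G i = 0 := fun i hi => by
    have : (m : ℝ) + w + 1 ≤ i := by exact_mod_cast hi
    have : (0 : ℝ) ≤ w := by positivity
    exact max_eq_left (mul_nonpos_of_nonneg_of_nonpos (by linarith) (by linarith))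
  have hGmid : ∀ i, m ≤ i → i ≤ m + w + 1 → G i = ((i : ℝ) - m) * (m + w + 1 - i) := fun i h1 h2 => by
    have e1 : (m : ℝ) ≤ i := by exact_mod_cast h1
    have e2 : (i : ℝ) ≤ m + w + 1 := by exact_mod_cast h2
    exact max_eq_right (mul_nonneg (by linarith) (by linarith))
  have hstep : ∀ i, η * G (i + 1) ≤ bc N i * G i + bc N (i + 1) * G (i + 2) - α * G (i + 1) := by
    intro i
    by_cases hi : m ≤ i ∧ i + 1 ≤ m + w
    · have e1 : (m : ℝ) ≤ i := by exact_mod_cast hi.1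
      have e2 : (i : ℝ) + 1 ≤ m + w := by exact_mod_cast hi.2
      have f1 : b * G i ≤ bc N i * G i := mul_le_mul_of_nonneg_right (hb i hi.1) (hG0 _)
      have f2 : b * G (i + 2) ≤ bc N (i + 1) * G (i + 2) :=
        mul_le_mul_of_nonneg_right (hb _ (by omega)) (hG0 _)
      have g0 := hGmid i hi.1 (by omega)
      have g1 := hGmid (i + 1) (by omega) (by omega)
      have g2 := hGmid (i + 2) (by omega) (by omega)
      push_cast at g1 g2
      have f3 : (w : ℝ) ≤ G (i + 1) := by
        rw [g1]
        nlinarith [mul_nonneg (sub_nonneg.2 e1) (sub_nonneg.2 e2)]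
      have f4 : G i + G (i + 2) = 2 * G (i + 1) - 2 := by rw [g0, g1, g2]; ring
      have hw' : (1 : ℝ) ≤ w := by exact_mod_cast hw0
      have f5 : 0 ≤ 2 * b - α - η := by
        by_contra hlt
        push Not at hlt
        nlinarith
      nlinarith [mul_le_mul_of_nonneg_left f3 f5]
    · have : G (i + 1) = 0 := by
        by_cases h : m ≤ i
        · exact hGhi _ (by omega)
        · exact hGlo _ (by omega)
      rw [this]
      have := mul_nonneg (bc_nonneg N i) (hG0 i)
      have := mul_nonneg (bc_nonneg N (i + 1)) (hG0 (i + 2))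
      linarith
  have hlow := lp_lower hE hC (α := α) hη.le hG0 (L := m + w + 1) (hGlo 0 (by omega)) (hGlo 1 hm)
    (hGhi _ le_rfl) (hGhi _ (by omega)) hstep
  rw [← hN'] at hlow
  set W := Finset.Ico m (m + w) with hW
  have hWs : W ⊆ Finset.range (m + w + 1) := fun i hi => by
    simp only [hW, Finset.mem_Ico, Finset.mem_range] at hi ⊢; omega
  have hsupp : ∀ F : ℕ → ℝ, (∀ i, G (i + 1) = 0 → F i = 0) →
      ∑ i ∈ Finset.range (m + w + 1), F i = ∑ i ∈ W, F i := fun F hF => by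
    refine (Finset.sum_subset hWs fun i hi hi' => hF i ?_).symm
    simp only [hW, Finset.mem_Ico, not_and, not_lt] at hi'
    by_cases h : m ≤ i
    · exact hGhi _ (by have := hi' h; omega)
    · exact hGlo _ (by omega)
  rw [hsupp _ fun i hi => by rw [hi]; norm_num] at hlow
  have hs : ∀ t, ∑ i ∈ Finset.range (m + w + 1), G (i + 1) * pk N (i + 1) t =
      ∑ i ∈ W, G (i + 1) * pk N (i + 1) t := fun t => hsupp _ fun i hi => by rw [hi, zero_mul]
  simp only [hs] at hlow
  set S := ∑ i ∈ W, G (i + 1) ^ 2 with hS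
  have hSpos : 0 < S := by
    refine lt_of_lt_of_le ?_ (Finset.single_le_sum (f := fun i => G (i + 1) ^ 2)
      (fun i _ => sq_nonneg _) (show m ∈ W by simp [hW]; omega))
    have : G (m + 1) = w := by
      rw [hGmid _ (by omega) (by omega)]; push_cast; ring
    simp only [this]
    have : (0 : ℝ) < w := by exact_mod_cast hw0
    positivity
  set V : E → E → ℝ := fun x y => ∑ i ∈ W, pk N (i + 1) ⟪u x, u y⟫_ℝ ^ 2 with hV
  have hV0 : ∀ x y, 0 ≤ V x y := fun x y => Finset.sum_nonneg fun i _ => sq_nonneg _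
  have hVd : ∀ x ∈ C, V x x = ∑ i ∈ W, hdim N (i + 1) := fun x hx => by
    refine Finset.sum_congr rfl fun i _ => ?_
    have h1 := sg_diag hN.le 1 (i + 1)
    rw [one_pow, one_pow] at h1
    rw [real_inner_self_eq_norm_sq, hC x hx, one_pow, pk, h1, mul_one,
      Real.sq_sqrt (hdim_pos hN (i + 1)).le]
  have hf : ∀ x ∈ C, ∀ y ∈ C, (⟪u x, u y⟫_ℝ - α) * (∑ i ∈ W, G (i + 1) * pk N (i + 1) ⟪u x, u y⟫_ℝ) ^ 2 ≤
      S * ((if y = x then V x y else 0) + if y ≠ x ∧ α ≤ ⟪u x, u y⟫_ℝ then V x y else 0) := by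
    intro x hx y hy
    have hcs : (∑ i ∈ W, G (i + 1) * pk N (i + 1) ⟪u x, u y⟫_ℝ) ^ 2 ≤ S * V x y :=
      Finset.sum_mul_sq_le_sq_mul_sq _ _ _
    have ht : ⟪u x, u y⟫_ℝ - α ≤ 1 := by
      have := real_inner_le_norm (u x) (u y)
      rw [hC x hx, hC y hy] at this
      linarith
    by_cases hα' : α ≤ ⟪u x, u y⟫_ℝ
    · have : (⟪u x, u y⟫_ℝ - α) * (∑ i ∈ W, G (i + 1) * pk N (i + 1) ⟪u x, u y⟫_ℝ) ^ 2 ≤ S * V x y :=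
        (mul_le_of_le_one_left (sq_nonneg _) ht).trans hcs
      by_cases hxy : y = x
      · rw [if_pos hxy, if_neg (fun h => h.1 hxy), add_zero]
        exact this
      · simpa [hxy, hα'] using this
    · push Not at hα'
      refine (mul_nonpos_of_nonpos_of_nonneg (by linarith) (sq_nonneg _)).trans ?_
      refine mul_nonneg hSpos.le (add_nonneg ?_ ?_)
      · split_ifs
        exacts [hV0 _ _, le_rfl]
      · split_ifs
        exacts [hV0 _ _, le_rfl]
  have hup := Finset.sum_le_sum fun x hx => Finset.sum_le_sum (hf x hx)
  have h2 := hlow.trans hup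
  simp only [← Finset.mul_sum, Finset.sum_add_distrib, Finset.sum_ite_eq'] at h2
  rw [Finset.sum_congr rfl fun x hx => by rw [if_pos hx, hVd x hx], Finset.sum_const,
    nsmul_eq_mul] at h2
  simp only [Finset.sum_filter]
  have h3 : η * (C.card : ℝ) ^ 2 ≤ C.card * ∑ i ∈ W, hdim N (i + 1) +
      ∑ x ∈ C, ∑ y ∈ C, (if y ≠ x ∧ α ≤ ⟪u x, u y⟫_ℝ then V x y else 0) := by
    refine le_of_mul_le_mul_left ?_ hSpos
    linarith
  have h4 : (C.card : ℝ) * (2 * ∑ i ∈ W, hdim N (i + 1)) ≤ C.card * (η * C.card) :=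
    mul_le_mul_of_nonneg_left hM (by positivity)
  simp only [hV] at h3
  nlinarith

end
end GaussRel

namespace GaussRel
open ProbabilityTheory
open scoped InnerProductSpace
set_option linter.unusedSectionVars false

section

variable {E : Type*} [NormedAddCommGroup E] [InnerProductSpace ℝ E] [FiniteDimensional ℝ E]
  [MeasurableSpace E] [BorelSpace E]

local notation "dim" => (Module.finrank ℝ E : ℝ)

/-- Change of measure from a shifted and scaled Gaussian to the standard one. -/
lemma tilt_le (v : E) {σ : ℝ} (hσ : 0 < σ) {K : ℝ} {B : Set E} (hB : MeasurableSet B)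
    (h : ∀ z, v + σ • z ∈ B → -(dim * log σ) + (‖v + σ • z‖ ^ 2 - ‖z‖ ^ 2) / 2 ≤ K) :
    (stdGaussian E).real {z | v + σ • z ∈ B} ≤ exp K * (stdGaussian E).real B := by
  set f : E → ℝ := B.indicator 1 with hf
  have e1 : (stdGaussian E).real {z | v + σ • z ∈ B} = ∫ z, f (v + σ • z) ∂(stdGaussian E) := by
    exact (integral_indicator_one
      (hB.preimage (by fun_prop : Measurable fun z : E => v + σ • z))).symm
  set G : E → ℝ := fun u => exp (-((σ⁻¹) ^ 2 - 1) * ‖u - v‖ ^ 2 / 2) * f u with hG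
  have e2 := integral_scale hσ (fun z => f (v + z))
  have e3 := integral_shift v G
  simp only [hG, add_sub_cancel_left] at e3
  rw [e1, e2, e3, ← integral_indicator_one hB, ← integral_const_mul, ← integral_const_mul]
  refine integral_mono_of_nonneg (ae_of_all _ fun y => ?_)
    (((integrable_const (1 : ℝ)).indicator hB).const_mul _) (ae_of_all _ fun y => ?_)
  · have : 0 ≤ f y := Set.indicator_nonneg (fun _ _ => zero_le_one) y
    simp only [Pi.zero_apply]
    positivity
  · by_cases hy : y ∈ B
    · simp only [hf, Set.indicator_of_mem hy, Pi.one_apply, mul_one]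
      rw [← exp_add, ← Real.rpow_natCast, ← Real.rpow_neg hσ.le, Real.rpow_def_of_pos hσ, ← exp_add]
      refine exp_le_exp.2 ?_
      have hz : v + σ • (σ⁻¹ • (y - v)) = y := by
        rw [smul_smul, mul_inv_cancel₀ hσ.ne', one_smul]; abel
      have := h (σ⁻¹ • (y - v)) (by rwa [hz])
      rw [hz, norm_smul, mul_pow, Real.norm_eq_abs, sq_abs] at this
      have hn := norm_sub_sq_real y v
      rw [real_inner_comm] at hn
      refine le_trans (le_of_eq ?_) this
      linear_combination (1 / 2 : ℝ) * hn
    · simp [hf, Set.indicator_of_notMem hy]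

lemma integral_cap_norm_pow (hE : 2 < Module.finrank ℝ E) (x : E) (α : ℝ) (i : ℕ) :
    ∫ z, {z | α * ‖z‖ ≤ ⟪x, z⟫_ℝ}.indicator (fun z : E => ‖z‖ ^ (2 * i)) z ∂(stdGaussian E) =
      (stdGaussian E).real {z | α * ‖z‖ ≤ ⟪x, z⟫_ℝ} *
        (hdim (dim - 2) i * znorm (dim - 2) i) := by
  set B := {z : E | α * ‖z‖ ≤ ⟪x, z⟫_ℝ} with hB
  have hBm : MeasurableSet B := measurableSet_le (by fun_prop) (by fun_prop)
  induction i with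
  | zero =>
    simp only [mul_zero, pow_zero]
    rw [← integral_norm_pow hE 0]
    simp only [mul_zero, pow_zero, integral_const, probReal_univ, smul_eq_mul, mul_one]
    exact integral_indicator_one hBm
  | succ i ih =>
    have hG : Gr (B.indicator fun z : E => ‖z‖ ^ (2 * i)) := (Gr.norm.pow _).indicator hBm
    have h1 := hG.integral_norm_sq_mul (2 * i) fun σ hσ => by
      rw [← integral_const_mul]
      congr 1 with z
      have : σ • z ∈ B ↔ z ∈ B := by
        simp only [hB, Set.mem_ofPred_eq, norm_smul, inner_smul_right, Real.norm_eq_abs,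
          abs_of_pos hσ]
        rw [mul_left_comm, mul_le_mul_iff_right₀ hσ]
      by_cases hz : z ∈ B
      · rw [Set.indicator_of_mem hz, Set.indicator_of_mem (this.2 hz), norm_smul, mul_pow,
          Real.norm_eq_abs, abs_of_pos hσ]
      · rw [Set.indicator_of_notMem hz, Set.indicator_of_notMem (mt this.1 hz), mul_zero]
    have h2 := (Gr.norm.pow (2 * i) : Gr fun z : E => ‖z‖ ^ (2 * i)).integral_norm_sq_mul (2 * i)
      fun σ hσ => by
        rw [← integral_const_mul]
        simp only [norm_smul, mul_pow, Real.norm_eq_abs, abs_of_pos hσ]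
    rw [ih] at h1
    rw [integral_norm_pow hE i] at h2
    have e : ∀ z : E, ‖z‖ ^ 2 * B.indicator (fun z : E => ‖z‖ ^ (2 * i)) z =
        B.indicator (fun z : E => ‖z‖ ^ (2 * (i + 1))) z := fun z => by
      by_cases hz : z ∈ B
      · simp only [Set.indicator_of_mem hz]; ring
      · simp only [Set.indicator_of_notMem hz, mul_zero]
    have e2 : ∀ z : E, ‖z‖ ^ 2 * ‖z‖ ^ (2 * i) = ‖z‖ ^ (2 * (i + 1)) := fun z => by ring
    simp only [e] at h1
    simp only [e2] at h2
    rw [integral_norm_pow hE] at h2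
    rw [h1, h2]
    ring

/-- A polynomial which is at least `P` on a cap satisfies `hdim * P² * (measure of cap) ≤ 1`. -/
lemma hdim_mul_sq_mul_cap_le (hE : 2 < Module.finrank ℝ E) {x : E} (hx : ‖x‖ = 1) {α P : ℝ} {i : ℕ}
    (hα1 : α ≤ 1) (hP : 0 ≤ P) (h : ∀ t, α ≤ t → t ≤ 1 → P ≤ sg (dim - 2) i t 1) :
    hdim (dim - 2) i * P ^ 2 * (stdGaussian E).real {z | α * ‖z‖ ≤ ⟪x, z⟫_ℝ} ≤ 1 := by
  have hd : (2 : ℝ) < dim := by exact_mod_cast hE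
  have hc := znorm_pos (N := dim - 2) (by linarith) i
  have h1 := integral_zon_mul_zon hE i x x
  rw [zon_self hE, hx, one_pow, mul_one] at h1
  have h2 := integral_cap_norm_pow hE x α i
  set B := {z : E | α * ‖z‖ ≤ ⟪x, z⟫_ℝ} with hB
  have hBm : MeasurableSet B := measurableSet_le (by fun_prop) (by fun_prop)
  have h3 : P ^ 2 * ∫ z, B.indicator (fun z : E => ‖z‖ ^ (2 * i)) z ∂(stdGaussian E) ≤
      ∫ z, zon i x z * zon i x z ∂(stdGaussian E) := by
    rw [← integral_const_mul]
    refine integral_mono (((Gr.norm.pow _).indicator hBm).const_mul _).integrable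
      ((Gr.zon i x).mul (Gr.zon i x)).integrable fun z => ?_
    by_cases hz : z ∈ B
    · simp only [Set.indicator_of_mem hz]
      have hP2 : P * ‖z‖ ^ i ≤ zon i x z := by
        rcases eq_or_ne z 0 with h0 | h0
        · subst h0
          rcases Nat.eq_zero_or_pos i with hi | hi
          · subst hi
            simpa using h 1 hα1 le_rfl
          · have := zon_smul i x 0 0
            simp [hi.ne'] at this ⊢
            rw [this]
        · have hn : 0 < ‖z‖ := norm_pos_iff.2 h0
          have hh := h (‖z‖⁻¹ * ⟪x, z⟫_ℝ) ?_ ?_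
          · have e := zon_smul i x (‖z‖⁻¹ • z) ‖z‖
            rw [smul_smul, mul_inv_cancel₀ hn.ne', one_smul] at e
            rw [e, mul_comm]
            refine mul_le_mul_of_nonneg_left ?_ (by positivity)
            rw [zon, inner_smul_right, hx, norm_smul, norm_inv, norm_norm, inv_mul_cancel₀ hn.ne']
            simpa using hh
          · rw [inv_mul_eq_div, le_div_iff₀ hn]; exact hz
          · rw [inv_mul_eq_div, div_le_one hn]
            simpa [hx] using real_inner_le_norm x z
      have := mul_self_le_mul_self (by positivity) hP2
      calc _ = P * ‖z‖ ^ i * (P * ‖z‖ ^ i) := by ring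
        _ ≤ _ := this
    · simp only [Set.indicator_of_notMem hz, mul_zero]
      exact mul_self_nonneg _
  rw [h1, h2] at h3
  refine le_of_mul_le_mul_right ?_ hc
  linarith

end

set_option maxHeartbeats 800000 in
lemma cap_prob {α ε : ℝ} (hα : 0 < α) (hα1 : α < 1) (hε : 0 < ε) : ∃ n₀ : ℕ, ∀ (E : Type)
    [NormedAddCommGroup E] [InnerProductSpace ℝ E] [FiniteDimensional ℝ E]
    [MeasurableSpace E] [BorelSpace E], n₀ ≤ Module.finrank ℝ E → ∀ x : E, ‖x‖ = 1 →
    exp (-(Module.finrank ℝ E * (-(1 / 2) * log (1 - α ^ 2) + ε))) ≤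
      (stdGaussian E).real {z | α * ‖z‖ ≤ ⟪x, z⟫_ℝ} := by
  obtain ⟨s, ⟨hs1, hsε⟩, hs⟩ : ∃ s, (s < 1 ∧ -(1 / 2) * log (1 - s ^ 2) <
      -(1 / 2) * log (1 - α ^ 2) + ε / 4) ∧ α < s := by
    have h1 : 1 - α ^ 2 ≠ 0 := by nlinarith
    have hc : ContinuousAt (fun s => -(1 / 2) * log (1 - s ^ 2)) α := by
      fun_prop (disch := assumption)
    have e := ((eventually_lt_nhds hα1).and (hc.eventually_lt (continuousAt_const
      (y := -(1 / 2) * log (1 - α ^ 2) + ε / 4)) (by linarith))).filter_mono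
      (nhdsWithin_le_nhds (s := Set.Ioi α))
    exact (e.and self_mem_nhdsWithin).exists
  have hs0 : 0 < s := hα.trans hs
  have hs2 : 0 < 1 - s ^ 2 := by nlinarith
  obtain ⟨δ, ⟨⟨hδ1, hδ2⟩, hδ3⟩, hδ⟩ : ∃ δ, ((α ^ 2 * (1 + 3 * δ) < (s - δ) ^ 2 ∧ δ < s) ∧
      δ < min (ε / 8) 1) ∧ 0 < δ := by
    have hc : ContinuousAt (fun δ => α ^ 2 * (1 + 3 * δ)) 0 := by fun_prop
    have e := (((hc.eventually_lt (g := fun δ => (s - δ) ^ 2) (by fun_prop) (by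
      nlinarith)).and (eventually_lt_nhds hs0)).and
      (eventually_lt_nhds (a := (0 : ℝ)) (b := min (ε / 8) 1) (by positivity))).filter_mono
      (nhdsWithin_le_nhds (s := Set.Ioi 0))
    exact (e.and self_mem_nhdsWithin).exists
  have hδ4 : δ < ε / 8 := hδ3.trans_le (min_le_left _ _)
  have hδ5 : δ < 1 := hδ3.trans_le (min_le_right _ _)
  have ev : ∀ c : ℝ, 0 < c → ∀ᶠ n : ℕ in atTop, exp (-c * n) < 1 / 10 := fun c hc =>
    ((tendsto_exp_neg_mul hc).comp tendsto_natCast_atTop_atTop).eventually_lt_const (by norm_num)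
  obtain ⟨n₀, hn₀⟩ := eventually_atTop.1 (((ev _ (rate_upper_pos hδ)).and
    (ev _ (rate_lower_pos hδ hδ5))).and ((ev (δ ^ 2 / 2) (by positivity)).and
    ((ev (ε / 4) (by positivity)).and (eventually_ge_atTop 1))))
  refine ⟨n₀, fun E _ _ _ _ _ hn x hx => ?_⟩
  obtain ⟨⟨k1, k2⟩, k3, k4, k5⟩ := hn₀ _ hn
  set n : ℝ := (Module.finrank ℝ E : ℝ) with hndef
  have hn1 : (1 : ℝ) ≤ n := by rw [hndef]; exact_mod_cast k5
  have hn0 : 0 < n := by linarith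
  set σ := √(1 - s ^ 2) with hσdef
  have hσ : 0 < σ := sqrt_pos.2 hs2
  have hσ2 : σ ^ 2 = 1 - s ^ 2 := sq_sqrt hs2.le
  have hσ1 : σ ≤ 1 := by nlinarith
  set r := √n with hr
  have hr2 : r ^ 2 = n := sq_sqrt hn0.le
  have hr0 : 0 < r := sqrt_pos.2 hn0
  set v := (s * r) • x with hv
  set T : Set E := {z | (1 + δ) * n ≤ ‖z‖ ^ 2} ∪ {z | ‖z‖ ^ 2 ≤ (1 - δ) * n} ∪
    {z | δ ^ 2 * n ≤ (δ * r) * ⟪x, z⟫_ℝ} ∪ {z | δ ^ 2 * n ≤ (-(δ * r)) * ⟪x, z⟫_ℝ} with hT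
  have hTm : MeasurableSet T := by
    have m1 : MeasurableSet {z : E | (1 + δ) * n ≤ ‖z‖ ^ 2} :=
      measurableSet_le (by fun_prop) (by fun_prop)
    have m2 : MeasurableSet {z : E | ‖z‖ ^ 2 ≤ (1 - δ) * n} :=
      measurableSet_le (by fun_prop) (by fun_prop)
    have m3 : ∀ a b : ℝ, MeasurableSet {z : E | a ≤ b * ⟪x, z⟫_ℝ} := fun a b =>
      measurableSet_le (by fun_prop) (by fun_prop)
    exact ((m1.union m2).union (m3 _ _)).union (m3 _ _)
  have hTp : (stdGaussian E).real T ≤ 1 / 2 := by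
    refine (measureReal_union_le _ _).trans ?_
    have a1 := inner_tail x (δ * r) (δ ^ 2 * n)
    have a2 := inner_tail x (-(δ * r)) (δ ^ 2 * n)
    have e1 : (δ * r) ^ 2 * ‖x‖ ^ 2 / 2 - δ ^ 2 * n = -(δ ^ 2 / 2) * n := by
      rw [hx, mul_pow, hr2]; ring
    have e2 : (-(δ * r)) ^ 2 * ‖x‖ ^ 2 / 2 - δ ^ 2 * n = -(δ ^ 2 / 2) * n := by
      rw [← e1]; ring
    rw [e1] at a1
    rw [e2] at a2
    have a3 := norm_sq_upper_tail (E := E) hδ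
    have a4 := norm_sq_lower_tail (E := E) hδ hδ5
    have u1 := measureReal_union_le (μ := stdGaussian E)
      ({z | (1 + δ) * n ≤ ‖z‖ ^ 2} ∪ {z | ‖z‖ ^ 2 ≤ (1 - δ) * n})
      {z | δ ^ 2 * n ≤ (δ * r) * ⟪x, z⟫_ℝ}
    have u2 := measureReal_union_le (μ := stdGaussian E)
      {z | (1 + δ) * n ≤ ‖z‖ ^ 2} {z | ‖z‖ ^ 2 ≤ (1 - δ) * n}
    linarith
  set B : Set E := {z | α * ‖z‖ ≤ ⟪x, z⟫_ℝ} with hB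
  have hBm : MeasurableSet B := measurableSet_le (by fun_prop) (by fun_prop)
  have facts : ∀ z, z ∉ T → ‖z‖ ^ 2 < (1 + δ) * n ∧ (1 - δ) * n < ‖z‖ ^ 2 ∧
      ‖v + σ • z‖ ^ 2 ≤ (1 + 3 * δ) * n ∧ (s - δ) * r ≤ ⟪x, v + σ • z⟫_ℝ := fun z hz => by
    simp only [hT, Set.mem_union, Set.mem_ofPred_eq, not_or, not_le] at hz
    obtain ⟨⟨⟨b1, b2⟩, b3⟩, b4⟩ := hz
    have c3 : ⟪x, z⟫_ℝ < δ * r := by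
      have : (δ * r) * ⟪x, z⟫_ℝ < (δ * r) * (δ * r) := by
        rw [← hr2] at b3; linarith
      exact lt_of_mul_lt_mul_left this (by positivity)
    have c4 : -⟪x, z⟫_ℝ < δ * r := by
      have : (δ * r) * (-⟪x, z⟫_ℝ) < (δ * r) * (δ * r) := by
        rw [← hr2] at b4; linarith
      exact lt_of_mul_lt_mul_left this (by positivity)
    have hvn : ‖v‖ ^ 2 = s ^ 2 * n := by
      rw [hv, norm_smul, hx, mul_one, Real.norm_eq_abs, sq_abs, mul_pow, hr2]
    have hxx : ⟪x, x⟫_ℝ = 1 := by rw [real_inner_self_eq_norm_sq, hx, one_pow]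
    refine ⟨b1, b2, ?_, ?_⟩
    · rw [norm_add_sq_real, hvn, norm_smul, mul_pow, Real.norm_eq_abs, sq_abs, hσ2, hv,
        inner_smul_left, inner_smul_right, RCLike.conj_to_real]
      have d1 : s * r * (σ * ⟪x, z⟫_ℝ) ≤ δ * n := by
        have p1 : s * r * (σ * ⟪x, z⟫_ℝ) ≤ s * r * (σ * (δ * r)) := by gcongr
        have p2 : s * r * (σ * (δ * r)) = (s * σ) * (δ * n) := by rw [← hr2]; ring
        have p3 : s * σ ≤ 1 := mul_le_one₀ hs1.le hσ.le hσ1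
        have p4 : 0 ≤ δ * n := by positivity
        rw [p2] at p1
        have p5 := mul_le_mul_of_nonneg_right p3 p4
        linarith
      have d2 : (1 - s ^ 2) * ‖z‖ ^ 2 ≤ (1 - s ^ 2) * ((1 + δ) * n) :=
        mul_le_mul_of_nonneg_left b1.le hs2.le
      have d3 : 0 ≤ s ^ 2 * (δ * n) := by positivity
      linarith
    · rw [inner_add_right, hv, inner_smul_right, inner_smul_right, hxx]
      have : σ * (-⟪x, z⟫_ℝ) ≤ 1 * (δ * r) := by
        have q0 : 0 ≤ δ * r := by positivity
        have q1 : σ * (-⟪x, z⟫_ℝ) ≤ σ * (δ * r) := by gcongr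
        exact q1.trans (mul_le_mul_of_nonneg_right hσ1 q0)
      linarith
  set B' : Set E := {y | (1 - δ) * n < ‖σ⁻¹ • (y - v)‖ ^ 2 ∧ ‖y‖ ^ 2 ≤ (1 + 3 * δ) * n ∧
    (s - δ) * r ≤ ⟪x, y⟫_ℝ} with hB'
  have hB'm : MeasurableSet B' := by
    have m1 : MeasurableSet {y : E | (1 - δ) * n < ‖σ⁻¹ • (y - v)‖ ^ 2} :=
      measurableSet_lt (by fun_prop) (by fun_prop)
    have m2 : MeasurableSet {y : E | ‖y‖ ^ 2 ≤ (1 + 3 * δ) * n} :=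
      measurableSet_le (by fun_prop) (by fun_prop)
    have m3 : MeasurableSet {y : E | (s - δ) * r ≤ ⟪x, y⟫_ℝ} :=
      measurableSet_le (by fun_prop) (by fun_prop)
    exact m1.inter (m2.inter m3)
  have hz : ∀ z : E, σ⁻¹ • (v + σ • z - v) = z := fun z => by
    rw [add_sub_cancel_left, smul_smul, inv_mul_cancel₀ hσ.ne', one_smul]
  have hlogσ : log σ = (1 / 2) * log (1 - s ^ 2) := by rw [hσdef, Real.log_sqrt hs2.le]; ring
  have t1 := tilt_le v hσ (K := n * (-(1 / 2) * log (1 - s ^ 2) + 2 * δ)) hB'm fun z h => by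
    simp only [hB', Set.mem_ofPred_eq, hz] at h
    rw [hlogσ]
    have h1 := h.1
    have h2 := h.2.1
    linarith
  have t2 : 1 / 2 ≤ (stdGaussian E).real {z | v + σ • z ∈ B'} := by
    have : Tᶜ ⊆ {z | v + σ • z ∈ B'} := fun z h => by
      have := facts z h
      simp only [hB', Set.mem_ofPred_eq, hz]
      exact ⟨this.2.1, this.2.2.1, this.2.2.2⟩
    have h1 := measureReal_mono (μ := stdGaussian E) this
    rw [measureReal_compl hTm, probReal_univ] at h1
    linarith
  have t3 : (stdGaussian E).real B' ≤ (stdGaussian E).real B := by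
    refine measureReal_mono fun y h => ?_
    simp only [hB', Set.mem_ofPred_eq] at h
    simp only [hB, Set.mem_ofPred_eq]
    have hpos : 0 ≤ (s - δ) * r := mul_nonneg (by linarith) hr0.le
    refine le_trans (abs_le_of_sq_le_sq' ?_ hpos).2 h.2.2
    calc (α * ‖y‖) ^ 2 = α ^ 2 * ‖y‖ ^ 2 := by ring
      _ ≤ α ^ 2 * ((1 + 3 * δ) * n) := by gcongr; exact h.2.1
      _ = α ^ 2 * (1 + 3 * δ) * n := by ring
      _ ≤ (s - δ) ^ 2 * n := by gcongr
      _ = ((s - δ) * r) ^ 2 := by rw [mul_pow, hr2]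
  have t4 : 1 / 2 ≤ exp (n * (-(1 / 2) * log (1 - s ^ 2) + 2 * δ)) * (stdGaussian E).real B :=
    (t2.trans t1).trans (mul_le_mul_of_nonneg_left t3 (exp_pos _).le)
  rw [mul_comm, ← div_le_iff₀ (exp_pos _), div_eq_mul_inv, ← exp_neg] at t4
  refine le_trans ?_ t4
  have : exp (-(ε / 4) * n) ≤ 1 / 2 := by linarith
  refine le_trans ?_ (mul_le_mul_of_nonneg_right this (exp_pos _).le)
  rw [← exp_add]
  refine exp_le_exp.2 ?_
  have g1 : n * (-(1 / 2) * log (1 - s ^ 2)) ≤ n * (-(1 / 2) * log (1 - α ^ 2) + ε / 4) :=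
    mul_le_mul_of_nonneg_left hsε.le hn0.le
  have g2 : n * δ ≤ n * (ε / 8) := mul_le_mul_of_nonneg_left hδ4.le hn0.le
  have g3 : 0 < n * ε := by positivity
  linarith
end GaussRel

namespace GaussRel
open ProbabilityTheory
open scoped InnerProductSpace
set_option linter.unusedSectionVars false

/-- Exponential growth rate of the dimension of harmonics of degree `u * n` on the sphere. -/
noncomputable def hrate (u : ℝ) : ℝ := (1 + u) * log (1 + u) - u * log u

/-- The degree, relative to the dimension, at which the largest zero of the ultraspherical
polynomial is `α`. -/
noncomputable def kap (α : ℝ) : ℝ := ((√(1 - α ^ 2))⁻¹ - 1) / 2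

lemma hrate_nonneg {u : ℝ} (hu : 0 < u) : 0 ≤ hrate u := by
  have h1 : 0 ≤ log (1 + u) := log_nonneg (by linarith)
  have h2 : log u ≤ log (1 + u) := log_le_log hu (by linarith)
  rw [hrate]
  nlinarith

lemma kap_pos {α : ℝ} (hα : 0 < α) (hα1 : α < 1) : 0 < kap α := by
  have h1 : 0 < 1 - α ^ 2 := by nlinarith
  have h2 : √(1 - α ^ 2) < 1 := by
    rw [Real.sqrt_lt' one_pos]; nlinarith
  have := (one_lt_inv₀ (sqrt_pos.2 h1)).2 h2
  rw [kap]
  linarith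

lemma one_add_two_kap {α : ℝ} (hα : 0 < α) (hα1 : α < 1) :
    (1 + 2 * kap α) ^ 2 * (1 - α ^ 2) = 1 := by
  have h1 : 0 < 1 - α ^ 2 := by nlinarith
  have h2 : √(1 - α ^ 2) ≠ 0 := (sqrt_pos.2 h1).ne'
  rw [kap]
  nth_rewrite 2 [← Real.sq_sqrt h1.le]
  field_simp
  ring

lemma hdim_le_choose {k : ℕ} (hk : 1 ≤ k) (i : ℕ) :
    hdim k i ≤ (2 * i + k) / k * ((i + k).choose i : ℝ) := by
  have hk' : (0 : ℝ) < k := by exact_mod_cast hk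
  induction i with
  | zero => simp [hdim, hk'.ne']
  | succ i ih =>
    have hc : ((i + 1 : ℕ) : ℝ) * ((i + 1 + k).choose (i + 1) : ℝ) =
        (i + k + 1) * ((i + k).choose i : ℝ) := by
      have := Nat.add_one_mul_choose_eq (i + k) i
      have e : i + 1 + k = (i + k).succ := by omega
      rw [e]
      have h2 : (((i + k).succ * (i + k).choose i : ℕ) : ℝ) =
        (((i + k).succ.choose i.succ * i.succ : ℕ) : ℝ) := by exact_mod_cast this
      push_cast at h2 ⊢
      linarith
    rw [hdim]
    have hi : (0 : ℝ) < i + 1 := by positivity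
    have hc' : ((i + 1 + k).choose (i + 1) : ℝ) =
        (i + k + 1) / (i + 1) * ((i + k).choose i : ℝ) := by
      rw [div_mul_eq_mul_div, eq_div_iff hi.ne', ← hc]
      push_cast; ring
    rw [hc']
    have hd : (0 : ℝ) < 2 * i + k := by positivity
    calc hdim k i * ((k + 2 + 2 * i) * (i + k) / ((i + 1) * (2 * i + k)))
        ≤ ((2 * i + k) / k * ((i + k).choose i : ℝ)) *
          ((k + 2 + 2 * i) * (i + k) / ((i + 1) * (2 * i + k))) := by gcongr
      _ = (2 * (i + 1 : ℕ) + k) / k * ((i + k) / (i + 1) * ((i + k).choose i : ℝ)) := by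
        push_cast; field_simp; ring
      _ ≤ (2 * (i + 1 : ℕ) + k) / k * ((i + k + 1) / (i + 1) * ((i + k).choose i : ℝ)) := by
        have : ((i : ℝ) + k) / (i + 1) ≤ (i + k + 1) / (i + 1) :=
          div_le_div_of_nonneg_right (by linarith) hi.le
        gcongr

lemma choose_mul_pow_le_one {x : ℝ} (hx : 0 ≤ x) (hx1 : x ≤ 1) (i k : ℕ) :
    ((i + k).choose i : ℝ) * (x ^ i * (1 - x) ^ k) ≤ 1 := by
  have h := add_pow x (1 - x) (i + k)
  rw [add_sub_cancel, one_pow] at h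
  refine le_trans (le_trans (le_of_eq ?_) (Finset.single_le_sum
    (f := fun m => x ^ m * (1 - x) ^ (i + k - m) * ((i + k).choose m : ℝ))
    (fun m _ => ?_) (show i ∈ Finset.range (i + k + 1) by simp))) h.ge
  · simp only [Nat.add_sub_cancel_left]; ring
  · have : 0 ≤ 1 - x := by linarith
    positivity

lemma hdim_le_exp {k : ℕ} (hk : 1 ≤ k) {u : ℝ} (hu : 0 < u) {i : ℕ} (hi : i ≤ u * k) :
    hdim k i ≤ (2 * u + 1) * exp (k * hrate u) := by
  have hk' : (0 : ℝ) < k := by exact_mod_cast hk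
  have hu1 : 0 < 1 + u := by linarith
  have h1 := choose_mul_pow_le_one (x := u / (1 + u)) (by positivity)
    ((div_le_one hu1).2 (by linarith)) i k
  have e1 : 1 - u / (1 + u) = (1 + u)⁻¹ := by field_simp; ring
  have e2 : (u / (1 + u)) ^ i * (1 - u / (1 + u)) ^ k =
      exp (-(i * (log (1 + u) - log u) + k * log (1 + u))) := by
    rw [e1, ← Real.exp_log (show 0 < u / (1 + u) by positivity),
      ← Real.exp_log (show 0 < (1 + u)⁻¹ by positivity), ← exp_nat_mul, ← exp_nat_mul, ← exp_add,
      Real.log_div hu.ne' hu1.ne', Real.log_inv]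
    congr 1; ring
  rw [e2, exp_neg, ← div_eq_mul_inv, div_le_one (exp_pos _)] at h1
  have h2 : exp (i * (log (1 + u) - log u) + k * log (1 + u)) ≤ exp (k * hrate u) := by
    refine exp_le_exp.2 ?_
    have : 0 ≤ log (1 + u) - log u := sub_nonneg.2 (log_le_log hu (by linarith))
    have := mul_le_mul_of_nonneg_right hi this
    rw [hrate]
    linarith
  refine (hdim_le_choose hk i).trans (mul_le_mul ?_ (h1.trans h2) (by positivity) (by positivity))
  rw [div_le_iff₀ hk']
  linarith

lemma hdim_add_le {N κ : ℝ} (hN : 2 ≤ N) (hκ : 0 < κ) {i₀ : ℕ} (h : κ * N ≤ 2 * i₀) (d : ℕ) :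
    hdim N (i₀ + d) ≤ (2 * (1 + 2 / κ)) ^ d * hdim N i₀ := by
  have hN0 : 0 < N := by linarith
  induction d with
  | zero => simp
  | succ d ih =>
    have hpos := hdim_pos hN0 (i₀ + d)
    rw [← add_assoc, hdim, pow_succ]
    set i := i₀ + d with hi
    have hi0 : (i₀ : ℝ) ≤ i := by exact_mod_cast Nat.le_add_right _ _
    have h1 : (N + 2 + 2 * i) * (i + N) / ((i + 1) * (2 * i + N)) ≤ 2 * (1 + 2 / κ) := by
      rw [mul_div_mul_comm, div_mul_div_comm, mul_comm, div_le_iff₀ (by positivity)]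
      have f1 : N + 2 + 2 * (i : ℝ) ≤ 2 * (2 * i + N) := by
        have : (0 : ℝ) ≤ i := by positivity
        linarith
      have f2 : i + N ≤ (1 + 2 / κ) * ((i : ℝ) + 1) := by
        have : N ≤ 2 / κ * i := by
          rw [div_mul_eq_mul_div, le_div_iff₀ hκ]; linarith
        have : 0 < 2 / κ := by positivity
        nlinarith
      have := mul_le_mul f1 f2 (by positivity) (by positivity)
      linarith
    calc hdim N i * _ ≤ ((2 * (1 + 2 / κ)) ^ d * hdim N i₀) * (2 * (1 + 2 / κ)) :=
          mul_le_mul ih h1 (by positivity) (by have := hdim_pos hN0 i₀; positivity)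
      _ = _ := by ring

lemma le_bc {N v b : ℝ} (hN : 2 ≤ N) (hv : 0 < v) (hb : (2 * b) ^ 2 = 1 - (v ^ 2)⁻¹) {i : ℕ}
    (hi : v * N ≤ 2 * i + N) : b ≤ bc N i := by
  refine Real.le_sqrt_of_sq_le ?_
  have hi0 : (0 : ℝ) ≤ i := by positivity
  have e : b ^ 2 = (1 - (v ^ 2)⁻¹) / 4 := by linarith
  rw [e, div_le_div_iff₀ (by norm_num) (by positivity)]
  have h1 : (N / (2 * i + N)) ^ 2 ≤ (v ^ 2)⁻¹ := by
    rw [← inv_pow]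
    refine pow_le_pow_left₀ (by positivity) ?_ 2
    rw [div_le_iff₀ (by positivity), inv_mul_eq_div, le_div_iff₀ hv]
    linarith
  have h2 : 0 < (2 * i + N) * (2 * i + 2 + N) := by positivity
  have h3 : (1 - (v ^ 2)⁻¹) * ((2 * i + N) * (2 * i + 2 + N)) ≤
      (1 - (N / (2 * i + N)) ^ 2) * ((2 * i + N) * (2 * i + 2 + N)) := by
    refine mul_le_mul_of_nonneg_right (by linarith) h2.le
  refine h3.trans (le_of_sub_nonneg ?_)
  have e2 : (i + 1) * (i + N) * 4 - (1 - (N / (2 * i + N)) ^ 2) * ((2 * i + N) * (2 * i + 2 + N)) =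
      2 * N + 2 * N ^ 2 / (2 * i + N) := by
    field_simp
    ring
  rw [e2]
  have : 0 ≤ 2 * N ^ 2 / (2 * i + N) := by positivity
  linarith

/-- Orthonormal ultraspherical polynomials of degree slightly beyond the critical one. -/
lemma pk_sq_le {N α : ℝ} (hN : 2 ≤ N) (hα : 0 < α) (hα1 : α < 1) {i₀ : ℕ}
    (hi : kap α * N ≤ 2 * i₀) (hi' : i₀ ≤ kap α * N) :
    0 < sg N i₀ α 1 ∧ ∀ t, α ≤ t → t ≤ 1 → sg N i₀ α 1 ≤ sg N i₀ t 1 ∧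
      ∀ d, pk N (i₀ + d) t ^ 2 ≤ (32 * (1 + 2 / kap α)) ^ d * (1 + α⁻¹) ^ 2 *
        (hdim N i₀ * sg N i₀ α 1 ^ 2) * exp (N * (α / (1 - α ^ 2)) * (t - α)) := by
  have hN0 : 0 < N := by linarith
  have hκ := kap_pos hα hα1
  have hκ2 := one_add_two_kap hα hα1
  have hα2 : 0 < 1 - α ^ 2 := by nlinarith
  have hi0 : (0 : ℝ) < i₀ := by nlinarith
  set κ := kap α with hκdef
  have hκ3 : 4 * κ * (1 + κ) * (1 - α ^ 2) = α ^ 2 := by linear_combination hκ2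
  set c := α * N / (2 * i₀ * (1 - α ^ 2)) with hc
  have hκ4 : 2 * κ * (1 - α ^ 2) ≤ α ^ 2 := by
    rw [← hκ3]
    nlinarith [mul_pos hκ hα2, mul_pos (mul_pos hκ hκ) hα2]
  have hc1 : 1 ≤ α * c := by
    rw [hc, mul_div_assoc', le_div_iff₀ (by positivity)]
    have : i₀ * (1 - α ^ 2) ≤ κ * N * (1 - α ^ 2) := mul_le_mul_of_nonneg_right hi' hα2.le
    have := mul_le_mul_of_nonneg_right hκ4 hN0.le
    linarith
  have hc2 : i₀ * ((1 - α ^ 2) * c ^ 2 + 1) + N * (1 - α * c) ≤ 0 := by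
    have e : i₀ * ((1 - α ^ 2) * c ^ 2 + 1) + N * (1 - α * c) =
        (4 * i₀ * (i₀ + N) * (1 - α ^ 2) - α ^ 2 * N ^ 2) / (4 * i₀ * (1 - α ^ 2)) := by
      rw [hc]; field_simp; ring
    rw [e]
    refine div_nonpos_of_nonpos_of_nonneg ?_ (by positivity)
    have : i₀ * (i₀ + N) ≤ κ * N * (κ * N + N) := by gcongr
    have := mul_le_mul_of_nonneg_right this hα2.le
    have e2 : 4 * (κ * N * (κ * N + N) * (1 - α ^ 2)) = α ^ 2 * N ^ 2 := by
      linear_combination N ^ 2 * hκ3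
    linarith
  have hg := fun {t} (h1 : α ≤ t) (h2 : t ≤ 1) => sg_growth hN0 hα hα1 hc1 hc2 h1 h2
  have hP := (hg le_rfl hα1.le).1
  refine ⟨hP, fun t ht ht1 => ⟨(hg ht ht1).2.1, fun d => ?_⟩⟩
  have hr := sg_ratio hN0 hα hc1 hc2 ht ht1 i₀ le_rfl
  have hgr := (hg ht ht1).2.2
  set S := sg N i₀ t 1 with hS
  set P := sg N i₀ α 1 with hPd
  have hS0 : 0 < S := hr.1
  have h1 := sg_abs_growth hN0 (t := t) (abs_le.2 ⟨by linarith, ht1⟩) i₀ d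
  rw [abs_of_pos hr.1, abs_of_pos hr.2.1] at h1
  have h2 : sg N (i₀ + 1) t 1 ≤ α⁻¹ * S := by
    rw [inv_mul_eq_div, le_div_iff₀ hα]
    nlinarith [hr.2.2.2, hr.2.1]
  have h3 : |sg N (i₀ + d) t 1| ≤ 4 ^ d * ((1 + α⁻¹) * S) := by
    have : (4 : ℝ) ^ d * (S + sg N (i₀ + 1) t 1) ≤ 4 ^ d * ((1 + α⁻¹) * S) := by
      gcongr; linarith
    linarith [abs_nonneg (sg N (i₀ + d + 1) t 1)]
  have h4 : sg N (i₀ + d) t 1 ^ 2 ≤ 16 ^ d * (1 + α⁻¹) ^ 2 * S ^ 2 := by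
    rw [← sq_abs]
    refine (pow_le_pow_left₀ (abs_nonneg _) h3 2).trans (le_of_eq ?_)
    rw [mul_pow, mul_pow, ← pow_mul, mul_comm d 2, pow_mul]
    norm_num
    ring
  have h5 : S ^ 2 ≤ P ^ 2 * exp (N * (α / (1 - α ^ 2)) * (t - α)) := by
    refine (pow_le_pow_left₀ hS0.le hgr 2).trans (le_of_eq ?_)
    rw [mul_pow, ← exp_nat_mul, mul_comm]
    congr 2
    rw [hc]
    push_cast
    field_simp
  have hH := hdim_add_le hN hκ hi d
  rw [pk, mul_pow, Real.sq_sqrt (hdim_pos hN0 _).le]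
  have hH0 := hdim_pos hN0 i₀
  calc hdim N (i₀ + d) * sg N (i₀ + d) t 1 ^ 2 ≤
      ((2 * (1 + 2 / κ)) ^ d * hdim N i₀) * (16 ^ d * (1 + α⁻¹) ^ 2 *
        (P ^ 2 * exp (N * (α / (1 - α ^ 2)) * (t - α)))) := by
        refine mul_le_mul hH (h4.trans ?_) (sq_nonneg _) (by positivity)
        gcongr
    _ = _ := by
      rw [show 32 * (1 + 2 / κ) = 2 * (1 + 2 / κ) * 16 by ring, mul_pow (2 * (1 + 2 / κ))]
      ring

end GaussRel

namespace GaussRel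
open ProbabilityTheory
open scoped InnerProductSpace
set_option linter.unusedSectionVars false

lemma continuousAt_hrate {u : ℝ} (hu : 0 < u) : ContinuousAt hrate u := by
  have h1 : 1 + u ≠ 0 := by positivity
  have h2 : u ≠ 0 := hu.ne'
  unfold hrate
  fun_prop (disch := assumption)

set_option maxHeartbeats 1600000 in
open Classical in
/-- A spherical code of rate larger than `ψ(arccos α)` has many pairs of codewords with inner
product at least `α`, counted with exponential weights. -/
lemma sum_exp_inner_ge {α ε : ℝ} (hα : 0 < α) (hα1 : α < 1) (hε : 0 < ε) : ∃ n₀ : ℕ,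
    ∀ (E : Type) [NormedAddCommGroup E] [InnerProductSpace ℝ E] [FiniteDimensional ℝ E]
    [MeasurableSpace E] [BorelSpace E], n₀ ≤ Module.finrank ℝ E → ∀ (C : Finset E) (u : E → E),
    (∀ x ∈ C, ‖u x‖ = 1) → exp (Module.finrank ℝ E * (hrate (kap α) + ε)) ≤ C.card →
    (C.card : ℝ) ^ 2 * exp (Module.finrank ℝ E * (1 / 2 * log (1 - α ^ 2) - ε)) ≤
      ∑ x ∈ C, ∑ y ∈ C.filter (fun y => y ≠ x ∧ α ≤ ⟪u x, u y⟫_ℝ),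
        exp (Module.finrank ℝ E * (α / (1 - α ^ 2)) * (⟪u x, u y⟫_ℝ - α)) := by
  have hκ := kap_pos hα hα1
  have hκ2 := one_add_two_kap hα hα1
  have hα2 : 0 < 1 - α ^ 2 := by nlinarith
  set κ := kap α with hκdef
  set L := log (32 * (1 + 2 / κ)) with hL
  have hL0 : 0 < L := log_pos (by have : 0 < 2 / κ := by positivity
                                  linarith)
  obtain ⟨e, ⟨he1, he2⟩, he⟩ : ∃ e, (hrate (κ + 2 * e) < hrate κ + ε / 8 ∧ e < ε / (16 * L)) ∧
      0 < e := by
    have hc : ContinuousAt (fun e => hrate (κ + 2 * e)) 0 := by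
      have h1 : ContinuousAt (fun e : ℝ => κ + 2 * e) 0 := by fun_prop
      exact ContinuousAt.comp (g := hrate) (by simpa using continuousAt_hrate hκ) h1
    have e := ((hc.eventually_lt (continuousAt_const (y := hrate κ + ε / 8)) (by simp [hε])).and
      (eventually_lt_nhds (a := (0 : ℝ)) (b := ε / (16 * L)) (by positivity))).filter_mono
      (nhdsWithin_le_nhds (s := Set.Ioi 0))
    exact (e.and self_mem_nhdsWithin).exists
  have he3 : e * L ≤ ε / 16 := by
    have := (lt_div_iff₀ (by positivity)).1 he2
    linarith
  set v := 1 + 2 * κ + e with hv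
  have hv0 : 0 < v := by positivity
  have hv1 : 0 < 1 - (v ^ 2)⁻¹ := by
    have : (v ^ 2)⁻¹ < 1 := inv_lt_one_of_one_lt₀ (by nlinarith)
    linarith
  set α₂ := √(1 - (v ^ 2)⁻¹) with hα₂
  have hα₂s : α₂ ^ 2 = 1 - (v ^ 2)⁻¹ := sq_sqrt hv1.le
  have hαα₂ : α < α₂ := by
    refine Real.lt_sqrt_of_sq_lt ?_
    have h1 : (v ^ 2)⁻¹ < 1 - α ^ 2 := by
      rw [inv_lt_iff_one_lt_mul₀ (by positivity), mul_comm]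
      exact hκ2.symm.trans_lt <| mul_lt_mul_of_pos_right
        (pow_lt_pow_left₀ (by linarith) (by positivity) two_ne_zero) hα2
    linarith
  set η := (α₂ - α) / 2 with hη
  have hη0 : 0 < η := by rw [hη]; linarith
  set w := ⌈α₂ / η⌉₊ with hw
  have hw0 : 1 ≤ w := Nat.one_le_iff_ne_zero.2 (Nat.ceil_pos.2 (by
    have : 0 < α₂ := hα.trans hαα₂
    positivity)).ne'
  have hw1 : α₂ ≤ η * w := by
    have := Nat.le_ceil (α₂ / η)
    rw [div_le_iff₀ hη0] at this
    linarith
  set A := w * (1 + α⁻¹) ^ 2 * exp (ε / 8) with hA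
  have hA0 : 0 < A := by
    have : (0 : ℝ) < w := by exact_mod_cast hw0
    positivity
  obtain ⟨n₁, hn₁⟩ := cap_prob hα hα1 (show 0 < ε / 4 by positivity)
  have tN : Tendsto (fun n : ℕ => (n : ℝ)) atTop atTop := tendsto_natCast_atTop_atTop
  have ev : ∀ c : ℝ, 0 < c → ∀ᶠ n : ℕ in atTop, exp (-(ε / 4) * n) ≤ c := fun c hc =>
    ((((tendsto_exp_neg_mul (show 0 < ε / 4 by positivity)).comp tN)).eventually_lt_const hc).mono
      fun n hn => hn.le
  obtain ⟨n₂, hn₂⟩ := eventually_atTop.1 ((ev (η / (2 * (w * (2 * (κ + 2 * e) + 1)))) (by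
    have : (0 : ℝ) < w := by exact_mod_cast hw0
    positivity)).and ((ev (η / (2 * A)) (by positivity)).and
    (tN.eventually_ge_atTop ((w + 4) / e + 4 / κ + 4))))
  refine ⟨max n₁ n₂, fun E _ _ _ _ _ hn C u hC hM => ?_⟩
  obtain ⟨k1, k2, k3⟩ := hn₂ _ ((le_max_right _ _).trans hn)
  have hcap := hn₁ E ((le_max_left _ _).trans hn)
  set n := Module.finrank ℝ E with hnd
  have q1 : 0 < (w + 4) / e := by positivity
  have q2 : 0 < 4 / κ := by positivity
  have hn4 : (4 : ℝ) ≤ n := by linarith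
  have hn4' : 4 ≤ n := by exact_mod_cast hn4
  obtain ⟨k, hk⟩ : ∃ k, n = k + 2 := ⟨n - 2, by omega⟩
  have hE : 2 < n := by omega
  have hNk : (n : ℝ) - 2 = k := by rw [hk]; push_cast; ring
  set N : ℝ := (k : ℝ) with hN
  have hN2 : 2 ≤ N := by linarith
  have hN0 : 0 < N := by linarith
  have hNn : N ≤ n := by linarith
  have hNe : w + 4 ≤ e * N := by
    have : (w + 4) / e ≤ N := by linarith
    rw [div_le_iff₀ he] at this; linarith
  have hNκ : 2 ≤ κ * N := by
    have : 4 / κ ≤ N := by linarith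
    rw [div_le_iff₀ hκ] at this; linarith
  set i₀ := ⌊κ * N⌋₊ with hi₀
  have hi₀1 : (i₀ : ℝ) ≤ κ * N := Nat.floor_le (by positivity)
  have hi₀2 : κ * N < i₀ + 1 := Nat.lt_floor_add_one _
  set d₀ := ⌈e * N⌉₊ with hd₀
  have hd₀1 : e * N ≤ d₀ := Nat.le_ceil _
  have hd₀2 : d₀ < e * N + 1 := Nat.ceil_lt_add_one (by positivity)
  set m := i₀ + d₀ with hm
  have hm1 : 1 ≤ m := by
    have hw' : (0 : ℝ) ≤ w := Nat.cast_nonneg w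
    have : (0 : ℝ) < d₀ := by linarith
    have : 0 < d₀ := by exact_mod_cast this
    omega
  have hdimw : ∀ j ∈ Finset.Ico m (m + w), ((j : ℝ) + 1) - i₀ ≤ 2 * e * N ∧
      ((j + 1 : ℕ) : ℝ) ≤ (κ + 2 * e) * N := fun j hj => by
    rw [Finset.mem_Ico] at hj
    have h1 : (j : ℝ) + 1 ≤ i₀ + d₀ + w := by
      have : j + 1 ≤ i₀ + d₀ + w := by omega
      exact_mod_cast this
    have hw' : (0 : ℝ) ≤ w := by positivity
    push_cast
    constructor <;> linarith
  have hHs : ∑ i ∈ Finset.Ico m (m + w), hdim N (i + 1) ≤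
      w * ((2 * (κ + 2 * e) + 1) * exp (N * hrate (κ + 2 * e))) := by
    refine (Finset.sum_le_card_nsmul _ _ _ fun j hj =>
      hdim_le_exp (k := k) (by omega) (by positivity) (hdimw j hj).2).trans (le_of_eq ?_)
    rw [Nat.card_Ico, Nat.add_sub_cancel_left, nsmul_eq_mul]
  have hM' : 2 * ∑ i ∈ Finset.Ico m (m + w), hdim N (i + 1) ≤ η * C.card := by
    have h1 : exp (N * hrate (κ + 2 * e)) ≤
        exp (-(ε / 4) * n) * exp (n * (hrate κ + ε)) := by
      rw [← exp_add]
      refine exp_le_exp.2 ?_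
      have h0 := hrate_nonneg (u := κ + 2 * e) (by positivity)
      have h2 := mul_le_mul_of_nonneg_right hNn h0
      have h3 : n * hrate (κ + 2 * e) ≤ n * (hrate κ + ε / 8) :=
        mul_le_mul_of_nonneg_left he1.le (by positivity)
      have h4 : 0 ≤ n * ε := by positivity
      linarith
    have hw' : (0 : ℝ) < w := by exact_mod_cast hw0
    rw [le_div_iff₀ (by positivity)] at k1
    calc _ ≤ 2 * (w * ((2 * (κ + 2 * e) + 1) * (exp (-(ε / 4) * n) * exp (n * (hrate κ + ε))))) := by
          refine mul_le_mul_of_nonneg_left (hHs.trans ?_) (by norm_num)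
          gcongr
      _ = (exp (-(ε / 4) * n) * (2 * (w * (2 * (κ + 2 * e) + 1)))) * exp (n * (hrate κ + ε)) := by
          ring
      _ ≤ η * C.card := mul_le_mul k1 hM (exp_pos _).le hη0.le
  have hlp := lp_sum (E := E) hE hC hα.le hη0 (b := α₂ / 2) hm1 (fun i hi => by
    rw [← hnd, hNk]
    refine le_bc hN2 hv0 (by rw [← hα₂s]; ring) ?_
    have : (m : ℝ) ≤ i := by exact_mod_cast hi
    rw [hm] at this
    push_cast at this
    linarith [hv]) (by positivity) hw0 (by
    rw [show 2 * (α₂ / 2) - α - η = η by rw [hη]; ring]; linarith) (by rw [← hnd, hNk]; exact hM')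
  rw [← hnd, hNk] at hlp
  rcases C.eq_empty_or_nonempty with hCe | ⟨x₀, hx₀⟩
  · subst hCe; simp
  obtain ⟨hP, hpk⟩ := pk_sq_le hN2 hα hα1 (i₀ := i₀) (by rw [← hκdef]; linarith) hi₀1
  rw [← hκdef] at hpk
  set P := sg N i₀ α 1 with hPd
  have hcapb := hdim_mul_sq_mul_cap_le hE (hC x₀ hx₀) (P := P) (i := i₀) hα1.le hP.le
    fun t h1 h2 => by rw [← hnd, hNk]; exact (hpk t h1 h2).1
  rw [← hnd, hNk] at hcapb
  have hHP : hdim N i₀ * P ^ 2 ≤ exp (n * (-(1 / 2) * log (1 - α ^ 2) + ε / 4)) := by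
    have h0 : 0 ≤ hdim N i₀ * P ^ 2 := mul_nonneg (hdim_pos hN0 _).le (sq_nonneg _)
    have := (mul_le_mul_of_nonneg_left (hcap (u x₀) (hC x₀ hx₀)) h0).trans hcapb
    rwa [exp_neg, ← div_eq_mul_inv, div_le_one (exp_pos _)] at this
  have hpt : ∀ x ∈ C, ∀ y ∈ C.filter (fun y => y ≠ x ∧ α ≤ ⟪u x, u y⟫_ℝ),
      ∑ i ∈ Finset.Ico m (m + w), pk N (i + 1) ⟪u x, u y⟫_ℝ ^ 2 ≤
      A * exp (n * (-(1 / 2) * log (1 - α ^ 2) + ε / 2)) *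
        exp (n * (α / (1 - α ^ 2)) * (⟪u x, u y⟫_ℝ - α)) := fun x hx y hy => by
    rw [Finset.mem_filter] at hy
    have ht1 : ⟪u x, u y⟫_ℝ ≤ 1 := by
      have := real_inner_le_norm (u x) (u y)
      rwa [hC x hx, hC y hy.1, one_mul] at this
    set t := ⟪u x, u y⟫_ℝ
    refine (Finset.sum_le_card_nsmul _ _ ((1 + α⁻¹) ^ 2 * exp (n * (ε / 8)) *
      exp (n * (-(1 / 2) * log (1 - α ^ 2) + ε / 4)) *
        exp (n * (α / (1 - α ^ 2)) * (t - α))) fun j hj => ?_).trans ?_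
    · have hj' := hdimw j hj
      rw [Finset.mem_Ico] at hj
      obtain ⟨d, hd⟩ : ∃ d, j + 1 = i₀ + d := ⟨j + 1 - i₀, by omega⟩
      rw [hd]
      refine ((hpk t hy.2.2 ht1).2 d).trans ?_
      have g1 : (32 * (1 + 2 / κ)) ^ d ≤ exp (n * (ε / 8)) := by
        rw [← Real.exp_log (show 0 < 32 * (1 + 2 / κ) by positivity), ← hL, ← exp_nat_mul]
        refine exp_le_exp.2 ?_
        have hd' : (d : ℝ) ≤ 2 * e * N := by
          have : (j : ℝ) + 1 = i₀ + d := by exact_mod_cast hd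
          linarith [hj'.1]
        have g2 : d * L ≤ 2 * e * N * L := mul_le_mul_of_nonneg_right hd' hL0.le
        have g3 : N * (e * L) ≤ N * (ε / 16) := mul_le_mul_of_nonneg_left he3 hN0.le
        have g4 : N * ε ≤ n * ε := mul_le_mul_of_nonneg_right hNn hε.le
        linarith
      have g5 : exp (N * (α / (1 - α ^ 2)) * (t - α)) ≤ exp (n * (α / (1 - α ^ 2)) * (t - α)) := by
        refine exp_le_exp.2 ?_
        have : 0 ≤ t - α := sub_nonneg.2 hy.2.2
        gcongr
      rw [mul_comm ((1 + α⁻¹) ^ 2)]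
      have : 0 ≤ hdim N i₀ * P ^ 2 := mul_nonneg (hdim_pos hN0 _).le (sq_nonneg _)
      gcongr
    · rw [Nat.card_Ico, Nat.add_sub_cancel_left, nsmul_eq_mul, hA]
      have : exp (n * (ε / 8)) * exp (n * (-(1 / 2) * log (1 - α ^ 2) + ε / 4)) ≤
          exp (ε / 8) * exp (n * (-(1 / 2) * log (1 - α ^ 2) + ε / 2)) := by
        rw [← exp_add, ← exp_add]
        refine exp_le_exp.2 ?_
        have : 0 ≤ n * ε := by positivity
        linarith
      calc _ = w * (1 + α⁻¹) ^ 2 * (exp (n * (ε / 8)) *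
            exp (n * (-(1 / 2) * log (1 - α ^ 2) + ε / 4))) *
              exp (n * (α / (1 - α ^ 2)) * (t - α)) := by ring
        _ ≤ w * (1 + α⁻¹) ^ 2 * (exp (ε / 8) *
            exp (n * (-(1 / 2) * log (1 - α ^ 2) + ε / 2))) *
              exp (n * (α / (1 - α ^ 2)) * (t - α)) := by gcongr
        _ = _ := by ring
  have hfin := hlp.trans (Finset.sum_le_sum fun x hx => Finset.sum_le_sum (hpt x hx))
  simp only [← Finset.mul_sum] at hfin
  set S := ∑ x ∈ C, ∑ y ∈ C.filter (fun y => y ≠ x ∧ α ≤ ⟪u x, u y⟫_ℝ),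
    exp (n * (α / (1 - α ^ 2)) * (⟪u x, u y⟫_ℝ - α)) with hS
  set X := exp (n * (-(1 / 2) * log (1 - α ^ 2) + ε / 2)) with hX
  have hX0 : 0 < X := exp_pos _
  rw [le_div_iff₀ (by positivity)] at k2
  have h1 : exp (n * (1 / 2 * log (1 - α ^ 2) - ε)) * X = exp (-(ε / 4) * n) ^ 2 := by
    rw [hX, ← exp_add, ← exp_nat_mul]
    congr 1
    push_cast
    ring
  have h2 : exp (-(ε / 4) * n) ≤ 1 := exp_le_one_iff.2 (by
    have : 0 ≤ ε * n := by positivity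
    linarith)
  have h3 : A * (exp (n * (1 / 2 * log (1 - α ^ 2) - ε)) * X) ≤ η / 2 := by
    rw [h1, sq]
    have : exp (-(ε / 4) * n) * exp (-(ε / 4) * n) ≤ exp (-(ε / 4) * n) :=
      mul_le_of_le_one_left (exp_pos _).le h2
    have := mul_le_mul_of_nonneg_left this hA0.le
    linarith
  refine le_of_mul_le_mul_left ?_ (mul_pos hA0 hX0)
  have h4 := mul_le_mul_of_nonneg_left h3 (sq_nonneg (C.card : ℝ))
  linarith

end GaussRel

namespace GaussRel
open ProbabilityTheory
open scoped InnerProductSpace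
set_option linter.unusedSectionVars false

lemma hrate_lt {u v : ℝ} (hu : 0 < u) (huv : u < v) : hrate u < hrate v := by
  have hd : ∀ x, 0 < x → HasDerivAt hrate (log (1 + x) - log x) x := fun x hx => by
    have h1 : HasDerivAt (fun x : ℝ => 1 + x) 1 x := (hasDerivAt_id' x).const_add 1
    have h2 := h1.mul (h1.log (by positivity))
    have h3 := (hasDerivAt_id' x).mul ((hasDerivAt_id' x).log hx.ne')
    refine (h2.sub h3).congr_deriv ?_
    field_simp
    ring
  refine strictMonoOn_of_deriv_pos (convex_Ioi 0) (fun x hx => (hd x hx).continuousAt.continuousWithinAt)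
    (fun x hx => ?_) (Set.mem_Ioi.2 hu) (Set.mem_Ioi.2 (hu.trans huv)) huv
  rw [interior_Ioi] at hx
  rw [(hd x hx).deriv]
  exact sub_pos.2 (log_lt_log hx (by linarith))

lemma kap_lt {α β : ℝ} (hα : 0 < α) (hαβ : α < β) (hβ : β < 1) : kap α < kap β := by
  have h1 : 0 < 1 - β ^ 2 := by nlinarith
  have h2 : √(1 - β ^ 2) < √(1 - α ^ 2) := sqrt_lt_sqrt h1.le (by nlinarith)
  have h3 := inv_strictAnti₀ (sqrt_pos.2 h1) h2
  unfold kap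
  linarith

section

variable {E : Type*} [NormedAddCommGroup E] [InnerProductSpace ℝ E]

lemma norm_sub_sq_le_of_norm_sq {n a η t : ℝ} (h0 : 0 ≤ n * (a - η)) {x y : E}
    (hx : |‖x‖ ^ 2 - n * a| ≤ η * n) (hy : |‖y‖ ^ 2 - n * a| ≤ η * n) (hx0 : 0 < ‖x‖)
    (hy0 : 0 < ‖y‖) (ht0 : 0 ≤ t) (ht1 : t ≤ 1) (hηn : 0 ≤ η * n)
    (ht : t = ⟪‖x‖⁻¹ • x, ‖y‖⁻¹ • y⟫_ℝ) :
    ‖x - y‖ ^ 2 ≤ 2 * n * a * (1 - t) + 4 * (η * n) := by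
  have h1 : ⟪x, y⟫_ℝ = ‖x‖ * ‖y‖ * t := by
    rw [ht, real_inner_smul_left, real_inner_smul_right]
    field_simp
  rw [abs_le] at hx hy
  have h2 : n * (a - η) ≤ ‖x‖ * ‖y‖ := by
    refine abs_le_of_sq_le_sq' ?_ (by positivity) |>.2
    rw [mul_pow ‖x‖, sq (n * (a - η))]
    exact mul_le_mul (by linarith) (by linarith) h0 (sq_nonneg _)
  have h3 := mul_le_mul_of_nonneg_right h2 ht0
  rw [norm_sub_sq_real, h1]
  have h4 : η * n * t ≤ η * n := mul_le_of_le_one_right hηn ht1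
  linarith

end

set_option maxHeartbeats 1600000 in
open Classical in
/-- Lower bound on the error probability of codes of rate slightly below `ψ(arccos α)`. -/
lemma exists_sum_perr_ge_low_rate {a α δ : ℝ} (ha : 0 < a) (hα : 0 < α) (hα1 : α < 1)
    (haα : a * (1 - α ^ 2) = 4 * α) (hδ : 0 < δ)
    (hmain : a * (1 - α) / 8 < a * (1 - α) / 4 - 1 / 2 * log (1 - α ^ 2) - hrate (kap α)) :
    ∃ ρ η : ℝ, 0 < ρ ∧ ρ < hrate (kap α) ∧ 0 < η ∧ ∃ n₀ : ℕ,
    ∀ (E : Type) [NormedAddCommGroup E] [InnerProductSpace ℝ E] [FiniteDimensional ℝ E]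
    [MeasurableSpace E] [BorelSpace E], n₀ ≤ Module.finrank ℝ E → ∀ C : Finset E,
    (∀ x ∈ C, |‖x‖ ^ 2 - Module.finrank ℝ E * a| ≤ η * Module.finrank ℝ E) →
    exp (Module.finrank ℝ E * ρ) ≤ 2 * C.card →
    C.card * exp (-(Module.finrank ℝ E *
      (a * (1 - α) / 4 - 1 / 2 * log (1 - α ^ 2) - ρ + δ))) ≤ ∑ x ∈ C, perr C x := by
  set g : ℝ → ℝ := fun t => a * (1 - t) / 4 - 1 / 2 * log (1 - t ^ 2) with hg
  have hα2 : 0 < 1 - α ^ 2 := by nlinarith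
  change a * (1 - α) / 8 < g α - hrate (kap α) at hmain
  change ∃ ρ η : ℝ, 0 < ρ ∧ ρ < hrate (kap α) ∧ 0 < η ∧ ∃ n₀ : ℕ,
    ∀ (E : Type) [NormedAddCommGroup E] [InnerProductSpace ℝ E] [FiniteDimensional ℝ E]
    [MeasurableSpace E] [BorelSpace E], n₀ ≤ Module.finrank ℝ E → ∀ C : Finset E,
    (∀ x ∈ C, |‖x‖ ^ 2 - Module.finrank ℝ E * a| ≤ η * Module.finrank ℝ E) →
    exp (Module.finrank ℝ E * ρ) ≤ 2 * C.card →
    C.card * exp (-(Module.finrank ℝ E * (g α - ρ + δ))) ≤ ∑ x ∈ C, perr C x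
  set μ := g α - hrate (kap α) - a * (1 - α) / 8 with hμ
  have hμ0 : 0 < μ := by rw [hμ]; linarith
  obtain ⟨α', ⟨hg', h8, hα'⟩, hα'α⟩ : ∃ α', (g α' < g α + δ / 8 ∧
      a * (1 - α') / 8 < a * (1 - α) / 8 + μ / 2 ∧ 0 < α') ∧ α' < α := by
    have hne : 1 - α ^ 2 ≠ 0 := hα2.ne'
    have c1 : ContinuousAt g α := by fun_prop (disch := assumption)
    have c2 : ContinuousAt (fun t => a * (1 - t) / 8) α := by fun_prop
    have e := ((c1.eventually_lt (continuousAt_const (y := g α + δ / 8)) (by linarith)).and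
      ((c2.eventually_lt (continuousAt_const (y := a * (1 - α) / 8 + μ / 2)) (by linarith)).and
      (eventually_gt_nhds hα))).filter_mono (nhdsWithin_le_nhds (s := Set.Iio α))
    exact (e.and self_mem_nhdsWithin).exists
  have hα'1 : α' < 1 := hα'α.trans hα1
  have hα'2 : 0 < 1 - α' ^ 2 := by nlinarith
  have hr := hrate_lt (kap_pos hα' hα'1) (kap_lt hα' hα'α hα1)
  set ε := min (δ / 16) ((hrate (kap α) - hrate (kap α')) / 4) with hε
  have hε0 : 0 < ε := lt_min (by positivity) (by linarith)
  have hε1 : ε ≤ δ / 16 := min_le_left _ _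
  have hε2 : ε ≤ (hrate (kap α) - hrate (kap α')) / 4 := min_le_right _ _
  set ρ := hrate (kap α') + 2 * ε with hρ
  set η := min (min ε (2 * μ)) (a / 2) with hη
  have hη0 : 0 < η := lt_min (lt_min hε0 (by positivity)) (by positivity)
  have hη1 : η ≤ ε := (min_le_left _ _).trans (min_le_left _ _)
  have hη2 : η ≤ 2 * μ := (min_le_left _ _).trans (min_le_right _ _)
  have hη3 : η ≤ a / 2 := min_le_right _ _
  have hρ1 : ρ < hrate (kap α) := by linarith
  have hρ0 : 0 < ρ := by
    have := hrate_nonneg (kap_pos hα' hα'1)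
    linarith
  obtain ⟨n₁, hn₁⟩ := exists_sum_perr_ge (A := a + η) (β := 2 * a * (1 - α') + 4 * η)
    (E₀ := g α - ρ + δ / 2) (δ := δ / 2) (by
      have : 0 < a * (1 - α') := mul_pos ha (by linarith)
      linarith) (by positivity) (by linarith)
  obtain ⟨n₂, hn₂⟩ := sum_exp_inner_ge hα' hα'1 hε0
  obtain ⟨n₃, hn₃⟩ := eventually_atTop.1
    (tendsto_natCast_atTop_atTop (R := ℝ).eventually_ge_atTop (log 4 / ε + 1))
  refine ⟨ρ, η, hρ0, hρ1, hη0, max n₁ (max n₂ n₃), fun E _ _ _ _ _ hn C hC hM => ?_⟩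
  have hn1 := hn₁ E ((le_max_left _ _).trans hn) C
  have hn2 := hn₂ E ((le_max_left _ _).trans ((le_max_right _ _).trans hn))
  have hn3 := hn₃ _ ((le_max_right _ _).trans ((le_max_right _ _).trans hn))
  set n := Module.finrank ℝ E with hnd
  have hn1' : (1 : ℝ) ≤ n := by
    have : 0 ≤ log 4 / ε := div_nonneg (log_nonneg (by norm_num)) hε0.le
    linarith
  have hn0 : (0 : ℝ) < n := by linarith
  have hlog : log 4 ≤ n * ε := by
    have : log 4 / ε ≤ n := by linarith
    rwa [div_le_iff₀ hε0] at this
  have hηn : 0 ≤ η * n := by positivity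
  have h4 : (4 : ℝ) ≤ exp (n * ε) := by
    rw [← Real.exp_log (show (0 : ℝ) < 4 by norm_num)]
    exact exp_le_exp.2 hlog
  refine (le_of_eq ?_).trans (hn1 (fun x hx => ?_) fun C' hC' hcard => ?_)
  · congr 2; ring
  · have := (abs_le.1 (hC x hx)).2
    linarith
  have hcard' : (C.card : ℝ) ≤ 2 * C'.card := by exact_mod_cast hcard
  have hpos : ∀ x ∈ C, 0 < ‖x‖ := fun x hx => by
    have h1 := (abs_le.1 (hC x hx)).1
    have h2 : 0 < n * (a - η) := mul_pos hn0 (by linarith)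
    have h3 : 0 < ‖x‖ ^ 2 := by linarith
    exact (norm_nonneg x).lt_of_ne' fun h => by rw [h] at h3; norm_num at h3
  have hMρ : exp (n * (ρ - ε)) ≤ C'.card := by
    have h1 : exp (n * ρ) = exp (n * (ρ - ε)) * exp (n * ε) := by rw [← exp_add]; congr 1; ring
    have h2 := mul_le_mul_of_nonneg_left h4 (exp_pos (n * (ρ - ε))).le
    linarith
  have h2 := hn2 C' (fun x => ‖x‖⁻¹ • x) (fun x hx => by
    rw [norm_smul, norm_inv, norm_norm, inv_mul_cancel₀ (hpos x (hC' hx)).ne'])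
    (by rw [show hrate (kap α') + ε = ρ - ε by rw [hρ]; ring]; exact hMρ)
  set X := exp (-(n * (a * (1 - α') / 4 + η / 2))) with hX
  have h3 : (C'.card : ℝ) * exp (-(n * (g α - ρ + δ / 2))) ≤
      (C'.card : ℝ) ^ 2 * exp (n * (1 / 2 * log (1 - α' ^ 2) - ε)) * X := by
    rw [sq, mul_assoc, mul_assoc]
    refine mul_le_mul_of_nonneg_left ?_ (Nat.cast_nonneg _)
    refine le_trans ?_ (mul_le_mul_of_nonneg_right hMρ (by positivity))
    rw [hX, ← exp_add, ← exp_add]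
    refine exp_le_exp.2 ?_
    have : n * (g α' + 2 * ε + η / 2) ≤ n * (g α + δ / 2) :=
      mul_le_mul_of_nonneg_left (by linarith) hn0.le
    simp only [hg] at this ⊢
    linarith
  refine h3.trans ((mul_le_mul_of_nonneg_right h2 (exp_pos _).le).trans ?_)
  rw [Finset.sum_mul]
  refine Finset.sum_le_sum fun x hx => ?_
  rw [Finset.sum_mul]
  have hca : α' / (1 - α' ^ 2) ≤ a / 4 := by
    rw [div_le_iff₀ hα'2]
    have h5 : a * (1 - α ^ 2) ≤ a * (1 - α' ^ 2) :=
      mul_le_mul_of_nonneg_left (by linarith [pow_le_pow_left₀ hα'.le hα'α.le 2]) ha.le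
    linarith
  have key : ∀ y ∈ C'.filter (fun y => y ≠ x ∧ α' ≤ ⟪‖x‖⁻¹ • x, ‖y‖⁻¹ • y⟫_ℝ),
      ‖x - y‖ ^ 2 ≤ (2 * a * (1 - α') + 4 * η) * n ∧
      exp (n * (α' / (1 - α' ^ 2)) * (⟪‖x‖⁻¹ • x, ‖y‖⁻¹ • y⟫_ℝ - α')) * X ≤ aff x y := by
    intro y hy
    rw [Finset.mem_filter] at hy
    obtain ⟨hy, -, ht⟩ := hy
    have hx0 := hpos x (hC' hx)
    have hy0 := hpos y (hC' hy)
    obtain ⟨t, htd⟩ : ∃ t, t = ⟪‖x‖⁻¹ • x, ‖y‖⁻¹ • y⟫_ℝ := ⟨_, rfl⟩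
    have ht1 : t ≤ 1 := by
      have := real_inner_le_norm (‖x‖⁻¹ • x) (‖y‖⁻¹ • y)
      rwa [norm_smul, norm_smul, norm_inv, norm_norm, norm_inv, norm_norm,
        inv_mul_cancel₀ hx0.ne', inv_mul_cancel₀ hy0.ne', one_mul, ← htd] at this
    rw [← htd] at ht ⊢
    have hd := norm_sub_sq_le_of_norm_sq (n := n) (a := a) (η := η)
      (mul_nonneg hn0.le (by linarith)) (hC x (hC' hx)) (hC y (hC' hy)) hx0 hy0
      (hα'.le.trans ht) ht1 hηn htd
    have e1 : n * a * (1 - t) ≤ n * a * (1 - α') :=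
      mul_le_mul_of_nonneg_left (by linarith) (by positivity)
    refine ⟨by linarith, ?_⟩
    rw [hX, ← exp_add, aff]
    refine exp_le_exp.2 ?_
    have e2 : n * (α' / (1 - α' ^ 2)) * (t - α') ≤ n * (a / 4) * (t - α') :=
      mul_le_mul_of_nonneg_right (mul_le_mul_of_nonneg_left hca hn0.le) (by linarith)
    linarith
  refine (Finset.sum_le_sum fun y hy => (key y hy).2).trans ?_
  refine Finset.sum_le_sum_of_subset_of_nonneg (fun y hy => ?_) fun y _ _ => (exp_pos _).le
  have h6 := (key y hy).1
  rw [Finset.mem_filter] at hy ⊢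
  exact ⟨hy.1, hy.2.1, h6⟩

end GaussRel

namespace GaussRel
open ProbabilityTheory
open scoped InnerProductSpace
set_option linter.unusedSectionVars false

section

variable {E : Type*} [NormedAddCommGroup E] [InnerProductSpace ℝ E] [FiniteDimensional ℝ E]
  [MeasurableSpace E] [BorelSpace E]

local notation "dim" => (Module.finrank ℝ E : ℝ)

lemma integral_inner_pow_four (e : E) :
    ∫ z : E, ⟪e, z⟫_ℝ ^ 4 ∂(stdGaussian E) = 3 * ‖e‖ ^ 4 := by
  have h := ((Gr.inner e).pow 3).hasDerivAt_shift 0 e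
  have e1 : ∀ s : ℝ, ∫ z : E, ⟪e, 0 + s • e + z⟫_ℝ ^ 3 ∂(stdGaussian E) =
      (s * ‖e‖ ^ 2) ^ 3 + 3 * (s * ‖e‖ ^ 2) ^ 2 * (∫ z : E, ⟪e, z⟫_ℝ ∂(stdGaussian E)) +
      3 * (s * ‖e‖ ^ 2) * ‖e‖ ^ 2 + ∫ z : E, ⟪e, z⟫_ℝ ^ 3 ∂(stdGaussian E) := fun s => by
    have e2 : ∀ z : E, ⟪e, 0 + s • e + z⟫_ℝ ^ 3 = (s * ‖e‖ ^ 2) ^ 3 +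
        3 * (s * ‖e‖ ^ 2) ^ 2 * ⟪e, z⟫_ℝ + 3 * (s * ‖e‖ ^ 2) * ⟪e, z⟫_ℝ ^ 2 + ⟪e, z⟫_ℝ ^ 3 :=
      fun z => by
        rw [zero_add, inner_add_right, inner_smul_right, real_inner_self_eq_norm_sq]; ring
    simp only [e2]
    have g1 := (Gr.inner e).const_mul (3 * (s * ‖e‖ ^ 2) ^ 2)
    have g2 := ((Gr.inner e).pow 2).const_mul (3 * (s * ‖e‖ ^ 2))
    have g0 := Gr.const (E := E) ((s * ‖e‖ ^ 2) ^ 3)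
    rw [integral_add ((g0.add g1).add g2).integrable ((Gr.inner e).pow 3).integrable,
      integral_add (g0.add g1).integrable g2.integrable, integral_add g0.integrable g1.integrable,
      integral_const_mul, integral_const_mul, integral_inner_sq, integral_const]
    simp
  simp only [e1] at h
  have h1 : HasDerivAt (fun s : ℝ => s * ‖e‖ ^ 2) (‖e‖ ^ 2) 0 := by
    simpa using (hasDerivAt_id' (0 : ℝ)).mul_const (‖e‖ ^ 2)
  have h2 := ((((h1.pow 3).add (((h1.pow 2).const_mul 3).mul_const
    (∫ z : E, ⟪e, z⟫_ℝ ∂(stdGaussian E)))).add ((h1.const_mul 3).mul_const (‖e‖ ^ 2))).add_const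
    (∫ z : E, ⟪e, z⟫_ℝ ^ 3 ∂(stdGaussian E)))
  have h3 := h.unique h2
  simp only [zero_add] at h3
  have e3 : ∀ z : E, ⟪e, z⟫_ℝ ^ 4 = ⟪e, z⟫_ℝ * ⟪e, z⟫_ℝ ^ 3 := fun z => by ring
  simp only [e3]
  rw [h3]
  norm_num
  ring

/-- There is a direction along which a family of vectors has nearly average energy. -/
lemma exists_unit_vector_sum_sq_le (hE : 0 < Module.finrank ℝ E) {ι : Type*} (s : Finset ι)
    (p : ι → E) (c : ι → ℝ) : ∃ v : E, ‖v‖ = 1 ∧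
      ∑ i ∈ s, (c i + ‖p i‖ ^ 2 / dim - ⟪p i, v⟫_ℝ ^ 2) ^ 2 ≤
        ∑ i ∈ s, (c i ^ 2 + 2 * (‖p i‖ ^ 2) ^ 2 / dim ^ 2) := by
  have hd : (0 : ℝ) < dim := by exact_mod_cast hE
  by_contra! hcon
  set D := ∑ i ∈ s, (c i ^ 2 + 2 * (‖p i‖ ^ 2) ^ 2 / dim ^ 2) with hD
  set b : ι → ℝ := fun i => c i + ‖p i‖ ^ 2 / dim with hb
  set F : E → ℝ := fun z => ∑ i ∈ s, (b i ^ 2 * ‖z‖ ^ 4 - 2 * b i * (‖z‖ ^ 2 * ⟪p i, z⟫_ℝ ^ 2) +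
    ⟪p i, z⟫_ℝ ^ 4) - D * ‖z‖ ^ 4 with hF
  have g4 : Gr (fun z : E => ‖z‖ ^ 4) := Gr.norm.pow 4
  have gp : ∀ q : E, Gr (fun z : E => ‖z‖ ^ 2 * ⟪q, z⟫_ℝ ^ 2) := fun q =>
    (Gr.norm.pow 2).mul ((Gr.inner q).pow 2)
  have gi : ∀ i, Gr (fun z : E => b i ^ 2 * ‖z‖ ^ 4 - 2 * b i * (‖z‖ ^ 2 * ⟪p i, z⟫_ℝ ^ 2) +
    ⟪p i, z⟫_ℝ ^ 4) := fun i => ((g4.const_mul _).sub ((gp _).const_mul _)).add ((Gr.inner _).pow 4)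
  have gF : Gr F := (Gr.sum s gi).sub (g4.const_mul D)
  have hpos : ∀ z, z ≠ 0 → 0 < F z := fun z hz => by
    have hz0 : 0 < ‖z‖ := norm_pos_iff.2 hz
    have h := hcon (‖z‖⁻¹ • z) (by rw [norm_smul, norm_inv, norm_norm, inv_mul_cancel₀ hz0.ne'])
    have h1 : F z = ‖z‖ ^ 4 * (∑ i ∈ s, (c i + ‖p i‖ ^ 2 / dim - ⟪p i, ‖z‖⁻¹ • z⟫_ℝ ^ 2) ^ 2 - D) := by
      simp only [hF]
      rw [mul_sub, Finset.mul_sum, mul_comm D]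
      congr 1
      refine Finset.sum_congr rfl fun i _ => ?_
      rw [inner_smul_right]
      simp only [hb]
      field_simp
      ring
    rw [h1]
    exact mul_pos (by positivity) (by linarith)
  have hnn : ∀ z, 0 ≤ F z := fun z => by
    by_cases hz : z = 0
    · simp [hF, hz]
    · exact (hpos z hz).le
  have i2 : ∫ z : E, ‖z‖ ^ 4 ∂(stdGaussian E) = (dim + 2) * dim := by
    have := (Gr.norm (E := E).pow 2).homog_norm_sq (d := 2) fun s z => by
      rw [norm_smul, mul_pow, Real.norm_eq_abs, sq_abs]
    rw [integral_norm_sq] at this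
    rw [show ((2 : ℕ) : ℝ) = 2 by norm_num] at this
    rw [← this]
    refine integral_congr_ae (ae_of_all _ fun z => ?_)
    simp only; ring
  have i3 : ∀ q : E, ∫ z : E, ‖z‖ ^ 2 * ⟪q, z⟫_ℝ ^ 2 ∂(stdGaussian E) = (dim + 2) * ‖q‖ ^ 2 :=
    fun q => by
      have := ((Gr.inner q).pow 2).homog_norm_sq (d := 2) fun s z => by
        rw [inner_smul_right, mul_pow]
      rwa [integral_inner_sq, show ((2 : ℕ) : ℝ) = 2 by norm_num] at this
  have hIntegrable : ∫ z, F z ∂(stdGaussian E) ≤ 0 := by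
    have e1 : ∫ z, F z ∂(stdGaussian E) = ∑ i ∈ s, (b i ^ 2 * ((dim + 2) * dim) -
        2 * b i * ((dim + 2) * ‖p i‖ ^ 2) + 3 * ‖p i‖ ^ 4) - D * ((dim + 2) * dim) := by
      simp only [hF]
      rw [integral_sub (Gr.sum s gi).integrable (g4.const_mul D).integrable, integral_const_mul, i2,
        integral_finsetSum _ fun i _ => (gi i).integrable]
      congr 1
      refine Finset.sum_congr rfl fun i _ => ?_
      rw [integral_add ((g4.const_mul _).sub ((gp _).const_mul _)).integrable
        ((Gr.inner _).pow 4).integrable, integral_sub (g4.const_mul _).integrable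
        ((gp _).const_mul _).integrable, integral_const_mul, integral_const_mul, i2, i3,
        integral_inner_pow_four]
    rw [e1, hD, Finset.sum_mul, ← Finset.sum_sub_distrib]
    refine Finset.sum_nonpos fun i _ => ?_
    have : b i ^ 2 * ((dim + 2) * dim) - 2 * b i * ((dim + 2) * ‖p i‖ ^ 2) + 3 * ‖p i‖ ^ 4 -
        (c i ^ 2 + 2 * (‖p i‖ ^ 2) ^ 2 / dim ^ 2) * ((dim + 2) * dim) = -(6 * ‖p i‖ ^ 4 / dim) := by
      simp only [hb]
      field_simp
      ring
    rw [this]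
    exact neg_nonpos.2 (by positivity)
  have h0 := (integral_eq_zero_iff_of_nonneg hnn gF.integrable).1
    (le_antisymm hIntegrable (integral_nonneg hnn))
  have h1 : ∫ z : E, ‖z‖ ^ 2 ∂(stdGaussian E) = 0 := by
    refine integral_eq_zero_of_ae ?_
    filter_upwards [h0] with z hz
    have : z = 0 := by
      by_contra hz0
      exact (hpos z hz0).ne' hz
    simp [this]
  rw [integral_norm_sq] at h1
  exact hd.ne' h1

/-- There are subspaces onto which most vectors of a spherical code project with nearly
proportional energy. -/
lemma exists_submodule_sum_sq_le (C : Finset E) {s : ℝ} (hC : ∀ x ∈ C, ‖x‖ ^ 2 = s) {k : ℕ}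
    (hk : 1 ≤ k) (hkn : k ≤ Module.finrank ℝ E) : ∃ K : Submodule ℝ E, Module.finrank ℝ K = k ∧
      ∑ x ∈ C, (‖K.starProjection x‖ ^ 2 - k / dim * s) ^ 2 ≤
        C.card * (2 * s ^ 2 * ((k : ℝ)⁻¹ - dim⁻¹)) := by
  induction hkn using Nat.decreasingInduction with
  | self =>
    have hd : dim ≠ 0 := by positivity
    refine ⟨⊤, finrank_top ℝ E, ?_⟩
    rw [Finset.sum_eq_zero fun x hx => ?_]
    · simp
    · rw [Submodule.starProjection_top, div_self hd]
      simp [hC x hx]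
  | of_succ m hm ih =>
    obtain ⟨K, hK, hsum⟩ := ih (by omega)
    have hm0 : (0 : ℝ) < m := by exact_mod_cast hk
    have hn0 : (0 : ℝ) < dim := by
      have : 0 < Module.finrank ℝ E := by omega
      exact_mod_cast this
    obtain ⟨v, hv, hvs⟩ := exists_unit_vector_sum_sq_le (E := K) (by omega) C
      (fun x => K.orthogonalProjectionOnto x)
      (fun x => (1 - 1 / ((m : ℝ) + 1)) * (‖K.starProjection x‖ ^ 2 - (m + 1 : ℕ) / dim * s))
    have hv' : ‖(v : E)‖ = 1 := hv
    have hin : ∀ x : E, ⟪K.orthogonalProjectionOnto x, v⟫_ℝ = ⟪(v : E), x⟫_ℝ := fun x =>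
      (Submodule.inner_orthogonalProjectionOnto_eq_of_mem_right v x).trans (real_inner_comm _ _)
    have hvK : ⟪(v : E), (v : E)⟫_ℝ = 1 := by rw [real_inner_self_eq_norm_sq, hv', one_pow]
    refine ⟨(ℝ ∙ (v : E))ᗮ ⊓ K, ?_, ?_⟩
    · refine Submodule.finrank_add_inf_finrank_orthogonal' ?_ ?_
      · rw [Submodule.span_singleton_le_iff_mem]; exact v.2
      · rw [finrank_span_singleton (by rintro h; rw [h] at hv'; simp at hv'), hK]; omega
    · have hproj : ∀ x : E, ((ℝ ∙ (v : E))ᗮ ⊓ K).starProjection x =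
          K.starProjection x - ⟪(v : E), x⟫_ℝ • (v : E) := fun x => by
        refine Submodule.eq_starProjection_of_mem_of_inner_eq_zero ⟨?_, ?_⟩ fun w hw => ?_
        · rw [SetLike.mem_coe, Submodule.mem_orthogonal_singleton_iff_inner_right, inner_sub_right,
            inner_smul_right, hvK, ← hin x, real_inner_comm]
          change ⟪K.starProjection x, (v : E)⟫_ℝ - ⟪K.starProjection x, (v : E)⟫_ℝ * 1 = 0
          ring
        · exact K.sub_mem (Submodule.starProjection_apply_mem _ _) (K.smul_mem _ v.2)
        · have h1 := Submodule.starProjection_inner_eq_zero (K := K) x w hw.2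
          have h2 := Submodule.mem_orthogonal_singleton_iff_inner_right.1 hw.1
          rw [← sub_add, inner_add_left, h1, inner_smul_left, h2]
          simp
      have hnorm : ∀ x : E, ‖((ℝ ∙ (v : E))ᗮ ⊓ K).starProjection x‖ ^ 2 =
          ‖K.starProjection x‖ ^ 2 - ⟪K.orthogonalProjectionOnto x, v⟫_ℝ ^ 2 := fun x => by
        rw [hproj, norm_sub_sq_real, inner_smul_right, norm_smul, hv', mul_one, hin,
          Real.norm_eq_abs, sq_abs]
        have : ⟪K.starProjection x, (v : E)⟫_ℝ = ⟪(v : E), x⟫_ℝ := hin x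
        rw [this]; ring
      have hpn : ∀ x : E, ‖K.orthogonalProjectionOnto x‖ = ‖K.starProjection x‖ := fun x => rfl
      rw [hK] at hvs
      push_cast at hvs hsum
      have hle : ∀ x ∈ C, ‖K.starProjection x‖ ^ 2 ≤ s := fun x hx => by
        rw [← hC x hx]
        have := Submodule.norm_sq_eq_add_norm_sq_starProjection x K
        have := sq_nonneg ‖Kᗮ.starProjection x‖
        linarith
      calc _ = ∑ x ∈ C, ((1 - 1 / ((m : ℝ) + 1)) * (‖K.starProjection x‖ ^ 2 - (m + 1) / dim * s) +
            ‖K.orthogonalProjectionOnto x‖ ^ 2 / (m + 1) -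
            ⟪K.orthogonalProjectionOnto x, v⟫_ℝ ^ 2) ^ 2 := by
            refine Finset.sum_congr rfl fun x _ => ?_
            rw [hnorm, hpn]
            congr 1
            field_simp
            ring
        _ ≤ _ := hvs
        _ ≤ ∑ x ∈ C, ((‖K.starProjection x‖ ^ 2 - (m + 1) / dim * s) ^ 2 +
            2 * s ^ 2 * ((m : ℝ)⁻¹ - ((m : ℝ) + 1)⁻¹)) := by
            refine Finset.sum_le_sum fun x hx => add_le_add ?_ ?_
            · rw [mul_pow]
              refine mul_le_of_le_one_left (sq_nonneg _) ?_
              have h1 : 1 / ((m : ℝ) + 1) ≤ 1 := by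
                rw [div_le_one (by positivity)]; linarith
              have h2 : 0 ≤ 1 / ((m : ℝ) + 1) := by positivity
              exact pow_le_one₀ (by linarith) (by linarith)
            · have h1 : (‖K.starProjection x‖ ^ 2) ^ 2 ≤ s ^ 2 :=
                pow_le_pow_left₀ (sq_nonneg _) (hle x hx) 2
              have h2 : (m : ℝ)⁻¹ - ((m : ℝ) + 1)⁻¹ = 1 / (m * (m + 1)) := by
                field_simp; ring
              have h3 : (1 : ℝ) / (m + 1) ^ 2 ≤ 1 / (m * (m + 1)) :=
                one_div_le_one_div_of_le (by positivity) (by nlinarith)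
              rw [hpn, h2]
              calc _ = 2 * ((‖K.starProjection x‖ ^ 2) ^ 2 * (1 / ((m : ℝ) + 1) ^ 2)) := by ring
                _ ≤ 2 * (s ^ 2 * (1 / ((m : ℝ) * (m + 1)))) :=
                  mul_le_mul_of_nonneg_left (mul_le_mul h1 h3 (by positivity) (by positivity))
                    (by norm_num)
                _ = _ := by ring
        _ ≤ _ := by
            rw [Finset.sum_add_distrib, Finset.sum_const, nsmul_eq_mul]
            linarith

end

end GaussRel

namespace GaussRel
open ProbabilityTheory
open scoped InnerProductSpace
set_option linter.unusedSectionVars false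

section
variable {E : Type*} [NormedAddCommGroup E] [InnerProductSpace ℝ E] [FiniteDimensional ℝ E]
  [MeasurableSpace E] [BorelSpace E]
local notation "dim" => (Module.finrank ℝ E : ℝ)

/-- Noise vectors of typical length, typically oriented with respect to `p`. -/
def typical (η : ℝ) (p : E) : Set E :=
  {z | |‖z‖ ^ 2 - dim| ≤ η * dim ∧ |⟪p, z⟫_ℝ| ≤ η * dim}

lemma measurableSet_typical (η : ℝ) (p : E) : MeasurableSet (typical η p) := by
  have m1 : MeasurableSet {z : E | |‖z‖ ^ 2 - dim| ≤ η * dim} :=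
    measurableSet_le (by fun_prop) (by fun_prop)
  have m2 : MeasurableSet {z : E | |⟪p, z⟫_ℝ| ≤ η * dim} :=
    measurableSet_le (by fun_prop) (by fun_prop)
  exact m1.inter m2

lemma exists_typical_compl_le {η A : ℝ} (hη : 0 < η) (hη1 : η < 1) (hA : 0 < A) :
    ∃ n₀ : ℕ, ∀ (E : Type) [NormedAddCommGroup E] [InnerProductSpace ℝ E]
      [FiniteDimensional ℝ E] [MeasurableSpace E] [BorelSpace E], n₀ ≤ Module.finrank ℝ E →
      ∀ p : E, ‖p‖ ^ 2 ≤ A * Module.finrank ℝ E →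
        1 / 2 ≤ (stdGaussian E).real (typical η p) := by
  have t (c : ℝ) (hc : 0 < c) := ((tendsto_exp_neg_mul hc).comp
    tendsto_natCast_atTop_atTop).eventually_lt_const (u := 1 / 8) (by norm_num)
  obtain ⟨n₀, hn₀⟩ := eventually_atTop.1 ((t _ (rate_upper_pos hη)).and
    ((t _ (rate_lower_pos hη hη1)).and (t _ (by positivity : 0 < η ^ 2 / (2 * A)))))
  refine ⟨n₀, fun E _ _ _ _ _ hn p hp => ?_⟩
  obtain ⟨h1, h2, h3⟩ := hn₀ _ hn
  simp only [Function.comp_apply] at h1 h2 h3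
  have a1 := norm_sq_upper_tail (E := E) hη
  have a2 := norm_sq_lower_tail (E := E) hη hη1
  have a3 := inner_tail_linear p hA hp hη
  have a4 := inner_tail_linear (-p) hA (by rwa [norm_neg]) hη
  have h4 := probReal_compl_eq_one_sub (μ := stdGaussian E) (measurableSet_typical η p)
  have h5 : (typical η p)ᶜ ⊆ {z | (1 + η) * (Module.finrank ℝ E : ℝ) ≤ ‖z‖ ^ 2} ∪
      {z | ‖z‖ ^ 2 ≤ (1 - η) * (Module.finrank ℝ E : ℝ)} ∪
      {z | η * (Module.finrank ℝ E : ℝ) ≤ ⟪p, z⟫_ℝ} ∪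
      {z | η * (Module.finrank ℝ E : ℝ) ≤ ⟪-p, z⟫_ℝ} := by
    intro z hz
    simp only [typical, Set.mem_compl_iff, Set.mem_ofPred_eq, Set.mem_union, inner_neg_left] at hz ⊢
    by_contra! hc
    obtain ⟨⟨⟨c1, c2⟩, c3⟩, c4⟩ := hc
    exact hz ⟨abs_le.2 ⟨by linarith, by linarith⟩, abs_le.2 ⟨by linarith, by linarith⟩⟩
  have h6 := measureReal_mono (μ := stdGaussian E) h5
  have h7 := h6.trans ((measureReal_union_le _ _).trans (add_le_add_left
    ((measureReal_union_le _ _).trans (add_le_add_left (measureReal_union_le _ _) _)) _))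
  linarith

set_option maxHeartbeats 800000 in
/-- If a Gaussian ball around `p` is shrunk towards the origin and inflated, it is covered by the
part inside `W`, charged to a centred Gaussian, and the part outside `W`, charged to the noise. -/
lemma half_le_of_shrink {a α η : ℝ} (hα : 0 < α) (hα1 : α < 1)
    (haα : a * (1 - α ^ 2) = 4 * α) (hη : 0 ≤ η) {p : E} (hp : ‖p‖ ^ 2 - dim * a ≤ η * dim)
    (ht : 1 / 2 ≤ (stdGaussian E).real (typical η p)) {W : Set E} (hW : MeasurableSet W) :
    1 / 2 ≤ exp (dim * (-(1 / 2 * log (1 - α)) + 2 * η)) * (stdGaussian E).real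
        {w | √((1 + α) / (1 - α)) • w ∈ W} +
      exp (dim * (α / (1 + α) - 1 / 2 * log (1 + α) + 2 * η)) * (stdGaussian E).real
        {z | p + z ∉ W} := by
  have h1 : 0 < 1 - α := by linarith
  have h2 : 0 < 1 + α := by linarith
  set σ := √(1 + α) with hσ
  have hσ0 : 0 < σ := sqrt_pos.2 h2
  have hσ2 : σ ^ 2 = 1 + α := sq_sqrt h2.le
  set q := √(1 - α) with hq
  have hq0 : 0 < q := sqrt_pos.2 h1
  have hq2 : q ^ 2 = 1 - α := sq_sqrt h1.le
  have hr : √((1 + α) / (1 - α)) = σ / q := sqrt_div h2.le _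
  rw [hr]
  have hlσ : log σ = 1 / 2 * log (1 + α) := by rw [hσ, log_sqrt h2.le]; ring
  have hlq : log q = 1 / 2 * log (1 - α) := by rw [hq, log_sqrt h1.le]; ring
  have hσ3 : σ ≤ 2 := sqrt_le_iff.2 ⟨by norm_num, by linarith⟩
  have hq1 : q ≤ 1 := sqrt_le_iff.2 ⟨by norm_num, by linarith⟩
  have hsq : 0 < 1 - α ^ 2 := by nlinarith
  have hc1 : σ * q / 2 * q ≤ 1 := by
    have := mul_le_mul hσ3 (pow_le_one₀ hq0.le hq1 : q ^ 2 ≤ 1) (sq_nonneg q) (by norm_num)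
    linarith
  have hc2 : (1 - α) / 2 * σ ≤ 1 := by
    have := mul_le_mul (by linarith : (1 - α) / 2 ≤ 1 / 2) hσ3 hσ0.le (by norm_num)
    linarith
  have hc3 : (1 - α) ^ 2 / 4 ≤ 1 / 2 := by
    have : (1 - α) ^ 2 ≤ 1 := pow_le_one₀ h1.le (by linarith)
    linarith
  have hd : (0 : ℝ) ≤ dim := Nat.cast_nonneg _
  have hηd : 0 ≤ η * dim := by positivity
  have hT := measurableSet_typical (E := E) η p
  have ha : a = 4 * α / (1 - α ^ 2) := by
    rw [eq_div_iff hsq.ne']; exact haα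
  have t1 := tilt_le ((σ * q / 2) • p) hq0
    (K := dim * (-(1 / 2 * log (1 - α)) + 2 * η))
    (B := {w | q⁻¹ • (w - (σ * q / 2) • p) ∈ typical η p ∧ (σ / q) • w ∈ W})
    ((hT.preimage (by fun_prop : Measurable fun w : E => q⁻¹ • (w - (σ * q / 2) • p))).inter
      (hW.preimage (by fun_prop : Measurable fun w : E => (σ / q) • w)))
    (fun z hz => by
      obtain ⟨⟨b1, b2⟩, -⟩ := hz
      rw [add_sub_cancel_left, inv_smul_smul₀ hq0.ne'] at b1 b2
      rw [norm_add_sq_real, norm_smul, norm_smul, inner_smul_left, inner_smul_right,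
        Real.norm_of_nonneg hq0.le, Real.norm_of_nonneg (by positivity), hlq]
      simp only [conj_trivial]
      have e1 : (σ * q / 2) * (q * ⟪p, z⟫_ℝ) ≤ 1 * (η * dim) := by
        rw [← mul_assoc]
        refine (mul_le_mul_of_nonneg_left (abs_le.1 b2).2 (by positivity)).trans
          (mul_le_mul_of_nonneg_right hc1 hηd)
      have e2 : (σ * q / 2 * ‖p‖) ^ 2 = (1 + α) * (1 - α) / 4 * ‖p‖ ^ 2 := by
        rw [← hσ2, ← hq2]; ring
      have e3 : (1 + α) * (1 - α) / 4 * ‖p‖ ^ 2 ≤ (1 + α) * (1 - α) / 4 * (dim * a + η * dim) :=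
        mul_le_mul_of_nonneg_left (by linarith) (by positivity)
      have e4 : (q * ‖z‖) ^ 2 = ‖z‖ ^ 2 - α * ‖z‖ ^ 2 := by rw [mul_pow, hq2]; ring
      have e5 : α * (dim - η * dim) ≤ α * ‖z‖ ^ 2 :=
        mul_le_mul_of_nonneg_left (by linarith [(abs_le.1 b1).1]) hα.le
      have e6 : (1 + α) * (1 - α) / 4 * (dim * a + η * dim) =
          dim * α + (1 - α ^ 2) / 4 * (η * dim) := by
        linear_combination dim / 4 * haα
      have e7 : (1 - α ^ 2) / 4 * (η * dim) ≤ 1 * (η * dim) :=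
        mul_le_mul_of_nonneg_right (by linarith [sq_nonneg α]) hηd
      have e8 : α * (η * dim) ≤ 1 * (η * dim) := mul_le_mul_of_nonneg_right hα1.le hηd
      rw [e2, e4]
      linarith)
  have t2 := tilt_le (-((1 - α) / 2) • p) hσ0
    (K := dim * (α / (1 + α) - 1 / 2 * log (1 + α) + 2 * η))
    (B := {w | σ⁻¹ • (w - (-((1 - α) / 2)) • p) ∈ typical η p ∧ p + w ∈ Wᶜ})
    ((hT.preimage (by fun_prop : Measurable fun w : E => σ⁻¹ • (w - (-((1 - α) / 2)) • p))).inter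
      (hW.compl.preimage (by fun_prop : Measurable fun w : E => p + w)))
    (fun z hz => by
      obtain ⟨⟨b1, b2⟩, -⟩ := hz
      rw [add_sub_cancel_left, inv_smul_smul₀ hσ0.ne'] at b1 b2
      rw [norm_add_sq_real, norm_smul, norm_smul, inner_smul_left, inner_smul_right,
        Real.norm_of_nonneg hσ0.le, norm_neg, Real.norm_of_nonneg (by positivity), hlσ]
      simp only [conj_trivial]
      have e1 : -((1 - α) / 2) * (σ * ⟪p, z⟫_ℝ) ≤ 1 * (η * dim) := by
        have : -((1 - α) / 2) * (σ * ⟪p, z⟫_ℝ) = ((1 - α) / 2 * σ) * -⟪p, z⟫_ℝ := by ring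
        rw [this]
        refine (mul_le_mul_of_nonneg_left (by linarith [(abs_le.1 b2).1])
          (by positivity)).trans (mul_le_mul_of_nonneg_right hc2 hηd)
      have e2 : ((1 - α) / 2 * ‖p‖) ^ 2 ≤ (1 - α) ^ 2 / 4 * (dim * a + η * dim) := by
        calc _ = (1 - α) ^ 2 / 4 * ‖p‖ ^ 2 := by ring
          _ ≤ _ := mul_le_mul_of_nonneg_left (by linarith) (by positivity)
      have e4 : (σ * ‖z‖) ^ 2 = ‖z‖ ^ 2 + α * ‖z‖ ^ 2 := by rw [mul_pow, hσ2]; ring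
      have e5 : α * ‖z‖ ^ 2 ≤ α * (dim + η * dim) :=
        mul_le_mul_of_nonneg_left (by linarith [(abs_le.1 b1).2]) hα.le
      have e6 : (1 - α) ^ 2 / 4 * (dim * a) + α * dim = 2 * (dim * (α / (1 + α))) := by
        rw [ha]
        have h12 : 1 - α ^ 2 = (1 - α) * (1 + α) := by ring
        rw [h12]
        field_simp
        ring
      have e7 : (1 - α) ^ 2 / 4 * (η * dim) ≤ 1 / 2 * (η * dim) :=
        mul_le_mul_of_nonneg_right hc3 hηd
      have e8 : α * (η * dim) ≤ 1 * (η * dim) := mul_le_mul_of_nonneg_right hα1.le hηd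
      rw [e4]
      linarith)
  have h3 : typical η p ⊆ {z | (σ * q / 2) • p + q • z ∈
      {w | q⁻¹ • (w - (σ * q / 2) • p) ∈ typical η p ∧ (σ / q) • w ∈ W}} ∪
      {z | -((1 - α) / 2) • p + σ • z ∈
      {w | σ⁻¹ • (w - (-((1 - α) / 2)) • p) ∈ typical η p ∧ p + w ∈ Wᶜ}} := by
    intro z hz
    simp only [Set.mem_union, Set.mem_ofPred_eq, add_sub_cancel_left, inv_smul_smul₀ hq0.ne',
      inv_smul_smul₀ hσ0.ne', hz, true_and, Set.mem_compl_iff]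
    have : (σ / q) • ((σ * q / 2) • p + q • z) = p + (-((1 - α) / 2) • p + σ • z) := by
      rw [smul_add, smul_smul, smul_smul, div_mul_cancel₀ _ hq0.ne']
      have e : σ / q * (σ * q / 2) = 1 + -((1 - α) / 2) := by
        field_simp; rw [hσ2]; ring
      rw [e, add_smul, one_smul, add_assoc]
    rw [this]
    exact em _
  have h4 := measureReal_mono (μ := stdGaussian E) h3
  have h5 := (ht.trans h4).trans (measureReal_union_le _ _)
  refine h5.trans (add_le_add (t1.trans ?_) (t2.trans ?_))
  · exact mul_le_mul_of_nonneg_left (measureReal_mono fun w hw => hw.2) (exp_pos _).le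
  · exact mul_le_mul_of_nonneg_left (measureReal_mono fun w hw => hw.2) (exp_pos _).le

open Classical in
/-- Sphere-packing bound for list decoding regions at the critical rate. -/
lemma exists_sphere_packing {a α δ : ℝ} (ha : 0 < a) (hα : 0 < α) (hα1 : α < 1)
    (haα : a * (1 - α ^ 2) = 4 * α) (hδ : 0 < δ) :
    ∃ η > 0, ∃ n₀ : ℕ, ∀ (E : Type) [NormedAddCommGroup E] [InnerProductSpace ℝ E]
      [FiniteDimensional ℝ E] [MeasurableSpace E] [BorelSpace E], n₀ ≤ Module.finrank ℝ E →
      ∀ (ι : Type) (C : Finset ι) (p : ι → E),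
        (∀ i ∈ C, ‖p i‖ ^ 2 - Module.finrank ℝ E * a ≤ η * Module.finrank ℝ E) →
        ∀ (W : ι → Set E) (L : ℝ), (∀ i, MeasurableSet (W i)) →
          (∀ y, ((C.filter fun i => y ∈ W i).card : ℝ) ≤ L) →
          (C.card : ℝ) / 2 ≤ exp (Module.finrank ℝ E * (-(1 / 2 * log (1 - α)) + δ)) * L +
            exp (Module.finrank ℝ E * (α / (1 + α) - 1 / 2 * log (1 + α) + δ)) *
              ∑ i ∈ C, (stdGaussian E).real {z | p i + z ∉ W i} := by
  obtain ⟨η, hη, hη1, hηδ⟩ : ∃ η : ℝ, 0 < η ∧ η < 1 ∧ 2 * η ≤ δ :=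
    ⟨min (δ / 2) (1 / 2), by positivity, (min_le_right _ _).trans_lt (by norm_num),
      by linarith [min_le_left (δ / 2) (1 / 2)]⟩
  obtain ⟨n₀, hn₀⟩ := exists_typical_compl_le hη hη1 (A := a + 1) (by linarith)
  refine ⟨η, hη, n₀, fun E _ _ _ _ _ hn ι C p hp W L hW hL => ?_⟩
  have hd : (0 : ℝ) ≤ Module.finrank ℝ E := Nat.cast_nonneg _
  set r := √((1 + α) / (1 - α)) with hr
  have hmr : ∀ i, MeasurableSet {w : E | r • w ∈ W i} := fun i =>
    (hW i).preimage (by fun_prop : Measurable fun w : E => r • w)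
  have h1 : ∑ i ∈ C, (stdGaussian E).real {w | r • w ∈ W i} ≤ L := by
    have e1 : ∀ i ∈ C, (stdGaussian E).real {w | r • w ∈ W i} =
        ∫ w, {w : E | r • w ∈ W i}.indicator 1 w ∂(stdGaussian E) := fun i _ =>
      (integral_indicator_one (hmr i)).symm
    have e2 : ∀ i ∈ C, Integrable ({w : E | r • w ∈ W i}.indicator (1 : E → ℝ))
        (stdGaussian E) := fun i _ => (integrable_const (1 : ℝ)).indicator (hmr i)
    rw [Finset.sum_congr rfl e1, ← integral_finsetSum _ e2]
    calc _ ≤ ∫ _w : E, L ∂(stdGaussian E) := by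
          refine integral_mono (integrable_finsetSum _ e2) (integrable_const _) fun w => ?_
          refine le_trans (le_of_eq ?_) (hL (r • w))
          rw [Finset.card_filter, Nat.cast_sum]
          refine Finset.sum_congr rfl fun i _ => ?_
          by_cases h : r • w ∈ W i <;> simp [Set.indicator, h]
      _ = L := by simp
  have h2 : ∀ i ∈ C, (1 : ℝ) / 2 ≤ exp (Module.finrank ℝ E * (-(1 / 2 * log (1 - α)) + δ)) *
      (stdGaussian E).real {w | r • w ∈ W i} +
      exp (Module.finrank ℝ E * (α / (1 + α) - 1 / 2 * log (1 + α) + δ)) *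
        (stdGaussian E).real {z | p i + z ∉ W i} := fun i hi => by
    have h3 := half_le_of_shrink hα hα1 haα hη.le (hp i hi) (hn₀ E hn (p i) (by
      nlinarith [hp i hi])) (hW i)
    refine h3.trans (add_le_add (mul_le_mul_of_nonneg_right ?_ measureReal_nonneg)
      (mul_le_mul_of_nonneg_right ?_ measureReal_nonneg)) <;>
    exact exp_le_exp.2 (mul_le_mul_of_nonneg_left (by linarith) hd)
  have h3 := Finset.sum_le_sum h2
  rw [Finset.sum_add_distrib, ← Finset.mul_sum, ← Finset.mul_sum, Finset.sum_const,
    nsmul_eq_mul] at h3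
  have h4 := mul_le_mul_of_nonneg_left h1
    (exp_pos (Module.finrank ℝ E * (-(1 / 2 * log (1 - α)) + δ))).le
  linarith

end

end GaussRel

namespace GaussRel
open ProbabilityTheory
open scoped InnerProductSpace
set_option linter.unusedSectionVars false

section
variable {E : Type*} [NormedAddCommGroup E] [InnerProductSpace ℝ E] [FiniteDimensional ℝ E]
  [MeasurableSpace E] [BorelSpace E]
local notation "dim" => (Module.finrank ℝ E : ℝ)

lemma charFun_map_subtype (K : Submodule ℝ E) (t : E) :
    charFun ((stdGaussian K).map ((↑) : K → E)) t = Complex.exp (-‖K.starProjection t‖ ^ 2 / 2) := by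
  have h := charFun_stdGaussian (K.orthogonalProjectionOnto t)
  rw [charFun_apply] at h ⊢
  rw [integral_map (by fun_prop) (by fun_prop)]
  have e : ‖K.starProjection t‖ = ‖K.orthogonalProjectionOnto t‖ := rfl
  rw [e, ← h]
  refine integral_congr_ae (Eventually.of_forall fun z => ?_)
  have := Submodule.inner_orthogonalProjectionOnto_eq_of_mem_left z t
  simp only
  rw [← this]

/-- The standard Gaussian is the sum of independent standard Gaussians on a subspace and on its
orthogonal complement. -/
lemma stdGaussian_eq_map_prod (K : Submodule ℝ E) :
    stdGaussian E = ((stdGaussian Kᗮ).prod (stdGaussian K)).map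
      (fun p => (p.1 : E) + (p.2 : E)) := by
  have e : ((stdGaussian Kᗮ).prod (stdGaussian K)).map (fun p => (p.1 : E) + (p.2 : E)) =
      (((stdGaussian Kᗮ).map ((↑) : Kᗮ → E)).prod ((stdGaussian K).map ((↑) : K → E))).map
        (fun p : E × E => p.1 + p.2) := by
    rw [Measure.map_prod_map _ _ (by fun_prop) (by fun_prop),
      Measure.map_map (by fun_prop) (by fun_prop)]
    rfl
  have i1 : IsProbabilityMeasure ((stdGaussian Kᗮ).map ((↑) : Kᗮ → E)) :=
    Measure.isProbabilityMeasure_map (by fun_prop)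
  have i2 : IsProbabilityMeasure ((stdGaussian K).map ((↑) : K → E)) :=
    Measure.isProbabilityMeasure_map (by fun_prop)
  have i3 : IsProbabilityMeasure ((((stdGaussian Kᗮ).map ((↑) : Kᗮ → E)).prod
      ((stdGaussian K).map ((↑) : K → E))).map (fun p : E × E => p.1 + p.2)) :=
    Measure.isProbabilityMeasure_map (by fun_prop)
  rw [e]
  refine Measure.ext_of_charFun (funext fun t => ?_)
  rw [charFun_map_add_prod_eq_mul, Pi.mul_apply, charFun_map_subtype, charFun_map_subtype,
    charFun_stdGaussian, ← Complex.exp_add]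
  have h : (‖t‖ : ℂ) ^ 2 = ‖K.starProjection t‖ ^ 2 + ‖Kᗮ.starProjection t‖ ^ 2 := by
    exact_mod_cast congrArg (fun r : ℝ => (r : ℂ))
      (Submodule.norm_sq_eq_add_norm_sq_starProjection t K)
  rw [h]
  congr 1
  ring

/-- Probability that the channel output of `u x` does not make `x` the strict maximizer of the
log-likelihood biased by `w`. -/
noncomputable def berr {ι : Type*} (S : Finset ι) (u : ι → E) (w : ι → ℝ) (x : ι) : ℝ :=
  (stdGaussian E).real {z | ∃ c ∈ S, c ≠ x ∧
    w x + (⟪u x, u x + z⟫_ℝ - ‖u x‖ ^ 2 / 2) ≤ w c + (⟪u c, u x + z⟫_ℝ - ‖u c‖ ^ 2 / 2)}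

lemma berr_mono {ι : Type*} {S T : Finset ι} (h : S ⊆ T) (u : ι → E) (w : ι → ℝ) (x : ι) :
    berr S u w x ≤ berr T u w x :=
  measureReal_mono fun _ ⟨c, hc, h'⟩ => ⟨c, h hc, h'⟩

lemma mem_nearSet_iff_score (C : Finset E) (x z : E) : z ∈ nearSet C x 0 ↔ ∃ c ∈ C, c ≠ x ∧
    ⟪x, x + z⟫_ℝ - ‖x‖ ^ 2 / 2 ≤ ⟪c, x + z⟫_ℝ - ‖c‖ ^ 2 / 2 := by
  simp only [nearSet, Set.mem_ofPred_eq]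
  refine exists_congr fun c => and_congr_right fun _ => and_congr_right fun _ => ?_
  rw [norm_sub_sq_real, inner_sub_left, inner_add_right, inner_add_right,
    real_inner_self_eq_norm_sq]
  constructor <;> intro h <;> linarith

open Classical in
/-- Weighting does not help to guess the index of the largest of finitely many numbers. -/
lemma sum_exp_filter_le {ι : Type*} (S : Finset ι) (s w : ι → ℝ) :
    ∑ x ∈ S with ∃ c ∈ S, c ≠ x ∧ s x ≤ s c, exp (s x) ≤
      2 * ∑ x ∈ S with ∃ c ∈ S, c ≠ x ∧ w x + s x ≤ w c + s c, exp (s x) := by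
  by_cases hm : ∃ m ∈ S, ∀ c ∈ S, c ≠ m → w c + s c < w m + s m
  · obtain ⟨m, hmS, hm⟩ := hm
    have h1 : ∑ x ∈ S.erase m, exp (s x) ≤
        ∑ x ∈ S with ∃ c ∈ S, c ≠ x ∧ w x + s x ≤ w c + s c, exp (s x) := by
      refine Finset.sum_le_sum_of_subset_of_nonneg (fun x hx => ?_) fun _ _ _ => (exp_pos _).le
      obtain ⟨hxm, hx⟩ := Finset.mem_erase.1 hx
      exact Finset.mem_filter.2 ⟨hx, m, hmS, hxm.symm, (hm x hx hxm).le⟩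
    have h0 : 0 ≤ ∑ x ∈ S.erase m, exp (s x) := Finset.sum_nonneg fun _ _ => (exp_pos _).le
    by_cases h2 : ∃ c ∈ S, c ≠ m ∧ s m ≤ s c
    · obtain ⟨c, hc, hcm, hsc⟩ := h2
      have h3 : exp (s m) ≤ ∑ x ∈ S.erase m, exp (s x) :=
        (exp_le_exp.2 hsc).trans (Finset.single_le_sum (f := fun x => exp (s x))
          (fun _ _ => (exp_pos _).le) (Finset.mem_erase.2 ⟨hcm, hc⟩))
      have h4 := Finset.sum_erase_add S (fun x => exp (s x)) hmS
      have h5 : ∑ x ∈ S with ∃ c ∈ S, c ≠ x ∧ s x ≤ s c, exp (s x) ≤ ∑ x ∈ S, exp (s x) :=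
        Finset.sum_le_sum_of_subset_of_nonneg (Finset.filter_subset _ _)
          fun _ _ _ => (exp_pos _).le
      linarith
    · have h5 : ∑ x ∈ S with ∃ c ∈ S, c ≠ x ∧ s x ≤ s c, exp (s x) ≤
          ∑ x ∈ S.erase m, exp (s x) := by
        refine Finset.sum_le_sum_of_subset_of_nonneg (fun x hx => ?_) fun _ _ _ => (exp_pos _).le
        obtain ⟨hx, hx'⟩ := Finset.mem_filter.1 hx
        exact Finset.mem_erase.2 ⟨fun h => h2 (h ▸ hx'), hx⟩
      linarith
  · push Not at hm
    rw [Finset.filter_true_of_mem (p := fun x => ∃ c ∈ S, c ≠ x ∧ w x + s x ≤ w c + s c) hm]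
    have h5 : ∑ x ∈ S with ∃ c ∈ S, c ≠ x ∧ s x ≤ s c, exp (s x) ≤ ∑ x ∈ S, exp (s x) :=
      Finset.sum_le_sum_of_subset_of_nonneg (Finset.filter_subset _ _)
        fun _ _ _ => (exp_pos _).le
    have h6 : 0 ≤ ∑ x ∈ S, exp (s x) := Finset.sum_nonneg fun _ _ => (exp_pos _).le
    linarith

lemma measurableSet_berr {ι : Type*} (S : Finset ι) (u : ι → E) (w : ι → ℝ) (x : ι) :
    MeasurableSet {y : E | ∃ c ∈ S, c ≠ x ∧
      w x + (⟪u x, y⟫_ℝ - ‖u x‖ ^ 2 / 2) ≤ w c + (⟪u c, y⟫_ℝ - ‖u c‖ ^ 2 / 2)} := by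
  have e : {y : E | ∃ c ∈ S, c ≠ x ∧
      w x + (⟪u x, y⟫_ℝ - ‖u x‖ ^ 2 / 2) ≤ w c + (⟪u c, y⟫_ℝ - ‖u c‖ ^ 2 / 2)} =
      ⋃ c ∈ (S : Set ι), ⋃ _ : c ≠ x, {y : E |
        w x + (⟪u x, y⟫_ℝ - ‖u x‖ ^ 2 / 2) ≤ w c + (⟪u c, y⟫_ℝ - ‖u c‖ ^ 2 / 2)} := by
    ext y; simp only [Set.mem_iUnion, Set.mem_ofPred_eq, exists_prop, Finset.mem_coe]
  rw [e]
  exact MeasurableSet.biUnion S.countable_toSet fun c _ => MeasurableSet.iUnion fun _ =>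
    measurableSet_le (by fun_prop) (by fun_prop)

open Classical in
lemma sum_berr_eq {ι : Type*} (S : Finset ι) (u : ι → E) (w : ι → ℝ) :
    ∑ x ∈ S, berr S u w x = ∫ y, ∑ x ∈ S with ∃ c ∈ S, c ≠ x ∧
      w x + (⟪u x, y⟫_ℝ - ‖u x‖ ^ 2 / 2) ≤ w c + (⟪u c, y⟫_ℝ - ‖u c‖ ^ 2 / 2),
        exp (⟪u x, y⟫_ℝ - ‖u x‖ ^ 2 / 2) ∂(stdGaussian E) ∧
    Integrable (fun y => ∑ x ∈ S with ∃ c ∈ S, c ≠ x ∧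
      w x + (⟪u x, y⟫_ℝ - ‖u x‖ ^ 2 / 2) ≤ w c + (⟪u c, y⟫_ℝ - ‖u c‖ ^ 2 / 2),
        exp (⟪u x, y⟫_ℝ - ‖u x‖ ^ 2 / 2)) (stdGaussian E) := by
  set B : ι → Set E := fun x => {y : E | ∃ c ∈ S, c ≠ x ∧
      w x + (⟪u x, y⟫_ℝ - ‖u x‖ ^ 2 / 2) ≤ w c + (⟪u c, y⟫_ℝ - ‖u c‖ ^ 2 / 2)} with hB
  have hm : ∀ x, MeasurableSet (B x) := fun x => measurableSet_berr S u w x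
  have h1 : ∀ y, ∑ x ∈ S with ∃ c ∈ S, c ≠ x ∧
      w x + (⟪u x, y⟫_ℝ - ‖u x‖ ^ 2 / 2) ≤ w c + (⟪u c, y⟫_ℝ - ‖u c‖ ^ 2 / 2),
        exp (⟪u x, y⟫_ℝ - ‖u x‖ ^ 2 / 2) = ∑ x ∈ S, (B x).indicator (phi (u x)) y := fun y => by
    rw [Finset.sum_filter]
    refine Finset.sum_congr rfl fun x _ => ?_
    simp only [Set.indicator_apply, hB, Set.mem_ofPred_eq, phi]
  simp only [h1]
  have h2 : ∀ x ∈ S, Integrable ((B x).indicator (phi (u x))) (stdGaussian E) := fun x _ =>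
    (integrable_phi (u x)).indicator (hm x)
  refine ⟨?_, integrable_finsetSum _ h2⟩
  rw [integral_finsetSum _ h2]
  refine Finset.sum_congr rfl fun x _ => ?_
  have h3 := integral_shift (u x) ((B x).indicator 1)
  have h4 : berr S u w x = ∫ z, (B x).indicator (1 : E → ℝ) (u x + z) ∂(stdGaussian E) :=
    (integral_indicator_one
      ((hm x).preimage (by fun_prop : Measurable fun z : E => u x + z))).symm
  rw [h4, h3]
  refine integral_congr_ae (Eventually.of_forall fun y => ?_)
  by_cases hy : y ∈ B x <;> simp [hy, phi]

lemma sum_berr_zero_le {ι : Type*} (S : Finset ι) (u : ι → E) (w : ι → ℝ) :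
    ∑ x ∈ S, berr S u 0 x ≤ 2 * ∑ x ∈ S, berr S u w x := by
  classical
  obtain ⟨a1, a2⟩ := sum_berr_eq S u 0
  obtain ⟨b1, b2⟩ := sum_berr_eq S u w
  rw [a1, b1, ← integral_const_mul]
  refine integral_mono a2 (b2.const_mul 2) fun y => ?_
  have := sum_exp_filter_le S (fun x => ⟪u x, y⟫_ℝ - ‖u x‖ ^ 2 / 2) w
  simpa using this

open Classical in
/-- A lower bound on the error of every large code of distinct points extends to codes with
repetitions and biased decoders. -/
lemma card_mul_le_sum_berr {ι : Type*} {P : E → Prop} {B ε : ℝ} (hε : ε ≤ 1)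
    (hlow : ∀ D : Finset E, (∀ d ∈ D, P d) → B ≤ 2 * D.card → D.card * ε ≤ ∑ d ∈ D, perr D d)
    {S : Finset ι} {u : ι → E} (hP : ∀ x ∈ S, P (u x)) (hS : B ≤ S.card) (w : ι → ℝ) :
    S.card * ε ≤ 4 * ∑ x ∈ S, berr S u w x := by
  have h0 := sum_berr_zero_le S u w
  have hnn : ∀ x, 0 ≤ berr S u 0 x := fun x => measureReal_nonneg
  suffices h : S.card * ε ≤ 2 * ∑ x ∈ S, berr S u 0 x by linarith
  set U := S.filter (fun x => ∀ c ∈ S, u c = u x → c = x) with hU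
  set V := S.filter (fun x => ¬ ∀ c ∈ S, u c = u x → c = x) with hV
  have hUV : U.card + V.card = S.card := Finset.card_filter_add_card_filter_not _
  have hsub : ∀ T ⊆ S, ∑ x ∈ T, berr S u 0 x ≤ ∑ x ∈ S, berr S u 0 x := fun T hT =>
    Finset.sum_le_sum_of_subset_of_nonneg hT fun x _ _ => hnn x
  rcases le_total V.card U.card with hle | hle
  · have hinj : Set.InjOn u (U : Set ι) := fun x hx y hy hxy =>
      ((Finset.mem_filter.1 hy).2 x (Finset.mem_filter.1 hx).1 hxy)
    have hc : (U.image u).card = U.card := Finset.card_image_of_injOn hinj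
    have h1 : (S.card : ℝ) ≤ 2 * U.card := by exact_mod_cast (by omega : S.card ≤ 2 * U.card)
    have h2 := hlow (U.image u) (fun d hd => by
      obtain ⟨x, hx, rfl⟩ := Finset.mem_image.1 hd
      exact hP x (Finset.mem_filter.1 hx).1) (by rw [hc]; linarith)
    rw [hc, Finset.sum_image hinj] at h2
    have h3 : ∑ x ∈ U, perr (U.image u) (u x) ≤ ∑ x ∈ U, berr S u 0 x := by
      refine Finset.sum_le_sum fun x hx => measureReal_mono fun z hz => ?_
      obtain ⟨d, hd, hdx, hz⟩ := (mem_nearSet_iff_score _ _ _).1 hz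
      obtain ⟨c, hc, rfl⟩ := Finset.mem_image.1 hd
      exact ⟨c, (Finset.mem_filter.1 hc).1, fun h => hdx (by rw [h]), by simpa using hz⟩
    have h4 := hsub U (Finset.filter_subset _ _)
    rcases le_total 0 ε with hε0 | hε0
    · have := mul_le_mul_of_nonneg_right h1 hε0
      linarith
    · have h5 : S.card * ε ≤ 0 := mul_nonpos_of_nonneg_of_nonpos (Nat.cast_nonneg _) hε0
      have h6 : 0 ≤ ∑ x ∈ S, berr S u 0 x := Finset.sum_nonneg fun x _ => hnn x
      linarith
  · have h1 : (S.card : ℝ) ≤ 2 * V.card := by exact_mod_cast (by omega : S.card ≤ 2 * V.card)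
    have h2 : (V.card : ℝ) ≤ ∑ x ∈ V, berr S u 0 x := by
      rw [← nsmul_one, ← Finset.sum_const]
      refine Finset.sum_le_sum fun x hx => ?_
      obtain ⟨hx, hx'⟩ := Finset.mem_filter.1 hx
      push Not at hx'
      obtain ⟨c, hc, hcu, hcx⟩ := hx'
      have : {z | ∃ c ∈ S, c ≠ x ∧ (0 : ι → ℝ) x + (⟪u x, u x + z⟫_ℝ - ‖u x‖ ^ 2 / 2) ≤
          (0 : ι → ℝ) c + (⟪u c, u x + z⟫_ℝ - ‖u c‖ ^ 2 / 2)} = Set.univ :=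
        Set.eq_univ_of_forall fun z => ⟨c, hc, hcx, by simp [hcu]⟩
      rw [berr, this, probReal_univ]
    have h4 := hsub V (Finset.filter_subset _ _)
    have h5 : S.card * ε ≤ S.card * 1 := mul_le_mul_of_nonneg_left hε (Nat.cast_nonneg _)
    linarith

/-- The error probability of a codeword is bounded below by conditioning on the component of the
output orthogonal to a subspace. -/
lemma mul_measureReal_le_perr (C : Finset E) (x : E) (K : Submodule ℝ E) {ε : ℝ} (hε : 0 ≤ ε) :
    ε * (stdGaussian Kᗮ).real {z | Kᗮ.orthogonalProjectionOnto x + z ∉ {y | berr C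
        (fun c => K.orthogonalProjectionOnto c) (fun c => ⟪Kᗮ.orthogonalProjectionOnto c, y⟫_ℝ -
          ‖Kᗮ.orthogonalProjectionOnto c‖ ^ 2 / 2) x < ε}} ≤ perr C x := by
  have hN := measurableSet_nearSet C x 0
  have hadd : Measurable fun p : Kᗮ × K => (p.1 : E) + (p.2 : E) := by fun_prop
  have hsc : ∀ (c : E) (z₁ : Kᗮ) (z₂ : K), ⟪c, x + (z₁ + z₂)⟫_ℝ - ‖c‖ ^ 2 / 2 =
      (⟪Kᗮ.orthogonalProjectionOnto c, Kᗮ.orthogonalProjectionOnto x + z₁⟫_ℝ -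
        ‖Kᗮ.orthogonalProjectionOnto c‖ ^ 2 / 2) +
      (⟪K.orthogonalProjectionOnto c, K.orthogonalProjectionOnto x + z₂⟫_ℝ -
        ‖K.orthogonalProjectionOnto c‖ ^ 2 / 2) := fun c z₁ z₂ => by
    have h1 := Submodule.norm_sq_eq_add_norm_sq_starProjection c K
    have h2 : ‖K.starProjection c‖ = ‖K.orthogonalProjectionOnto c‖ := rfl
    have h3 : ‖Kᗮ.starProjection c‖ = ‖Kᗮ.orthogonalProjectionOnto c‖ := rfl
    have h4 : x + (z₁ + z₂) = ((Kᗮ.orthogonalProjectionOnto x + z₁ : Kᗮ) : E) +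
        ((K.orthogonalProjectionOnto x + z₂ : K) : E) := by
      conv_lhs => rw [← K.starProjection_add_starProjection_orthogonal x]
      push_cast
      change K.starProjection x + Kᗮ.starProjection x + _ = Kᗮ.starProjection x + _ +
        (K.starProjection x + _)
      abel
    rw [h4, inner_add_right, ← Submodule.inner_orthogonalProjectionOnto_eq_of_mem_right,
      ← Submodule.inner_orthogonalProjectionOnto_eq_of_mem_right, h1, h2, h3]
    ring
  have hsec : ∀ z₁ : Kᗮ, (stdGaussian K).real (Prod.mk z₁ ⁻¹'
      ((fun p : Kᗮ × K => (p.1 : E) + (p.2 : E)) ⁻¹' nearSet C x 0)) =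
      berr C (fun c => K.orthogonalProjectionOnto c) (fun c => ⟪Kᗮ.orthogonalProjectionOnto c,
        Kᗮ.orthogonalProjectionOnto x + z₁⟫_ℝ - ‖Kᗮ.orthogonalProjectionOnto c‖ ^ 2 / 2) x := by
    intro z₁
    unfold berr
    congr 1
    ext z₂
    simp only [Set.mem_preimage, mem_nearSet_iff_score, hsc, Set.mem_ofPred_eq]
  have h1 : stdGaussian E (nearSet C x 0) = ∫⁻ z₁, stdGaussian K (Prod.mk z₁ ⁻¹'
      ((fun p : Kᗮ × K => (p.1 : E) + (p.2 : E)) ⁻¹' nearSet C x 0)) ∂(stdGaussian Kᗮ) := by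
    rw [stdGaussian_eq_map_prod K, Measure.map_apply hadd hN,
      Measure.prod_apply (hN.preimage hadd)]
  have h2 := mul_meas_ge_le_lintegral (μ := stdGaussian Kᗮ)
    (measurable_measure_prodMk_left (ν := stdGaussian K) (hN.preimage hadd)) (ENNReal.ofReal ε)
  rw [← h1] at h2
  have h3 := ENNReal.toReal_mono (measure_ne_top _ _) h2
  rw [ENNReal.toReal_mul, ENNReal.toReal_ofReal hε] at h3
  refine le_trans (mul_le_mul_of_nonneg_left (measureReal_mono fun z hz => ?_) hε) h3
  simp only [Set.mem_ofPred_eq, not_lt] at hz ⊢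
  rw [← hsec] at hz
  exact ENNReal.ofReal_le_of_le_toReal hz

lemma measurableSet_berr_lt {F : Type*} [NormedAddCommGroup F] [InnerProductSpace ℝ F]
    [FiniteDimensional ℝ F] [MeasurableSpace F] [BorelSpace F] {ι : Type*} (S : Finset ι)
    (u : ι → E) (v : ι → F) (x : ι) (ε : ℝ) : MeasurableSet
      {y : F | berr S u (fun c => ⟪v c, y⟫_ℝ - ‖v c‖ ^ 2 / 2) x < ε} := by
  have hM : MeasurableSet {p : F × E | ∃ c ∈ S, c ≠ x ∧
      (⟪v x, p.1⟫_ℝ - ‖v x‖ ^ 2 / 2) + (⟪u x, u x + p.2⟫_ℝ - ‖u x‖ ^ 2 / 2) ≤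
        (⟪v c, p.1⟫_ℝ - ‖v c‖ ^ 2 / 2) + (⟪u c, u x + p.2⟫_ℝ - ‖u c‖ ^ 2 / 2)} := by
    have e : {p : F × E | ∃ c ∈ S, c ≠ x ∧
      (⟪v x, p.1⟫_ℝ - ‖v x‖ ^ 2 / 2) + (⟪u x, u x + p.2⟫_ℝ - ‖u x‖ ^ 2 / 2) ≤
        (⟪v c, p.1⟫_ℝ - ‖v c‖ ^ 2 / 2) + (⟪u c, u x + p.2⟫_ℝ - ‖u c‖ ^ 2 / 2)} =
        ⋃ c ∈ (S : Set ι), ⋃ _ : c ≠ x, {p : F × E |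
      (⟪v x, p.1⟫_ℝ - ‖v x‖ ^ 2 / 2) + (⟪u x, u x + p.2⟫_ℝ - ‖u x‖ ^ 2 / 2) ≤
        (⟪v c, p.1⟫_ℝ - ‖v c‖ ^ 2 / 2) + (⟪u c, u x + p.2⟫_ℝ - ‖u c‖ ^ 2 / 2)} := by
      ext y; simp only [Set.mem_iUnion, Set.mem_ofPred_eq, exists_prop, Finset.mem_coe]
    rw [e]
    exact MeasurableSet.biUnion S.countable_toSet fun c _ => MeasurableSet.iUnion fun _ =>
      measurableSet_le (by fun_prop) (by fun_prop)
  exact measurableSet_lt (measurable_measure_prodMk_left (ν := stdGaussian E) hM).ennreal_toReal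
    measurable_const

end

end GaussRel

namespace GaussRel
open ProbabilityTheory
open scoped InnerProductSpace
set_option linter.unusedSectionVars false

section
variable {E : Type} [NormedAddCommGroup E] [InnerProductSpace ℝ E] [FiniteDimensional ℝ E]
  [MeasurableSpace E] [BorelSpace E]
local notation "dim" => (Module.finrank ℝ E : ℝ)

open Classical in
/-- A list-decoding bound on `Kᗮ` and a decoding bound on `K` combine to a decoding bound. -/
lemma card_mul_le_sum_perr (C : Finset E) (K : Submodule ℝ E) {Pd : K → Prop} {B ε P Q : ℝ}
    (hB : 0 < B) (hε : 0 ≤ ε) (hε1 : ε ≤ 1) (hQ : 0 ≤ Q)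
    (hsp : ∀ (W : E → Set Kᗮ) (L : ℝ), (∀ i, MeasurableSet (W i)) →
      (∀ y, ((C.filter fun i => y ∈ W i).card : ℝ) ≤ L) → (C.card : ℝ) / 2 ≤ P * L +
        Q * ∑ i ∈ C, (stdGaussian Kᗮ).real {z | Kᗮ.orthogonalProjectionOnto i + z ∉ W i})
    (hlow : ∀ D : Finset K, (∀ d ∈ D, Pd d) → B ≤ 2 * D.card → D.card * ε ≤ ∑ d ∈ D, perr D d)
    (hP : ∀ x ∈ C, Pd (K.orthogonalProjectionOnto x)) (hPB : P * B ≤ C.card / 4) :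
    C.card * ε ≤ 16 * Q * ∑ x ∈ C, perr C x := by
  set W : E → Set Kᗮ := fun x => {y | berr C
        (fun c => K.orthogonalProjectionOnto c) (fun c => ⟪Kᗮ.orthogonalProjectionOnto c, y⟫_ℝ -
          ‖Kᗮ.orthogonalProjectionOnto c‖ ^ 2 / 2) x < ε / 4} with hW
  have h1 := hsp W B (fun x => measurableSet_berr_lt _ _ _ _ _) fun y => by
    by_contra! hlt
    set S := C.filter (fun i => y ∈ W i) with hS
    have hSC : S ⊆ C := Finset.filter_subset _ _
    have h2 := card_mul_le_sum_berr hε1 hlow (S := S) (u := fun c => K.orthogonalProjectionOnto c)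
      (fun x hx => hP x (hSC hx)) hlt.le (fun c => ⟪Kᗮ.orthogonalProjectionOnto c, y⟫_ℝ -
          ‖Kᗮ.orthogonalProjectionOnto c‖ ^ 2 / 2)
    have hne : S.Nonempty := by
      rw [← Finset.card_pos]
      exact_mod_cast hB.trans hlt
    have h3 : ∑ x ∈ S, berr S (fun c => K.orthogonalProjectionOnto c)
        (fun c => ⟪Kᗮ.orthogonalProjectionOnto c, y⟫_ℝ -
          ‖Kᗮ.orthogonalProjectionOnto c‖ ^ 2 / 2) x < ∑ _x ∈ S, ε / 4 :=
      Finset.sum_lt_sum_of_nonempty hne fun x hx =>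
        (berr_mono hSC _ _ x).trans_lt (Finset.mem_filter.1 hx).2
    rw [Finset.sum_const, nsmul_eq_mul] at h3
    linarith
  have h2 : ε / 4 * ∑ i ∈ C, (stdGaussian Kᗮ).real
      {z | Kᗮ.orthogonalProjectionOnto i + z ∉ W i} ≤ ∑ x ∈ C, perr C x := by
    rw [Finset.mul_sum]
    exact Finset.sum_le_sum fun x _ => mul_measureReal_le_perr C x K (by positivity)
  have h3 := mul_le_mul_of_nonneg_left h2 hQ
  have h4 := mul_le_mul_of_nonneg_right (h1.trans (add_le_add_left hPB _)) hε
  linarith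

open Classical in
lemma card_le_two_mul_card_filter {ι : Type*} (C : Finset ι) (f : ι → ℝ) {V t : ℝ}
    (hf : ∑ x ∈ C, f x ^ 2 ≤ C.card * V) (hV : 2 * V ≤ t ^ 2) (ht : 0 < t) :
    C.card ≤ 2 * (C.filter fun x => |f x| ≤ t).card := by
  have h0 := Finset.card_filter_add_card_filter_not (s := C) (fun x => |f x| ≤ t)
  have h1 : (C.filter fun x => ¬ |f x| ≤ t).card • t ^ 2 ≤
      ∑ x ∈ C.filter (fun x => ¬ |f x| ≤ t), f x ^ 2 :=
    Finset.card_nsmul_le_sum _ _ _ fun x hx => by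
      rw [← sq_abs (f x)]
      exact pow_le_pow_left₀ ht.le (not_le.1 (Finset.mem_filter.1 hx).2).le 2
  have h2 := Finset.sum_le_sum_of_subset_of_nonneg
    (Finset.filter_subset (fun x => ¬ |f x| ≤ t) C) fun x _ _ => sq_nonneg (f x)
  rw [nsmul_eq_mul] at h1
  have h3 : ((C.filter fun x => ¬ |f x| ≤ t).card : ℝ) * t ^ 2 ≤ C.card / 2 * t ^ 2 := by
    have := mul_le_mul_of_nonneg_left hV (Nat.cast_nonneg (α := ℝ) C.card)
    linarith
  have h4 := le_of_mul_le_mul_right h3 (by positivity)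
  have h5 : 2 * (C.filter fun x => ¬ |f x| ≤ t).card ≤ C.card := by
    have : 2 * ((C.filter fun x => ¬ |f x| ≤ t).card : ℝ) ≤ C.card := by linarith
    exact_mod_cast this
  omega

end

set_option maxHeartbeats 1600000 in
open Classical in
/-- Converse: the error of spherical codes whose rate lies between the low-rate threshold and the
critical rate. -/
lemma exists_sum_perr_ge_straight_line {a α R δ : ℝ} (ha : 0 < a) (hα : 0 < α) (hα1 : α < 1)
    (haα : a * (1 - α ^ 2) = 4 * α) (hδ : 0 < δ)
    (hmain : a * (1 - α) / 8 < a * (1 - α) / 4 - 1 / 2 * log (1 - α ^ 2) - hrate (kap α))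
    (hR0 : hrate (kap α) ≤ R) (hR1 : R ≤ -(1 / 2 * log (1 - α))) :
    ∃ n₀ : ℕ, ∀ (E : Type) [NormedAddCommGroup E] [InnerProductSpace ℝ E]
      [FiniteDimensional ℝ E] [MeasurableSpace E] [BorelSpace E], n₀ ≤ Module.finrank ℝ E →
      ∀ C : Finset E, (∀ x ∈ C, ‖x‖ ^ 2 = Module.finrank ℝ E * a) →
        exp (Module.finrank ℝ E * R) ≤ C.card →
        C.card * exp (-(Module.finrank ℝ E *
          (a * (1 - α) / 4 - 1 / 2 * log (1 - α ^ 2) - R + δ))) ≤ ∑ x ∈ C, perr C x := by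
  obtain ⟨ρ, η₁, hρ0, hρ, hη₁, N₁, hlow⟩ := exists_sum_perr_ge_low_rate ha hα hα1 haα
    (by positivity : 0 < δ / 4) hmain
  set A := a * (1 - α) / 4 - 1 / 2 * log (1 - α ^ 2) with hA
  set Rc := -(1 / 2 * log (1 - α)) with hRc
  have hEc : α / (1 + α) - 1 / 2 * log (1 + α) = A - Rc := by
    have e1 : 1 - α ^ 2 = (1 - α) * (1 + α) := by ring
    have e2 : a * (1 - α) / 4 = α / (1 + α) := by
      field_simp
      linear_combination haα
    rw [hA, hRc, e1, log_mul (by linarith) (by linarith), e2]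
    ring
  set τ := min (δ / 4) ((R - ρ) / 2) with hτ
  have hτ0 : 0 < τ := lt_min (by positivity) (by linarith)
  have hτδ : τ ≤ δ / 4 := min_le_left _ _
  have hτR : τ ≤ (R - ρ) / 2 := min_le_right _ _
  obtain ⟨η₂, hη₂, N₂, hsp⟩ := exists_sphere_packing ha hα hα1 haα (by positivity : 0 < τ / 2)
  rw [← hRc, hEc] at hsp
  have hD : 0 < Rc - ρ := by linarith
  set μ := (Rc - R + τ) / (Rc - ρ) with hμ
  have hμ0 : 0 < μ := div_pos (by linarith) hD
  have hμ1 : μ < 1 := by rw [hμ, div_lt_one hD]; linarith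
  have hμD : μ * (Rc - ρ) = Rc - R + τ := div_mul_cancel₀ _ hD.ne'
  set η := min (η₂ * (1 - μ)) (η₁ * (μ / 2)) with hη
  have hη0 : 0 < η := lt_min (mul_pos hη₂ (by linarith)) (by positivity)
  obtain ⟨x₀, hx₀⟩ := eventually_atTop.1 (((((eventually_ge_atTop (2 / μ)).and
    (eventually_ge_atTop (N₁ / (μ / 2)))).and (eventually_ge_atTop (N₂ / (1 - μ)))).and
    (eventually_ge_atTop (8 * a ^ 2 / (μ * η ^ 2)))).and
    ((eventually_ge_atTop ((Rc + τ / 2 - ρ + 3) / (τ / 2))).and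
      (eventually_ge_atTop (4 / (δ / 2)))))
  refine ⟨⌈x₀⌉₊, fun E _ _ _ _ _ hn C hC hcard => ?_⟩
  obtain ⟨⟨⟨⟨ev1, ev2⟩, ev3⟩, ev4⟩, ev5, ev6⟩ := hx₀ ((Module.finrank ℝ E : ℕ) : ℝ)
    ((Nat.le_ceil x₀).trans (by exact_mod_cast hn))
  set n : ℝ := ((Module.finrank ℝ E : ℕ) : ℝ) with hn'
  rw [div_le_iff₀ (by linarith)] at ev3
  rw [div_le_iff₀ (by positivity)] at ev1 ev2 ev4 ev5 ev6
  clear hx₀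
  have hn0 : 0 < n := by
    by_contra! h
    have := mul_nonpos_of_nonpos_of_nonneg h hμ0.le
    linarith
  set k := ⌊μ * n⌋₊ with hk
  have hk1 : (k : ℝ) ≤ μ * n := Nat.floor_le (by positivity)
  have hk2 : μ * n < k + 1 := Nat.lt_floor_add_one _
  have hk3 : μ / 2 * n ≤ k := by linarith
  have hk4 : 1 ≤ k := by
    have : (0 : ℝ) < k := by linarith
    exact_mod_cast this
  have hkn : k ≤ Module.finrank ℝ E := by
    have h : (k : ℝ) ≤ n := hk1.trans (mul_le_of_le_one_left hn0.le hμ1.le)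
    rw [hn'] at h
    exact_mod_cast h
  obtain ⟨K, hK, hKs⟩ := exists_submodule_sum_sq_le C hC hk4 hkn
  rw [← hn'] at hKs
  have hKo : (Module.finrank ℝ Kᗮ : ℝ) = n - k := by
    have h1 := K.finrank_add_finrank_orthogonal
    rw [hK] at h1
    rw [hn', ← h1]; push_cast; ring
  have hKo1 : (1 - μ) * n ≤ n - k := by linarith
  have hkpos : (0 : ℝ) < k := by positivity
  set C' := C.filter (fun x => |‖K.starProjection x‖ ^ 2 - k / n * (n * a)| ≤ η * n) with hC'
  have hcard' : C.card ≤ 2 * C'.card := by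
    refine card_le_two_mul_card_filter C _ hKs ?_ (by positivity)
    have h1 : (k : ℝ)⁻¹ - n⁻¹ ≤ (μ / 2 * n)⁻¹ := by
      have := inv_anti₀ (by positivity) hk3
      have := inv_pos.2 hn0
      linarith
    calc 2 * (2 * (n * a) ^ 2 * ((k : ℝ)⁻¹ - n⁻¹)) ≤ 2 * (2 * (n * a) ^ 2 * (μ / 2 * n)⁻¹) := by
          gcongr
      _ = 8 * a ^ 2 * n / μ := by field_simp; ring
      _ ≤ n * (μ * η ^ 2) * n / μ := by gcongr
      _ = (η * n) ^ 2 := by field_simp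
  have hgood : ∀ x ∈ C', |‖K.starProjection x‖ ^ 2 - k * a| ≤ η * n := fun x hx => by
    have h := (Finset.mem_filter.1 hx).2
    rwa [← mul_assoc, div_mul_cancel₀ _ hn0.ne'] at h
  have hε1 : exp (-((k : ℝ) * (A - ρ + δ / 4))) ≤ 1 := by
    rw [exp_le_one_iff, neg_nonpos]
    have : 0 ≤ a * (1 - α) := mul_nonneg ha.le (by linarith)
    exact mul_nonneg hkpos.le (by linarith)
  have hC'R : exp (n * R) / 2 ≤ C'.card := by
    have : (C.card : ℝ) ≤ 2 * C'.card := by exact_mod_cast hcard'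
    linarith
  have hmain2 := card_mul_le_sum_perr C' K (Pd := fun d => |‖d‖ ^ 2 - k * a| ≤ η₁ * k)
    (B := exp (k * ρ)) (ε := exp (-((k : ℝ) * (A - ρ + δ / 4))))
    (P := exp ((n - k) * (Rc + τ / 2))) (Q := exp ((n - k) * (A - Rc + τ / 2)))
    (exp_pos _) (exp_pos _).le hε1 (exp_pos _).le ?_ ?_ ?_ ?_
  · have h1 : ∑ x ∈ C', perr C' x ≤ ∑ x ∈ C, perr C x :=
      (Finset.sum_le_sum fun x _ => perr_mono (Finset.filter_subset _ _) x).trans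
        (Finset.sum_le_sum_of_subset_of_nonneg (Finset.filter_subset _ _)
          fun _ _ _ => perr_nonneg _ _)
    have h2 : (C.card : ℝ) ≤ 2 * C'.card := by exact_mod_cast hcard'
    set Q := exp ((n - k) * (A - Rc + τ / 2)) with hQ
    set ε := exp (-((k : ℝ) * (A - ρ + δ / 4))) with hε
    have h3 : 32 * Q * exp (-(n * (A - R + δ))) ≤ ε := by
      have h4 : (32 : ℝ) ≤ exp 4 := by
        have h5 := exp_one_gt_d9
        have h6 : exp 4 = exp 1 ^ 4 := by rw [← exp_nat_mul]; norm_num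
        rw [h6]
        exact le_trans (by norm_num) (pow_le_pow_left₀ (by norm_num) h5.le 4)
      calc _ ≤ exp 4 * Q * exp (-(n * (A - R + δ))) := by gcongr
        _ = exp (4 + (n - k) * (A - Rc + τ / 2) + -(n * (A - R + δ))) := by
          rw [exp_add, exp_add]
        _ ≤ ε := by
          refine exp_le_exp.2 ?_
          have h7 := mul_le_mul_of_nonneg_left hk1 hD.le
          have h8 : (Rc - ρ) * (μ * n) = (Rc - R + τ) * n := by rw [← hμD]; ring
          have h9 : (n - k) * (τ / 2) ≤ (n - k) * (δ / 4) :=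
            mul_le_mul_of_nonneg_left (by linarith) (le_trans (mul_nonneg (by linarith) hn0.le) hKo1)
          have h10 : n * τ ≤ n * (δ / 4) := mul_le_mul_of_nonneg_left hτδ hn0.le
          linarith
    have h4 : C.card * ε ≤ 32 * Q * ∑ x ∈ C, perr C x := by
      have e1 := mul_le_mul_of_nonneg_right h2 (exp_pos (-((k : ℝ) * (A - ρ + δ / 4)))).le
      have e2 := mul_le_mul_of_nonneg_left h1 (exp_pos ((n - k) * (A - Rc + τ / 2))).le
      linarith
    have h5 := mul_le_mul_of_nonneg_left h3 (Nat.cast_nonneg (α := ℝ) C.card)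
    have h6 : 32 * Q * (C.card * exp (-(n * (A - R + δ)))) ≤ 32 * Q * ∑ x ∈ C, perr C x := by
      linarith
    exact le_of_mul_le_mul_left h6 (by positivity)
  · intro W L hW hL
    have h := hsp Kᗮ (by
      have : (N₂ : ℝ) ≤ Module.finrank ℝ Kᗮ := by rw [hKo]; linarith
      exact_mod_cast this) E C' (fun x => Kᗮ.orthogonalProjectionOnto x) (fun x hx => by
        rw [hKo]
        have h1 := (abs_le.1 (hgood x hx)).1
        have h2 := Submodule.norm_sq_eq_add_norm_sq_starProjection x K
        rw [hC x (Finset.mem_filter.1 hx).1] at h2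
        have h3 : ‖Kᗮ.orthogonalProjectionOnto x‖ = ‖Kᗮ.starProjection x‖ := rfl
        have h4 : η * n ≤ η₂ * ((1 - μ) * n) := by
          rw [← mul_assoc]; exact mul_le_mul_of_nonneg_right (min_le_left _ _) hn0.le
        have h5 := mul_le_mul_of_nonneg_left hKo1 hη₂.le
        rw [h3]
        linarith) W L hW hL
    rwa [hKo] at h
  · intro D hD hDc
    have h := hlow K (by
      have : (N₁ : ℝ) ≤ Module.finrank ℝ K := by rw [hK]; linarith
      exact_mod_cast this) D (by rw [hK]; exact hD) (by rw [hK]; exact hDc)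
    rwa [hK] at h
  · intro x hx
    have h3 : ‖K.orthogonalProjectionOnto x‖ = ‖K.starProjection x‖ := rfl
    simp only [h3]
    refine (hgood x hx).trans ?_
    have h4 : η * n ≤ η₁ * (μ / 2 * n) := by
      rw [← mul_assoc]; exact mul_le_mul_of_nonneg_right (min_le_right _ _) hn0.le
    exact h4.trans (mul_le_mul_of_nonneg_left hk3 hη₁.le)
  · have h4 : (8 : ℝ) ≤ exp 3 := by
      have h5 := exp_one_gt_d9
      have h6 : exp 3 = exp 1 ^ 3 := by rw [← exp_nat_mul]; norm_num
      rw [h6]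
      exact le_trans (by norm_num) (pow_le_pow_left₀ (by norm_num) h5.le 3)
    have h5 : exp ((n - k) * (Rc + τ / 2)) * exp (k * ρ) * exp 3 ≤ exp (n * R) := by
      rw [← exp_add, ← exp_add]
      refine exp_le_exp.2 ?_
      have h7 := mul_le_mul_of_nonneg_left hk2.le (by linarith : 0 ≤ Rc + τ / 2 - ρ)
      have h8 : (Rc - ρ) * (μ * n) = (Rc - R + τ) * n := by rw [← hμD]; ring
      have h9 : 0 ≤ τ / 2 * (μ * n) := by positivity
      linarith
    have h6 := mul_le_mul_of_nonneg_left h4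
      (mul_nonneg (exp_pos ((n - k) * (Rc + τ / 2))).le (exp_pos (k * ρ)).le)
    linarith

end GaussRel

namespace GaussRel
open ProbabilityTheory
open scoped InnerProductSpace
set_option linter.unusedSectionVars false

section RandomCoding

variable {E : Type*} [NormedAddCommGroup E] [InnerProductSpace ℝ E] [FiniteDimensional ℝ E]
  [MeasurableSpace E] [BorelSpace E]

local notation "dim" => (Module.finrank ℝ E : ℝ)

open Classical in
/-- Union bound for the error probability. -/
lemma perr_le_sum_aff (C : Finset E) (x : E) : perr C x ≤ ∑ c ∈ C.erase x, aff c x := by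
  have h : nearSet C x 0 = ⋃ c ∈ C.erase x,
      {z | ‖c - x‖ ^ 2 / 4 ≤ (1 / 2 : ℝ) * ⟪c - x, z⟫_ℝ} := by
    ext z
    simp only [nearSet, Set.mem_ofPred_eq, Set.mem_iUnion, Finset.mem_erase, exists_prop, sub_zero]
    refine ⟨fun ⟨c, h1, h2, h3⟩ => ⟨c, ⟨h2, h1⟩, by linarith⟩,
      fun ⟨c, ⟨h2, h1⟩, h3⟩ => ⟨c, h1, h2, by linarith⟩⟩
  rw [perr, h]
  refine (measureReal_biUnion_finset_le _ _).trans (Finset.sum_le_sum fun c _ => ?_)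
  refine (inner_tail (c - x) (1 / 2) (‖c - x‖ ^ 2 / 4)).trans (le_of_eq ?_)
  rw [aff]; congr 1; ring

lemma aff_eq_of_norm_sq {x y : E} {r : ℝ} (hx : ‖x‖ ^ 2 = r) (hy : ‖y‖ ^ 2 = r) :
    aff x y = exp (-(r / 4)) * exp (⟪x, y⟫_ℝ / 4) := by
  rw [aff, ← exp_add, norm_sub_sq_real, hx, hy]
  congr 1; ring

lemma integral_exp_inner_sub_sq (v : E) {s : ℝ} (hs : 0 < s) :
    ∫ z, exp (-((s⁻¹) ^ 2 - 1) * ‖z‖ ^ 2 / 2) * exp ⟪v, z⟫_ℝ ∂(stdGaussian E) =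
      s ^ Module.finrank ℝ E * exp (s ^ 2 * ‖v‖ ^ 2 / 2) := by
  have h := integral_scale hs (fun z : E => exp ⟪v, z⟫_ℝ)
  simp only [inner_smul_right, ← real_inner_smul_left] at h
  rw [integral_exp_inner, norm_smul, mul_pow, Real.norm_eq_abs, sq_abs] at h
  rw [h, mul_inv_cancel_left₀ (by positivity)]

lemma integrable_exp_inner_sub_sq (v : E) {s : ℝ} (hs : 0 < s) :
    Integrable (fun z => exp (-((s⁻¹) ^ 2 - 1) * ‖z‖ ^ 2 / 2) * exp ⟪v, z⟫_ℝ)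
      (stdGaussian E) := by
  refine (integrable_scale_iff hs (fun z : E => exp ⟪v, z⟫_ℝ)).1 ?_
  simpa [inner_smul_right, real_inner_smul_left] using integrable_exp_inner (s • v) 0

/-- Radial projection onto the sphere of squared radius `r`. -/
noncomputable def toSphere (r : ℝ) (g : E) : E := (√r / ‖g‖) • g

@[fun_prop] lemma measurable_toSphere (r : ℝ) : Measurable (toSphere r : E → E) := by
  unfold toSphere; fun_prop

lemma norm_sq_toSphere {r : ℝ} (hr : 0 ≤ r) {g : E} (hg : 0 < ‖g‖) : ‖toSphere r g‖ ^ 2 = r := by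
  rw [toSphere, norm_smul, mul_pow, Real.norm_eq_abs, sq_abs, div_pow, Real.sq_sqrt hr]
  field_simp

lemma typical_zero_bounds {η : ℝ} (hη : 0 < η) (hη1 : η ≤ 1 / 2) {g : E}
    (hg : g ∈ typical η (0 : E)) : ‖g‖ ^ 2 ≤ (1 + η) * dim ∧ dim ≤ (1 + 2 * η) * ‖g‖ ^ 2 := by
  have h := abs_le.1 hg.1
  have hd : (0 : ℝ) ≤ dim := by positivity
  refine ⟨by linarith, ?_⟩
  have : (1 + 2 * η) * ((1 - η) * dim) ≤ (1 + 2 * η) * ‖g‖ ^ 2 :=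
    mul_le_mul_of_nonneg_left (by linarith) (by linarith)
  have h2 : 0 ≤ (η * (1 - 2 * η)) * dim := by
    have : 0 ≤ 1 - 2 * η := by linarith
    positivity
  nlinarith

lemma integral_aff_toSphere_le {a α η : ℝ} (ha : 0 < a) (hα : 0 < α) (hα1 : α < 1)
    (haα : a * (1 - α ^ 2) = 4 * α) (hη : 0 < η) (hη1 : η ≤ 1 / 2)
    (hd : 0 < dim) {y : E} (hy : ‖y‖ ^ 2 = dim * a) :
    ∫ g in typical η (0 : E), aff y (toSphere (dim * a) g) ∂(stdGaussian E) ≤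
      2 * exp (-(dim * (a * (1 - α) / 4 - 1 / 2 * log (1 - α ^ 2) - 3 / 8 * a * α * η))) := by
  have hα2 : 0 < 1 - α ^ 2 := by nlinarith
  set s := √(1 - α ^ 2) with hsdef
  have hs : 0 < s := Real.sqrt_pos.2 hα2
  have hs2 : s ^ 2 = 1 - α ^ 2 := Real.sq_sqrt hα2.le
  set κ := √(1 + 2 * η) with hκdef
  have hκ2 : κ ^ 2 = 1 + 2 * η := Real.sq_sqrt (by linarith)
  set v := (√a * κ / 4) • y with hv
  have hβ : (s⁻¹) ^ 2 - 1 = a * α / 4 := by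
    rw [inv_pow, hs2, show a = 4 * α / (1 - α ^ 2) by field_simp; linarith]
    field_simp; ring
  have hvn : s ^ 2 * ‖v‖ ^ 2 / 2 = dim * (a * α / 8 * (1 + 2 * η)) := by
    rw [hv, norm_smul, mul_pow, Real.norm_eq_abs, sq_abs, div_pow, mul_pow, hκ2,
      Real.sq_sqrt ha.le, hs2, hy, show (1 - α ^ 2) * (a * (1 + 2 * η) / 4 ^ 2 * (dim * a)) / 2 =
        (a * (1 - α ^ 2)) * (a * (1 + 2 * η) / 4 ^ 2 * dim) / 2 by ring, haα]
    ring
  have hpt : ∀ g ∈ typical η (0 : E), aff y (toSphere (dim * a) g) ≤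
      exp (-(dim * a / 4)) * (1 + exp (dim * (a * α / 8 * (1 + η))) *
        (exp (-((s⁻¹) ^ 2 - 1) * ‖g‖ ^ 2 / 2) * exp ⟪v, g⟫_ℝ)) := by
    intro g hg
    obtain ⟨h1, h2⟩ := typical_zero_bounds hη hη1 hg
    have hg2 : 0 < ‖g‖ := by
      rcases (norm_nonneg g).eq_or_lt with h | h
      · rw [← h, zero_pow two_ne_zero, mul_zero] at h2; linarith
      · exact h
    rw [aff_eq_of_norm_sq hy (norm_sq_toSphere (by positivity) hg2)]
    refine mul_le_mul_of_nonneg_left ?_ (exp_pos _).le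
    rw [toSphere, inner_smul_right]
    rcases le_total ⟪y, g⟫_ℝ 0 with h | h
    · have : exp (√(dim * a) / ‖g‖ * ⟪y, g⟫_ℝ / 4) ≤ 1 := exp_le_one_iff.2 (by
        have := mul_nonpos_of_nonneg_of_nonpos (by positivity : 0 ≤ √(dim * a) / ‖g‖) h
        linarith)
      have h3 : 0 < exp (dim * (a * α / 8 * (1 + η))) *
        (exp (-((s⁻¹) ^ 2 - 1) * ‖g‖ ^ 2 / 2) * exp ⟪v, g⟫_ℝ) := by positivity
      linarith
    · have h3 : √(dim * a) / ‖g‖ ≤ √a * κ := by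
        rw [div_le_iff₀ hg2]
        refine (Real.sqrt_le_sqrt (mul_le_mul_of_nonneg_right h2 ha.le)).trans (le_of_eq ?_)
        rw [mul_right_comm, Real.sqrt_mul (by positivity), Real.sqrt_sq hg2.le,
          Real.sqrt_mul (by positivity), mul_comm √(1 + 2 * η)]
      have h4 := mul_le_mul_of_nonneg_right h3 h
      have h5 : a * α / 8 * ‖g‖ ^ 2 ≤ a * α / 8 * ((1 + η) * dim) :=
        mul_le_mul_of_nonneg_left h1 (by positivity)
      rw [← exp_add, ← exp_add, hβ, hv, real_inner_smul_left]
      refine (exp_le_exp.2 ?_).trans (le_add_of_nonneg_left zero_le_one)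
      linarith
  have hi := ((integrable_const 1).add ((integrable_exp_inner_sub_sq v hs).const_mul
    (exp (dim * (a * α / 8 * (1 + η)))))).const_mul (exp (-(dim * a / 4)))
  simp only [Pi.add_apply] at hi
  have hIntegrable : Integrable (fun g => aff y (toSphere (dim * a) g)) (stdGaussian E) := by
    refine Integrable.of_bound (C := 1) ?_ (ae_of_all _ fun g => ?_)
    · unfold aff; fun_prop
    · rw [Real.norm_eq_abs, abs_of_pos (aff_pos _ _), aff]
      exact exp_le_one_iff.2 (by have := sq_nonneg ‖y - toSphere (dim * a) g‖; linarith)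
  refine (setIntegral_mono_on hIntegrable.integrableOn hi.integrableOn
    (measurableSet_typical _ _) hpt).trans ?_
  refine (setIntegral_le_integral hi (ae_of_all _ fun g => by positivity)).trans ?_
  rw [integral_const_mul, integral_add (integrable_const _)
    ((integrable_exp_inner_sub_sq v hs).const_mul _), integral_const_mul,
    integral_exp_inner_sub_sq v hs, hvn]
  simp only [integral_const, probReal_univ, smul_eq_mul, mul_one]
  have hsn : s ^ Module.finrank ℝ E = exp (dim * (1 / 2 * log (1 - α ^ 2))) := by
    have := sqrt_pow_inv_eq hα2 (Module.finrank ℝ E)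
    rw [← inv_inj, this, ← exp_neg]; congr 1; ring
  rw [hsn, ← exp_add, ← exp_add]
  have hlog : -(a * α / 4) ≤ log (1 - α ^ 2) := by
    have := one_sub_inv_le_log_of_pos hα2
    rw [← hs2, ← inv_pow] at this
    rw [← hs2]; linarith
  set Q := dim * (a * α / 8 * (1 + η)) +
      (dim * (1 / 2 * log (1 - α ^ 2)) + dim * (a * α / 8 * (1 + 2 * η))) with hQ
  have hQ0 : 0 ≤ Q := by
    have e : Q = dim * (a * α / 4 + 1 / 2 * log (1 - α ^ 2) + 3 / 8 * a * α * η) := by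
      rw [hQ]; ring
    rw [e]
    have := mul_pos (mul_pos ha hα) hη
    refine mul_nonneg hd.le (by nlinarith [mul_pos ha hα])
  have h1 : 1 ≤ exp Q := one_le_exp hQ0
  calc exp (-(dim * a / 4)) * (1 + exp Q) ≤ exp (-(dim * a / 4)) * (2 * exp Q) :=
        mul_le_mul_of_nonneg_left (by linarith) (exp_pos _).le
    _ = 2 * exp (-(dim * a / 4) + Q) := by rw [exp_add _ Q]; ring
    _ = _ := by rw [hQ]; congr 2; ring

open Classical in
/-- Greedy (expurgation-free) selection of a code whose total affinity is as small as the average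
one. -/
lemma exists_code_of_integral_aff_le {r m : ℝ} (hr : 0 ≤ r) {S : Set E} (hS : MeasurableSet S)
    (hS0 : ∀ g ∈ S, 0 < ‖g‖) (hS1 : 1 / 2 ≤ (stdGaussian E).real S)
    (hm : ∀ y : E, ‖y‖ ^ 2 = r → ∫ g in S, aff y (toSphere r g) ∂(stdGaussian E) ≤ m)
    (hm0 : 0 < m) (k : ℕ) (hk : 3 * k * m < 1) :
    ∃ C : Finset E, (∀ x ∈ C, ‖x‖ ^ 2 = r) ∧ C.card = k ∧
      ∑ x ∈ C, ∑ c ∈ C.erase x, aff c x ≤ 3 * k ^ 2 * m := by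
  induction k with
  | zero => exact ⟨∅, by simp, rfl, by simp⟩
  | succ k ih =>
    push_cast at hk ⊢
    obtain ⟨C, h1, h2, h3⟩ := ih (by linarith)
    have hIntegrable (y : E) : Integrable (fun g => aff y (toSphere r g)) (stdGaussian E) := by
      refine Integrable.of_bound (C := 1) ?_ (ae_of_all _ fun g => ?_)
      · unfold aff; fun_prop
      · rw [Real.norm_eq_abs, abs_of_pos (aff_pos _ _), aff]
        exact exp_le_one_iff.2 (by have := sq_nonneg ‖y - toSphere r g‖; linarith)
    have hsum : ∫ g in S, ∑ c ∈ C, aff c (toSphere r g) ∂(stdGaussian E) ≤ k * m := by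
      rw [integral_finsetSum _ fun c _ => (hIntegrable c).integrableOn]
      refine (Finset.sum_le_sum fun c hc => hm c (h1 c hc)).trans ?_
      rw [Finset.sum_const, h2, nsmul_eq_mul]
    obtain ⟨g, hgS, hg⟩ : ∃ g ∈ S, ∑ c ∈ C, aff c (toSphere r g) ≤ 3 * (k + 1 / 2) * m := by
      by_contra! hcon
      have h4 := setIntegral_mono_on (integrable_const (3 * (k + 1 / 2) * m)).integrableOn
        (integrable_finsetSum C fun c _ => hIntegrable c).integrableOn hS fun g hg => (hcon g hg).le
      rw [setIntegral_const, smul_eq_mul] at h4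
      have h5 : 1 / 2 * (3 * (k + 1 / 2) * m) ≤ (stdGaussian E).real S * (3 * (k + 1 / 2) * m) :=
        mul_le_mul_of_nonneg_right hS1 (by positivity)
      have h6 : 0 ≤ (k : ℝ) * m := by positivity
      linarith
    have hnot : toSphere r g ∉ C := fun hC => by
      have h4 : aff (toSphere r g) (toSphere r g) ≤ ∑ c ∈ C, aff c (toSphere r g) :=
        Finset.single_le_sum (f := fun c => aff c (toSphere r g)) (fun c _ => (aff_pos _ _).le) hC
      have h5 : aff (toSphere r g) (toSphere r g) = 1 := by simp [aff]
      linarith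
    refine ⟨insert (toSphere r g) C, ?_, by rw [Finset.card_insert_of_notMem hnot, h2], ?_⟩
    · intro x hx
      rcases Finset.mem_insert.1 hx with rfl | hx
      · exact norm_sq_toSphere hr (hS0 g hgS)
      · exact h1 x hx
    · rw [Finset.sum_insert hnot, Finset.erase_insert hnot]
      have h4 : ∑ x ∈ C, ∑ c ∈ (insert (toSphere r g) C).erase x, aff c x =
          ∑ x ∈ C, aff x (toSphere r g) + ∑ x ∈ C, ∑ c ∈ C.erase x, aff c x := by
        rw [← Finset.sum_add_distrib]
        refine Finset.sum_congr rfl fun x hx => ?_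
        have hne : toSphere r g ≠ x := fun h => hnot (h ▸ hx)
        rw [Finset.erase_insert_of_ne hne, Finset.sum_insert
          (fun h => hnot (Finset.mem_of_mem_erase h)), aff_comm]
      rw [h4]
      have h6 : 0 ≤ (k : ℝ) * m := by positivity
      nlinarith

end RandomCoding

/-- Random coding bound: spherical codes of rate at most `R` whose average error probability
decays with the random coding exponent. -/
lemma exists_code_sum_perr_le {a α R ε : ℝ} (ha : 0 < a) (hα : 0 < α) (hα1 : α < 1)
    (haα : a * (1 - α ^ 2) = 4 * α) (hε : 0 < ε)
    (hR : R < a * (1 - α) / 4 - 1 / 2 * log (1 - α ^ 2)) :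
    ∃ n₀ : ℕ, ∀ (E : Type) [NormedAddCommGroup E] [InnerProductSpace ℝ E]
      [FiniteDimensional ℝ E] [MeasurableSpace E] [BorelSpace E], n₀ ≤ Module.finrank ℝ E →
      ∀ M : ℕ, (M : ℝ) ≤ 2 * exp (Module.finrank ℝ E * R) →
      ∃ C : Finset E, (∀ x ∈ C, ‖x‖ ^ 2 = Module.finrank ℝ E * a) ∧ C.card = M ∧
        ∑ x ∈ C, perr C x ≤ M * exp (-(Module.finrank ℝ E *
          (a * (1 - α) / 4 - 1 / 2 * log (1 - α ^ 2) - R - ε))) := by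
  set G := a * (1 - α) / 4 - 1 / 2 * log (1 - α ^ 2) with hG
  set δ := min (ε / 2) ((G - R) / 2) with hδ
  have hδ0 : 0 < δ := lt_min (by linarith) (by linarith)
  have hδ1 : δ ≤ ε / 2 := min_le_left _ _
  have hδ2 : δ ≤ (G - R) / 2 := min_le_right _ _
  set η := min (1 / 2) (δ / (3 / 8 * a * α)) with hη
  have haα0 : 0 < 3 / 8 * a * α := by positivity
  have hη0 : 0 < η := lt_min (by norm_num) (by positivity)
  have hη1 : η ≤ 1 / 2 := min_le_left _ _
  have hη2 : 3 / 8 * a * α * η ≤ δ := by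
    have := min_le_right (1 / 2) (δ / (3 / 8 * a * α))
    rw [← hη, le_div_iff₀ haα0] at this
    linarith
  obtain ⟨n₁, hn₁⟩ := exists_typical_compl_le hη0 (by linarith : η < 1) one_pos
  obtain ⟨n₂, hn₂⟩ := eventually_atTop.1 (((tendsto_exp_neg_mul hδ0).comp
    tendsto_natCast_atTop_atTop).eventually_lt_const (u := 1 / 12) (by norm_num))
  refine ⟨max (max n₁ n₂) 1, fun E _ _ _ _ _ hn M hM => ?_⟩
  have hd : (0 : ℝ) < Module.finrank ℝ E := by
    exact_mod_cast Nat.lt_of_lt_of_le one_pos ((le_max_right _ _).trans hn)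
  have hS := hn₁ E ((le_max_left _ _).trans ((le_max_left _ _).trans hn)) 0 (by simp)
  have hsmall := hn₂ _ ((le_max_right _ _).trans ((le_max_left _ _).trans hn))
  simp only [Function.comp_apply] at hsmall
  set n := (Module.finrank ℝ E : ℝ) with hndef
  set m := 2 * exp (-(n * (G - δ))) with hmdef
  have hMm : 3 * M * m ≤ 12 * exp (-δ * n) * exp (-(n * (G - R - 2 * δ))) := by
    calc 3 * M * m ≤ 3 * (2 * exp (n * R)) * m := by gcongr
      _ = 12 * (exp (n * R) * exp (-(n * (G - δ)))) := by rw [hmdef]; ring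
      _ = _ := by rw [mul_assoc, ← exp_add, ← exp_add]; congr 2; ring
  have h1 : 12 * exp (-δ * n) < 1 := by linarith
  obtain ⟨C, hC1, hC2, hC3⟩ := exists_code_of_integral_aff_le (E := E) (r := n * a) (m := m)
    (by positivity) (measurableSet_typical η 0)
    (fun g hg => (norm_nonneg g).lt_of_ne fun h => by
      have := (typical_zero_bounds hη0 hη1 hg).2
      rw [← h, zero_pow two_ne_zero, mul_zero] at this
      linarith) hS
    (fun y hy => (integral_aff_toSphere_le ha hα hα1 haα hη0 hη1 hd hy).trans (by
      rw [hmdef]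
      have : n * (G - δ) ≤ n * (G - 3 / 8 * a * α * η) :=
        mul_le_mul_of_nonneg_left (by linarith) hd.le
      gcongr)) (by positivity) M
    (hMm.trans_lt (mul_lt_one_of_nonneg_of_lt_one_left (by positivity) h1
      (exp_le_one_iff.2 (neg_nonpos.2 (mul_nonneg hd.le (by linarith))))))
  classical
  refine ⟨C, hC1, hC2, (Finset.sum_le_sum fun x _ => perr_le_sum_aff C x).trans ?_⟩
  have h2 : ∑ x ∈ C, ∑ c ∈ C.erase x, aff c x ≤ 3 * M ^ 2 * m := by convert hC3
  refine h2.trans ?_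
  rw [show (3 : ℝ) * M ^ 2 * m = M * (3 * M * m) by ring]
  refine mul_le_mul_of_nonneg_left (hMm.trans ?_) (by positivity)
  refine (mul_le_of_le_one_left (exp_pos _).le h1.le).trans (exp_le_exp.2 (neg_le_neg ?_))
  exact mul_le_mul_of_nonneg_left (by linarith) hd.le

end GaussRel

namespace GaussRel
open ProbabilityTheory
open scoped InnerProductSpace
set_option linter.unusedSectionVars false

lemma neg_le_log_tan_bound : -(0.87756 : ℝ) ≤ log 0.4158 := by
  rw [Real.le_log_iff_exp_le (by norm_num), exp_neg, inv_le_comm₀ (exp_pos _) (by norm_num)]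
  refine le_trans ?_ (Real.sum_le_exp_of_nonneg (by norm_num) 10)
  norm_num [Finset.sum_range_succ, Nat.factorial]

lemma log_ge_of_le {τ : ℝ} (hτ : 0 < τ) : 0.12244 - 0.4158 / τ ≤ log τ := by
  have h1 := one_sub_inv_le_log_of_pos (x := τ / 0.4158) (by positivity)
  rw [log_div hτ.ne' (by norm_num), inv_div] at h1
  have h2 := neg_le_log_tan_bound
  linarith

lemma one_sub_mul_log_ge {x : ℝ} (hx : 0 < x) (hx1 : x ≤ 0.18) :
    x * (0.98009 - 1.2563 * x) ≤ (1 - x) * log (1 + x) := by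
  have h := Real.sum_range_le_log_div (x := x / (2 + x)) (by positivity)
    ((div_lt_one (by positivity)).2 (by linarith)) 2
  have e : (1 + x / (2 + x)) / (1 - x / (2 + x)) = 1 + x := by
    have : 2 + x ≠ 0 := by positivity
    field_simp; ring
  rw [e] at h
  norm_num [Finset.sum_range_succ] at h
  have h3 : x * (0.98009 - 1.2563 * x) ≤ (1 - x) * (2 * (x / (2 + x) + (x / (2 + x)) ^ 3 / 3)) := by
    have h2x : 0 < 2 + x := by positivity
    have e2 : (1 - x) * (2 * (x / (2 + x) + (x / (2 + x)) ^ 3 / 3)) =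
        x * ((2 * (1 - x) * (3 * (2 + x) ^ 2 + x ^ 2)) / (3 * (2 + x) ^ 3)) := by
      field_simp
    rw [e2]
    refine mul_le_mul_of_nonneg_left ?_ hx.le
    rw [le_div_iff₀ (by positivity)]
    nlinarith [sq_nonneg (x - 0.173), mul_nonneg hx.le (sq_nonneg (x - 0.173)),
      mul_nonneg (mul_nonneg hx.le hx.le) (sq_nonneg (x - 0.173)), mul_nonneg hx.le hx.le]
  refine h3.trans (mul_le_mul_of_nonneg_left (by linarith) (by linarith))

lemma quartic_pos {τ : ℝ} (hτ : 0 < τ) (h1 : τ ≤ 0.4158) :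
    0 < (1 - τ) + 1.22497 * (τ * (1 + τ)) - 1.2563 * (τ ^ 3 * (1 + τ)) - 0.8316 * (1 + τ) := by
  have e : (1 - τ) + 1.22497 * (τ * (1 + τ)) - 1.2563 * (τ ^ 3 * (1 + τ)) - 0.8316 * (1 + τ) =
    ((1 - 0.4158) + 1.22497 * (0.4158 * (1 + 0.4158)) -
      1.2563 * (0.4158 ^ 3 * (1 + 0.4158)) - 0.8316 * (1 + 0.4158)) +
      (0.4158 - τ) * (1.8316 - 1.22497 - 1.22497 * (τ + 0.4158) +
        1.2563 * (τ ^ 2 + 0.4158 * τ + 0.4158 ^ 2) +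
        1.2563 * (τ ^ 3 + τ ^ 2 * 0.4158 + τ * 0.4158 ^ 2 + 0.4158 ^ 3)) := by ring
  rw [e]
  have h2 : 0 ≤ 1.8316 - 1.22497 - 1.22497 * (τ + 0.4158) +
      1.2563 * (τ ^ 2 + 0.4158 * τ + 0.4158 ^ 2) +
      1.2563 * (τ ^ 3 + τ ^ 2 * 0.4158 + τ * 0.4158 ^ 2 + 0.4158 ^ 3) := by
    have : 0 ≤ τ ^ 3 := by positivity
    nlinarith [sq_nonneg (τ - 0.15)]
  have := mul_nonneg (sub_nonneg.2 h1) h2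
  norm_num at this ⊢
  linarith

lemma tan_half_ineq {τ : ℝ} (hτ : 0 < τ) (h1 : τ ≤ 0.4158) :
    0 < τ / (1 + τ) ^ 2 + log (1 + τ ^ 2) + τ ^ 2 / (1 - τ ^ 2) * log (τ ^ 2) := by
  have hx : τ ^ 2 ≤ 0.18 := by nlinarith
  have hx1 : 0 < 1 - τ ^ 2 := by linarith
  have a1 := one_sub_mul_log_ge (pow_pos hτ 2) hx
  have a2 := mul_le_mul_of_nonneg_left (log_ge_of_le hτ) (by positivity : 0 ≤ 2 * τ ^ 2)
  have a3 := mul_pos (div_pos hτ (by linarith : 0 < 1 + τ)) (quartic_pos hτ h1)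
  have e1 : (1 - τ ^ 2) * (τ / (1 + τ) ^ 2 + log (1 + τ ^ 2) + τ ^ 2 / (1 - τ ^ 2) * log (τ ^ 2)) =
      (1 - τ) * τ / (1 + τ) + (1 - τ ^ 2) * log (1 + τ ^ 2) + 2 * τ ^ 2 * log τ := by
    rw [log_pow]
    field_simp
    push_cast
    ring
  have e2 : τ / (1 + τ) * ((1 - τ) + 1.22497 * (τ * (1 + τ)) - 1.2563 * (τ ^ 3 * (1 + τ)) -
      0.8316 * (1 + τ)) = (1 - τ) * τ / (1 + τ) + τ ^ 2 * (0.98009 - 1.2563 * τ ^ 2) +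
        2 * τ ^ 2 * (0.12244 - 0.4158 / τ) := by
    field_simp
    ring
  refine pos_of_mul_pos_right (?_ : 0 < (1 - τ ^ 2) * _) hx1.le
  rw [e1]
  linarith

/-- The numerical inequality that limits the range of signal-to-noise ratios. -/
lemma hrate_kap_add_log_lt {a α : ℝ} (ha : 0 < a) (ha' : a ≤ 5.7) (hα : 0 < α) (hα1 : α < 1)
    (haα : a * (1 - α ^ 2) = 4 * α) :
    a * (1 - α) / 8 < a * (1 - α) / 4 - 1 / 2 * log (1 - α ^ 2) - hrate (kap α) := by
  have hα2 : 0 < 1 - α ^ 2 := by nlinarith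
  set s := √(1 - α ^ 2) with hsdef
  have hs : 0 < s := Real.sqrt_pos.2 hα2
  have hs2 : s ^ 2 = 1 - α ^ 2 := Real.sq_sqrt hα2.le
  have hs1 : s < 1 := by nlinarith
  have h1s : 0 < 1 - s := by linarith
  set τ := α / (1 + s) with hτdef
  have hτ : 0 < τ := by positivity
  have hτ2 : τ ^ 2 = (1 - s) / (1 + s) := by
    rw [hτdef, div_pow, div_eq_div_iff (by positivity) (by positivity),
      show α ^ 2 = 1 - s ^ 2 by linarith]
    ring
  have hτ1 : τ ≤ 0.4158 := by
    by_contra! hcon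
    have b1 : (0.4158 : ℝ) ^ 2 < (1 - s) / (1 + s) := by rw [← hτ2]; gcongr
    rw [lt_div_iff₀ (by positivity)] at b1
    have b2 : s < 0.7052 := by norm_num at b1; linarith
    have b3 : s ^ 2 < 0.7052 ^ 2 := by gcongr
    have b4 : 0.709 < α := by
      refine lt_of_pow_lt_pow_left₀ 2 hα.le ?_
      norm_num at b3 ⊢; linarith
    rw [← hs2] at haα
    have b5 : a * s ^ 2 ≤ 5.7 * 0.7052 ^ 2 := by gcongr
    norm_num at b5; linarith
  have key := tan_half_ineq hτ hτ1
  have k1 : τ / (1 + τ) ^ 2 = a * (1 - α) / 8 := by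
    have c1 : (1 + s + α) ^ 2 = 2 * (1 + s) * (1 + α) := by linear_combination hs2
    have c2 : τ / (1 + τ) ^ 2 = α * (1 + s) / (1 + s + α) ^ 2 := by
      rw [hτdef]; field_simp
    rw [c2, c1, div_eq_div_iff (by positivity) (by norm_num)]
    linear_combination (-(2 * (1 + s))) * haα
  have k2 : 1 + τ ^ 2 = 2 / (1 + s) := by rw [hτ2]; field_simp; ring
  have k3 : τ ^ 2 / (1 - τ ^ 2) = (1 - s) / (2 * s) := by
    have : 1 - τ ^ 2 = 2 * s / (1 + s) := by rw [hτ2]; field_simp; ring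
    rw [this, hτ2]; field_simp
  rw [k1, k2, k3, hτ2, log_div two_ne_zero (by positivity), log_div h1s.ne' (by positivity)] at key
  have k4 : kap α = (1 - s) / (2 * s) := by rw [kap, ← hsdef]; field_simp
  have k5 : 1 + (1 - s) / (2 * s) = (1 + s) / (2 * s) := by field_simp; ring
  have k6 : (1 + s) / (2 * s) - (1 - s) / (2 * s) = 1 := by field_simp; ring
  rw [hrate, k4, k5, log_div (by positivity) (by positivity), log_div h1s.ne' (by positivity),
    log_mul two_ne_zero hs.ne', ← hs2, log_pow]
  push_cast
  have k7 : (1 + s) / (2 * s) = 1 + (1 - s) / (2 * s) := k5.symm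
  rw [k7]
  linarith

lemma psi_arccos {α : ℝ} (hα : 0 < α) (hα1 : α < 1) : psi (arccos α) = hrate (kap α) := by
  have hα2 : 0 < 1 - α ^ 2 := by nlinarith
  rw [psi, sin_arccos, kap]
  set s := √(1 - α ^ 2) with hsdef
  have hs : 0 < s := Real.sqrt_pos.2 hα2
  have hs2 : s ^ 2 = 1 - α ^ 2 := Real.sq_sqrt hα2.le
  have h1s : 0 < 1 - s := by nlinarith
  have k4 : (s⁻¹ - 1) / 2 = (1 - s) / (2 * s) := by field_simp
  have k5 : 1 + (1 - s) / (2 * s) = (1 + s) / (2 * s) := by field_simp; ring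
  rw [hrate, k4, k5, log_div (by positivity) (by positivity), log_div h1s.ne' (by positivity),
    log_div (by positivity) (by positivity), log_div (by positivity) (by positivity), ← k5]
  ring

/-- The parameter `α = cos θ_x` and the quantities of the channel in terms of it. -/
lemma exists_cos_thetax {a : ℝ} (ha : 0 < a) : ∃ α : ℝ, 0 < α ∧ α < 1 ∧
    a * (1 - α ^ 2) = 4 * α ∧ thetax a = arccos α ∧ Rx a = -(1 / 2 * log (1 - α ^ 2)) ∧
    RcritG a = -(1 / 2 * log (1 - α)) := by
  set D := √(1 + a ^ 2 / 4) with hD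
  have hD2 : D ^ 2 = 1 + a ^ 2 / 4 := Real.sq_sqrt (by positivity)
  have hD1 : 1 < D := by rw [hD, Real.lt_sqrt zero_le_one]; nlinarith [pow_pos ha 2]
  have hDa : a ^ 2 = 4 * (D ^ 2 - 1) := by linarith
  set α := 2 * (D - 1) / a with hα
  have hα0 : 0 < α := div_pos (by linarith) ha
  have hα2 : α ^ 2 = (D - 1) / (D + 1) := by
    rw [hα, div_pow, hDa, div_eq_div_iff (by nlinarith) (by linarith)]; ring
  have h1 : 1 - α ^ 2 = 2 / (D + 1) := by rw [hα2]; field_simp; ring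
  have h1p : 0 < 1 - α ^ 2 := by rw [h1]; positivity
  have hα1 : α < 1 := by nlinarith
  have haα : a * (1 - α ^ 2) = 4 * α := by
    rw [h1, hα, ← mul_div_assoc, ← mul_div_assoc, div_eq_div_iff (by linarith) ha.ne']
    linear_combination 2 * hDa
  have hRx : Rx a = -(1 / 2 * log (1 - α ^ 2)) := by
    rw [Rx, ← hD, show 1 / 2 + 1 / 2 * D = (1 - α ^ 2)⁻¹ by rw [h1, inv_div]; ring, log_inv]; ring
  refine ⟨α, hα0, hα1, haα, ?_, hRx, ?_⟩
  · rw [thetax, hRx, show -2 * -(1 / 2 * log (1 - α ^ 2)) = log (1 - α ^ 2) by ring,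
      exp_log h1p, sub_sub_cancel, Real.sqrt_sq hα0.le]
  · have e : 1 / 2 + a / 4 + 1 / 2 * D = (1 - α)⁻¹ := by
      have e1 : (1 / 2 + 1 / 2 * D) * (1 - α ^ 2) = 1 := by rw [h1]; field_simp; ring
      refine eq_inv_of_mul_eq_one_left ?_
      have h2 : 1 + α ≠ 0 := by linarith
      apply mul_right_cancel₀ h2
      linear_combination e1 + haα / 4
    rw [RcritG, ← hD, e, log_inv]; ring

end GaussRel

namespace GaussRel
open ProbabilityTheory
open scoped InnerProductSpace
set_option linter.unusedSectionVars false

/-- The identification of `ℝⁿ` with Euclidean space. -/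
def toEuc (n : ℕ) : (Fin n → ℝ) ↪ EuclideanSpace ℝ (Fin n) :=
  (WithLp.equiv 2 (Fin n → ℝ)).symm.toEmbedding

lemma norm_sq_toEuc {n : ℕ} (x : Fin n → ℝ) : ‖toEuc n x‖ ^ 2 = ∑ i, x i ^ 2 :=
  EuclideanSpace.real_norm_sq_eq _

lemma eudist_le_iff {n : ℕ} (c x z : Fin n → ℝ) :
    eudist c (fun i => x i + z i) ≤ eudist x (fun i => x i + z i) ↔
      ‖toEuc n c - toEuc n x‖ ^ 2 / 2 - 0 ≤ ⟪toEuc n c - toEuc n x, toEuc n z⟫_ℝ := by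
  have e1 : ∑ i, (c i - (x i + z i)) ^ 2 = ‖toEuc n c - toEuc n x - toEuc n z‖ ^ 2 := by
    rw [EuclideanSpace.real_norm_sq_eq]
    exact Finset.sum_congr rfl fun i _ => by simp [toEuc]; ring
  have e2 : ∑ i, (x i - (x i + z i)) ^ 2 = ‖toEuc n z‖ ^ 2 := by
    rw [norm_sq_toEuc]; simp
  rw [eudist, eudist, Real.sqrt_le_sqrt_iff (by positivity), e1, e2, norm_sub_sq_real]
  constructor <;> intro h <;> linarith

lemma PeG_eq {n : ℕ} (C : Finset (Fin n → ℝ)) :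
    PeG C = (C.card : ℝ)⁻¹ * ∑ x ∈ C.map (toEuc n), perr (C.map (toEuc n)) x := by
  rw [PeG, Finset.sum_map]
  congr 1
  refine Finset.sum_congr rfl fun x _ => ?_
  rw [perr, ← map_pi_eq_stdGaussian, measureReal_def,
    Measure.map_apply (by fun_prop) (measurableSet_nearSet _ _ _)]
  congr 2
  ext z
  simp only [nearSet, Set.mem_ofPred_eq, Set.mem_preimage, Finset.mem_map, eudist_le_iff]
  constructor
  · rintro ⟨c, h1, h2, h3⟩
    exact ⟨_, ⟨c, h1, rfl⟩, fun h => h2 ((toEuc n).injective h), h3⟩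
  · rintro ⟨_, ⟨c, h1, rfl⟩, h2, h3⟩
    exact ⟨c, h1, fun h => h2 (h ▸ rfl), h3⟩

/-- Two-sided exponential bounds on the optimal error probability determine the reliability
function. -/
lemma relEG_eq_of_bounds {a R e : ℝ}
    (h : ∀ δ > 0, ∃ n₀ : ℕ, ∀ n ≥ n₀,
      (∀ C : Finset (Fin n → ℝ), (∀ x ∈ C, ∑ i, (x i) ^ 2 = (n : ℝ) * a) →
        C.card = ⌈exp (R * n)⌉₊ → exp (-(n * (e + δ))) ≤ PeG C) ∧
      ∃ C : Finset (Fin n → ℝ), (∀ x ∈ C, ∑ i, (x i) ^ 2 = (n : ℝ) * a) ∧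
        C.card = ⌈exp (R * n)⌉₊ ∧ PeG C ≤ exp (-(n * (e - δ)))) :
    relEG a R = e := by
  refine Tendsto.limsup_eq (Metric.tendsto_atTop.2 fun ε hε => ?_)
  obtain ⟨n₀, hn₀⟩ := h (ε / 2) (by linarith)
  refine ⟨max n₀ 1, fun n hn => ?_⟩
  obtain ⟨h1, C, hC, hcard, h2⟩ := hn₀ n ((le_max_left _ _).trans hn)
  have hn0 : (0 : ℝ) < n := by exact_mod_cast (le_max_right n₀ 1).trans hn
  set S := (fun C : Finset (Fin n → ℝ) => 1 / PeG C) ''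
      {C | (∀ x ∈ C, ∑ i, (x i)^2 = (n : ℝ) * a) ∧ C.card = ⌈Real.exp (R * n)⌉₊}
  have hub : ∀ y ∈ S, y ≤ exp (n * (e + ε / 2)) := by
    rintro _ ⟨D, ⟨hD1, hD2⟩, rfl⟩
    have := one_div_le_one_div_of_le (exp_pos _) (h1 D hD1 hD2)
    simpa only [exp_neg, one_div, inv_inv] using this
  have hmem : 1 / PeG C ∈ S := ⟨C, ⟨hC, hcard⟩, rfl⟩
  have hlow : exp (n * (e - ε / 2)) ≤ sSup S := by
    refine le_trans ?_ (le_csSup ⟨_, hub⟩ hmem)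
    have := one_div_le_one_div_of_le ((exp_pos _).trans_le (h1 C hC hcard)) h2
    rwa [exp_neg, one_div, inv_inv] at this
  have hup : sSup S ≤ exp (n * (e + ε / 2)) := csSup_le ⟨_, hmem⟩ hub
  have hpos : 0 < sSup S := (exp_pos _).trans_le hlow
  rw [← Real.le_log_iff_exp_le hpos] at hlow
  rw [← Real.log_le_iff_le_exp hpos] at hup
  have e1 : e - ε / 2 ≤ (n : ℝ)⁻¹ * log (sSup S) := by
    rw [inv_mul_eq_div, le_div_iff₀ hn0]; linarith
  have e2 : (n : ℝ)⁻¹ * log (sSup S) ≤ e + ε / 2 := by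
    rw [inv_mul_eq_div, div_le_iff₀ hn0]; linarith
  rw [Real.dist_eq, abs_lt]
  constructor <;> linarith

/-- The reliability function equals the random coding exponent between `R₁` and `R_crit`. -/
lemma relEG_eq_E0G {a R : ℝ} (ha : 0 < a) (ha' : a ≤ 5.7) (hlo : psi (thetax a) ≤ R)
    (hhi : R ≤ RcritG a) : relEG a R = E0G a R := by
  obtain ⟨α, hα, hα1, haα, hθ, hRx, hRc⟩ := exists_cos_thetax ha
  rw [hθ, psi_arccos hα hα1] at hlo
  rw [hRc] at hhi
  have hE : E0G a R = a * (1 - α) / 4 - 1 / 2 * log (1 - α ^ 2) - R := by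
    rw [E0G, hθ, cos_arccos (by linarith) hα1.le, hRx]; ring
  have hR0 : 0 ≤ R := (hrate_nonneg (kap_pos hα hα1)).trans hlo
  have hRlt : R < a * (1 - α) / 4 - 1 / 2 * log (1 - α ^ 2) := by
    have h1 : log (1 - α ^ 2) = log (1 - α) + log (1 + α) := by
      rw [← log_mul (by linarith) (by linarith)]; congr 1; ring
    have h2 : log (1 + α) < α := by
      have := log_lt_sub_one_of_pos (x := 1 + α) (by linarith) (by linarith)
      linarith
    have h3 : a * (1 - α) * (1 + α) = 4 * α := by rw [← haα]; ring
    have h4 : 2 * α ≤ a * (1 - α) := by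
      have : a * (1 - α) * (1 + α) ≤ a * (1 - α) * 2 :=
        mul_le_mul_of_nonneg_left (by linarith) (mul_nonneg ha.le (by linarith))
      linarith
    rw [h1]; linarith
  rw [hE]
  refine relEG_eq_of_bounds fun δ hδ => ?_
  obtain ⟨n₁, hn₁⟩ := exists_sum_perr_ge_straight_line ha hα hα1 haα hδ
    (hrate_kap_add_log_lt ha ha' hα hα1 haα) hlo hhi
  obtain ⟨n₂, hn₂⟩ := exists_code_sum_perr_le ha hα hα1 haα hδ hRlt
  refine ⟨max n₁ n₂, fun n hn => ?_⟩
  have hfr : Module.finrank ℝ (EuclideanSpace ℝ (Fin n)) = n := finrank_euclideanSpace_fin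
  have hM0 : (0 : ℝ) < ⌈exp (R * n)⌉₊ := by exact_mod_cast Nat.ceil_pos.2 (exp_pos _)
  constructor
  · intro C hC hcard
    have h := hn₁ (EuclideanSpace ℝ (Fin n)) (by rw [hfr]; exact (le_max_left _ _).trans hn)
      (C.map (toEuc n)) (by
        intro x hx
        obtain ⟨y, hy, rfl⟩ := Finset.mem_map.1 hx
        rw [norm_sq_toEuc, hfr, hC y hy])
      (by rw [hfr, Finset.card_map, hcard, mul_comm]; exact Nat.le_ceil _)
    rw [hfr, Finset.card_map, hcard] at h
    rw [PeG_eq, hcard, le_inv_mul_iff₀ hM0]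
    exact h
  · obtain ⟨C, hC, hcard, h⟩ := hn₂ (EuclideanSpace ℝ (Fin n))
      (by rw [hfr]; exact (le_max_right _ _).trans hn) ⌈exp (R * n)⌉₊ (by
        rw [hfr, mul_comm (n : ℝ)]
        have h1 := (Nat.ceil_lt_add_one (exp_pos (R * n)).le).le
        have h2 : 1 ≤ exp (R * n) := one_le_exp (by positivity)
        linarith)
    have hmap : (C.map (WithLp.equiv 2 (Fin n → ℝ)).toEmbedding).map (toEuc n) = C := by
      rw [Finset.map_map]; exact Finset.map_refl
    refine ⟨C.map (WithLp.equiv 2 (Fin n → ℝ)).toEmbedding, ?_, by rw [Finset.card_map, hcard], ?_⟩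
    · intro x hx
      obtain ⟨y, hy, rfl⟩ := Finset.mem_map.1 hx
      have := hC y hy
      rw [hfr, EuclideanSpace.real_norm_sq_eq] at this
      exact this
    · rw [PeG_eq, hmap, Finset.card_map, hcard, inv_mul_le_iff₀ hM0]
      rw [hfr] at h
      exact h

end GaussRel

/-- For every signal-to-noise ratio `0 < a ≤ 5.7` and every rate `R₁ ≤ R ≤ R_crit`, where
`R₁ = ψ(θ_x)`, the reliability function of the Gaussian channel equals the random coding
exponent: `E(R,a) = E₀(R,a) = (a/4)(1 − cos θ_x) + R_x − R`. -/
theorem gaussian_reliability_equals_random_coding (a R : ℝ)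
    (ha : 0 < a) (ha' : a ≤ 5.7)
    (hlo : psi (thetax a) ≤ R) (hhi : R ≤ RcritG a) :
    relEG a R = E0G a R := by
  exact GaussRel.relEG_eq_E0G ha ha' hlo hhi
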